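/- Let ℛ_M = ⟨ℝ, (r)_{r∈ℝ}, +, −, ·, <, (E_{k,re}, E_{k,im})_{k=2,4,6}, exp, sin⌈_{[−π,π]}, cos⌈_{[−π,π]}⟩ be the expansion of the ordered field of real numbers by the unrestricted exponential function exp, the restricted sine and cosine (equal to 0 outside [−π,π]), and the binary functions E_{k,re}(x,y) = Re(E_k(x+iy)) and E_{k,im}(x,y) = Im(E_k(x+iy)) for |x| ≤ 1/2 and y ≥ √3/2, and equal to 0 elsewhere. Then the theory of ℛ_M is strongly model complete. -/

import Mathlib

open FirstOrder Complex

noncomputable section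

/-- A theory of an `L`-structure with interpretation `S` on `M` is strongly model complete:
every formula is equivalent to an existential formula with a quantifier-free matrix whose
witnesses are unique. -/
def StronglyModelComplete (L : FirstOrder.Language) (M : Type*) (S : L.Structure M) : Prop :=
  letI := S
  ∀ (k : ℕ) (φ : L.Formula (Fin k)),
    ∃ (m : ℕ) (ψ : L.Formula (Fin k ⊕ Fin m)),
      FirstOrder.Language.BoundedFormula.IsQF ψ ∧
      (∀ x : Fin k → M, φ.Realize x ↔ ∃ w : Fin m → M, ψ.Realize (Sum.elim x w)) ∧
      (∀ (x : Fin k → M) (w w' : Fin m → M),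
        ψ.Realize (Sum.elim x w) → ψ.Realize (Sum.elim x w') → w = w')

/-- `ζ(k) = Σ_{r≥1} r⁻ᵏ`, as a complex number. -/
def zetaC (k : ℕ) : ℂ := ∑' n : ℕ, 1 / ((n : ℂ) + 1) ^ k

/-- The normalized weight-`k` level-one Eisenstein series
`E_k(τ) = (1/(2ζ(k))) Σ_{(m,n)≠(0,0)} (mτ+n)⁻ᵏ` (for `k = 4, 6`). -/
def Eis (k : ℕ) (τ : ℂ) : ℂ :=
  1 / (2 * zetaC k) *
    ∑' p : ℤ × ℤ, if p = (0, 0) then 0 else 1 / ((p.1 : ℂ) * τ + (p.2 : ℂ)) ^ k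

/-- `G₂(τ) = (1/2)Σ_{n≠0} n⁻² + (1/2)Σ_{m≠0}(Σ_{n∈ℤ}(mτ+n)⁻²)` (iterated sum, in this
order), the weight-2 quasimodular Eisenstein series. -/
def G2 (τ : ℂ) : ℂ :=
  1 / 2 * (∑' n : ℤ, if n = 0 then 0 else 1 / (n : ℂ) ^ 2) +
    1 / 2 * ∑' m : ℤ, if m = 0 then 0 else ∑' n : ℤ, 1 / ((m : ℂ) * τ + (n : ℂ)) ^ 2

/-- The normalized Eisenstein series of weight `k`, for `k = 2, 4, 6`:
`E₂ = G₂/ζ(2)` and `E_k` as usual for `k = 4, 6`. -/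
def EisFull (k : ℕ) (τ : ℂ) : ℂ :=
  if k = 2 then G2 τ / zetaC 2 else Eis k τ

/-- The weights `2`, `4`, `6`, indexed by `Fin 3`. -/
def wt : Fin 3 → ℕ := ![2, 4, 6]

/-- The language of `ℛ_M`: constants for all real numbers, `-`, `+`, `·`, `<`, the
unrestricted exponential, the restricted sine and cosine `sin⌈[-π,π]`, `cos⌈[-π,π]`, and
binary function symbols `E_{k,re}`, `E_{k,im}` for `k = 2, 4, 6`. -/
def LM : FirstOrder.Language where
  Functions := fun k =>
    match k with
    | 0 => ℝ              -- a constant for each real number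
    | 1 => Unit ⊕ Fin 3   -- negation; sin⌈[-π,π], cos⌈[-π,π], exp
    | 2 => Fin 2 ⊕ (Fin 3 × Bool)  -- +, · and the symbols E_{k,re}, E_{k,im}
    | _ + 3 => Empty
  Relations := fun k =>
    match k with
    | 2 => PUnit  -- the order relation <
    | _ => Empty

/-- The structure `ℛ_M`: the symbol `(i, b)` is interpreted by the real (if `b`) or
imaginary (if `¬b`) part of `E_{wt i}(x+iy)` on `|x| ≤ 1/2`, `y ≥ √3/2`, and by `0`
elsewhere; `sin` and `cos` are restricted to `[-π,π]` (and `0` elsewhere) and `exp` is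
unrestricted. -/
def LMStructure : LM.Structure ℝ where
  funMap := fun {k} f x =>
    match k, f, x with
    | 0, r, _ => (show ℝ from r)
    | 1, Sum.inl _, x => -x 0
    | 1, Sum.inr c, x =>
        if c = 0 then (if -Real.pi ≤ x 0 ∧ x 0 ≤ Real.pi then Real.sin (x 0) else 0)
        else if c = 1 then (if -Real.pi ≤ x 0 ∧ x 0 ≤ Real.pi then Real.cos (x 0) else 0)
        else Real.exp (x 0)
    | 2, Sum.inl c, x => if c = 0 then x 0 + x 1 else x 0 * x 1
    | 2, Sum.inr s, x =>
        if |x 0| ≤ 1 / 2 ∧ Real.sqrt 3 / 2 ≤ x 1 then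
          if s.2 then (EisFull (wt s.1) ((x 0 : ℂ) + (x 1 : ℂ) * Complex.I)).re
          else (EisFull (wt s.1) ((x 0 : ℂ) + (x 1 : ℂ) * Complex.I)).im
        else 0
    | _ + 3, e, _ => e.elim
  RelMap := fun {k} r x =>
    match k, r, x with
    | 2, _, x => x 0 < x 1

namespace RM

open Filter Topology Set

attribute [local instance] LMStructure

/-- Sets defined by quantifier-free formulas. -/
def QF {ι : Type} (S : Set (ι → ℝ)) : Prop :=
  ∃ ψ : LM.Formula ι, FirstOrder.Language.BoundedFormula.IsQF ψ ∧ ∀ x, x ∈ S ↔ ψ.Realize x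

theorem QF.inter {ι : Type} {S T : Set (ι → ℝ)} (hS : QF S) (hT : QF T) : QF (S ∩ T) := by
  obtain ⟨φ, h1, h2⟩ := hS
  obtain ⟨ψ, h3, h4⟩ := hT
  refine ⟨φ ⊓ ψ, h1.inf h3, fun x => ?_⟩
  rw [mem_inter_iff, h2, h4, Language.Formula.realize_inf]

theorem QF.compl {ι : Type} {S : Set (ι → ℝ)} (hS : QF S) : QF Sᶜ := by
  obtain ⟨φ, h1, h2⟩ := hS
  refine ⟨φ.not, h1.not, fun x => ?_⟩
  rw [mem_compl_iff, h2, Language.Formula.realize_not]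

theorem QF.union {ι : Type} {S T : Set (ι → ℝ)} (hS : QF S) (hT : QF T) : QF (S ∪ T) := by
  have := (hS.compl.inter hT.compl).compl
  rwa [compl_inter, compl_compl, compl_compl] at this

theorem QF.preimage {ι κ : Type} {S : Set (ι → ℝ)} (hS : QF S) (g : ι → κ) :
    QF {x : κ → ℝ | (fun i => x (g i)) ∈ S} := by
  obtain ⟨φ, h1, h2⟩ := hS
  refine ⟨φ.relabel g, ?_, fun x => ?_⟩
  · exact Language.BoundedFormula.IsQF.relabel h1 _
  · rw [Language.Formula.realize_relabel, mem_ofPred_eq, h2]; rfl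

theorem QF.univ {ι : Type} : QF (univ : Set (ι → ℝ)) :=
  ⟨⊤, Language.BoundedFormula.IsQF.top, fun x => by simp⟩

theorem QF.eq_term {ι : Type} (s t : LM.Term ι) :
    QF {x : ι → ℝ | s.realize x = t.realize x} :=
  ⟨s.equal t, (Language.BoundedFormula.IsAtomic.equal _ _).isQF, fun x => by
    rw [Language.Formula.realize_equal]; rfl⟩

theorem QF.iInter {ι κ : Type} [Finite κ] {S : κ → Set (ι → ℝ)} (hS : ∀ k, QF (S k)) :
    QF (⋂ k, S k) := by
  have := Fintype.ofFinite κ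
  suffices H : ∀ A : Finset κ, QF (⋂ k ∈ A, S k) by simpa using H Finset.univ
  intro A
  classical
  induction A using Finset.induction_on with
  | empty => simpa using QF.univ
  | insert a A _ ih => rw [Finset.set_biInter_insert]; exact (hS a).inter ih

/-- The term `s < t`. -/
theorem QF.lt_var {ι : Type} (i j : ι) : QF {x : ι → ℝ | x i < x j} := by
  let R : LM.Relations 2 := PUnit.unit
  refine ⟨R.formula ![Language.Term.var i, Language.Term.var j],
    (Language.BoundedFormula.IsAtomic.rel _ _).isQF, fun x => ?_⟩
  rw [Language.Formula.realize_rel]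
  rfl

theorem QF.eq_const {ι : Type} (i : ι) (c : ℝ) : QF {x : ι → ℝ | x i = c} := by
  let C : LM.Functions 0 := c
  exact QF.eq_term (Language.Term.var i) (Language.Term.func C ![])

theorem QF.eq_var {ι : Type} (i j : ι) : QF {x : ι → ℝ | x i = x j} :=
  QF.eq_term (Language.Term.var i) (Language.Term.var j)

theorem QF.add {ι : Type} (i j k : ι) : QF {x : ι → ℝ | x k = x i + x j} := by
  let C : LM.Functions 2 := Sum.inl 0
  exact QF.eq_term (Language.Term.var k)
    (Language.Term.func C ![Language.Term.var i, Language.Term.var j])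

theorem QF.mul {ι : Type} (i j k : ι) : QF {x : ι → ℝ | x k = x i * x j} := by
  let C : LM.Functions 2 := Sum.inl 1
  exact QF.eq_term (Language.Term.var k)
    (Language.Term.func C ![Language.Term.var i, Language.Term.var j])

theorem QF.exp {ι : Type} (i k : ι) : QF {x : ι → ℝ | x k = Real.exp (x i)} := by
  let C : LM.Functions 1 := Sum.inr 2
  exact QF.eq_term (Language.Term.var k) (Language.Term.func C ![Language.Term.var i])

/-- The restricted sine. -/
def sinR (t : ℝ) : ℝ := if -Real.pi ≤ t ∧ t ≤ Real.pi then Real.sin t else 0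

/-- The restricted cosine. -/
def cosR (t : ℝ) : ℝ := if -Real.pi ≤ t ∧ t ≤ Real.pi then Real.cos t else 0

/-- The restricted Eisenstein series, real part if `b` and imaginary part otherwise. -/
def eisR (s : Fin 3 × Bool) (a b : ℝ) : ℝ :=
  if |a| ≤ 1 / 2 ∧ Real.sqrt 3 / 2 ≤ b then
    if s.2 then (EisFull (wt s.1) ((a : ℂ) + (b : ℂ) * Complex.I)).re
    else (EisFull (wt s.1) ((a : ℂ) + (b : ℂ) * Complex.I)).im
  else 0

theorem QF.sinR {ι : Type} (i k : ι) : QF {x : ι → ℝ | x k = sinR (x i)} := by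
  let C : LM.Functions 1 := Sum.inr 0
  exact QF.eq_term (Language.Term.var k) (Language.Term.func C ![Language.Term.var i])

theorem QF.cosR {ι : Type} (i k : ι) : QF {x : ι → ℝ | x k = cosR (x i)} := by
  let C : LM.Functions 1 := Sum.inr 1
  exact QF.eq_term (Language.Term.var k) (Language.Term.func C ![Language.Term.var i])

theorem QF.eisR {ι : Type} (s : Fin 3 × Bool) (i j k : ι) :
    QF {x : ι → ℝ | x k = eisR s (x i) (x j)} := by
  let C : LM.Functions 2 := Sum.inr s
  exact QF.eq_term (Language.Term.var k)
    (Language.Term.func C ![Language.Term.var i, Language.Term.var j])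

/-- Sets defined by existential formulas with unique witnesses. -/
def SE {ι : Type} (S : Set (ι → ℝ)) : Prop :=
  ∃ (m : ℕ) (T : Set (ι ⊕ Fin m → ℝ)), QF T ∧ (∀ x, x ∈ S ↔ ∃ w, Sum.elim x w ∈ T) ∧
    ∀ x w w', Sum.elim x w ∈ T → Sum.elim x w' ∈ T → w = w'

theorem SE.of_qf {ι κ : Type} [Finite κ] {S : Set (ι → ℝ)} {T : Set (ι ⊕ κ → ℝ)} (hT : QF T)
    (h1 : ∀ x, x ∈ S ↔ ∃ w, Sum.elim x w ∈ T)
    (h2 : ∀ x w w', Sum.elim x w ∈ T → Sum.elim x w' ∈ T → w = w') : SE S := by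
  obtain ⟨m, ⟨e⟩⟩ := Finite.exists_equiv_fin κ
  have key : ∀ (x : ι → ℝ) (w : Fin m → ℝ), (fun i => Sum.elim x w (Sum.map id e i)) =
      Sum.elim x (fun k => w (e k)) := by
    intro x w; funext i; cases i <;> rfl
  refine ⟨m, _, hT.preimage (Sum.map id e), fun x => ?_, fun x w w' hw hw' => ?_⟩
  · rw [h1]
    constructor
    · rintro ⟨w, hw⟩
      refine ⟨fun k => w (e.symm k), ?_⟩
      rw [mem_ofPred_eq, key]; simpa using hw
    · rintro ⟨w, hw⟩
      rw [mem_ofPred_eq, key] at hw; exact ⟨_, hw⟩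
  · rw [mem_ofPred_eq, key] at hw hw'
    have := h2 _ _ _ hw hw'
    funext k
    simpa using congrFun this (e.symm k)

theorem QF.se {ι : Type} {S : Set (ι → ℝ)} (h : QF S) : SE S := by
  refine SE.of_qf (κ := Empty) (h.preimage Sum.inl) (fun x => ?_) (fun x w w' _ _ => ?_)
  · exact ⟨fun h => ⟨Empty.elim, h⟩, fun ⟨_, h⟩ => h⟩
  · exact Subsingleton.elim _ _

theorem SE.congr {ι : Type} {S T : Set (ι → ℝ)} (h : SE S) (e : ∀ x, x ∈ T ↔ x ∈ S) : SE T := by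
  rwa [show T = S from Set.ext e]

theorem SE.proj {ι κ : Type} [Finite κ] {S : Set (ι → ℝ)} {T : Set (ι ⊕ κ → ℝ)} (hT : SE T)
    (h1 : ∀ x, x ∈ S ↔ ∃ w, Sum.elim x w ∈ T)
    (h2 : ∀ x w w', Sum.elim x w ∈ T → Sum.elim x w' ∈ T → w = w') : SE S := by
  obtain ⟨m, U, hU, u1, u2⟩ := hT
  have key : ∀ (x : ι → ℝ) (w : κ ⊕ Fin m → ℝ),
      (fun i => Sum.elim x w ((Equiv.sumAssoc ι κ (Fin m)) i)) =
      Sum.elim (Sum.elim x (w ∘ Sum.inl)) (w ∘ Sum.inr) := by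
    intro x w; funext i; rcases i with (i | i) | i <;> rfl
  refine SE.of_qf (hU.preimage (Equiv.sumAssoc ι κ (Fin m))) (fun x => ?_) (fun x w w' hw hw' => ?_)
  · rw [h1]
    constructor
    · rintro ⟨w, hw⟩
      obtain ⟨v, hv⟩ := (u1 _).1 hw
      refine ⟨Sum.elim w v, ?_⟩
      rw [mem_ofPred_eq, key]; simpa using hv
    · rintro ⟨w, hw⟩
      rw [mem_ofPred_eq, key] at hw
      exact ⟨_, (u1 _).2 ⟨_, hw⟩⟩
  · rw [mem_ofPred_eq, key] at hw hw'
    have e1 := h2 _ _ _ ((u1 _).2 ⟨_, hw⟩) ((u1 _).2 ⟨_, hw'⟩)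
    rw [← e1] at hw'
    have e2 := u2 _ _ _ hw hw'
    funext k
    rcases k with k | k
    · exact congrFun e1 k
    · exact congrFun e2 k

theorem SE.preimage {ι κ : Type} {S : Set (ι → ℝ)} (hS : SE S) (g : ι → κ) :
    SE {x : κ → ℝ | (fun i => x (g i)) ∈ S} := by
  obtain ⟨m, T, hT, h1, h2⟩ := hS
  have key : ∀ (x : κ → ℝ) (w : Fin m → ℝ), (fun i => Sum.elim x w (Sum.map g id i)) =
      Sum.elim (fun i => x (g i)) w := by
    intro x w; funext i; cases i <;> rfl
  refine ⟨m, _, hT.preimage (Sum.map g id), fun x => ?_, fun x w w' hw hw' => ?_⟩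
  · rw [mem_ofPred_eq, h1]
    simp only [mem_ofPred_eq, key]
  · rw [mem_ofPred_eq, key] at hw hw'
    exact h2 _ _ _ hw hw'

theorem SE.inter {ι : Type} {S T : Set (ι → ℝ)} (hS : SE S) (hT : SE T) : SE (S ∩ T) := by
  obtain ⟨m, U, hU, u1, u2⟩ := hS
  obtain ⟨n, V, hV, v1, v2⟩ := hT
  have hU' := hU.preimage (Sum.map id Sum.inl : ι ⊕ Fin m → ι ⊕ (Fin m ⊕ Fin n))
  have hV' := hV.preimage (Sum.map id Sum.inr : ι ⊕ Fin n → ι ⊕ (Fin m ⊕ Fin n))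
  have k1 : ∀ (x : ι → ℝ) (w : Fin m ⊕ Fin n → ℝ), (fun i => Sum.elim x w (Sum.map id Sum.inl i)) =
      Sum.elim x (w ∘ Sum.inl) := by
    intro x w; funext i; cases i <;> rfl
  have k2 : ∀ (x : ι → ℝ) (w : Fin m ⊕ Fin n → ℝ), (fun i => Sum.elim x w (Sum.map id Sum.inr i)) =
      Sum.elim x (w ∘ Sum.inr) := by
    intro x w; funext i; cases i <;> rfl
  refine SE.of_qf (hU'.inter hV') (fun x => ?_) (fun x w w' hw hw' => ?_)
  · simp only [mem_inter_iff, mem_ofPred_eq, k1, k2, u1, v1]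
    constructor
    · rintro ⟨⟨a, ha⟩, b, hb⟩
      exact ⟨Sum.elim a b, by simpa using ha, by simpa using hb⟩
    · rintro ⟨w, h, h'⟩
      exact ⟨⟨_, h⟩, _, h'⟩
  · simp only [mem_inter_iff, mem_ofPred_eq, k1, k2] at hw hw'
    have e1 := u2 _ _ _ hw.1 hw'.1
    have e2 := v2 _ _ _ hw.2 hw'.2
    funext k
    rcases k with k | k
    · exact congrFun e1 k
    · exact congrFun e2 k

theorem SE.union {ι : Type} {S T : Set (ι → ℝ)} (hS : SE S) (hT : SE T) (hd : Disjoint S T) :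
    SE (S ∪ T) := by
  obtain ⟨m, U, hU, u1, u2⟩ := hS
  obtain ⟨n, V, hV, v1, v2⟩ := hT
  have hU' := hU.preimage (Sum.map id Sum.inl : ι ⊕ Fin m → ι ⊕ (Fin m ⊕ Fin n))
  have hV' := hV.preimage (Sum.map id Sum.inr : ι ⊕ Fin n → ι ⊕ (Fin m ⊕ Fin n))
  have k1 : ∀ (x : ι → ℝ) (w : Fin m ⊕ Fin n → ℝ), (fun i => Sum.elim x w (Sum.map id Sum.inl i)) =
      Sum.elim x (w ∘ Sum.inl) := by
    intro x w; funext i; cases i <;> rfl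
  have k2 : ∀ (x : ι → ℝ) (w : Fin m ⊕ Fin n → ℝ), (fun i => Sum.elim x w (Sum.map id Sum.inr i)) =
      Sum.elim x (w ∘ Sum.inr) := by
    intro x w; funext i; cases i <;> rfl
  have z1 : QF (⋂ k : Fin m, {z : ι ⊕ (Fin m ⊕ Fin n) → ℝ | z (Sum.inr (Sum.inl k)) = 0}) :=
    QF.iInter fun k => QF.eq_const _ _
  have z2 : QF (⋂ k : Fin n, {z : ι ⊕ (Fin m ⊕ Fin n) → ℝ | z (Sum.inr (Sum.inr k)) = 0}) :=
    QF.iInter fun k => QF.eq_const _ _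
  have e1 : ∀ (x : ι → ℝ) (w : Fin m ⊕ Fin n → ℝ), Sum.elim x w ∈
      (⋂ k : Fin m, {z : ι ⊕ (Fin m ⊕ Fin n) → ℝ | z (Sum.inr (Sum.inl k)) = 0}) ↔
      w ∘ Sum.inl = 0 := by
    intro x w; simp only [mem_iInter, mem_ofPred_eq, Sum.elim_inr, funext_iff, Function.comp,
      Pi.zero_apply]
  have e2 : ∀ (x : ι → ℝ) (w : Fin m ⊕ Fin n → ℝ), Sum.elim x w ∈
      (⋂ k : Fin n, {z : ι ⊕ (Fin m ⊕ Fin n) → ℝ | z (Sum.inr (Sum.inr k)) = 0}) ↔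
      w ∘ Sum.inr = 0 := by
    intro x w; simp only [mem_iInter, mem_ofPred_eq, Sum.elim_inr, funext_iff, Function.comp,
      Pi.zero_apply]
  have ext : ∀ w w' : Fin m ⊕ Fin n → ℝ, w ∘ Sum.inl = w' ∘ Sum.inl → w ∘ Sum.inr = w' ∘ Sum.inr →
      w = w' := by
    intro w w' h h'
    funext k
    rcases k with k | k
    · exact congrFun h k
    · exact congrFun h' k
  refine SE.of_qf ((hU'.inter z2).union (hV'.inter z1)) (fun x => ?_) (fun x w w' hw hw' => ?_)
  · simp only [mem_union, mem_inter_iff, e1, e2, mem_ofPred_eq, k1, k2, u1, v1]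
    constructor
    · rintro (⟨a, ha⟩ | ⟨a, ha⟩)
      · exact ⟨Sum.elim a 0, Or.inl (by simpa using ha)⟩
      · exact ⟨Sum.elim 0 a, Or.inr (by simpa using ha)⟩
    · rintro ⟨w, h | h⟩
      · exact Or.inl ⟨_, h.1⟩
      · exact Or.inr ⟨_, h.1⟩
  · simp only [mem_union, mem_inter_iff, e1, e2, mem_ofPred_eq, k1, k2] at hw hw'
    rcases hw with hw | hw <;> rcases hw' with hw' | hw'
    · exact ext _ _ (u2 _ _ _ hw.1 hw'.1) (hw.2.trans hw'.2.symm)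
    · exact (disjoint_left.1 hd ((u1 x).2 ⟨_, hw.1⟩) ((v1 x).2 ⟨_, hw'.1⟩)).elim
    · exact (disjoint_left.1 hd ((u1 x).2 ⟨_, hw'.1⟩) ((v1 x).2 ⟨_, hw.1⟩)).elim
    · exact ext _ _ (hw.2.trans hw'.2.symm) (v2 _ _ _ hw.1 hw'.1)

theorem SE.iInter {ι κ : Type} [Finite κ] {S : κ → Set (ι → ℝ)} (hS : ∀ k, SE (S k)) :
    SE (⋂ k, S k) := by
  have := Fintype.ofFinite κ
  suffices H : ∀ A : Finset κ, SE (⋂ k ∈ A, S k) by simpa using H Finset.univ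
  intro A
  classical
  induction A using Finset.induction_on with
  | empty => simpa using QF.univ.se
  | insert a A _ ih => rw [Finset.set_biInter_insert]; exact (hS a).inter ih

/-- `f` restricted to `B` has an `SE` graph. -/
def SEon {ι : Type} (B : Set (ι → ℝ)) (f : (ι → ℝ) → ℝ) : Prop :=
  SE {z : Option ι → ℝ | (fun i => z (some i)) ∈ B ∧ z none = f fun i => z (some i)}

theorem SEon.congr {ι : Type} {B : Set (ι → ℝ)} {f g : (ι → ℝ) → ℝ} (h : SEon B f)
    (e : EqOn f g B) : SEon B g := by
  refine SE.congr h fun z => ?_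
  simp only [mem_ofPred_eq]
  exact and_congr_right fun hz => by rw [e hz]

/-- The preimage of an `SE` set under a partial `SE` map is `SE`. -/
theorem SE.comp {ι κ : Type} [Finite κ] {B : Set (ι → ℝ)} {S : Set (κ → ℝ)}
    {g : κ → (ι → ℝ) → ℝ} (hB : SE B) (hS : SE S) (hg : ∀ k, SEon B (g k)) :
    SE {x | x ∈ B ∧ (fun k => g k x) ∈ S} := by
  have h1 : SE {z : ι ⊕ κ → ℝ | (fun k => z (Sum.inr k)) ∈ S} := hS.preimage Sum.inr
  have h2 : SE (⋂ k, {z : ι ⊕ κ → ℝ | (fun i => z (Sum.inl i)) ∈ B ∧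
      z (Sum.inr k) = g k fun i => z (Sum.inl i)}) := SE.iInter fun k =>
    (hg k).preimage (fun o : Option ι => o.elim (Sum.inr k) Sum.inl)
  have h3 : SE {z : ι ⊕ κ → ℝ | (fun i => z (Sum.inl i)) ∈ B} := hB.preimage Sum.inl
  refine SE.proj ((h1.inter h2).inter h3) (fun x => ?_) (fun x w w' hw hw' => ?_)
  · simp only [mem_inter_iff, mem_ofPred_eq, mem_iInter, Sum.elim_inr, Sum.elim_inl]
    constructor
    · rintro ⟨h, h'⟩
      exact ⟨fun k => g k x, ⟨h', fun k => ⟨h, rfl⟩⟩, h⟩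
    · rintro ⟨w, ⟨h, h'⟩, hb⟩
      refine ⟨hb, ?_⟩
      convert h using 2 with k
      exact (h' k).2.symm
  · simp only [mem_inter_iff, mem_ofPred_eq, mem_iInter, Sum.elim_inr, Sum.elim_inl] at hw hw'
    funext k
    rw [(hw.1.2 k).2, (hw'.1.2 k).2]

theorem SEon.reindex {ι κ : Type} {B : Set (ι → ℝ)} {f : (ι → ℝ) → ℝ} (hf : SEon B f)
    (g : ι → κ) : SEon {x : κ → ℝ | (fun i => x (g i)) ∈ B} fun x => f fun i => x (g i) :=
  hf.preimage (Option.map g)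

theorem SEon.proj {ι : Type} {B : Set (ι → ℝ)} (hB : SE B) (i : ι) : SEon B fun x => x i :=
  (hB.preimage some).inter (QF.eq_var none (some i)).se

theorem SEon.const {ι : Type} {B : Set (ι → ℝ)} (hB : SE B) (c : ℝ) : SEon B fun _ => c :=
  (hB.preimage some).inter (QF.eq_const none c).se

theorem SEon.comp {ι κ : Type} [Finite κ] {B : Set (ι → ℝ)} {C : Set (κ → ℝ)}
    {f : (κ → ℝ) → ℝ} {g : κ → (ι → ℝ) → ℝ} (hB : SE B) (hf : SEon C f) (hg : ∀ k, SEon B (g k))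
    (hC : ∀ x ∈ B, (fun k => g k x) ∈ C) : SEon B fun x => f fun k => g k x := by
  have hB' : SE {z : Option ι → ℝ | (fun i => z (some i)) ∈ B} := hB.preimage some
  have := SE.comp (B := {z : Option ι → ℝ | (fun i => z (some i)) ∈ B}) (κ := Option κ)
    (g := fun o z => o.elim (z none) fun k => g k fun i => z (some i)) hB' hf (by
      intro o
      rcases o with _ | k
      · exact SEon.proj hB' none
      · exact (hg k).preimage (fun o : Option ι => o.elim none fun i => some (some i)))
  refine SE.congr this fun z => ?_
  simp only [mem_ofPred_eq, Option.elim]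
  exact and_congr_right fun hz => ⟨fun h => ⟨hC _ hz, h⟩, fun h => h.2⟩

theorem SEon.restrict {ι : Type} {B C : Set (ι → ℝ)} {f : (ι → ℝ) → ℝ} (hf : SEon B f)
    (hC : SE C) (h : C ⊆ B) : SEon C f := by
  refine SE.congr ((hC.preimage some).inter hf) fun z => ?_
  simp only [mem_ofPred_eq, mem_inter_iff]
  exact ⟨fun ⟨a, b⟩ => ⟨a, h a, b⟩, fun ⟨a, _, b⟩ => ⟨a, b⟩⟩

theorem SEon.piecewise {ι : Type} {B C : Set (ι → ℝ)} {f g : (ι → ℝ) → ℝ} (hf : SEon B f)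
    (hg : SEon C g) (hd : Disjoint B C) [DecidablePred (· ∈ B)] :
    SEon (B ∪ C) fun x => if x ∈ B then f x else g x := by
  refine SE.congr (SE.union hf hg ?_) fun z => ?_
  · rw [disjoint_left]
    exact fun z h h' => disjoint_left.1 hd h.1 h'.1
  · simp only [mem_ofPred_eq, mem_union]
    by_cases h : (fun i => z (some i)) ∈ B
    · have := disjoint_left.1 hd h
      simp [h, this]
    · simp [h]

theorem SEon.comp₁ {ι : Type} {B : Set (ι → ℝ)} {u : ℝ → ℝ} {D : Set ℝ} {g : (ι → ℝ) → ℝ}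
    (hB : SE B) (hu : SEon {x : Unit → ℝ | x () ∈ D} fun x => u (x ())) (hg : SEon B g)
    (hD : ∀ x ∈ B, g x ∈ D) : SEon B fun x => u (g x) :=
  SEon.comp (κ := Unit) (g := fun _ => g) hB hu (fun _ => hg) hD

theorem SEon.comp₂ {ι : Type} {B : Set (ι → ℝ)} {u : ℝ → ℝ → ℝ} {f g : (ι → ℝ) → ℝ}
    (hB : SE B) (hu : SEon univ fun x : Bool → ℝ => u (x false) (x true)) (hf : SEon B f)
    (hg : SEon B g) : SEon B fun x => u (f x) (g x) :=
  SEon.comp (κ := Bool) (g := fun b => if b then g else f) hB hu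
    (fun b => by cases b <;> simpa) (fun _ _ => mem_univ _)

theorem SEon.add {ι : Type} {B : Set (ι → ℝ)} {f g : (ι → ℝ) → ℝ}
    (hB : SE B) (hf : SEon B f) (hg : SEon B g) : SEon B fun x => f x + g x :=
  SEon.comp₂ (u := fun a b => a + b) hB
    ((QF.add (some false) (some true) none).se.congr fun z => by simp) hf hg

theorem SEon.mul {ι : Type} {B : Set (ι → ℝ)} {f g : (ι → ℝ) → ℝ}
    (hB : SE B) (hf : SEon B f) (hg : SEon B g) : SEon B fun x => f x * g x :=
  SEon.comp₂ (u := fun a b => a * b) hB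
    ((QF.mul (some false) (some true) none).se.congr fun z => by simp) hf hg

theorem SEon.exp {ι : Type} {B : Set (ι → ℝ)} {f : (ι → ℝ) → ℝ}
    (hB : SE B) (hf : SEon B f) : SEon B fun x => Real.exp (f x) :=
  SEon.comp₁ (u := Real.exp) (D := univ) hB
    ((QF.exp (some ()) none).se.congr fun z => by simp) hf fun _ _ => mem_univ _

theorem SEon.sub {ι : Type} {B : Set (ι → ℝ)} {f g : (ι → ℝ) → ℝ}
    (hB : SE B) (hf : SEon B f) (hg : SEon B g) : SEon B fun x => f x - g x :=
  (hf.add hB ((SEon.const hB (-1)).mul hB hg)).congr fun x _ => by ring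

theorem SEon.eq {ι : Type} {B : Set (ι → ℝ)} {f g : (ι → ℝ) → ℝ}
    (hB : SE B) (hf : SEon B f) (hg : SEon B g) : SE {x | x ∈ B ∧ f x = g x} :=
  (SE.comp (κ := Bool) (g := fun b => if b then g else f) hB (QF.eq_var false true).se
    (fun b => by cases b <;> simpa)).congr fun x => by simp

theorem SEon.lt {ι : Type} {B : Set (ι → ℝ)} {f g : (ι → ℝ) → ℝ}
    (hB : SE B) (hf : SEon B f) (hg : SEon B g) : SE {x | x ∈ B ∧ f x < g x} :=
  (SE.comp (κ := Bool) (g := fun b => if b then g else f) hB (QF.lt_var false true).se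
    (fun b => by cases b <;> simpa)).congr fun x => by simp

theorem SEon.ne {ι : Type} {B : Set (ι → ℝ)} {f g : (ι → ℝ) → ℝ}
    (hB : SE B) (hf : SEon B f) (hg : SEon B g) : SE {x | x ∈ B ∧ f x ≠ g x} :=
  (SE.comp (κ := Bool) (g := fun b => if b then g else f) hB (QF.eq_var false true).compl.se
    (fun b => by cases b <;> simpa)).congr fun x => by simp

theorem SEon.le {ι : Type} {B : Set (ι → ℝ)} {f g : (ι → ℝ) → ℝ}
    (hB : SE B) (hf : SEon B f) (hg : SEon B g) : SE {x | x ∈ B ∧ f x ≤ g x} :=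
  (SE.comp (κ := Bool) (g := fun b => if b then g else f) hB (QF.lt_var true false).compl.se
    (fun b => by cases b <;> simpa)).congr fun x => by simp

/-- A function given by a unique solution of an `SE` condition is `SE`. -/
theorem SEon.of_unique {ι : Type} {B : Set (ι → ℝ)} {f : (ι → ℝ) → ℝ} {S : Set (Option ι → ℝ)}
    (hB : SE B) (hS : SE S)
    (h : ∀ x ∈ B, ∀ t : ℝ, (fun o : Option ι => o.elim t x) ∈ S ↔ t = f x) : SEon B f := by
  refine SE.congr ((hB.preimage some).inter hS) fun z => ?_
  simp only [mem_ofPred_eq, mem_inter_iff]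
  refine and_congr_right fun hz => ?_
  rw [← h _ hz]
  convert Iff.rfl using 2
  funext o; cases o <;> rfl

theorem SEon.inv {ι : Type} {B : Set (ι → ℝ)} {f : (ι → ℝ) → ℝ}
    (hB : SE B) (hf : SEon B f) (h : ∀ x ∈ B, f x ≠ 0) : SEon B fun x => (f x)⁻¹ := by
  have hB' : SE {z : Option ι → ℝ | (fun i => z (some i)) ∈ B} := hB.preimage some
  have hf' : SEon {z : Option ι → ℝ | (fun i => z (some i)) ∈ B} fun z => f fun i => z (some i) :=
    hf.reindex some
  refine SEon.of_unique hB (SEon.eq hB' (hf'.mul hB' (SEon.proj hB' none)) (SEon.const hB' 1)) ?_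
  intro x hx t
  have := h x hx
  simp only [mem_ofPred_eq, Option.elim]
  constructor
  · rintro ⟨_, h⟩
    exact eq_inv_of_mul_eq_one_right h
  · rintro rfl
    exact ⟨hx, mul_inv_cancel₀ this⟩

variable {n m : ℕ}

/-- The `i`-th partial derivative. -/
def pd (i : Fin n) (f : (Fin n → ℝ) → ℝ) : (Fin n → ℝ) → ℝ :=
  fun x => fderiv ℝ f x (Pi.single i 1)

/-- Iterated partial derivatives. -/
def pdl : List (Fin n) → ((Fin n → ℝ) → ℝ) → (Fin n → ℝ) → ℝ
  | [], f => f
  | i :: l, f => pd i (pdl l f)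

/-- `f` is analytic on the ball of radius `ρ` and all its derivatives have `SE` graphs there. -/
structure AOn (ρ : ℝ) (f : (Fin n → ℝ) → ℝ) : Prop where
  analytic : AnalyticOnNhd ℝ f (Metric.ball 0 ρ)
  se : ∀ l, SEon (Metric.ball 0 ρ) (pdl l f)

/-- Germs at the origin of analytic functions all of whose derivatives have `SE` graphs. -/
def IsA (f : (Fin n → ℝ) → ℝ) : Prop := ∃ ρ > 0, AOn ρ f

theorem SE.ball {ρ : ℝ} (hρ : 0 < ρ) : SE (Metric.ball (0 : Fin n → ℝ) ρ) := by
  have : SE (⋂ i : Fin n, ({x : Fin n → ℝ | x ∈ univ ∧ -ρ < x i} ∩ {x | x ∈ univ ∧ x i < ρ})) :=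
    SE.iInter fun i =>
      (SEon.lt QF.univ.se (SEon.const QF.univ.se _) (SEon.proj QF.univ.se i)).inter
      (SEon.lt QF.univ.se (SEon.proj QF.univ.se i) (SEon.const QF.univ.se _))
  refine this.congr fun x => ?_
  simp [pi_norm_lt_iff hρ, abs_lt]

theorem pd_congr {U : Set (Fin n → ℝ)} (hU : IsOpen U) {f g : (Fin n → ℝ) → ℝ} (h : EqOn f g U)
    (i : Fin n) : EqOn (pd i f) (pd i g) U := by
  intro x hx
  have : f =ᶠ[𝓝 x] g := h.eventuallyEq_of_mem (hU.mem_nhds hx)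
  simp only [pd]
  rw [this.fderiv_eq]

theorem pdl_congr {U : Set (Fin n → ℝ)} (hU : IsOpen U) {f g : (Fin n → ℝ) → ℝ} (h : EqOn f g U)
    (l : List (Fin n)) : EqOn (pdl l f) (pdl l g) U := by
  induction l with
  | nil => exact h
  | cons i l ih => exact pd_congr hU ih i

theorem analytic_pd {U : Set (Fin n → ℝ)} {f : (Fin n → ℝ) → ℝ} (h : AnalyticOnNhd ℝ f U)
    (i : Fin n) : AnalyticOnNhd ℝ (pd i f) U := fun x hx =>
  (ContinuousLinearMap.apply ℝ ℝ (Pi.single i 1 : Fin n → ℝ)).analyticAt _ |>.comp (h x hx).fderiv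

theorem analytic_pdl {U : Set (Fin n → ℝ)} {f : (Fin n → ℝ) → ℝ} (h : AnalyticOnNhd ℝ f U)
    (l : List (Fin n)) : AnalyticOnNhd ℝ (pdl l f) U := by
  induction l with
  | nil => exact h
  | cons i l ih => exact analytic_pd ih i

theorem pdl_append (l l' : List (Fin n)) (f : (Fin n → ℝ) → ℝ) :
    pdl (l ++ l') f = pdl l (pdl l' f) := by
  induction l with
  | nil => rfl
  | cons i l ih => simp [pdl, ih]

theorem AOn.of_closed {ρ : ℝ} (hρ : 0 < ρ) (G : Set ((Fin n → ℝ) → ℝ))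
    (ha : ∀ g ∈ G, AnalyticOnNhd ℝ g (Metric.ball 0 ρ)) (hs : ∀ g ∈ G, SEon (Metric.ball 0 ρ) g)
    (hd : ∀ g ∈ G, ∀ i, ∃ h ∈ Algebra.adjoin ℝ G, EqOn (pd i g) h (Metric.ball 0 ρ))
    {f : (Fin n → ℝ) → ℝ} (hf : f ∈ Algebra.adjoin ℝ G) : AOn ρ f := by
  have hA : ∀ f ∈ Algebra.adjoin ℝ G, AnalyticOnNhd ℝ f (Metric.ball 0 ρ) := by
    intro f hf
    induction hf using Algebra.adjoin_induction with
    | mem x hx => exact ha x hx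
    | algebraMap r => exact analyticOnNhd_const
    | add x y _ _ h h' => exact h.add h'
    | mul x y _ _ h h' => exact h.mul h'
  have hS : ∀ f ∈ Algebra.adjoin ℝ G, SEon (Metric.ball 0 ρ) f := by
    intro f hf
    induction hf using Algebra.adjoin_induction with
    | mem x hx => exact hs x hx
    | algebraMap r => exact SEon.const (SE.ball hρ) r
    | add x y _ _ h h' => exact h.add (SE.ball hρ) h'
    | mul x y _ _ h h' => exact h.mul (SE.ball hρ) h'
  have hD : ∀ f ∈ Algebra.adjoin ℝ G, ∀ i, ∃ h ∈ Algebra.adjoin ℝ G,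
      EqOn (pd i f) h (Metric.ball 0 ρ) := by
    intro f hf i
    induction hf using Algebra.adjoin_induction with
    | mem x hx => exact hd x hx i
    | algebraMap r =>
      refine ⟨0, Subalgebra.zero_mem _, fun x _ => ?_⟩
      simp only [pd]
      rw [show (algebraMap ℝ ((Fin n → ℝ) → ℝ) r) = fun _ => r from rfl]
      simp
    | add x y hx hy h h' =>
      obtain ⟨a, a1, a2⟩ := h
      obtain ⟨b, b1, b2⟩ := h'
      refine ⟨a + b, Subalgebra.add_mem _ a1 b1, fun z hz => ?_⟩
      have e1 := a2 hz
      have e2 := b2 hz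
      simp only [pd, Pi.add_apply] at e1 e2 ⊢
      rw [fderiv_add (hA x hx z hz).differentiableAt (hA y hy z hz).differentiableAt, ← e1, ← e2]
      rfl
    | mul x y hx hy h h' =>
      obtain ⟨a, a1, a2⟩ := h
      obtain ⟨b, b1, b2⟩ := h'
      refine ⟨x * b + y * a, Subalgebra.add_mem _ (Subalgebra.mul_mem _ hx b1)
        (Subalgebra.mul_mem _ hy a1), fun z hz => ?_⟩
      have e1 := a2 hz
      have e2 := b2 hz
      simp only [pd, Pi.add_apply, Pi.mul_apply] at e1 e2 ⊢
      rw [fderiv_mul (hA x hx z hz).differentiableAt (hA y hy z hz).differentiableAt, ← e1, ← e2]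
      rfl
  refine ⟨hA f hf, fun l => ?_⟩
  suffices H : ∃ h ∈ Algebra.adjoin ℝ G, EqOn (pdl l f) h (Metric.ball 0 ρ) by
    obtain ⟨h, h1, h2⟩ := H
    exact (hS h h1).congr h2.symm
  induction l with
  | nil => exact ⟨f, hf, fun _ _ => rfl⟩
  | cons i l ih =>
    obtain ⟨h, h1, h2⟩ := ih
    obtain ⟨g, g1, g2⟩ := hD h h1 i
    exact ⟨g, g1, (pd_congr Metric.isOpen_ball h2 i).trans g2⟩

theorem AOn.mono {ρ ρ' : ℝ} {f : (Fin n → ℝ) → ℝ} (h : AOn ρ f) (h0 : 0 < ρ') (hr : ρ' ≤ ρ) :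
    AOn ρ' f :=
  ⟨h.analytic.mono (Metric.ball_subset_ball hr),
    fun l => (h.se l).restrict (SE.ball h0) (Metric.ball_subset_ball hr)⟩

theorem AOn.congr {ρ : ℝ} {f g : (Fin n → ℝ) → ℝ} (h : AOn ρ f) (e : EqOn f g (Metric.ball 0 ρ)) :
    AOn ρ g :=
  ⟨h.analytic.congr Metric.isOpen_ball e,
    fun l => (h.se l).congr (pdl_congr Metric.isOpen_ball e l)⟩

theorem AOn.pdl {ρ : ℝ} {f : (Fin n → ℝ) → ℝ} (h : AOn ρ f) (l : List (Fin n)) :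
    AOn ρ (pdl l f) :=
  ⟨analytic_pdl h.analytic l, fun l' => by rw [← pdl_append]; exact h.se _⟩

theorem IsA.congr {f g : (Fin n → ℝ) → ℝ} (h : IsA f) (e : f =ᶠ[𝓝 0] g) : IsA g := by
  obtain ⟨ρ, hρ, h⟩ := h
  obtain ⟨ε, hε, he⟩ := Metric.eventually_nhds_iff_ball.1 e
  exact ⟨min ρ ε, lt_min hρ hε, (h.mono (lt_min hρ hε) (min_le_left _ _)).congr
    fun x hx => he x (Metric.ball_subset_ball (min_le_right _ _) hx)⟩

theorem IsA.analyticAt {f : (Fin n → ℝ) → ℝ} (h : IsA f) : AnalyticAt ℝ f 0 := by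
  obtain ⟨ρ, hρ, h⟩ := h
  exact h.analytic 0 (Metric.mem_ball_self hρ)

theorem IsA.pdl {f : (Fin n → ℝ) → ℝ} (h : IsA f) (l : List (Fin n)) : IsA (pdl l f) := by
  obtain ⟨ρ, hρ, h⟩ := h
  exact ⟨ρ, hρ, h.pdl l⟩

theorem pd_comp {h : Fin m → (Fin n → ℝ) → ℝ} {f : (Fin m → ℝ) → ℝ} {x : Fin n → ℝ}
    (hf : DifferentiableAt ℝ f fun j => h j x) (hh : ∀ j, DifferentiableAt ℝ (h j) x) (i : Fin n) :
    RM.pd i (fun x => f fun j => h j x) x =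
      ∑ j, RM.pd j f (fun j => h j x) * RM.pd i (h j) x := by
  have hd : HasFDerivAt (fun x j => h j x) (ContinuousLinearMap.pi fun j => fderiv ℝ (h j) x) x :=
    hasFDerivAt_pi.2 fun j => (hh j).hasFDerivAt
  simp only [RM.pd]
  have e : fderiv ℝ (fun x => f fun j => h j x) x = (fderiv ℝ f fun j => h j x).comp
      (ContinuousLinearMap.pi fun j => fderiv ℝ (h j) x) :=
    (HasFDerivAt.comp x (g := f) hf.hasFDerivAt hd).fderiv
  rw [e, ContinuousLinearMap.comp_apply]
  conv_lhs => rw [pi_eq_sum_univ' (ContinuousLinearMap.pi (fun j => fderiv ℝ (h j) x)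
    (Pi.single i (1 : ℝ)))]
  rw [map_sum]
  refine Finset.sum_congr rfl fun j _ => ?_
  rw [map_smul, smul_eq_mul, mul_comm]
  congr 2

theorem AOn.comp {ρ ρ' : ℝ} (hρ : 0 < ρ') {f : (Fin m → ℝ) → ℝ} {h : Fin m → (Fin n → ℝ) → ℝ}
    (hf : AOn ρ f) (hh : ∀ j, AOn ρ' (h j))
    (hm : ∀ x ∈ Metric.ball 0 ρ', (fun j => h j x) ∈ Metric.ball (0 : Fin m → ℝ) ρ) :
    AOn ρ' fun x => f fun j => h j x := by
  let G : Set ((Fin n → ℝ) → ℝ) := range (fun l => fun x => RM.pdl l f fun j => h j x) ∪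
    range fun p : Fin m × List (Fin n) => RM.pdl p.2 (h p.1)
  have hb := SE.ball (n := n) hρ
  refine AOn.of_closed (G := G) hρ ?_ ?_ ?_ (Algebra.subset_adjoin (Or.inl ⟨[], rfl⟩))
  · rintro g (⟨l, rfl⟩ | ⟨⟨j, l⟩, rfl⟩)
    · intro x hx
      refine AnalyticAt.comp (g := RM.pdl l f) (f := fun x j => h j x)
        (analytic_pdl hf.analytic l _ (hm x hx)) ?_
      exact AnalyticAt.pi fun j => (hh j).analytic x hx
    · exact analytic_pdl (hh j).analytic l
  · rintro g (⟨l, rfl⟩ | ⟨⟨j, l⟩, rfl⟩)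
    · exact SEon.comp hb (hf.se l) (fun j => (hh j).se []) hm
    · exact (hh j).se l
  · rintro g (⟨l, rfl⟩ | ⟨⟨j, l⟩, rfl⟩) i
    · refine ⟨fun x => ∑ j, RM.pdl (j :: l) f (fun j => h j x) * RM.pdl [i] (h j) x, ?_,
        fun x hx => ?_⟩
      · have : (fun x => ∑ j, RM.pdl (j :: l) f (fun j => h j x) * RM.pdl [i] (h j) x) =
            ∑ j, (fun x => RM.pdl (j :: l) f (fun j => h j x)) * RM.pdl [i] (h j) := by
          funext x; simp
        rw [this]
        refine Subalgebra.sum_mem _ fun j _ => Subalgebra.mul_mem _ ?_ ?_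
        · exact Algebra.subset_adjoin (Or.inl ⟨j :: l, rfl⟩)
        · exact Algebra.subset_adjoin (Or.inr ⟨(j, [i]), rfl⟩)
      · exact pd_comp (analytic_pdl hf.analytic l _ (hm x hx)).differentiableAt
          (fun j => ((hh j).analytic x hx).differentiableAt) i
    · exact ⟨_, Algebra.subset_adjoin (Or.inr ⟨(j, i :: l), rfl⟩), fun x _ => rfl⟩

theorem AOn.const {ρ : ℝ} (hρ : 0 < ρ) (c : ℝ) : AOn ρ fun _ : Fin n → ℝ => c :=
  AOn.of_closed (G := ∅) hρ (by simp) (by simp) (by simp) (Subalgebra.algebraMap_mem _ c)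

theorem pd_proj (i j : Fin n) : RM.pd i (fun x => x j) =
    fun _ : Fin n → ℝ => if j = i then 1 else 0 := by
  funext x
  simp only [RM.pd]
  have : HasFDerivAt (fun x : Fin n → ℝ => x j) (ContinuousLinearMap.proj (R := ℝ) j) x :=
    (ContinuousLinearMap.proj (R := ℝ) (φ := fun _ : Fin n => ℝ) j).hasFDerivAt
  rw [this.fderiv]
  simp [Pi.single_apply]

theorem AOn.proj {ρ : ℝ} (hρ : 0 < ρ) (j : Fin n) : AOn ρ fun x : Fin n → ℝ => x j := by
  refine AOn.of_closed (G := {fun x => x j}) hρ ?_ ?_ ?_ (Algebra.subset_adjoin (mem_singleton _))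
  · rintro _ rfl
    exact fun x _ => (ContinuousLinearMap.proj (R := ℝ) (φ := fun _ : Fin n => ℝ) j).analyticAt x
  · rintro _ rfl
    exact SEon.proj (SE.ball hρ) j
  · rintro _ rfl i
    rw [pd_proj]
    exact ⟨_, Subalgebra.algebraMap_mem _ (if j = i then 1 else 0), fun _ _ => rfl⟩

theorem AOn.of_adjoin {ρ : ℝ} (hρ : 0 < ρ) {G : Set ((Fin n → ℝ) → ℝ)} (hG : ∀ g ∈ G, AOn ρ g)
    {f : (Fin n → ℝ) → ℝ} (hf : f ∈ Algebra.adjoin ℝ G) : AOn ρ f := by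
  let H : Set ((Fin n → ℝ) → ℝ) := {h | ∃ g ∈ G, ∃ l, h = RM.pdl l g}
  have : G ⊆ H := fun g hg => ⟨g, hg, [], rfl⟩
  refine AOn.of_closed (G := H) hρ ?_ ?_ ?_ (Algebra.adjoin_mono this hf)
  · rintro _ ⟨g, hg, l, rfl⟩; exact analytic_pdl (hG g hg).analytic l
  · rintro _ ⟨g, hg, l, rfl⟩; exact (hG g hg).se l
  · rintro _ ⟨g, hg, l, rfl⟩ i
    exact ⟨_, Algebra.subset_adjoin ⟨g, hg, i :: l, rfl⟩, fun _ _ => rfl⟩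

theorem AOn.add {ρ : ℝ} (hρ : 0 < ρ) {f g : (Fin n → ℝ) → ℝ} (hf : AOn ρ f) (hg : AOn ρ g) :
    AOn ρ fun x => f x + g x :=
  AOn.of_adjoin (G := {f, g}) hρ (by rintro _ (rfl | rfl) <;> assumption)
    (Subalgebra.add_mem _ (Algebra.subset_adjoin (Or.inl rfl))
      (Algebra.subset_adjoin (Or.inr rfl)))

theorem AOn.mul {ρ : ℝ} (hρ : 0 < ρ) {f g : (Fin n → ℝ) → ℝ} (hf : AOn ρ f) (hg : AOn ρ g) :
    AOn ρ fun x => f x * g x :=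
  AOn.of_adjoin (G := {f, g}) hρ (by rintro _ (rfl | rfl) <;> assumption)
    (Subalgebra.mul_mem _ (Algebra.subset_adjoin (Or.inl rfl))
      (Algebra.subset_adjoin (Or.inr rfl)))

theorem IsA.const (c : ℝ) : IsA fun _ : Fin n → ℝ => c := ⟨1, one_pos, AOn.const one_pos c⟩

theorem IsA.proj (j : Fin n) : IsA fun x : Fin n → ℝ => x j := ⟨1, one_pos, AOn.proj one_pos j⟩

theorem IsA.add {f g : (Fin n → ℝ) → ℝ} (hf : IsA f) (hg : IsA g) : IsA fun x => f x + g x := by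
  obtain ⟨ρ, hρ, hf⟩ := hf
  obtain ⟨ρ', hρ', hg⟩ := hg
  have h0 := lt_min hρ hρ'
  exact ⟨_, h0, (hf.mono h0 (min_le_left _ _)).add h0 (hg.mono h0 (min_le_right _ _))⟩

theorem IsA.mul {f g : (Fin n → ℝ) → ℝ} (hf : IsA f) (hg : IsA g) : IsA fun x => f x * g x := by
  obtain ⟨ρ, hρ, hf⟩ := hf
  obtain ⟨ρ', hρ', hg⟩ := hg
  have h0 := lt_min hρ hρ'
  exact ⟨_, h0, (hf.mono h0 (min_le_left _ _)).mul h0 (hg.mono h0 (min_le_right _ _))⟩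

theorem IsA.neg {f : (Fin n → ℝ) → ℝ} (hf : IsA f) : IsA fun x => -f x := by
  simpa using (IsA.const (n := n) (-1)).mul hf

theorem IsA.sub {f g : (Fin n → ℝ) → ℝ} (hf : IsA f) (hg : IsA g) : IsA fun x => f x - g x := by
  simpa [sub_eq_add_neg] using hf.add hg.neg

theorem IsA.sum {ι : Type} (s : Finset ι) {f : ι → (Fin n → ℝ) → ℝ} (h : ∀ i ∈ s, IsA (f i)) :
    IsA fun x => ∑ i ∈ s, f i x := by
  classical
  induction s using Finset.induction_on with
  | empty => simpa using IsA.const 0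
  | insert a s ha ih =>
    simp only [Finset.sum_insert ha]
    exact (h a (by simp)).add (ih fun i hi => h i (by simp [hi]))

theorem IsA.prod {ι : Type} (s : Finset ι) {f : ι → (Fin n → ℝ) → ℝ} (h : ∀ i ∈ s, IsA (f i)) :
    IsA fun x => ∏ i ∈ s, f i x := by
  classical
  induction s using Finset.induction_on with
  | empty => simpa using IsA.const 1
  | insert a s ha ih =>
    simp only [Finset.prod_insert ha]
    exact (h a (by simp)).mul (ih fun i hi => h i (by simp [hi]))

theorem IsA.pow {f : (Fin n → ℝ) → ℝ} (hf : IsA f) (k : ℕ) : IsA fun x => f x ^ k := by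
  simpa using IsA.prod (Finset.range k) (fun _ _ => hf)

theorem IsA.continuousAt {f : (Fin n → ℝ) → ℝ} (h : IsA f) : ContinuousAt f 0 :=
  h.analyticAt.continuousAt

theorem tendsto_pi_zero {α : Type*} {l : Filter α} {h : Fin m → α → ℝ}
    (h0 : ∀ j, Tendsto (h j) l (𝓝 0)) : Tendsto (fun x j => h j x) l (𝓝 0) :=
  tendsto_pi_nhds.2 h0

theorem IsA.tendsto_zero {h : Fin m → (Fin n → ℝ) → ℝ} (hh : ∀ j, IsA (h j))
    (h0 : ∀ j, h j 0 = 0) : Tendsto (fun x j => h j x) (𝓝 0) (𝓝 0) :=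
  tendsto_pi_zero fun j => by simpa [ContinuousAt, h0] using (hh j).continuousAt

theorem IsA.comp {f : (Fin m → ℝ) → ℝ} {h : Fin m → (Fin n → ℝ) → ℝ} (hf : IsA f)
    (hh : ∀ j, IsA (h j)) (h0 : ∀ j, h j 0 = 0) : IsA fun x => f fun j => h j x := by
  obtain ⟨ρ, hρ, hf⟩ := hf
  have ht := IsA.tendsto_zero hh h0
  choose r hr hh using hh
  obtain ⟨ε, hε, he⟩ := Metric.eventually_nhds_iff_ball.1
    (ht.eventually (Metric.ball_mem_nhds _ hρ))
  obtain ⟨δ, hδ, hd⟩ : ∃ δ > 0, ∀ j, δ ≤ r j := by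
    rcases isEmpty_or_nonempty (Fin m) with h | h
    · exact ⟨1, one_pos, fun j => h.elim j⟩
    · obtain ⟨j, hj⟩ := Finite.exists_min r
      exact ⟨r j, hr j, hj⟩
  have h0 := lt_min hε hδ
  exact ⟨_, h0, hf.comp h0 (fun j => (hh j).mono h0 ((min_le_right _ _).trans (hd j)))
    fun x hx => he x (Metric.ball_subset_ball (min_le_left _ _) hx)⟩

theorem pd_add_left (r : Fin n → ℝ) (f : (Fin n → ℝ) → ℝ) (i : Fin n) :
    RM.pd i (fun z => f (r + z)) = fun z => RM.pd i f (r + z) := by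
  funext z
  simp only [RM.pd]
  rw [fderiv_comp_add_left]

theorem pdl_add_left (r : Fin n → ℝ) (f : (Fin n → ℝ) → ℝ) (l : List (Fin n)) :
    RM.pdl l (fun z => f (r + z)) = fun z => RM.pdl l f (r + z) := by
  induction l with
  | nil => rfl
  | cons i l ih => simp only [RM.pdl, ih, pd_add_left]

theorem AOn.translate {ρ : ℝ} {f : (Fin n → ℝ) → ℝ} (hf : AOn ρ f) {r : Fin n → ℝ} (hr : ‖r‖ < ρ) :
    IsA fun z => f (r + z) := by
  have h0 : 0 < ρ - ‖r‖ := sub_pos.2 hr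
  have hm : ∀ x ∈ Metric.ball 0 (ρ - ‖r‖), r + x ∈ Metric.ball (0 : Fin n → ℝ) ρ := by
    intro x hx
    rw [mem_ball_zero_iff] at hx ⊢
    linarith [norm_add_le r x]
  refine ⟨ρ - ‖r‖, h0, fun x hx => ?_, fun l => ?_⟩
  · exact AnalyticAt.comp (g := f) (f := fun z => r + z) (hf.analytic _ (hm x hx))
      (analyticAt_const.add analyticAt_id)
  · rw [pdl_add_left]
    exact SEon.comp (g := fun k x => r k + x k) (SE.ball h0) (hf.se l)
      (fun k => (SEon.const (SE.ball h0) _).add (SE.ball h0) (SEon.proj (SE.ball h0) k)) hm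

theorem pd_one_var {u : ℝ → ℝ} {u' : ℝ} {x : Fin 1 → ℝ} (h : HasDerivAt u u' (x 0)) (i : Fin 1) :
    RM.pd i (fun x => u (x 0)) x = u' := by
  simp only [RM.pd]
  have h1 : HasFDerivAt (fun x : Fin 1 → ℝ => x 0) (ContinuousLinearMap.proj (R := ℝ) 0) x :=
    (ContinuousLinearMap.proj (R := ℝ) (φ := fun _ : Fin 1 => ℝ) 0).hasFDerivAt
  have := h.hasFDerivAt.comp x h1
  rw [show (fun x : Fin 1 → ℝ => u (x 0)) = u ∘ fun x : Fin 1 → ℝ => x 0 from rfl, this.fderiv]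
  simp [Subsingleton.elim i 0]

theorem IsA.comp₁ {u : ℝ → ℝ} (hu : IsA fun x : Fin 1 → ℝ => u (x 0)) {f : (Fin n → ℝ) → ℝ}
    (hf : IsA f) (h0 : f 0 = 0) : IsA fun x => u (f x) :=
  IsA.comp (h := fun _ => f) hu (fun _ => hf) fun _ => h0

theorem mem_ball_one {ρ : ℝ} {x : Fin 1 → ℝ} : x ∈ Metric.ball 0 ρ ↔ |x 0| < ρ := by
  rw [mem_ball_zero_iff]
  have : ‖x‖ = |x 0| := by
    rw [Pi.norm_def]; simp
  rw [this]

theorem analytic_one_var {u : ℝ → ℝ} {x : Fin 1 → ℝ} (h : AnalyticAt ℝ u (x 0)) :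
    AnalyticAt ℝ (fun x : Fin 1 → ℝ => u (x 0)) x :=
  AnalyticAt.comp (g := u) (f := fun x : Fin 1 → ℝ => x 0) h
    ((ContinuousLinearMap.proj (R := ℝ) (φ := fun _ : Fin 1 => ℝ) 0).analyticAt x)

theorem IsA.inv₁ {r : ℝ} (hr : r ≠ 0) : IsA fun x : Fin 1 → ℝ => (r + x 0)⁻¹ := by
  have hp : 0 < |r| := abs_pos.2 hr
  have hne : ∀ x ∈ Metric.ball (0 : Fin 1 → ℝ) |r|, r + x 0 ≠ 0 := by
    intro x hx h
    rw [mem_ball_one, show x 0 = -r by linarith, abs_neg] at hx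
    exact lt_irrefl _ hx
  refine ⟨|r|, hp, AOn.of_closed (G := {fun x : Fin 1 → ℝ => (r + x 0)⁻¹}) hp ?_ ?_ ?_
    (Algebra.subset_adjoin (mem_singleton _))⟩
  · rintro _ rfl x hx
    exact analytic_one_var (u := fun t => (r + t)⁻¹)
      ((analyticAt_const.add analyticAt_id).inv (hne x hx))
  · rintro _ rfl
    exact SEon.inv (SE.ball hp) ((SEon.const (SE.ball hp) r).add (SE.ball hp)
      (SEon.proj (SE.ball hp) 0)) hne
  · rintro _ rfl i
    refine ⟨algebraMap ℝ _ (-1) * ((fun x : Fin 1 → ℝ => (r + x 0)⁻¹) * fun x => (r + x 0)⁻¹),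
      Subalgebra.mul_mem _ (Subalgebra.algebraMap_mem _ _) (Subalgebra.mul_mem _
        (Algebra.subset_adjoin (mem_singleton _)) (Algebra.subset_adjoin (mem_singleton _))), fun x hx => ?_⟩
    rw [pd_one_var (u := fun t => (r + t)⁻¹) (((hasDerivAt_id _).const_add r).inv (hne x hx))]
    have := hne x hx
    simp only [Pi.mul_apply, Pi.algebraMap_apply, Algebra.algebraMap_self, RingHom.id_apply, id]
    field_simp

theorem IsA.inv {f : (Fin n → ℝ) → ℝ} (hf : IsA f) (h0 : f 0 ≠ 0) : IsA fun x => (f x)⁻¹ := by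
  have := IsA.comp₁ (u := fun t => (f 0 + t)⁻¹) (IsA.inv₁ h0) (hf.sub (IsA.const (f 0))) (by simp)
  simpa using this

theorem AOn.exp {ρ : ℝ} (hp : 0 < ρ) : AOn ρ fun x : Fin 1 → ℝ => Real.exp (x 0) := by
  refine AOn.of_closed (G := {fun x : Fin 1 → ℝ => Real.exp (x 0)}) hp ?_ ?_ ?_
    (Algebra.subset_adjoin (mem_singleton _))
  · rintro _ rfl x hx
    exact analytic_one_var (u := Real.exp) analyticAt_rexp
  · rintro _ rfl
    exact SEon.exp (SE.ball hp) (SEon.proj (SE.ball hp) 0)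
  · rintro _ rfl i
    exact ⟨_, Algebra.subset_adjoin (mem_singleton _), fun x hx => pd_one_var (Real.hasDerivAt_exp _) i⟩

theorem IsA.exp {f : (Fin n → ℝ) → ℝ} (hf : IsA f) : IsA fun x => Real.exp (f x) := by
  have := (IsA.const (n := n) (Real.exp (f 0))).mul (IsA.comp₁ (u := Real.exp)
    ⟨1, one_pos, AOn.exp one_pos⟩ (hf.sub (IsA.const (f 0))) (by simp))
  simpa [← Real.exp_add] using this

theorem SEon.log {ι : Type} {B : Set (ι → ℝ)} {f : (ι → ℝ) → ℝ}
    (hB : SE B) (hf : SEon B f) (h : ∀ x ∈ B, 0 < f x) : SEon B fun x => Real.log (f x) := by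
  have hB' : SE {z : Option ι → ℝ | (fun i => z (some i)) ∈ B} := hB.preimage some
  refine SEon.of_unique hB (SEon.eq hB' (SEon.exp hB' (SEon.proj hB' none)) (hf.reindex some)) ?_
  intro x hx t
  have := h x hx
  simp only [mem_ofPred_eq, Option.elim]
  constructor
  · rintro ⟨_, h⟩
    rw [← h, Real.log_exp]
  · rintro rfl
    exact ⟨hx, Real.exp_log this⟩

theorem IsA.log₁ : IsA fun x : Fin 1 → ℝ => Real.log (1 + x 0) := by
  have hp : (0 : ℝ) < 1 := one_pos
  have hne : ∀ x ∈ Metric.ball (0 : Fin 1 → ℝ) 1, 0 < 1 + x 0 := by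
    intro x hx
    rw [mem_ball_one, abs_lt] at hx
    linarith
  obtain ⟨ρ, hρ, hi⟩ := IsA.inv₁ (one_ne_zero (α := ℝ))
  have h0 := lt_min hp hρ
  have hi := hi.mono h0 (min_le_right 1 ρ)
  have hne' : ∀ x ∈ Metric.ball (0 : Fin 1 → ℝ) (min 1 ρ), 0 < 1 + x 0 := fun x hx =>
    hne x (Metric.ball_subset_ball (min_le_left _ _) hx)
  have hs := SE.ball (n := 1) h0
  refine ⟨min 1 ρ, h0, AOn.of_closed (G := {fun x : Fin 1 → ℝ => Real.log (1 + x 0)} ∪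
    range fun l => RM.pdl l fun x : Fin 1 → ℝ => (1 + x 0)⁻¹) h0 ?_ ?_ ?_
    (Algebra.subset_adjoin (Or.inl rfl))⟩
  · rintro _ (rfl | ⟨l, rfl⟩)
    · intro x hx
      exact analytic_one_var (u := fun t => Real.log (1 + t))
        ((analyticAt_const.add analyticAt_id).log (hne' x hx))
    · exact (hi.pdl l).analytic
  · rintro _ (rfl | ⟨l, rfl⟩)
    · exact SEon.log hs ((SEon.const hs 1).add hs (SEon.proj hs 0)) hne'
    · exact hi.se l
  · rintro _ (rfl | ⟨l, rfl⟩) i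
    · refine ⟨_, Algebra.subset_adjoin (Or.inr ⟨[], rfl⟩), fun x hx => ?_⟩
      rw [pd_one_var (u := fun t => Real.log (1 + t))
        (((hasDerivAt_id _).const_add 1).log (hne' x hx).ne')]
      simp [RM.pdl]
    · exact ⟨_, Algebra.subset_adjoin (Or.inr ⟨i :: l, rfl⟩), fun x hx => rfl⟩

theorem IsA.log {f : (Fin n → ℝ) → ℝ} (hf : IsA f) (h0 : 0 < f 0) : IsA fun x => Real.log (f x) := by
  have := (IsA.const (n := n) (Real.log (f 0))).add (IsA.comp₁ (u := fun t => Real.log (1 + t)) IsA.log₁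
    ((hf.mul (IsA.const (f 0)⁻¹)).sub (IsA.const 1)) (by simp [h0.ne']))
  refine this.congr ?_
  filter_upwards [hf.continuousAt.eventually (lt_mem_nhds h0)] with x hx
  rw [add_sub_cancel, Real.log_mul hx.ne' (inv_ne_zero h0.ne'), Real.log_inv]
  ring

theorem IsA.rpow {f : (Fin n → ℝ) → ℝ} (hf : IsA f) (h0 : 0 < f 0) (c : ℝ) :
    IsA fun x => f x ^ c := by
  refine ((hf.log h0).mul (IsA.const c)).exp.congr ?_
  filter_upwards [hf.continuousAt.eventually (lt_mem_nhds h0)] with x hx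
  rw [Real.rpow_def_of_pos hx]

theorem germ_domain {f g : (Fin n → ℝ) → ℝ} (hf : AnalyticAt ℝ f 0) (hg : AnalyticAt ℝ g 0)
    (h : ∀ᶠ x in 𝓝 0, f x * g x = 0) : f =ᶠ[𝓝 0] 0 ∨ g =ᶠ[𝓝 0] 0 := by
  obtain ⟨ε, hε, he⟩ := Metric.eventually_nhds_iff_ball.1
    (h.and (hf.eventually_analyticAt.and hg.eventually_analyticAt))
  by_contra! hc
  obtain ⟨x, hx, hxB⟩ := ((not_eventually.1 hc.1).and_eventually
    (Metric.ball_mem_nhds (0 : Fin n → ℝ) hε)).exists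
  have h1 : ∀ᶠ y in 𝓝 x, g y = 0 := by
    filter_upwards [(he x hxB).2.1.continuousAt.eventually_ne hx,
      Metric.isOpen_ball.mem_nhds hxB] with y hy hyB
    exact (mul_eq_zero.1 (he y hyB).1).resolve_left hy
  have h2 := AnalyticOnNhd.eqOn_zero_of_preconnected_of_eventuallyEq_zero
    (fun y hy => (he y hy).2.2) (convex_ball (0 : Fin n → ℝ) ε).isPreconnected hxB h1
  exact hc.2 (h2.eventuallyEq_of_mem (Metric.ball_mem_nhds _ hε))

theorem germ_cancel {f g h : (Fin n → ℝ) → ℝ} (hf : AnalyticAt ℝ f 0) (hg : AnalyticAt ℝ g 0)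
    (hh : AnalyticAt ℝ h 0) (hf0 : ¬ f =ᶠ[𝓝 0] 0) (e : ∀ᶠ x in 𝓝 0, f x * g x = f x * h x) :
    g =ᶠ[𝓝 0] h := by
  have := (germ_domain hf (hg.sub hh) (by filter_upwards [e] with x hx; simp [mul_sub, hx])).resolve_left hf0
  filter_upwards [this] with x hx
  exact sub_eq_zero.1 hx

theorem proj_ne_zero (i : Fin n) : ¬ (fun x : Fin n → ℝ => x i) =ᶠ[𝓝 0] 0 := by
  intro h
  have : Tendsto (fun t : ℝ => (fun _ : Fin n => t)) (𝓝[≠] 0) (𝓝 0) :=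
    (tendsto_pi_nhds.2 fun j => tendsto_id).mono_left nhdsWithin_le_nhds
  obtain ⟨t, ht, ht'⟩ := ((this.eventually h).and self_mem_nhdsWithin).exists
  exact ht' ht

theorem analytic_div {f : (Fin n → ℝ) → ℝ} (hf : AnalyticAt ℝ f 0) (i : Fin n)
    (h0 : (fun x => f (Function.update x i 0)) =ᶠ[𝓝 0] 0) :
    ∃ h, AnalyticAt ℝ h 0 ∧ f =ᶠ[𝓝 0] fun x => x i * h x := by
  obtain ⟨p, R, hp⟩ := hf
  let P : (Fin n → ℝ) →L[ℝ] (Fin n → ℝ) := ContinuousLinearMap.id ℝ _ -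
    (ContinuousLinearMap.proj (R := ℝ) (φ := fun _ : Fin n => ℝ) i).smulRight (Pi.single i 1)
  have hP : ∀ x, P x = Function.update x i 0 := by
    intro x
    ext j
    by_cases hj : j = i
    · subst hj; simp [P]
    · simp [P, hj]
  have hPn : ‖P‖ ≤ 1 := by
    refine ContinuousLinearMap.opNorm_le_bound _ zero_le_one fun x => ?_
    rw [hP, one_mul, pi_norm_le_iff_of_nonneg (norm_nonneg _)]
    intro j
    by_cases hj : j = i
    · subst hj; simp
    · simpa [hj] using norm_le_pi_norm x j
  let L : (m j : ℕ) → Fin (m + 1) → (Fin n → ℝ) →L[ℝ] (Fin n → ℝ) := fun m j k =>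
    if (k : ℕ) < j then P else ContinuousLinearMap.id ℝ _
  have hL : ∀ m j k, ‖L m j k‖ ≤ 1 := by
    intro m j k
    dsimp only [L]
    split_ifs
    exacts [hPn, ContinuousLinearMap.norm_id_le]
  let e : Fin n → ℝ := Pi.single i 1
  have he : ‖e‖ ≤ 1 := by
    rw [pi_norm_le_iff_of_nonneg zero_le_one]
    intro j
    by_cases hj : j = i
    · subst hj; simp [e]
    · simp [e, hj]
  let q : FormalMultilinearSeries ℝ (Fin n → ℝ) ℝ := fun m =>
    ∑ j : Fin (m + 1), ((p (m + 1)).compContinuousLinearMap (L m j)).curryMid j e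
  have hq : ∀ m, ‖q m‖ ≤ (m + 1) * ‖p (m + 1)‖ := by
    intro m
    refine (norm_sum_le _ _).trans ((Finset.sum_le_card_nsmul _ _ ‖p (m + 1)‖ fun j _ => ?_).trans
      (by simp))
    refine (ContinuousLinearMap.le_opNorm _ _).trans ?_
    rw [ContinuousMultilinearMap.norm_curryMid]
    refine (mul_le_of_le_one_right (norm_nonneg _) he).trans
      ((ContinuousMultilinearMap.norm_compContinuousLinearMap_le _ _).trans
        (mul_le_of_le_one_right (norm_nonneg _) (Finset.prod_le_one (fun _ _ => norm_nonneg _)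
          fun k _ => hL m j k)))
  obtain ⟨r, hr0, hrR⟩ := ENNReal.lt_iff_exists_nnreal_btwn.1 hp.r_pos
  have hr0' : 0 < (r : ℝ) := by exact_mod_cast hr0
  obtain ⟨C, hC, hCb⟩ := p.norm_mul_pow_le_of_lt_radius (hrR.trans_le hp.r_le)
  have hrad : ((r / 2 : NNReal) : ENNReal) ≤ q.radius := by
    refine q.le_radius_of_bound (C / r) fun m => ?_
    have h1 := hCb (m + 1)
    have h2 : ((m : ℝ) + 1) ≤ 2 ^ m := by
      exact_mod_cast Nat.lt_two_pow_self (n := m)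
    calc ‖q m‖ * ((r / 2 : NNReal) : ℝ) ^ m ≤ ((m + 1) * ‖p (m + 1)‖) * ((r / 2 : NNReal) : ℝ) ^ m := by
            gcongr; exact hq m
      _ = ((m + 1) / 2 ^ m) * (‖p (m + 1)‖ * r ^ (m + 1)) / r := by
            push_cast; rw [div_pow, pow_succ]; field_simp
      _ ≤ 1 * C / r := by
            gcongr
            rw [div_le_one (by positivity)]; exact h2
      _ = C / r := by rw [one_mul]
  have hrad0 : 0 < q.radius := lt_of_lt_of_le (ENNReal.coe_pos.2 (half_pos (by exact_mod_cast hr0))) hrad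
  have hqs := q.hasFPowerSeriesOnBall hrad0
  refine ⟨q.sum, hqs.analyticAt, ?_⟩
  have htel : ∀ m (x : Fin n → ℝ),
      (p (m + 1) fun _ => x) - (p (m + 1) fun _ => P x) = x i * q m fun _ => x := by
    intro m x
    let u : ℕ → Fin (m + 1) → (Fin n → ℝ) := fun j k => if (k : ℕ) < j then P x else x
    have hu0 : u 0 = fun _ => x := by funext k; simp [u]
    have hu1 : u (m + 1) = fun _ => P x := by funext k; simp only [u]; rw [if_pos k.2]
    rw [← hu0, ← hu1, ← Finset.sum_range_sub' (fun j => p (m + 1) (u j)), Finset.sum_range]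
    simp only [q, sum_apply, Finset.mul_sum]
    refine Finset.sum_congr rfl fun j _ => ?_
    have e1 : u j = Function.update (u j) j x := by
      simp only [u]
      rw [eq_comm, Function.update_eq_self_iff]
      simp
    have e2 : u (j + 1) = Function.update (u j) j (P x) := by
      funext k
      by_cases hk : k = j
      · subst hk; simp [u]
      · have : (k : ℕ) ≠ j := fun h => hk (Fin.ext h)
        simp only [u, Function.update_of_ne hk]
        congr 1
        simp only [eq_iff_iff]; omega
    rw [e2]
    nth_rewrite 1 [e1]
    rw [← ContinuousMultilinearMap.map_update_sub]
    have e3 : x - P x = x i • e := by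
      rw [hP]
      ext k
      by_cases hk : k = i
      · subst hk; simp [e]
      · simp [e, hk]
    rw [e3, ContinuousMultilinearMap.map_update_smul, smul_eq_mul]
    rw [ContinuousMultilinearMap.curryMid_apply, ContinuousMultilinearMap.compContinuousLinearMap_apply]
    congr 2
    funext k
    rcases eq_or_ne k j with rfl | hk
    · simp [L]
    · obtain ⟨k', rfl⟩ := Fin.exists_succAbove_eq hk
      simp only [Function.update_of_ne hk, Fin.insertNth_apply_succAbove, L, u]
      split_ifs <;> rfl
  have hBR : Metric.eball (0 : Fin n → ℝ) R ∈ 𝓝 0 := Metric.eball_mem_nhds _ hp.r_pos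
  have hBq : Metric.eball (0 : Fin n → ℝ) q.radius ∈ 𝓝 0 := Metric.eball_mem_nhds _ hrad0
  have hPt : Tendsto P (𝓝 0) (𝓝 0) := by simpa using P.continuous.tendsto 0
  filter_upwards [h0, hBR, hBq, hPt.eventually hBR] with x hx hxR hxq hPxR
  have s1 := hp.hasSum hxR
  have s2 := hp.hasSum hPxR
  have s3 := (hqs.hasSum hxq).mul_left (x i)
  simp only [zero_add] at s1 s2 s3
  have hx' : f (P x) = 0 := by rw [hP]; exact hx
  have s4 := s1.sub s2
  rw [hx', sub_zero] at s4
  have s5 := (hasSum_nat_add_iff' 1).2 s4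
  have z0 : (p 0 fun _ => x) - (p 0 fun _ => P x) = 0 := by
    rw [sub_eq_zero]; congr 1; exact Subsingleton.elim _ _
  simp only [Finset.range_one, Finset.sum_singleton, z0, sub_zero] at s5
  simp only [htel] at s5
  exact s5.unique s3

theorem pd_comm {U : Set (Fin n → ℝ)} {f : (Fin n → ℝ) → ℝ}
    (h : AnalyticOnNhd ℝ f U) (i j : Fin n) : EqOn (pd i (pd j f)) (pd j (pd i f)) U := by
  intro x hx
  have hs : IsSymmSndFDerivAt ℝ f x :=
    (h x hx).contDiffAt.isSymmSndFDerivAt_of_omega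
  have hd : DifferentiableAt ℝ (fderiv ℝ f) x := (h x hx).fderiv.differentiableAt
  have key : ∀ i j : Fin n, pd i (pd j f) x = fderiv ℝ (fderiv ℝ f) x (Pi.single i 1) (Pi.single j 1) := by
    intro i j
    rw [show pd j f = fun y => fderiv ℝ f y (Pi.single j 1) from rfl, pd,
      fderiv_clm_apply hd (differentiableAt_const _)]
    simp
  rw [key, key, hs]

theorem pdl_perm {U : Set (Fin n → ℝ)} (hU : IsOpen U) {f : (Fin n → ℝ) → ℝ}
    (h : AnalyticOnNhd ℝ f U) {l l' : List (Fin n)} (p : l.Perm l') : EqOn (pdl l f) (pdl l' f) U := by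
  induction p with
  | nil => exact fun _ _ => rfl
  | cons a _ ih => exact pd_congr hU ih a
  | swap a b l => exact pd_comm (analytic_pdl h l) b a
  | trans _ _ ih1 ih2 => exact ih1.trans ih2

theorem pd_add' {f g : (Fin n → ℝ) → ℝ} {x : Fin n → ℝ} (hf : DifferentiableAt ℝ f x)
    (hg : DifferentiableAt ℝ g x) (i : Fin n) :
    pd i (fun x => f x + g x) x = pd i f x + pd i g x := by
  simp only [pd]
  rw [fderiv_fun_add hf hg]; rfl

theorem pd_mul' {f g : (Fin n → ℝ) → ℝ} {x : Fin n → ℝ} (hf : DifferentiableAt ℝ f x)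
    (hg : DifferentiableAt ℝ g x) (i : Fin n) :
    pd i (fun x => f x * g x) x = f x * pd i g x + g x * pd i f x := by
  simp only [pd]
  rw [fderiv_fun_mul hf hg]; rfl

theorem pd_const (c : ℝ) (i : Fin n) (x : Fin n → ℝ) : pd i (fun _ => c) x = 0 := by
  simp [pd]

theorem analytic_proj (i : Fin n) (x : Fin n → ℝ) : AnalyticAt ℝ (fun x : Fin n → ℝ => x i) x :=
  (ContinuousLinearMap.proj (R := ℝ) (φ := fun _ : Fin n => ℝ) i).analyticAt x

theorem pdl_coord_mul {U : Set (Fin n → ℝ)} (hU : IsOpen U) {f h : (Fin n → ℝ) → ℝ}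
    (hh : AnalyticOnNhd ℝ h U) (i : Fin n) (e : EqOn f (fun x => x i * h x) U) (l : List (Fin n)) :
    EqOn (pdl l f) (fun x => x i * pdl l h x + l.count i * pdl (l.erase i) h x) U := by
  induction l with
  | nil => intro x hx; simpa [pdl] using e hx
  | cons j l ih =>
    intro x hx
    have a1 := (analytic_pdl hh l x hx).differentiableAt
    have a2 := (analytic_pdl hh (l.erase i) x hx).differentiableAt
    have a3 := (analytic_proj i x).differentiableAt
    have := pd_congr hU ih j hx
    rw [show pdl (j :: l) f = pd j (pdl l f) from rfl, this,
      pd_add' (f := fun x => x i * pdl l h x) (g := fun x => l.count i * pdl (l.erase i) h x)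
        (a3.mul a1) ((differentiableAt_const _).mul a2), pd_mul' a3 a1, pd_mul' (differentiableAt_const _) a2, pd_const, pd_proj]
    by_cases hj : i = j
    · subst hj
      simp only [if_true, List.erase_cons_head, List.count_cons_self, mul_zero, add_zero, mul_one]
      by_cases hi : i ∈ l
      · have := pdl_perm hU hh (List.perm_cons_erase hi) hx
        rw [this]
        simp only [pdl]
        push_cast; ring
      · rw [List.count_eq_zero_of_not_mem hi]
        simp [pdl]
    · have hj' : ¬ j = i := fun h => hj h.symm
      simp only [hj, if_false, mul_zero, add_zero]
      rw [List.count_cons_of_ne hj', List.erase_cons_tail (by simpa using hj')]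
      simp [pdl]

theorem IsA.div {f : (Fin n → ℝ) → ℝ} (hf : IsA f) (i : Fin n)
    (h0 : (fun x => f (Function.update x i 0)) =ᶠ[𝓝 0] 0) :
    ∃ h, IsA h ∧ f =ᶠ[𝓝 0] fun x => x i * h x := by
  classical
  obtain ⟨h, hh, e⟩ := analytic_div hf.analyticAt i h0
  refine ⟨h, ?_, e⟩
  obtain ⟨ρ', hρ', hf⟩ := hf
  obtain ⟨ε, hε, he⟩ := Metric.eventually_nhds_iff_ball.1 (e.and hh.eventually_analyticAt)
  let ρ := min ρ' ε
  have hρ : 0 < ρ := lt_min hρ' hε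
  have hf := hf.mono hρ (min_le_left _ _)
  have he' : EqOn f (fun x => x i * h x) (Metric.ball 0 ρ) := fun x hx =>
    (he x (Metric.ball_subset_ball (min_le_right _ _) hx)).1
  have hh' : AnalyticOnNhd ℝ h (Metric.ball 0 ρ) := fun x hx =>
    (he x (Metric.ball_subset_ball (min_le_right _ _) hx)).2
  refine ⟨ρ, hρ, hh', ?_⟩
  have hB := SE.ball (n := n) hρ
  have key := fun l => pdl_coord_mul Metric.isOpen_ball hh' i he' l
  suffices H : ∀ N (l : List (Fin n)), l.length ≤ N → SEon (Metric.ball 0 ρ) (RM.pdl l h) from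
    fun l => H _ l le_rfl
  have hB0 := SEon.eq hB (SEon.proj hB i) (SEon.const hB 0)
  have hB1 := SEon.ne hB (SEon.proj hB i) (SEon.const hB 0)
  have step : ∀ l : List (Fin n), (i ∈ l → SEon (Metric.ball 0 ρ) (RM.pdl (l.erase i) h)) →
      SEon (Metric.ball 0 ρ) (RM.pdl l h) := by
    intro l hl
    have hc : SEon (Metric.ball 0 ρ) (fun x => (l.count i : ℝ) * RM.pdl (l.erase i) h x) := by
      by_cases hi : i ∈ l
      · exact (SEon.const hB _).mul hB (hl hi)
      · exact (SEon.const hB 0).congr fun x _ => by simp [List.count_eq_zero_of_not_mem hi]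
    have s1 : SEon {x | x ∈ Metric.ball (0 : Fin n → ℝ) ρ ∧ x i ≠ 0} (RM.pdl l h) := by
      have i1 : {x | x ∈ Metric.ball (0 : Fin n → ℝ) ρ ∧ x i ≠ 0} ⊆ Metric.ball 0 ρ := fun x hx => hx.1
      refine ((((hf.se l).sub hB hc).restrict hB1 i1).mul hB1
        (((SEon.proj hB i).restrict hB1 i1).inv hB1 fun x hx => hx.2)).congr fun x hx => ?_
      have := hx.2
      simp only [key l hx.1]
      field_simp
      ring
    have s0 : SEon {x | x ∈ Metric.ball (0 : Fin n → ℝ) ρ ∧ x i = 0} (RM.pdl l h) := by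
      have i1 : {x | x ∈ Metric.ball (0 : Fin n → ℝ) ρ ∧ x i = 0} ⊆ Metric.ball 0 ρ := fun x hx => hx.1
      refine (((hf.se (i :: l)).mul hB (SEon.const hB (((l.count i : ℝ) + 1)⁻¹))).restrict hB0 i1).congr
        fun x hx => ?_
      have h1 : ((l.count i : ℝ) + 1) ≠ 0 := by positivity
      simp only [key (i :: l) hx.1, hx.2, List.count_cons_self, List.erase_cons_head]
      push_cast
      field_simp
      ring
    refine (cast (congrArg (fun B => SEon B _) ?_) (s0.piecewise s1 ?_)).congr (f := fun x =>
      if x ∈ {x | x ∈ Metric.ball (0 : Fin n → ℝ) ρ ∧ x i = 0} then RM.pdl l h x else RM.pdl l h x) ?_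
    · ext x
      simp only [mem_union, mem_ofPred_eq]
      tauto
    · rw [Set.disjoint_left]
      exact fun x hx hx' => hx'.2 hx.2
    · intro x _; simp
  intro N
  induction N with
  | zero =>
    intro l hl
    refine step l fun hi => ?_
    rw [List.length_eq_zero_iff.1 (Nat.le_zero.1 hl)] at hi
    simp at hi
  | succ N ih =>
    intro l hl
    refine step l fun hi => ih _ ?_
    rw [List.length_erase_of_mem hi]; omega

theorem cons_eq_fun {q : ℕ} (t : ℝ) (w : Fin q → ℝ) :
    (Fin.cons t w : Fin (q + 1) → ℝ) = fun j => Fin.cases t w j := by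
  funext j
  refine Fin.cases ?_ (fun k => ?_) j <;> simp

theorem pd_cons {q : ℕ} {f : (Fin (q + 1) → ℝ) → ℝ} {θ : (Fin q → ℝ) → ℝ} {w : Fin q → ℝ}
    (hf : DifferentiableAt ℝ f (Fin.cons (θ w) w)) (hθ : DifferentiableAt ℝ θ w) (i : Fin q) :
    pd i (fun w => f (Fin.cons (θ w) w)) w =
      pd 0 f (Fin.cons (θ w) w) * pd i θ w + pd i.succ f (Fin.cons (θ w) w) := by
  simp only [cons_eq_fun] at hf ⊢
  have := pd_comp (f := f) (h := fun j w => Fin.cases (θ w) w j) (x := w) hf (by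
    intro j
    refine Fin.cases ?_ (fun k => ?_) j
    · exact hθ
    · exact (analytic_proj k w).differentiableAt) i
  rw [this, Fin.sum_univ_succ]
  simp only [Fin.cases_zero, Fin.cases_succ, pd_proj]
  simp

theorem analyticAt_cons {q : ℕ} {θ : (Fin q → ℝ) → ℝ} {w : Fin q → ℝ} (h : AnalyticAt ℝ θ w) :
    AnalyticAt ℝ (fun w => (Fin.cons (θ w) w : Fin (q + 1) → ℝ)) w := by
  simp only [cons_eq_fun]
  refine AnalyticAt.pi fun j => ?_
  refine Fin.cases ?_ (fun k => ?_) j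
  · exact h
  · exact analytic_proj k w

theorem IsA.implicit {q : ℕ} {G : (Fin (q + 1) → ℝ) → ℝ} (hG : IsA G) (h0 : G 0 = 0)
    (h1 : RM.pd 0 G 0 ≠ 0) :
    ∃ θ : (Fin q → ℝ) → ℝ, IsA θ ∧ θ 0 = 0 ∧ ∀ᶠ w in 𝓝 0, G (Fin.cons (θ w) w) = 0 := by
  let Ψ : (Fin (q + 1) → ℝ) → (Fin (q + 1) → ℝ) := fun x => Fin.cons (G x) (Fin.tail x)
  have hΨ : AnalyticAt ℝ Ψ 0 := by
    refine AnalyticAt.pi fun j => ?_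
    refine Fin.cases ?_ (fun k => ?_) j
    · simpa [Ψ] using hG.analyticAt
    · simpa [Ψ, Fin.tail] using analytic_proj k.succ 0
  have hΨ0 : Ψ 0 = 0 := by
    funext j
    refine Fin.cases ?_ (fun k => ?_) j
    · simp [Ψ, h0]
    · simp [Ψ, Fin.tail]
  have hstrict := hΨ.hasStrictFDerivAt
  have hinj : Function.Injective (fderiv ℝ Ψ 0 : (Fin (q + 1) → ℝ) →ₗ[ℝ] (Fin (q + 1) → ℝ)) := by
    rw [← LinearMap.ker_eq_bot, LinearMap.ker_eq_bot']
    intro v hv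
    have hpi := hasFDerivAt_pi'.1 hΨ.differentiableAt.hasFDerivAt
    have hs : ∀ k : Fin q, v k.succ = 0 := by
      intro k
      have e : (fun x => Ψ x k.succ) = fun x => x k.succ := by funext x; simp [Ψ, Fin.tail]
      have a := hpi k.succ
      rw [e] at a
      have b : HasFDerivAt (fun x : Fin (q + 1) → ℝ => x k.succ)
        (ContinuousLinearMap.proj (R := ℝ) (φ := fun _ : Fin (q + 1) => ℝ) k.succ) 0 :=
        (ContinuousLinearMap.proj (R := ℝ) (φ := fun _ : Fin (q + 1) => ℝ) k.succ).hasFDerivAt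
      have := congrArg (fun L => L v) (a.unique b)
      simp only [ContinuousLinearMap.comp_apply, ContinuousLinearMap.proj_apply] at this
      rw [← this]
      exact congrFun hv k.succ
    have hz : v 0 = 0 := by
      have e : (fun x => Ψ x 0) = G := by funext x; simp [Ψ]
      have a := hpi 0
      rw [e] at a
      have := congrArg (fun L => L v) (a.unique hG.analyticAt.differentiableAt.hasFDerivAt)
      simp only [ContinuousLinearMap.comp_apply, ContinuousLinearMap.proj_apply] at this
      have h3 : fderiv ℝ G 0 v = 0 := by rw [← this]; exact congrFun hv 0
      have hv' : v = v 0 • Pi.single 0 1 := by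
        funext j
        refine Fin.cases ?_ (fun k => ?_) j
        · simp
        · simp [hs]
      rw [hv', map_smul, smul_eq_mul] at h3
      exact (mul_eq_zero.1 h3).resolve_right h1
    funext j
    exact Fin.cases hz hs j
  let e : (Fin (q + 1) → ℝ) ≃L[ℝ] (Fin (q + 1) → ℝ) :=
    (LinearEquiv.ofInjectiveEndo _ hinj).toContinuousLinearEquiv
  have he : (e : (Fin (q + 1) → ℝ) →L[ℝ] (Fin (q + 1) → ℝ)) = fderiv ℝ Ψ 0 := by
    ext v; rfl
  have hfd : HasStrictFDerivAt Ψ (e : (Fin (q + 1) → ℝ) →L[ℝ] (Fin (q + 1) → ℝ)) 0 := by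
    rw [he]; exact hstrict
  have hsym : AnalyticAt ℝ (hfd.localInverse Ψ e 0) 0 := by
    let R := hfd.toOpenPartialHomeomorph Ψ
    have hx : (0 : Fin (q + 1) → ℝ) ∈ R.source :=
      HasStrictFDerivAt.mem_toOpenPartialHomeomorph_source _
    obtain ⟨p, hp⟩ := hΨ
    have := R.hasFPowerSeriesAt_symm hx hp (i := e) (by
      rw [he, hp.fderiv_eq, LinearIsometryEquiv.symm_apply_apply]) |>.analyticAt
    have e0 : R 0 = 0 := hΨ0
    rw [e0] at this
    exact this
  have hright := hfd.eventually_right_inverse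
  have hleft := hfd.eventually_left_inverse
  have himg := hfd.localInverse_apply_image
  rw [hΨ0] at hright himg
  set Λ := hfd.localInverse Ψ e 0
  let θ : (Fin q → ℝ) → ℝ := fun w => Λ (Fin.cons 0 w) 0
  have hθ0 : θ 0 = 0 := by
    have : (Fin.cons 0 0 : Fin (q + 1) → ℝ) = 0 := by
      funext j; refine Fin.cases ?_ (fun k => ?_) j <;> simp
    simp only [θ, this, himg, Pi.zero_apply]
  have hcons0 : (Fin.cons 0 0 : Fin (q + 1) → ℝ) = 0 := by
    funext j; refine Fin.cases ?_ (fun k => ?_) j <;> simp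
  have hθa : AnalyticAt ℝ θ 0 := by
    have h2 : AnalyticAt ℝ (fun w : Fin q → ℝ => Λ (Fin.cons 0 w)) 0 := by
      refine AnalyticAt.comp (g := Λ) (f := fun w : Fin q → ℝ => (Fin.cons 0 w : Fin (q + 1) → ℝ)) ?_
        (analyticAt_cons (θ := fun _ => 0) analyticAt_const)
      rw [hcons0]; exact hsym
    exact (analytic_proj 0 _).comp h2
  have htc : Tendsto (fun w : Fin q → ℝ => (Fin.cons 0 w : Fin (q + 1) → ℝ)) (𝓝 0) (𝓝 0) := by
    have := (analyticAt_cons (w := (0 : Fin q → ℝ)) (θ := fun _ => 0) analyticAt_const).continuousAt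
    rwa [ContinuousAt, hcons0] at this
  have hΛc : ∀ᶠ w : Fin q → ℝ in 𝓝 0, Λ (Fin.cons 0 w) = Fin.cons (θ w) w := by
    filter_upwards [htc.eventually hright] with w hw
    have h2 : Fin.tail (Λ (Fin.cons 0 w)) = w := by
      have := congrArg Fin.tail hw
      simpa [Ψ] using this
    rw [← Fin.cons_self_tail (Λ (Fin.cons 0 w)), h2]
  have hsol : ∀ᶠ w : Fin q → ℝ in 𝓝 0, G (Fin.cons (θ w) w) = 0 := by
    filter_upwards [hΛc, htc.eventually hright] with w hw hw2
    rw [← hw]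
    have := congrFun hw2 0
    simpa [Ψ] using this
  refine ⟨θ, ?_, hθ0, hsol⟩
  have htθ : Tendsto (fun w : Fin q → ℝ => (Fin.cons (θ w) w : Fin (q + 1) → ℝ)) (𝓝 0) (𝓝 0) := by
    have := (analyticAt_cons hθa).continuousAt
    rwa [ContinuousAt, hθ0, hcons0] at this
  obtain ⟨ρG, hρG, hG⟩ := hG
  have hd0 : ∀ᶠ x in 𝓝 0, RM.pd 0 G x ≠ 0 :=
    (analytic_pd hG.analytic 0 0 (Metric.mem_ball_self hρG)).continuousAt.eventually_ne h1
  obtain ⟨ε, hε, hε'⟩ := Metric.eventually_nhds_iff_ball.1 (hleft.and hd0)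
  let ρ₁ := min ρG ε
  have hρ₁ : 0 < ρ₁ := lt_min hρG hε
  have hG := hG.mono hρ₁ (min_le_left _ _)
  obtain ⟨ρ₂, hρ₂, h2⟩ := Metric.eventually_nhds_iff_ball.1
    ((hsol.and (htθ.eventually (Metric.ball_mem_nhds 0 hρ₁))).and (hθa.eventually_analyticAt.and hΛc))
  have hsub := Metric.ball_subset_ball (x := (0 : Fin (q + 1) → ℝ)) (min_le_right ρG ε)
  let Γ : Set ((Fin q → ℝ) → ℝ) := {θ, fun w => (RM.pd 0 G (Fin.cons (θ w) w))⁻¹} ∪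
    range fun l : List (Fin (q + 1)) => fun w => RM.pdl l G (Fin.cons (θ w) w)
  have hB := SE.ball (n := q) hρ₂
  have hse : SEon (Metric.ball 0 ρ₂) θ := by
    have a := (hG.se []).reindex (κ := Option (Fin q)) (fun j => Fin.cases none some j)
    have hBB := (SE.ball (n := q + 1) hρ₁).preimage (κ := Option (Fin q)) (fun j => Fin.cases none some j)
    refine SEon.of_unique hB (SEon.eq hBB a (SEon.const hBB 0)) fun w hw t => ?_
    have e1 : (fun j => (Fin.cases none some j : Option (Fin q)).elim t w) =
        (Fin.cons t w : Fin (q + 1) → ℝ) := by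
      funext j; refine Fin.cases ?_ (fun k => ?_) j <;> simp
    simp only [mem_ofPred_eq, e1]
    constructor
    · rintro ⟨hm, hz⟩
      have := (hε' _ (hsub hm)).1
      have e2 : Ψ (Fin.cons t w) = Fin.cons 0 w := by
        simp only [Ψ, Fin.tail_cons]; congr 1
      rw [e2, (h2 w hw).2.2] at this
      simpa using (congrFun this 0).symm
    · rintro rfl
      exact ⟨(h2 w hw).1.2, (h2 w hw).1.1⟩
  have hcomp : ∀ l, SEon (Metric.ball 0 ρ₂) fun w => RM.pdl l G (Fin.cons (θ w) w) := by
    intro l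
    simp only [cons_eq_fun]
    refine SEon.comp (g := fun j w => Fin.cases (θ w) w j) hB (hG.se l) ?_ ?_
    · intro j
      refine Fin.cases ?_ (fun k => ?_) j
      · exact hse
      · exact SEon.proj hB k
    · intro w hw
      rw [← cons_eq_fun]
      exact (h2 w hw).1.2
  have hne : ∀ w ∈ Metric.ball 0 ρ₂, RM.pd 0 G (Fin.cons (θ w) w) ≠ 0 := fun w hw =>
    (hε' _ (hsub (h2 w hw).1.2)).2
  have hcan : ∀ l, AnalyticOnNhd ℝ (fun w => RM.pdl l G (Fin.cons (θ w) w)) (Metric.ball 0 ρ₂) := by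
    intro l w hw
    exact AnalyticAt.comp (g := RM.pdl l G) (f := fun w => (Fin.cons (θ w) w : Fin (q + 1) → ℝ))
      (analytic_pdl hG.analytic l _ (h2 w hw).1.2) (analyticAt_cons (h2 w hw).2.1)
  have hθi : ∀ i : Fin q, EqOn (RM.pd i θ) (fun w => (-1 : ℝ) * (RM.pdl [i.succ] G (Fin.cons (θ w) w) *
      (RM.pd 0 G (Fin.cons (θ w) w))⁻¹)) (Metric.ball 0 ρ₂) := by
    intro i w hw
    have hz : RM.pd i (fun w => G (Fin.cons (θ w) w)) w = 0 := by
      rw [pd_congr Metric.isOpen_ball (g := fun _ => 0) (fun w hw => (h2 w hw).1.1) i hw, pd_const]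
    rw [pd_cons (hG.analytic _ (h2 w hw).1.2).differentiableAt (h2 w hw).2.1.differentiableAt] at hz
    have := hne w hw
    simp only [RM.pdl]
    field_simp
    linear_combination hz
  have memΓ : ∀ l, (fun w => RM.pdl l G (Fin.cons (θ w) w)) ∈ Algebra.adjoin ℝ Γ := fun l =>
    Algebra.subset_adjoin (Or.inr ⟨l, rfl⟩)
  have memI : (fun w => (RM.pd 0 G (Fin.cons (θ w) w))⁻¹) ∈ Algebra.adjoin ℝ Γ :=
    Algebra.subset_adjoin (Or.inl (Or.inr rfl))
  have hθadj : ∀ i : Fin q, ∃ h ∈ Algebra.adjoin ℝ Γ, EqOn (RM.pd i θ) h (Metric.ball 0 ρ₂) := fun i =>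
    ⟨_, Subalgebra.mul_mem _ (Subalgebra.algebraMap_mem _ (-1 : ℝ))
      (Subalgebra.mul_mem _ (memΓ [i.succ]) memI), hθi i⟩
  have hladj : ∀ l (i : Fin q), ∃ h ∈ Algebra.adjoin ℝ Γ,
      EqOn (RM.pd i (fun w => RM.pdl l G (Fin.cons (θ w) w))) h (Metric.ball 0 ρ₂) := by
    intro l i
    obtain ⟨h, hh, e⟩ := hθadj i
    refine ⟨_, Subalgebra.add_mem _ (Subalgebra.mul_mem _ (memΓ (0 :: l)) hh) (memΓ (i.succ :: l)), ?_⟩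
    intro w hw
    rw [pd_cons (analytic_pdl hG.analytic l _ (h2 w hw).1.2).differentiableAt
      (h2 w hw).2.1.differentiableAt, e hw]
    rfl
  refine ⟨ρ₂, hρ₂, AOn.of_closed (G := Γ) hρ₂ ?_ ?_ ?_ (Algebra.subset_adjoin (Or.inl (Or.inl rfl)))⟩
  · rintro g ((rfl | rfl) | ⟨l, rfl⟩)
    · exact fun w hw => (h2 w hw).2.1
    · exact fun w hw => (hcan [0] w hw).inv (hne w hw)
    · exact hcan l
  · rintro g ((rfl | rfl) | ⟨l, rfl⟩)
    · exact hse
    · exact (hcomp [0]).inv hB hne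
    · exact hcomp l
  · rintro g ((rfl | rfl) | ⟨l, rfl⟩) i
    · exact hθadj i
    · obtain ⟨h, hh, e⟩ := hladj [0] i
      refine ⟨_, Subalgebra.mul_mem _ (Subalgebra.mul_mem _ (Subalgebra.algebraMap_mem _ (-1 : ℝ)) hh)
        (Subalgebra.mul_mem _ memI memI), ?_⟩
      intro w hw
      have hda : DifferentiableAt ℝ (fun w => RM.pd 0 G (Fin.cons (θ w) w)) w :=
        (hcan [0] w hw).differentiableAt
      have hdi : DifferentiableAt ℝ (fun w => (RM.pd 0 G (Fin.cons (θ w) w))⁻¹) w :=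
        ((hcan [0] w hw).inv (hne w hw)).differentiableAt
      have z : RM.pd i (fun w => RM.pd 0 G (Fin.cons (θ w) w) * (RM.pd 0 G (Fin.cons (θ w) w))⁻¹) w = 0 := by
        rw [pd_congr Metric.isOpen_ball (g := fun _ => 1) (fun w hw => mul_inv_cancel₀ (hne w hw)) i hw,
          pd_const]
      rw [pd_mul' hda hdi] at z
      have ew := e hw
      simp only [RM.pdl] at ew
      rw [ew] at z
      have := hne w hw
      change _ = (-1 : ℝ) * h w * ((RM.pd 0 G (Fin.cons (θ w) w))⁻¹ * (RM.pd 0 G (Fin.cons (θ w) w))⁻¹)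
      field_simp at z ⊢
      linear_combination z
    · exact hladj l i

/-- The monomial with exponent `β`. -/
def mono (β : Fin n → ℕ) (x : Fin n → ℝ) : ℝ := ∏ j, x j ^ β j

theorem mono_add (β γ : Fin n → ℕ) (x : Fin n → ℝ) : mono (β + γ) x = mono β x * mono γ x := by
  simp [mono, pow_add, Finset.prod_mul_distrib]

theorem mono_single (i : Fin n) (k : ℕ) (x : Fin n → ℝ) : mono (Pi.single i k) x = x i ^ k := by
  classical
  rw [mono, Finset.prod_eq_single i]
  · simp
  · intro j _ hj; simp [hj]
  · simp

@[simp] theorem mono_zero (x : Fin n → ℝ) : mono 0 x = 1 := by simp [mono]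

theorem mono_smul (k : ℕ) (β : Fin n → ℕ) (x : Fin n → ℝ) : mono (k • β) x = mono β x ^ k := by
  simp [mono, ← Finset.prod_pow, ← pow_mul, mul_comm]

theorem mono_pow (k : ℕ) (β : Fin n → ℕ) (x : Fin n → ℝ) :
    mono β (fun i => x i ^ k) = mono (k • β) x := by
  simp [mono, ← pow_mul]

theorem IsA.mono (β : Fin n → ℕ) : IsA (mono β) :=
  IsA.prod (f := fun j x => x j ^ β j) Finset.univ fun j _ => (IsA.proj j).pow _

theorem mono_pos (β : Fin n → ℕ) {x : Fin n → ℝ} (h : ∀ j, 0 < x j) : 0 < mono β x :=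
  Finset.prod_pos fun j _ => pow_pos (h j) _

theorem mono_at_zero {β : Fin n → ℕ} (h : β ≠ 0) : mono β (0 : Fin n → ℝ) = 0 := by
  obtain ⟨i, hi⟩ := Function.ne_iff.1 h
  exact Finset.prod_eq_zero (Finset.mem_univ i) (by simpa using hi)

/-- Induction on exponents. -/
theorem exp_induction {P : (Fin n → ℕ) → Prop} (h0 : P 0)
    (h1 : ∀ β i, P β → P (β + Pi.single i 1)) (β : Fin n → ℕ) : P β := by
  classical
  suffices H : ∀ N (β : Fin n → ℕ), ∑ i, β i = N → P β from H _ β rfl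
  intro N
  induction N with
  | zero =>
    intro β h
    have : β = 0 := by
      funext i
      exact (Finset.sum_eq_zero_iff.1 h) i (Finset.mem_univ i)
    exact this ▸ h0
  | succ N ih =>
    intro β h
    have : ∃ i, β i ≠ 0 := by
      by_contra! hc
      simp [hc] at h
    obtain ⟨i, hi⟩ := this
    have e : (β - Pi.single i 1) + Pi.single i 1 = β := by
      funext j
      by_cases hj : j = i
      · subst hj; simp; omega
      · simp [hj]
    rw [← e]
    refine h1 _ _ (ih _ ?_)
    have h2 : ∑ j, β j = ∑ j, ((β - Pi.single i 1) + Pi.single i 1 : Fin n → ℕ) j := by rw [e]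
    simp only [Pi.add_apply, Finset.sum_add_distrib, Finset.sum_pi_single', Finset.mem_univ, if_true] at h2
    omega

theorem mono_germ_ne (β : Fin n → ℕ) : ¬ (mono β : (Fin n → ℝ) → ℝ) =ᶠ[𝓝 0] 0 := by
  induction β using exp_induction with
  | h0 => intro h; simpa using h.self_of_nhds
  | h1 β i ih =>
    intro h
    have h' : ∀ᶠ x in 𝓝 0, mono β x * x i = 0 := by
      filter_upwards [h] with x hx
      rw [mono_add, mono_single, pow_one] at hx
      exact hx
    rcases germ_domain (IsA.mono β).analyticAt (IsA.proj i).analyticAt h' with h | h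
    · exact ih h
    · exact proj_ne_zero i h

theorem IsA.update {f : (Fin n → ℝ) → ℝ} (hf : IsA f) (i : Fin n) :
    IsA fun x => f (Function.update x i 0) := by
  have e : ∀ x : Fin n → ℝ, Function.update x i 0 = fun j => (if j = i then fun _ => 0 else fun x : Fin n → ℝ => x j) x := by
    intro x; funext j
    by_cases hj : j = i
    · subst hj; simp
    · simp [hj]
  simp only [e]
  refine hf.comp (fun j => ?_) fun j => ?_
  · split_ifs
    exacts [IsA.const 0, IsA.proj j]
  · split_ifs <;> rfl

theorem tendsto_update_zero (i : Fin n) :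
    Tendsto (fun x : Fin n → ℝ => Function.update x i 0) (𝓝 0) (𝓝 0) := by
  have : Continuous fun x : Fin n → ℝ => Function.update x i 0 := by fun_prop
  have := this.tendsto 0
  simpa using this

/-- A germ at `0` which is a monomial times a unit. -/
def MU (f : (Fin n → ℝ) → ℝ) : Prop :=
  ∃ β U, IsA U ∧ U 0 ≠ 0 ∧ f =ᶠ[𝓝 0] fun x => mono β x * U x

theorem factor {U : (Fin n → ℝ) → ℝ} (β : Fin n → ℕ) (hU : IsA U) (hU0 : U 0 ≠ 0)
    {a b : (Fin n → ℝ) → ℝ} (ha : IsA a) (hb : IsA b)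
    (h : (fun x => a x * b x) =ᶠ[𝓝 0] fun x => mono β x * U x) :
    ∃ β₁ β₂ U₁ U₂, β = β₁ + β₂ ∧ IsA U₁ ∧ U₁ 0 ≠ 0 ∧ IsA U₂ ∧ U₂ 0 ≠ 0 ∧
      (a =ᶠ[𝓝 0] fun x => mono β₁ x * U₁ x) ∧ b =ᶠ[𝓝 0] fun x => mono β₂ x * U₂ x := by
  induction β using exp_induction generalizing a b with
  | h0 =>
    have := h.self_of_nhds
    simp only [mono_zero, one_mul] at this
    rw [← this] at hU0
    exact ⟨0, 0, a, b, by simp, ha, left_ne_zero_of_mul hU0, hb, right_ne_zero_of_mul hU0,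
      by simp, by simp⟩
  | h1 β i ih =>
    have hz : ∀ᶠ x in 𝓝 0, a (Function.update x i 0) * b (Function.update x i 0) = 0 := by
      filter_upwards [(tendsto_update_zero i).eventually h] with x hx
      rw [hx, mono_add, mono_single]; simp
    have key : ∀ {a b : (Fin n → ℝ) → ℝ}, IsA a → IsA b →
        (fun x => a x * b x) =ᶠ[𝓝 0] (fun x => mono (β + Pi.single i 1) x * U x) →
        (fun x => a (Function.update x i 0)) =ᶠ[𝓝 0] 0 →
        ∃ a', IsA a' ∧ (a =ᶠ[𝓝 0] fun x => x i * a' x) ∧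
          (fun x => a' x * b x) =ᶠ[𝓝 0] fun x => mono β x * U x := by
      intro a b ha hb h h0
      obtain ⟨a', ha', e⟩ := ha.div i h0
      refine ⟨a', ha', e, germ_cancel (IsA.proj i).analyticAt (ha'.mul hb).analyticAt
        ((IsA.mono β).mul hU).analyticAt (proj_ne_zero i) ?_⟩
      filter_upwards [h, e] with x hx hx'
      rw [mono_add, mono_single, hx'] at hx
      linear_combination hx
    rcases germ_domain (ha.update i).analyticAt (hb.update i).analyticAt hz with h0 | h0
    · obtain ⟨a', ha', e, e'⟩ := key ha hb h h0
      obtain ⟨β₁, β₂, U₁, U₂, rfl, q1, q2, q3, q4, q5, q6⟩ := ih ha' hb e'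
      refine ⟨β₁ + Pi.single i 1, β₂, U₁, U₂, by abel, q1, q2, q3, q4, ?_, q6⟩
      filter_upwards [e, q5] with x h1 h2
      rw [h1, h2, mono_add, mono_single]; ring
    · obtain ⟨a', ha', e, e'⟩ := key hb ha (by simpa only [mul_comm] using h) h0
      obtain ⟨β₁, β₂, U₁, U₂, rfl, q1, q2, q3, q4, q5, q6⟩ := ih ha ha' (by simpa only [mul_comm] using e')
      refine ⟨β₁, β₂ + Pi.single i 1, U₁, U₂, by abel, q1, q2, q3, q4, q5, ?_⟩
      filter_upwards [e, q6] with x h1 h2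
      rw [h1, h2, mono_add, mono_single]; ring

theorem MU.congr {f g : (Fin n → ℝ) → ℝ} (h : MU f) (e : f =ᶠ[𝓝 0] g) : MU g := by
  obtain ⟨β, U, h1, h2, h3⟩ := h
  exact ⟨β, U, h1, h2, e.symm.trans h3⟩

theorem MU.isA {f : (Fin n → ℝ) → ℝ} (h : MU f) : IsA f := by
  obtain ⟨β, U, h1, h2, h3⟩ := h
  exact ((IsA.mono β).mul h1).congr h3.symm

theorem MU.mul {f g : (Fin n → ℝ) → ℝ} (hf : MU f) (hg : MU g) : MU fun x => f x * g x := by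
  obtain ⟨β, U, h1, h2, h3⟩ := hf
  obtain ⟨γ, V, h4, h5, h6⟩ := hg
  refine ⟨β + γ, fun x => U x * V x, h1.mul h4, mul_ne_zero h2 h5, ?_⟩
  filter_upwards [h3, h6] with x h7 h8
  rw [h7, h8, mono_add]; ring

theorem MU.unit {U : (Fin n → ℝ) → ℝ} (h : IsA U) (h0 : U 0 ≠ 0) : MU U :=
  ⟨0, U, h, h0, by simp⟩

theorem MU.proj (i : Fin n) : MU fun x : Fin n → ℝ => x i :=
  ⟨Pi.single i 1, fun _ => 1, IsA.const 1, one_ne_zero, by simp [mono_single]⟩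

theorem MU.prod {ι : Type} (s : Finset ι) {f : ι → (Fin n → ℝ) → ℝ} (h : ∀ i ∈ s, MU (f i)) :
    MU fun x => ∏ i ∈ s, f i x := by
  classical
  induction s using Finset.induction_on with
  | empty => simpa using MU.unit (n := n) (IsA.const 1) one_ne_zero
  | insert a s ha ih =>
    simp only [Finset.prod_insert ha]
    exact (h a (Finset.mem_insert_self _ _)).mul (ih fun i hi => h i (Finset.mem_insert_of_mem hi))

theorem MU.pow {f : (Fin n → ℝ) → ℝ} (hf : MU f) (k : ℕ) : MU fun x => f x ^ k := by
  simpa using MU.prod (Finset.range k) (fun _ _ => hf)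

theorem MU.comp {f : (Fin m → ℝ) → ℝ} {h : Fin m → (Fin n → ℝ) → ℝ} (hf : MU f)
    (hh : ∀ j, MU (h j)) (h0 : ∀ j, h j 0 = 0) : MU fun x => f fun j => h j x := by
  obtain ⟨β, U, h1, h2, h3⟩ := hf
  have h4 : MU fun x => (∏ j, h j x ^ β j) * U fun j => h j x :=
    (MU.prod (f := fun j x => h j x ^ β j) Finset.univ fun j _ => (hh j).pow _).mul
      (MU.unit (h1.comp (fun j => (hh j).isA) h0) (by rwa [show (fun j => h j 0) = 0 from funext h0]))
  refine h4.congr ?_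
  filter_upwards [(IsA.tendsto_zero (fun j => (hh j).isA) h0).eventually h3] with x hx
  rw [hx]; rfl

theorem MU.of_mul {a b : (Fin n → ℝ) → ℝ} (ha : IsA a) (hb : IsA b) (h : MU fun x => a x * b x) :
    MU a ∧ MU b := by
  obtain ⟨β, U, h1, h2, h3⟩ := h
  obtain ⟨β₁, β₂, U₁, U₂, -, q1, q2, q3, q4, q5, q6⟩ := factor β h1 h2 ha hb h3
  exact ⟨⟨β₁, U₁, q1, q2, q5⟩, ⟨β₂, U₂, q3, q4, q6⟩⟩

/-- The family `G` of germs at `0` is zero or generates a monomial ideal. -/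
def Princ {κ : Type} (G : κ → (Fin n → ℝ) → ℝ) : Prop :=
  (∀ k, G k =ᶠ[𝓝 0] 0) ∨ ∃ (β : Fin n → ℕ) (G' : κ → (Fin n → ℝ) → ℝ),
    (∀ k, IsA (G' k) ∧ G k =ᶠ[𝓝 0] fun x => mono β x * G' k x) ∧ ∃ k, G' k 0 ≠ 0

theorem Princ.congr {κ : Type} {G H : κ → (Fin n → ℝ) → ℝ} (h : Princ G)
    (e : ∀ k, G k =ᶠ[𝓝 0] H k) : Princ H := by
  rcases h with h | ⟨β, G', h1, h2⟩
  · exact Or.inl fun k => (e k).symm.trans (h k)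
  · exact Or.inr ⟨β, G', fun k => ⟨(h1 k).1, (e k).symm.trans (h1 k).2⟩, h2⟩

theorem Princ.mul {κ : Type} {G : κ → (Fin n → ℝ) → ℝ} (h : Princ G) {F : (Fin n → ℝ) → ℝ}
    (hF : MU F) : Princ fun k x => F x * G k x := by
  rcases h with h | ⟨β, G', h1, k0, h2⟩
  · exact Or.inl fun k => by filter_upwards [h k] with x hx; simp [hx]
  · obtain ⟨γ, U, q1, q2, q3⟩ := hF
    refine Or.inr ⟨γ + β, fun k x => U x * G' k x, fun k => ⟨q1.mul (h1 k).1, ?_⟩, k0, mul_ne_zero q2 h2⟩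
    filter_upwards [(h1 k).2, q3] with x e1 e2
    rw [e1, e2, mono_add]; ring

theorem Princ.of_mul {κ : Type} {G : κ → (Fin n → ℝ) → ℝ} {F : (Fin n → ℝ) → ℝ} (hF : IsA F)
    (hG : ∀ k, IsA (G k)) {β : Fin n → ℕ} {G' : κ → (Fin n → ℝ) → ℝ}
    (h : ∀ k, IsA (G' k) ∧ (fun x => F x * G k x) =ᶠ[𝓝 0] fun x => mono β x * G' k x)
    (h0 : ∃ k, G' k 0 ≠ 0) : MU F ∧ Princ G := by
  obtain ⟨k0, hk0⟩ := h0
  obtain ⟨β₁, β₂, U₁, U₂, rfl, q1, q2, q3, q4, q5, q6⟩ :=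
    factor β (h k0).1 hk0 hF (hG k0) (h k0).2
  refine ⟨⟨β₁, U₁, q1, q2, q5⟩, Or.inr ⟨β₂, fun k x => G' k x * (U₁ x)⁻¹,
    fun k => ⟨(h k).1.mul (q1.inv q2), ?_⟩, k0, mul_ne_zero hk0 (inv_ne_zero q2)⟩⟩
  refine germ_cancel (IsA.mono β₁).analyticAt (hG k).analyticAt
    ((IsA.mono β₂).mul ((h k).1.mul (q1.inv q2))).analyticAt (mono_germ_ne _) ?_
  filter_upwards [(h k).2, q5, q1.continuousAt.eventually_ne q2] with x e1 e2 e3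
  rw [e2, mono_add] at e1
  field_simp
  linear_combination e1

theorem root_div {d : ℕ} (hd : d ≠ 0) (e : Fin n → ℕ) {f B : (Fin n → ℝ) → ℝ} (hf : IsA f)
    (hB : IsA B) (h : (fun x => f x ^ d) =ᶠ[𝓝 0] fun x => mono (d • e) x * B x) :
    ∃ b, IsA b ∧ (f =ᶠ[𝓝 0] fun x => mono e x * b x) ∧ (fun x => b x ^ d) =ᶠ[𝓝 0] B := by
  induction e using exp_induction generalizing f with
  | h0 => exact ⟨f, hf, by simp, by simpa using h⟩
  | h1 e i ih =>
    have h0 : (fun x => f (Function.update x i 0)) =ᶠ[𝓝 0] 0 := by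
      filter_upwards [(tendsto_update_zero i).eventually h] with x hx
      simp only [mono_smul, mono_add, mono_single] at hx
      simp only [Function.update_self, pow_one, mul_zero, zero_pow hd, zero_mul] at hx
      exact pow_eq_zero_iff hd |>.1 hx
    obtain ⟨f', hf', e1⟩ := hf.div i h0
    obtain ⟨b, hb, e2, e3⟩ := ih hf' (by
      refine germ_cancel ((IsA.proj i).pow d).analyticAt (hf'.pow d).analyticAt
        ((IsA.mono _).mul hB).analyticAt ?_ ?_
      · have := mono_germ_ne (n := n) (Pi.single i d)
        simpa only [funext (mono_single (n := n) i d)] using this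
      · filter_upwards [h, e1] with x h1 h2
        rw [h2, mono_smul, mono_add, mono_single] at h1
        rw [mono_smul]
        linear_combination h1)
    refine ⟨b, hb, ?_, e3⟩
    filter_upwards [e1, e2] with x h1 h2
    rw [h1, h2, mono_add, mono_single]; ring

theorem analyticAt_iteratedDeriv {g : ℝ → ℝ} {x : ℝ} (hg : AnalyticAt ℝ g x) (j : ℕ) :
    AnalyticAt ℝ (iteratedDeriv j g) x := by
  induction j with
  | zero => simpa using hg
  | succ j ih => rw [iteratedDeriv_succ]; exact ih.deriv

theorem iteratedDeriv_add_id_mul {g : ℝ → ℝ} (hg : AnalyticAt ℝ g 0) (c : ℝ) (j : ℕ) :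
    iteratedDeriv (j + 1) (fun t => c + t * g t) 0 = (j + 1) * iteratedDeriv j g 0 := by
  suffices H : ∀ᶠ t in 𝓝 0, iteratedDeriv (j + 1) (fun t => c + t * g t) t =
      t * iteratedDeriv (j + 1) g t + (j + 1) * iteratedDeriv j g t by
    simpa using H.self_of_nhds
  induction j with
  | zero =>
    filter_upwards [hg.eventually_analyticAt] with t ht
    rw [iteratedDeriv_one, iteratedDeriv_one]
    have := ((hasDerivAt_id t).mul ht.differentiableAt.hasDerivAt).const_add c
    simp only [id] at this
    refine Eq.trans this.deriv ?_
    simp; ring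
  | succ j ih =>
    filter_upwards [hg.eventually_analyticAt, ih.eventually_nhds] with t ht h
    rw [iteratedDeriv_succ, Filter.EventuallyEq.deriv_eq h]
    have h1 := (analyticAt_iteratedDeriv ht (j + 1)).differentiableAt.hasDerivAt
    have h2 := (analyticAt_iteratedDeriv ht j).differentiableAt.hasDerivAt
    have h3 := ((hasDerivAt_id t).mul h1).add (h2.const_mul ((j : ℝ) + 1))
    rw [← iteratedDeriv_succ, ← iteratedDeriv_succ] at h3
    have h4 := h3.deriv
    simp only [id] at h4
    refine Eq.trans h4 ?_
    push_cast; ring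

theorem iteratedDeriv_taylor {s : ℕ} (a : ℕ → ℝ) {u : ℝ → ℝ} (hu : AnalyticAt ℝ u 0) {j : ℕ}
    (hj : j < s) :
    iteratedDeriv j (fun t => ∑ i ∈ Finset.range s, a i * t ^ i + t ^ s * u t) 0 = j.factorial * a j := by
  induction s generalizing a j with
  | zero => omega
  | succ s ih =>
    have e : (fun t => ∑ i ∈ Finset.range (s + 1), a i * t ^ i + t ^ (s + 1) * u t) =
        fun t => a 0 + t * (∑ i ∈ Finset.range s, a (i + 1) * t ^ i + t ^ s * u t) := by
      funext t
      rw [Finset.sum_range_succ', mul_add, Finset.mul_sum]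
      have : ∀ i, a (i + 1) * t ^ (i + 1) = t * (a (i + 1) * t ^ i) := fun i => by ring
      simp only [this]; ring
    rw [e]
    cases j with
    | zero => simp
    | succ j =>
      rw [iteratedDeriv_add_id_mul, ih (fun i => a (i + 1)) (by omega), Nat.factorial_succ]
      · push_cast; ring
      · fun_prop

theorem cons_zero_zero {q : ℕ} : (Fin.cons 0 0 : Fin (q + 1) → ℝ) = 0 := by
  funext j; refine Fin.cases rfl (fun k => rfl) j

theorem tendsto_cons {q : ℕ} : Tendsto (fun z : ℝ × (Fin q → ℝ) => (Fin.cons z.1 z.2 : Fin (q + 1) → ℝ))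
    (𝓝 0) (𝓝 0) := by
  have : Continuous fun z : ℝ × (Fin q → ℝ) => (Fin.cons z.1 z.2 : Fin (q + 1) → ℝ) := by fun_prop
  have := this.tendsto 0
  simpa [cons_zero_zero] using this

theorem tendsto_cons_zero {q : ℕ} :
    Tendsto (fun w : Fin q → ℝ => (Fin.cons 0 w : Fin (q + 1) → ℝ)) (𝓝 0) (𝓝 0) :=
  tendsto_cons.comp ((Continuous.prodMk_right (0 : ℝ)).tendsto (0 : Fin q → ℝ))

theorem eventually_cons_line {q : ℕ} {P : (Fin (q + 1) → ℝ) → Prop} (h : ∀ᶠ x in 𝓝 0, P x) :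
    ∀ᶠ w : Fin q → ℝ in 𝓝 0, ∀ᶠ t : ℝ in 𝓝 0, P (Fin.cons t w) := by
  have h1 := tendsto_cons_zero.eventually h.eventually_nhds
  filter_upwards [h1] with w hw
  have : Continuous fun t : ℝ => (Fin.cons t w : Fin (q + 1) → ℝ) := by fun_prop
  exact (this.tendsto 0).eventually hw

theorem analyticAt_line {q : ℕ} {G : (Fin (q + 1) → ℝ) → ℝ} {t : ℝ} {w : Fin q → ℝ}
    (h : AnalyticAt ℝ G (Fin.cons t w)) : AnalyticAt ℝ (fun t => G (Fin.cons t w)) t := by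
  have : AnalyticAt ℝ (fun t : ℝ => (Fin.cons t w : Fin (q + 1) → ℝ)) t := by
    simp only [cons_eq_fun]
    refine AnalyticAt.pi fun j => ?_
    refine Fin.cases ?_ (fun k => ?_) j
    · exact analyticAt_id
    · exact analyticAt_const
  exact AnalyticAt.comp (g := G) (f := fun t : ℝ => (Fin.cons t w : Fin (q + 1) → ℝ)) h this

theorem deriv_line {q : ℕ} {G : (Fin (q + 1) → ℝ) → ℝ} {t : ℝ} {w : Fin q → ℝ}
    (h : DifferentiableAt ℝ G (Fin.cons t w)) :
    deriv (fun t => G (Fin.cons t w)) t = RM.pd 0 G (Fin.cons t w) := by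
  have h1 : HasDerivAt (fun t : ℝ => (Fin.cons t w : Fin (q + 1) → ℝ)) (Pi.single 0 1) t := by
    rw [hasDerivAt_pi]
    refine fun j => ?_
    refine Fin.cases ?_ (fun k => ?_) j
    · simpa using hasDerivAt_id' t
    · simpa using hasDerivAt_const t (w k)
  exact (h.hasFDerivAt.comp_hasDerivAt t h1).deriv

theorem iteratedDeriv_line {q : ℕ} {G : (Fin (q + 1) → ℝ) → ℝ} {U : Set (Fin (q + 1) → ℝ)}
    (hU : IsOpen U) (h : AnalyticOnNhd ℝ G U) {t : ℝ} {w : Fin q → ℝ} (ht : Fin.cons t w ∈ U) (j : ℕ) :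
    iteratedDeriv j (fun t => G (Fin.cons t w)) t = pdl (List.replicate j 0) G (Fin.cons t w) := by
  induction j generalizing t with
  | zero => simp [pdl]
  | succ j ih =>
    have hc : Continuous fun t : ℝ => (Fin.cons t w : Fin (q + 1) → ℝ) := by fun_prop
    rw [iteratedDeriv_succ, Filter.EventuallyEq.deriv_eq
      (f := fun t => pdl (List.replicate j 0) G (Fin.cons t w))]
    · rw [deriv_line (analytic_pdl h _ _ ht).differentiableAt]; rfl
    · filter_upwards [hc.continuousAt.eventually (hU.mem_nhds ht)] with t' ht'
      exact ih ht'

/-- The `j`-th Taylor coefficient with respect to the first variable. -/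
def cf {q : ℕ} (j : ℕ) (G : (Fin (q + 1) → ℝ) → ℝ) (w : Fin q → ℝ) : ℝ :=
  iteratedDeriv j (fun t => G (Fin.cons t w)) 0 / j.factorial

theorem cf_congr {q : ℕ} {G H : (Fin (q + 1) → ℝ) → ℝ} (h : G =ᶠ[𝓝 0] H) (j : ℕ) :
    cf j G =ᶠ[𝓝 0] cf j H := by
  filter_upwards [eventually_cons_line h] with w hw
  rw [cf, cf, Filter.EventuallyEq.iteratedDeriv_eq _ hw]

theorem IsA.comp_cons_zero {q : ℕ} {G : (Fin (q + 1) → ℝ) → ℝ} (hG : IsA G) :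
    IsA fun w : Fin q → ℝ => G (Fin.cons 0 w) := by
  have := hG.comp (h := fun j w => Fin.cases 0 w j) (n := q) (fun j => ?_) fun j => ?_
  · simpa only [← cons_eq_fun] using this
  · refine Fin.cases ?_ (fun k => ?_) j
    exacts [IsA.const 0, IsA.proj k]
  · refine Fin.cases rfl (fun k => rfl) j

theorem cf_eq {q : ℕ} {G : (Fin (q + 1) → ℝ) → ℝ} (hG : IsA G) (j : ℕ) : ∀ᶠ w in 𝓝 0,
    cf j G w = pdl (List.replicate j 0) G (Fin.cons 0 w) / j.factorial := by
  obtain ⟨ρ, hρ, h⟩ := hG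
  filter_upwards [tendsto_cons_zero.eventually (Metric.ball_mem_nhds _ hρ)] with w hw
  rw [cf, iteratedDeriv_line Metric.isOpen_ball h.analytic hw]

theorem IsA.cf {q : ℕ} {G : (Fin (q + 1) → ℝ) → ℝ} (hG : IsA G) (j : ℕ) : IsA (cf j G) := by
  refine ((hG.pdl (List.replicate j 0)).comp_cons_zero.mul (IsA.const (j.factorial : ℝ)⁻¹)).congr ?_
  filter_upwards [cf_eq hG j] with w hw
  rw [hw]; rfl

theorem cf_zero {q : ℕ} (G : (Fin (q + 1) → ℝ) → ℝ) (w : Fin q → ℝ) : RM.cf 0 G w = G (Fin.cons 0 w) := by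
  simp [RM.cf]

theorem IsA.tail {q : ℕ} {f : (Fin q → ℝ) → ℝ} (hf : IsA f) : IsA fun x : Fin (q + 1) → ℝ => f (Fin.tail x) :=
  hf.comp (h := fun j x => x j.succ) (fun j => IsA.proj _) fun _ => rfl

theorem cf_taylor {q : ℕ} {s : ℕ} {a : ℕ → (Fin q → ℝ) → ℝ} {G U : (Fin (q + 1) → ℝ) → ℝ}
    (hU : AnalyticAt ℝ U 0) (h : ∀ᶠ x in 𝓝 0, G x =
      ∑ i ∈ Finset.range s, a i (Fin.tail x) * x 0 ^ i + x 0 ^ s * U x) {j : ℕ} (hj : j < s) :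
    RM.cf j G =ᶠ[𝓝 0] a j := by
  filter_upwards [eventually_cons_line h, tendsto_cons_zero.eventually hU.eventually_analyticAt] with w h1 h2
  have h3 : (fun t => G (Fin.cons t w)) =ᶠ[𝓝 0]
      fun t => ∑ i ∈ Finset.range s, a i w * t ^ i + t ^ s * U (Fin.cons t w) := by
    filter_upwards [h1] with t ht
    simpa using ht
  rw [RM.cf, h3.iteratedDeriv_eq, iteratedDeriv_taylor _ (analyticAt_line h2) hj,
    mul_div_cancel_left₀ _ (by positivity)]

theorem IsA.taylor {q : ℕ} {G : (Fin (q + 1) → ℝ) → ℝ} (hG : IsA G) (s : ℕ) :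
    ∃ U, IsA U ∧ ∀ᶠ x in 𝓝 0, G x =
      ∑ i ∈ Finset.range s, RM.cf i G (Fin.tail x) * x 0 ^ i + x 0 ^ s * U x := by
  induction s generalizing G with
  | zero => exact ⟨G, hG, by simp⟩
  | succ s ih =>
    have h0 : IsA fun x : Fin (q + 1) → ℝ => G (Fin.cons 0 (Fin.tail x)) :=
      IsA.tail hG.comp_cons_zero
    obtain ⟨h, hh, e⟩ := (hG.sub h0).div 0 (Eventually.of_forall fun x => by
      have : (Function.update x 0 0 : Fin (q + 1) → ℝ) = Fin.cons 0 (Fin.tail x) := by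
        funext j; refine Fin.cases ?_ (fun k => ?_) j <;> simp [Fin.tail]
      simp [this])
    obtain ⟨U, hU, e'⟩ := ih hh
    let a : ℕ → (Fin q → ℝ) → ℝ := fun i =>
      if i = 0 then fun w => G (Fin.cons 0 w) else RM.cf (i - 1) h
    have e2 : ∀ᶠ x in 𝓝 0, G x = ∑ i ∈ Finset.range (s + 1), a i (Fin.tail x) * x 0 ^ i
          + x 0 ^ (s + 1) * U x := by
      filter_upwards [e, e'] with x h1 h2
      rw [h2] at h1
      rw [Finset.sum_range_succ']
      rw [mul_add, Finset.mul_sum] at h1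
      have : ∀ i, RM.cf i h (Fin.tail x) * x 0 ^ (i + 1) = x 0 * (RM.cf i h (Fin.tail x) * x 0 ^ i) :=
        fun i => by ring
      simp only [a, Nat.add_eq_zero_iff, one_ne_zero, and_false, if_false, if_true, Nat.add_sub_cancel, this]
      linear_combination h1
    refine ⟨U, hU, ?_⟩
    have e3 : ∀ᶠ w in 𝓝 0, ∀ i ∈ Finset.range (s + 1), RM.cf i G w = a i w :=
      (Filter.eventually_all_finset _).2 fun i hi => cf_taylor hU.analyticAt e2 (Finset.mem_range.1 hi)
    have e4 : Tendsto (Fin.tail : (Fin (q + 1) → ℝ) → (Fin q → ℝ)) (𝓝 0) (𝓝 0) :=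
      IsA.tendsto_zero (h := fun j x => x j.succ) (fun j => IsA.proj _) fun _ => rfl
    filter_upwards [e2, e4.eventually e3] with x h1 h2
    rw [h1]
    congr 1
    exact Finset.sum_congr rfl fun i hi => by rw [h2 i hi]

variable {α : Type} {l : Filter α} {M : Set (α → ℝ)}

/-- A Hardy-type field of germs along `l`, closed under the `IsA` functions at infinitesimals and
under roots. -/
structure IsHF (l : Filter α) (M : Set (α → ℝ)) : Prop where
  congr : ∀ {f g : α → ℝ}, f ∈ M → f =ᶠ[l] g → g ∈ M
  const : ∀ c : ℝ, (fun _ => c) ∈ M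
  add : ∀ {f g : α → ℝ}, f ∈ M → g ∈ M → (fun a => f a + g a) ∈ M
  mul : ∀ {f g : α → ℝ}, f ∈ M → g ∈ M → (fun a => f a * g a) ∈ M
  inv : ∀ {f : α → ℝ}, f ∈ M → (fun a => (f a)⁻¹) ∈ M
  tri : ∀ {f : α → ℝ}, f ∈ M → f =ᶠ[l] 0 ∨ (∀ᶠ a in l, 0 < f a) ∨ ∀ᶠ a in l, f a < 0
  anal : ∀ {n : ℕ} {φ : (Fin n → ℝ) → ℝ}, IsA φ → ∀ {t : Fin n → α → ℝ}, (∀ i, t i ∈ M) →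
    (∀ i, Tendsto (t i) l (𝓝 0)) → (fun a => φ fun i => t i a) ∈ M
  root : ∀ {f : α → ℝ}, f ∈ M → (∀ᶠ a in l, 0 < f a) → ∀ {n : ℕ}, n ≠ 0 →
    (fun a => f a ^ ((n : ℝ)⁻¹)) ∈ M
  small : ∃ δ ∈ M, (∀ᶠ a in l, 0 < δ a) ∧ Tendsto δ l (𝓝 0)

namespace IsHF

variable (hM : IsHF l M)
include hM

theorem neg {f : α → ℝ} (hf : f ∈ M) : (fun a => -f a) ∈ M := by
  simpa using hM.mul (hM.const (-1)) hf

theorem sub {f g : α → ℝ} (hf : f ∈ M) (hg : g ∈ M) : (fun a => f a - g a) ∈ M := by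
  simpa [sub_eq_add_neg] using hM.add hf (hM.neg hg)

theorem div {f g : α → ℝ} (hf : f ∈ M) (hg : g ∈ M) : (fun a => f a / g a) ∈ M := by
  simpa [div_eq_mul_inv] using hM.mul hf (hM.inv hg)

theorem prod {ι : Type} (s : Finset ι) {f : ι → α → ℝ} (h : ∀ i ∈ s, f i ∈ M) :
    (fun a => ∏ i ∈ s, f i a) ∈ M := by
  classical
  induction s using Finset.induction_on with
  | empty => simpa using hM.const 1
  | insert i s hi ih =>
    simp only [Finset.prod_insert hi]
    exact hM.mul (h i (Finset.mem_insert_self _ _)) (ih fun j hj => h j (Finset.mem_insert_of_mem hj))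

theorem sum {ι : Type} (s : Finset ι) {f : ι → α → ℝ} (h : ∀ i ∈ s, f i ∈ M) :
    (fun a => ∑ i ∈ s, f i a) ∈ M := by
  classical
  induction s using Finset.induction_on with
  | empty => simpa using hM.const 0
  | insert i s hi ih =>
    simp only [Finset.sum_insert hi]
    exact hM.add (h i (Finset.mem_insert_self _ _)) (ih fun j hj => h j (Finset.mem_insert_of_mem hj))

theorem pow {f : α → ℝ} (hf : f ∈ M) (k : ℕ) : (fun a => f a ^ k) ∈ M := by
  simpa using hM.prod (Finset.range k) (fun _ _ => hf)

theorem cmp {f : α → ℝ} (hf : f ∈ M) (c : ℝ) :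
    (∀ᶠ a in l, f a = c) ∨ (∀ᶠ a in l, c < f a) ∨ ∀ᶠ a in l, f a < c := by
  rcases hM.tri (hM.sub hf (hM.const c)) with h | h | h
  · exact Or.inl (h.mono fun a ha => sub_eq_zero.1 ha)
  · exact Or.inr (Or.inl (h.mono fun a ha => sub_pos.1 ha))
  · exact Or.inr (Or.inr (h.mono fun a ha => sub_neg.1 ha))

theorem limit {f : α → ℝ} (hf : f ∈ M) :
    (∃ r, Tendsto f l (𝓝 r)) ∨ Tendsto f l atTop ∨ Tendsto f l atBot := by
  let S : Set ℝ := {c | ∀ᶠ a in l, c < f a}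
  have hS : ∀ c, c ∈ S → ∀ d ≤ c, d ∈ S := fun c hc d hd =>
    Eventually.mono hc fun a ha => lt_of_le_of_lt hd ha
  have hn : ∀ c, c ∉ S → ∀ᶠ a in l, f a ≤ c := by
    intro c hc
    rcases hM.cmp hf c with h | h | h
    · exact h.mono fun a ha => ha.le
    · exact absurd h hc
    · exact h.mono fun a ha => ha.le
  by_cases h0 : S.Nonempty
  · by_cases hb : BddAbove S
    · left
      refine ⟨sSup S, tendsto_order.2 ⟨fun c hc => ?_, fun c hc => ?_⟩⟩
      · obtain ⟨d, hd, hcd⟩ := exists_lt_of_lt_csSup h0 hc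
        exact hS d hd c hcd.le
      · have : (sSup S + c) / 2 ∉ S := fun h => by
          have := le_csSup hb h
          linarith
        exact (hn _ this).mono fun a ha => by linarith
    · right; left
      rw [tendsto_atTop]
      intro c
      rw [not_bddAbove_iff] at hb
      obtain ⟨d, hd, hcd⟩ := hb c
      exact (hS d hd c hcd.le).mono fun a ha => le_of_lt ha
  · right; right
    rw [tendsto_atBot]
    intro c
    exact hn c fun hc => h0 ⟨c, hc⟩

end IsHF

/-- Infinitesimal elements. -/
def Inf (l : Filter α) (M : Set (α → ℝ)) (f : α → ℝ) : Prop := f ∈ M ∧ Tendsto f l (𝓝 0)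

theorem IsHF.inf_comp (hM : IsHF l M) {φ : (Fin n → ℝ) → ℝ} (hφ : IsA φ) (h0 : φ 0 = 0)
    {t : Fin n → α → ℝ} (ht : ∀ i, Inf l M (t i)) : Inf l M fun a => φ fun i => t i a := by
  refine ⟨hM.anal hφ (fun i => (ht i).1) fun i => (ht i).2, ?_⟩
  have : Tendsto φ (𝓝 0) (𝓝 0) := by simpa [ContinuousAt, h0] using hφ.continuousAt
  exact this.comp (tendsto_pi_zero fun i => (ht i).2)

/-- `w = σ(v)` is a change of infinitesimal coordinates. -/
structure Chg (l : Filter α) (M : Set (α → ℝ)) (w : Fin n → α → ℝ) (σ : Fin n → (Fin m → ℝ) → ℝ)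
    (v : Fin m → α → ℝ) : Prop where
  isA : ∀ i, IsA (σ i)
  zero : ∀ i, σ i 0 = 0
  inf : ∀ j, Inf l M (v j)
  eq : ∀ i, w i =ᶠ[l] fun a => σ i fun j => v j a

theorem tendsto_inf {v : Fin m → α → ℝ} (h : ∀ j, Inf l M (v j)) :
    Tendsto (fun a j => v j a) l (𝓝 0) := tendsto_pi_zero fun j => (h j).2

theorem Chg.tendsto {w : Fin n → α → ℝ} {σ : Fin n → (Fin m → ℝ) → ℝ} {v : Fin m → α → ℝ}
    (h : Chg l M w σ v) : Tendsto (fun x i => σ i x) (𝓝 0) (𝓝 0) :=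
  IsA.tendsto_zero h.isA h.zero

theorem Chg.eq' {w : Fin n → α → ℝ} {σ : Fin n → (Fin m → ℝ) → ℝ} {v : Fin m → α → ℝ}
    (h : Chg l M w σ v) : ∀ᶠ a in l, (fun i => w i a) = fun i => σ i fun j => v j a := by
  filter_upwards [eventually_all.2 h.eq] with a ha
  exact funext ha

theorem Chg.trans {p : ℕ} {w : Fin n → α → ℝ} {σ : Fin n → (Fin m → ℝ) → ℝ} {v : Fin m → α → ℝ}
    {τ : Fin m → (Fin p → ℝ) → ℝ} {u : Fin p → α → ℝ} (h : Chg l M w σ v) (h' : Chg l M v τ u) :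
    Chg l M w (fun i x => σ i fun j => τ j x) u where
  isA i := (h.isA i).comp h'.isA h'.zero
  zero i := by
    rw [show (fun j => τ j 0) = 0 from funext h'.zero]; exact h.zero i
  inf := h'.inf
  eq i := by
    filter_upwards [h.eq i, h'.eq'] with a h1 h2
    rw [h1, h2]

theorem Chg.refl {w : Fin n → α → ℝ} (h : ∀ j, Inf l M (w j)) : Chg l M w (fun i x => x i) w :=
  ⟨IsA.proj, fun _ => rfl, h, fun _ => EventuallyEq.rfl⟩

theorem Chg.cons {q : ℕ} {t t' : α → ℝ} {w v : Fin q → α → ℝ} {σ : Fin q → (Fin q → ℝ) → ℝ}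
    (h : Chg l M w σ v) {η : (Fin (q + 1) → ℝ) → ℝ} (hη : IsA η) (h0 : η 0 = 0) (ht' : Inf l M t')
    (e : t =ᶠ[l] fun a => η (Fin.cons (t' a) fun j => v j a)) :
    Chg l M (Fin.cons t w : Fin (q + 1) → α → ℝ)
      (Fin.cons η fun j x => σ j (Fin.tail x) : Fin (q + 1) → (Fin (q + 1) → ℝ) → ℝ)
      (Fin.cons t' v : Fin (q + 1) → α → ℝ) where
  isA i := by
    refine Fin.cases hη (fun k => ?_) i
    exact IsA.tail (h.isA k)
  zero i := by
    refine Fin.cases h0 (fun k => ?_) i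
    exact h.zero k
  inf i := Fin.cases ht' (fun k => h.inf k) i
  eq i := by
    have e2 : ∀ a, (fun j => (Fin.cons t' v : Fin (q + 1) → α → ℝ) j a) =
        Fin.cons (t' a) fun j => v j a := by
      intro a; funext j; refine Fin.cases rfl (fun k => rfl) j
    refine Fin.cases ?_ (fun k => ?_) i
    · filter_upwards [e] with a ha
      rw [e2]; exact ha
    · filter_upwards [h.eq k] with a ha
      rw [e2]; exact ha

/-- Simultaneous monomialization of `E` and principalization of `G` along `w`. -/
def Good (l : Filter α) (M : Set (α → ℝ)) (w : Fin n → α → ℝ) (E : (Fin n → ℝ) → ℝ) {κ : Type}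
    (G : κ → (Fin n → ℝ) → ℝ) : Prop :=
  ∃ (σ : Fin n → (Fin n → ℝ) → ℝ) (v : Fin n → α → ℝ), Chg l M w σ v ∧
    (∀ j, ∀ᶠ a in l, 0 < v j a) ∧ MU (fun x => E fun i => σ i x) ∧
    Princ fun k x => G k fun i => σ i x

theorem Good.of_chg {w v : Fin n → α → ℝ} {σ : Fin n → (Fin n → ℝ) → ℝ} (h : Chg l M w σ v)
    {E : (Fin n → ℝ) → ℝ} {κ : Type} {G : κ → (Fin n → ℝ) → ℝ}
    (hg : Good l M v (fun x => E fun i => σ i x) fun k x => G k fun i => σ i x) : Good l M w E G := by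
  obtain ⟨τ, u, h1, h2, h3, h4⟩ := hg
  exact ⟨_, u, h.trans h1, h2, h3, h4⟩

theorem Good.factor {w : Fin n → α → ℝ} {E F : (Fin n → ℝ) → ℝ} (hE : IsA E) (hF : IsA F) {κ : Type}
    {G H : κ → (Fin n → ℝ) → ℝ} (h : Good l M w (fun x => E x * F x) H)
    (e : ∀ k, G k =ᶠ[𝓝 0] fun x => F x * H k x) : Good l M w E G := by
  obtain ⟨σ, v, h1, h2, h3, h4⟩ := h
  obtain ⟨h5, h6⟩ := h3.of_mul (hE.comp h1.isA h1.zero) (hF.comp h1.isA h1.zero)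
  refine ⟨σ, v, h1, h2, h5, (h4.mul h6).congr fun k => ?_⟩
  filter_upwards [h1.tendsto.eventually (e k)] with x hx
  exact hx.symm

theorem Good.congr {w : Fin n → α → ℝ} {E E' : (Fin n → ℝ) → ℝ} {κ : Type}
    {G G' : κ → (Fin n → ℝ) → ℝ} (h : Good l M w E G) (e : E =ᶠ[𝓝 0] E') (e' : ∀ k, G k =ᶠ[𝓝 0] G' k) :
    Good l M w E' G' := by
  obtain ⟨σ, v, h1, h2, h3, h4⟩ := h
  exact ⟨σ, v, h1, h2, h3.congr (h1.tendsto.eventually e),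
    h4.congr fun k => h1.tendsto.eventually (e' k)⟩

/-- A sign chart for one infinitesimal. -/
theorem IsHF.sign_chart (hM : IsHF l M) {f : α → ℝ} (hf : Inf l M f) :
    ∃ (c : ℝ) (g : α → ℝ), Inf l M g ∧ (∀ᶠ a in l, 0 < g a) ∧ (f =ᶠ[l] fun a => c * g a) ∧
      (f =ᶠ[l] 0 ∨ c ≠ 0) := by
  rcases hM.tri hf.1 with h | h | h
  · obtain ⟨δ, h1, h2, h3⟩ := hM.small
    exact ⟨0, δ, ⟨h1, h3⟩, h2, h.trans (by simp; rfl), Or.inl h⟩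
  · exact ⟨1, f, hf, h, by simp, Or.inr one_ne_zero⟩
  · exact ⟨-1, fun a => -f a, ⟨hM.neg hf.1, by simpa using hf.2.neg⟩, h.mono fun a ha => neg_pos.2 ha,
      by simp, Or.inr (by norm_num)⟩

theorem IsHF.sign_charts (hM : IsHF l M) {w : Fin n → α → ℝ} (hw : ∀ j, Inf l M (w j)) :
    ∃ (c : Fin n → ℝ) (v : Fin n → α → ℝ), Chg l M w (fun i x => c i * x i) v ∧
      ∀ j, ∀ᶠ a in l, 0 < v j a := by
  choose c v h1 h2 h3 h4 using fun j => hM.sign_chart (hw j)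
  exact ⟨c, v, ⟨fun i => (IsA.const _).mul (IsA.proj i), fun i => by simp, h1, h3⟩, h2⟩

/-- Local uniformization (principalization of families) in dimension `p`. -/
def LU (l : Filter α) (M : Set (α → ℝ)) (p : ℕ) : Prop :=
  ∀ w : Fin p → α → ℝ, (∀ j, Inf l M (w j)) → ∀ {κ : Type} (G : κ → (Fin p → ℝ) → ℝ),
    (∀ k, IsA (G k)) → ∃ (σ : Fin p → (Fin p → ℝ) → ℝ) (v : Fin p → α → ℝ), Chg l M w σ v ∧
      (∀ j, ∀ᶠ a in l, 0 < v j a) ∧ Princ fun k x => G k fun i => σ i x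

theorem germ_ne_of_inf [l.NeBot] {E : (Fin n → ℝ) → ℝ} {v : Fin n → α → ℝ} (hv : ∀ j, Inf l M (v j))
    (h : ∀ᶠ a in l, E (fun j => v j a) ≠ 0) : ¬ E =ᶠ[𝓝 0] 0 := by
  intro h0
  obtain ⟨a, h1, h2⟩ := (h.and ((tendsto_inf hv).eventually h0)).exists
  exact h1 h2

theorem LU.marked [l.NeBot] {p : ℕ} (h : LU l M p) {w : Fin p → α → ℝ} (hw : ∀ j, Inf l M (w j))
    {E : (Fin p → ℝ) → ℝ} (hE : IsA E) (hEw : ∀ᶠ a in l, E (fun j => w j a) ≠ 0) {κ : Type}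
    {G : κ → (Fin p → ℝ) → ℝ} (hG : ∀ k, IsA (G k)) : Good l M w E G := by
  obtain ⟨σ, v, h1, h2, h3⟩ := h w hw (fun k x => E x * G k x) fun k => hE.mul (hG k)
  have hEv : ∀ᶠ a in l, E (fun i => σ i fun j => v j a) ≠ 0 := by
    filter_upwards [hEw, h1.eq'] with a e1 e2
    rwa [← e2]
  have hEσ := hE.comp h1.isA h1.zero
  have hGσ := fun k => (hG k).comp h1.isA h1.zero
  rcases h3 with h3 | ⟨β, G', h3, h4⟩
  · have hz : ∀ k, (fun x => G k fun i => σ i x) =ᶠ[𝓝 0] 0 := fun k =>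
      (germ_domain hEσ.analyticAt (hGσ k).analyticAt (h3 k)).resolve_left
        (germ_ne_of_inf h1.inf hEv)
    obtain ⟨τ, u, q1, q2, q3⟩ := h v h1.inf (fun (_ : Unit) x => E fun i => σ i x) fun _ => hEσ
    refine ⟨_, u, h1.trans q1, q2, ?_, Or.inl fun k => q1.tendsto.eventually (hz k)⟩
    rcases q3 with q3 | ⟨β, G', q3, _, q4⟩
    · refine absurd (q3 ()) (germ_ne_of_inf q1.inf ?_)
      filter_upwards [hEv, q1.eq'] with a e1 e2
      rwa [← e2]
    · exact ⟨β, G' (), (q3 ()).1, q4, (q3 ()).2⟩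
  · obtain ⟨h5, h6⟩ := Princ.of_mul hEσ hGσ h3 h4
    exact ⟨σ, v, h1, h2, h5, h6⟩

theorem LU.charts [l.NeBot] (hM : IsHF l M) {q : ℕ} (h : LU l M q) {w : Fin q → α → ℝ}
    (hw : ∀ j, Inf l M (w j)) {E : (Fin q → ℝ) → ℝ} (hE : IsA E)
    (hEw : ∀ᶠ a in l, E (fun j => w j a) ≠ 0) {κ : Type} (s : ℕ) {a : ℕ → κ → (Fin q → ℝ) → ℝ}
    (ha : ∀ j k, IsA (a j k)) :
    ∃ (σ : Fin q → (Fin q → ℝ) → ℝ) (v : Fin q → α → ℝ), Chg l M w σ v ∧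
      (∀ j, ∀ᶠ a in l, 0 < v j a) ∧ MU (fun x => E fun i => σ i x) ∧
      ((∀ j < s, ∀ k, (fun x => a j k fun i => σ i x) =ᶠ[𝓝 0] 0) ∨
        ∃ (γ : Fin q → ℕ) (b : ℕ → κ → (Fin q → ℝ) → ℝ), (∀ j k, IsA (b j k)) ∧
          (∀ j < s, ∀ k, (fun x => a j k fun i => σ i x) =ᶠ[𝓝 0] fun x => mono ((s - j) • γ) x * b j k x) ∧
          ∃ j < s, ∃ k, b j k 0 ≠ 0) := by
  have hd : ∀ j < s, s.factorial / (s - j) ≠ 0 ∧ s.factorial / (s - j) * (s - j) = s.factorial := by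
    intro j hj
    have h1 : s - j ∣ s.factorial := Nat.dvd_factorial (by omega) (by omega)
    have h2 := Nat.div_mul_cancel h1
    refine ⟨fun h0 => ?_, h2⟩
    rw [h0, zero_mul] at h2
    exact s.factorial_ne_zero h2.symm
  obtain ⟨σ, v, h1, h2, h3, h4⟩ := h.marked hw hE hEw
    (G := fun (jk : Fin s × κ) x => a jk.1 jk.2 x ^ (s.factorial / (s - jk.1)))
    fun jk => (ha jk.1 jk.2).pow _
  rcases h4 with h4 | ⟨γ, B, h4, ⟨j0, k0⟩, h5⟩
  · refine ⟨σ, v, h1, h2, h3, Or.inl fun j hj k => ?_⟩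
    filter_upwards [h4 (⟨j, hj⟩, k)] with x hx
    exact (pow_eq_zero_iff (hd j hj).1).1 hx
  · let ρ : Fin q → (Fin q → ℝ) → ℝ := fun i x => x i ^ s.factorial
    have hf0 := s.factorial_ne_zero
    have hρ : Chg l M v ρ fun i a => v i a ^ ((s.factorial : ℝ)⁻¹) :=
      { isA := fun i => (IsA.proj i).pow _
        zero := fun i => by simp [ρ, hf0]
        inf := fun i => by
          refine ⟨hM.root (h1.inf i).1 (h2 i) hf0, ?_⟩
          have hpos : 0 < ((s.factorial : ℝ)⁻¹) := by positivity
          have := (h1.inf i).2.rpow_const (p := ((s.factorial : ℝ)⁻¹)) (Or.inr hpos.le)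
          rwa [Real.zero_rpow hpos.ne'] at this
        eq := fun i => by
          filter_upwards [h2 i] with a ha
          exact (Real.rpow_inv_natCast_pow ha.le hf0).symm }
    have hbex : ∀ (j : ℕ) (k : κ), ∃ b : (Fin q → ℝ) → ℝ, IsA b ∧ ∀ hj : j < s,
        ((fun x => a j k fun i => σ i fun i' => ρ i' x) =ᶠ[𝓝 0] fun x => mono ((s - j) • γ) x * b x) ∧
        (fun x => b x ^ (s.factorial / (s - j))) =ᶠ[𝓝 0] fun x => B (⟨j, hj⟩, k) fun i => ρ i x := by
      intro j k
      by_cases hj : j < s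
      · obtain ⟨b, q1, q2, q3⟩ := root_div (d := s.factorial / (s - j)) (hd j hj).1 ((s - j) • γ)
          (((ha j k).comp h1.isA h1.zero).comp hρ.isA hρ.zero)
          ((h4 (⟨j, hj⟩, k)).1.comp hρ.isA hρ.zero) (by
            filter_upwards [hρ.tendsto.eventually (h4 (⟨j, hj⟩, k)).2] with x hx
            rw [smul_smul, (hd j hj).2, ← mono_pow]
            exact hx)
        exact ⟨b, q1, fun _ => ⟨q2, q3⟩⟩
      · exact ⟨fun _ => 0, IsA.const 0, fun hj' => absurd hj' hj⟩
    choose b q1 q2 using hbex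
    refine ⟨_, _, h1.trans hρ, fun i => (h2 i).mono fun a ha => Real.rpow_pos_of_pos ha _,
      h3.comp (fun i => (MU.proj i).pow _) hρ.zero, Or.inr ⟨γ, b, q1, fun j hj k => (q2 j k hj).1,
      j0, j0.2, k0, fun h0 => h5 ?_⟩⟩
    have := (q2 j0 k0 j0.2).2.self_of_nhds
    simp only [h0, zero_pow (hd j0 j0.2).1] at this
    rw [show (fun i => ρ i 0) = 0 from funext hρ.zero] at this
    exact this.symm

theorem rpow_inv_pos_inf (hM : IsHF l M) {t : α → ℝ} (ht : Inf l M t) (hp : ∀ᶠ a in l, 0 < t a) {d : ℕ}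
    (hd : d ≠ 0) : Inf l M (fun a => t a ^ ((d : ℝ)⁻¹)) ∧ (∀ᶠ a in l, 0 < t a ^ ((d : ℝ)⁻¹)) ∧
      ∀ᶠ a in l, (t a ^ ((d : ℝ)⁻¹)) ^ d = t a := by
  refine ⟨⟨hM.root ht.1 hp hd, ?_⟩, hp.mono fun a ha => Real.rpow_pos_of_pos ha _,
    hp.mono fun a ha => Real.rpow_inv_natCast_pow ha.le hd⟩
  have hpos : 0 < ((d : ℝ)⁻¹) := by positivity
  have := ht.2.rpow_const (p := ((d : ℝ)⁻¹)) (Or.inr hpos.le)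
  rwa [Real.zero_rpow hpos.ne'] at this

theorem mono_update {q : ℕ} (γ : Fin q → ℕ) (i : Fin q) (x : Fin q → ℝ) :
    mono γ x = x i ^ γ i * mono (Function.update γ i 0) x := by
  rw [mono, mono, ← Finset.mul_prod_erase _ _ (Finset.mem_univ i),
    ← Finset.mul_prod_erase Finset.univ (fun j => x j ^ Function.update γ i 0 j) (Finset.mem_univ i)]
  simp only [Function.update_self, pow_zero, one_mul]
  congr 1
  exact Finset.prod_congr rfl fun j hj => by rw [Function.update_of_ne (Finset.ne_of_mem_erase hj)]

theorem mono_eq_of_eq {q : ℕ} (γ : Fin q → ℕ) {i : Fin q} (hi : γ i = 0) {x y : Fin q → ℝ}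
    (h : ∀ j, j ≠ i → x j = y j) : mono γ x = mono γ y := by
  refine Finset.prod_congr rfl fun j _ => ?_
  by_cases hj : j = i
  · rw [hj, hi, pow_zero, pow_zero]
  · rw [h j hj]

theorem IsHF.toric [l.NeBot] (hM : IsHF l M) {q : ℕ} (γ : Fin q → ℕ) (t : α → ℝ) (V : Fin q → α → ℝ)
    (ht : Inf l M t) (htp : ∀ᶠ a in l, 0 < t a) (hV : ∀ j, Inf l M (V j))
    (hVp : ∀ j, ∀ᶠ a in l, 0 < V j a)
    (hlim : Tendsto (fun a => mono γ (fun j => V j a) / t a) l (𝓝 0)) :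
    ∃ (σ : Fin (q + 1) → (Fin (q + 1) → ℝ) → ℝ) (v : Fin (q + 1) → α → ℝ),
      Chg l M (Fin.cons t V : Fin (q + 1) → α → ℝ) σ v ∧ (∀ j, ∀ᶠ a in l, 0 < v j a) ∧
      (∀ i, MU (σ i)) ∧ ∃ N, IsA N ∧ N 0 = 0 ∧
        (fun x => mono γ fun j => σ j.succ x) =ᶠ[𝓝 0] fun x => σ 0 x * N x := by
  classical
  induction hN : (Finset.univ.filter fun i => γ i ≠ 0).card generalizing γ t with
  | zero =>
    exfalso
    have h0 : γ = 0 := by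
      funext i
      by_contra hi
      have := Finset.card_eq_zero.1 hN
      exact Finset.notMem_empty i (this ▸ Finset.mem_filter.2 ⟨Finset.mem_univ i, hi⟩)
    subst h0
    simp only [mono_zero] at hlim
    have h1 := hlim.mul ht.2
    rw [zero_mul] at h1
    refine zero_ne_one (tendsto_nhds_unique (h1.congr' ?_) tendsto_const_nhds)
    filter_upwards [htp] with a ha
    field_simp
  | succ N ih =>
    obtain ⟨i, hi⟩ : (Finset.univ.filter fun i => γ i ≠ 0).Nonempty := by
      rw [← Finset.card_pos, hN]; omega
    have hi : γ i ≠ 0 := (Finset.mem_filter.1 hi).2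
    obtain ⟨hT, hTp, hTe⟩ := rpow_inv_pos_inf hM ht htp hi
    set T := fun a => t a ^ (((γ i : ℕ) : ℝ)⁻¹) with hTdef
    have hTpos : ∀ᶠ a in l, 0 < T a := hTp
    have hTpow : ∀ᶠ a in l, T a ^ γ i = t a := hTe
    set γ' := Function.update γ i 0 with hγ'
    have hγ'i : γ' i = 0 := by simp [γ']
    have hquot := hM.div (hV i).1 hT.1
    -- the case where the quotient `V i / T` has a finite limit `r`
    have fin_case : ∀ r : ℝ, Tendsto (fun a => V i a / T a) l (𝓝 r) →
        ∃ (σ : Fin (q + 1) → (Fin (q + 1) → ℝ) → ℝ) (v : Fin (q + 1) → α → ℝ),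
      Chg l M (Fin.cons t V : Fin (q + 1) → α → ℝ) σ v ∧ (∀ j, ∀ᶠ a in l, 0 < v j a) ∧
      (∀ i, MU (σ i)) ∧ ∃ N, IsA N ∧ N 0 = 0 ∧
        (fun x => mono γ fun j => σ j.succ x) =ᶠ[𝓝 0] fun x => σ 0 x * N x := by
      intro r hr
      obtain ⟨c, W, hW, hWp, hWe, hc⟩ := hM.sign_chart (f := fun a => V i a / T a - r)
        ⟨hM.sub hquot (hM.const r), by simpa using hr.sub_const r⟩
      -- new coordinates: `T`, and `V` with `V i` replaced by `W`
      have hrc : r = 0 → c ≠ 0 := by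
        rintro rfl
        refine hc.resolve_left fun h0 => ?_
        obtain ⟨a, h1, h2, h3⟩ := (h0.and ((hVp i).and hTpos)).exists
        have : V i a / T a - 0 = 0 := h1
        have := div_pos h2 h3
        linarith
      let U : (Fin (q + 1) → ℝ) → ℝ := fun x => r + c * x i.succ
      have hU : MU U := by
        by_cases h0 : r = 0
        · subst h0
          refine ((MU.unit (IsA.const c) (hrc rfl)).mul (MU.proj i.succ)).congr
            (Eventually.of_forall fun x => by simp [U])
        · exact MU.unit ((IsA.const r).add ((IsA.const c).mul (IsA.proj _))) (by simpa [U] using h0)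
      let σ : Fin (q + 1) → (Fin (q + 1) → ℝ) → ℝ :=
        Fin.cons (fun x => x 0 ^ γ i) fun j x => if j = i then x 0 * U x else x j.succ
      have hσMU : ∀ j, MU (σ j) := by
        intro j
        refine Fin.cases ((MU.proj 0).pow _) (fun k => ?_) j
        by_cases hk : k = i
        · simpa [σ, hk] using (MU.proj 0).mul hU
        · simpa [σ, hk] using MU.proj k.succ
      let N : (Fin (q + 1) → ℝ) → ℝ := fun x => U x ^ γ i * mono γ' (Fin.tail x)
      have hNA : IsA N := (hU.pow _).isA.mul (IsA.tail (IsA.mono γ'))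
      have hmono : ∀ x, mono γ (fun j => σ j.succ x) = σ 0 x * N x := by
        intro x
        rw [mono_update γ i, mono_eq_of_eq (y := Fin.tail x) _ hγ'i]
        · simp [σ, N, γ', mul_pow]; ring
        · intro j hj
          simp [σ, hj, Fin.tail]
      let v : Fin (q + 1) → α → ℝ := Fin.cons T fun j => if j = i then W else V j
      have hv : ∀ j, Inf l M (v j) := by
        intro j
        refine Fin.cases hT (fun k => ?_) j
        by_cases hk : k = i
        · simpa [v, hk] using hW
        · simpa [v, hk] using hV k
      have hchg : Chg l M (Fin.cons t V : Fin (q + 1) → α → ℝ) σ v :=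
        { isA := fun j => (hσMU j).isA
          zero := by
            intro j
            refine Fin.cases ?_ (fun k => ?_) j
            · simp [σ, hi]
            · by_cases hk : k = i <;> simp [σ, hk]
          inf := hv
          eq := by
            intro j
            refine Fin.cases ?_ (fun k => ?_) j
            · filter_upwards [hTpow] with a ha
              simpa [σ, v] using ha.symm
            · by_cases hk : k = i
              · subst hk
                filter_upwards [hWe, hTpos] with a h1 h2
                simp only [Fin.cons_succ, σ, if_true, U, v, Fin.cons_zero]
                rw [← h1]; field_simp; ring
              · simp [σ, v, hk] }
      refine ⟨σ, v, hchg, ?_, hσMU, N, hNA, ?_, Eventually.of_forall hmono⟩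
      · intro j
        refine Fin.cases hTpos (fun k => ?_) j
        by_cases hk : k = i
        · simpa [v, hk] using hWp
        · simpa [v, hk] using hVp k
      · clear_value N v
        have hNc : Tendsto N (𝓝 0) (𝓝 (N 0)) := hNA.continuousAt
        have h1 : Tendsto (fun a => N fun j => v j a) l (𝓝 (N 0)) := hNc.comp (tendsto_inf hv)
        refine tendsto_nhds_unique (h1.congr' ?_) hlim
        filter_upwards [hchg.eq', htp] with a h2 h3
        have h4 := hmono fun j => v j a
        have h5 : (fun j : Fin q => σ j.succ fun j => v j a) = fun j => V j a := by
          funext j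
          have := congrFun h2 j.succ
          simpa using this.symm
        have h6 : σ 0 (fun j => v j a) = t a := by
          have := congrFun h2 0
          simpa using this.symm
        rw [h5, h6] at h4
        rw [h4]; field_simp
    rcases hM.limit hquot with ⟨r, hr⟩ | h | h
    · exact fin_case r hr
    · have hT0 : Tendsto (fun a => T a / V i a) l (𝓝 0) :=
        (tendsto_inv_atTop_zero.comp h).congr fun a => by simp
      let t' : α → ℝ := fun a => t a / V i a ^ γ i
      have ht'e : ∀ᶠ a in l, (T a / V i a) ^ γ i = t' a := by
        filter_upwards [hTpow] with a ha
        rw [div_pow, ha]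
      have ht' : Inf l M t' := by
        refine ⟨hM.div ht.1 (hM.pow (hV i).1 _), ?_⟩
        have := hT0.pow (γ i)
        rw [zero_pow hi] at this
        exact this.congr' ht'e
      have ht'p : ∀ᶠ a in l, 0 < t' a := by
        filter_upwards [htp, hVp i] with a h1 h2
        exact div_pos h1 (pow_pos h2 _)
      obtain ⟨σ, v, h1, h2, h3, N, h4, h5, h6⟩ := ih γ' t' ht' ht'p (by
          refine hlim.congr' ?_
          filter_upwards [htp, hVp i] with a h1 h2
          rw [mono_update γ i]
          simp only [t', γ']
          field_simp) (by
          have : (Finset.univ.filter fun j => γ' j ≠ 0) = (Finset.univ.filter fun j => γ j ≠ 0).erase i := by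
            ext j
            by_cases hj : j = i
            · simp [hj, hγ'i]
            · simp [hj, γ']
          rw [this, Finset.card_erase_of_mem (by simpa using hi), hN]; rfl)
      refine ⟨Fin.cons (fun x => σ i.succ x ^ γ i * σ 0 x) fun j => σ j.succ, v, ?_, h2, ?_, N, h4, h5, ?_⟩
      · exact
        { isA := fun j => Fin.cases (((h1.isA _).pow _).mul (h1.isA _)) (fun k => h1.isA _) j
          zero := fun j => Fin.cases (by simp [h1.zero]) (fun k => h1.zero _) j
          inf := h1.inf
          eq := fun j => by
            refine Fin.cases ?_ (fun k => ?_) j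
            · filter_upwards [h1.eq 0, h1.eq i.succ, hVp i] with a e1 e2 e3
              simp only [Fin.cons_zero, Fin.cons_succ] at e1 e2 ⊢
              rw [← e1, ← e2]
              simp only [t']; field_simp
            · exact h1.eq k.succ }
      · exact fun j => Fin.cases (((h3 _).pow _).mul (h3 _)) (fun k => h3 _) j
      · filter_upwards [h6] with x hx
        simp only [Fin.cons_succ, Fin.cons_zero]
        rw [mono_update γ i, hx]; ring
    · exfalso
      obtain ⟨a, h1, h2, h3⟩ := ((h.eventually (eventually_lt_atBot 0)).and ((hVp i).and hTpos)).exists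
      have := div_pos h2 h3
      linarith

/-- Monomialization along `w` whose first coordinate is regular of order `s`. -/
def RegGood (l : Filter α) (M : Set (α → ℝ)) (q s : ℕ) : Prop :=
  ∀ (t : α → ℝ) (w : Fin q → α → ℝ), Inf l M t → (∀ j, Inf l M (w j)) → ∀ E : (Fin q → ℝ) → ℝ,
    IsA E → (∀ᶠ a in l, E (fun j => w j a) ≠ 0) → ∀ {κ : Type} (G : κ → (Fin (q + 1) → ℝ) → ℝ),
    (∀ k, IsA (G k)) → (∃ k, cf s (G k) 0 ≠ 0) →
      Good l M (Fin.cons t w : Fin (q + 1) → α → ℝ) (fun x => E (Fin.tail x)) G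

theorem tendsto_tail {q : ℕ} : Tendsto (Fin.tail : (Fin (q + 1) → ℝ) → (Fin q → ℝ)) (𝓝 0) (𝓝 0) :=
  IsA.tendsto_zero (h := fun j x => x j.succ) (fun _ => IsA.proj _) fun _ => rfl

theorem MU.tail {q : ℕ} {E : (Fin q → ℝ) → ℝ} (hE : MU E) : MU fun x : Fin (q + 1) → ℝ => E (Fin.tail x) :=
  hE.comp (h := fun j x => x j.succ) (fun _ => MU.proj _) fun _ => rfl

theorem cons_fun_eq {q : ℕ} (η : (Fin (q + 1) → ℝ) → ℝ) (σ : Fin q → (Fin q → ℝ) → ℝ)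
    (x : Fin (q + 1) → ℝ) :
    (fun i => (Fin.cons η fun j x => σ j (Fin.tail x) : Fin (q + 1) → (Fin (q + 1) → ℝ) → ℝ) i x) =
      Fin.cons (η x) fun j => σ j (Fin.tail x) := by
  funext j; refine Fin.cases rfl (fun k => rfl) j

theorem regGood_zero [l.NeBot] (hM : IsHF l M) {q : ℕ} (hLU : LU l M q) : RegGood l M q 0 := by
  intro t w ht hw E hE hEw κ G hG ⟨k, hk⟩
  obtain ⟨σ, v, h1, h2, h3, -⟩ := hLU.marked hw hE hEw (G := fun (i : Empty) => i.elim) fun i => i.elim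
  obtain ⟨c, g, hg, hgp, hge, -⟩ := hM.sign_chart ht
  have hc := h1.cons (η := fun x => c * x 0) (t := t) (t' := g) ((IsA.const c).mul (IsA.proj 0))
    (by simp) hg (by simpa using hge)
  refine ⟨_, _, hc, fun j => Fin.cases hgp h2 j, h3.tail, Or.inr ⟨0, _, fun k => ⟨(hG k).comp hc.isA hc.zero,
    by simp⟩, k, ?_⟩⟩
  rw [cf_zero, cons_zero_zero] at hk
  rwa [show (fun i => _) = _ from funext hc.zero]

theorem cf_shift_poly {s : ℕ} (hs : s ≠ 0) (c : ℕ → ℝ) (hc : c (s - 1) = 0) (r u : ℝ) :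
    iteratedDeriv (s - 1) (fun W => ∑ j ∈ Finset.range s, c j * (r + W) ^ j + (r + W) ^ s * u) 0 =
      (s - 1).factorial * (s * r * u) := by
  open Polynomial in
  let P : ℝ[X] := ∑ j ∈ Finset.range s, C (c j) * (X + C r) ^ j + C u * (X + C r) ^ s
  have hdeg : P.natDegree < s + 1 := by
    refine Nat.lt_succ_of_le (natDegree_add_le_of_degree_le (natDegree_sum_le_of_forall_le _ _ fun j hj => ?_) ?_)
    · refine (natDegree_C_mul_le _ _).trans ?_
      rw [natDegree_pow_X_add_C]; exact (Finset.mem_range.1 hj).le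
    · refine (natDegree_C_mul_le _ _).trans ?_
      rw [natDegree_pow_X_add_C]
  have hP : (fun W => ∑ j ∈ Finset.range s, c j * (r + W) ^ j + (r + W) ^ s * u) =
      fun W => ∑ i ∈ Finset.range s, P.coeff i * W ^ i + W ^ s * P.coeff s := by
    funext W
    have h1 : P.eval W = ∑ j ∈ Finset.range s, c j * (r + W) ^ j + (r + W) ^ s * u := by
      simp only [P, eval_add, eval_finsetSum, eval_mul, eval_C, eval_pow, eval_X, add_comm W r]
      ring
    rw [← h1, eval_eq_sum_range' hdeg, Finset.sum_range_succ]; ring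
  rw [hP, iteratedDeriv_taylor (u := fun _ => P.coeff s) _ analyticAt_const (by omega)]
  congr 1
  simp only [P, coeff_add, finsetSum_coeff, coeff_C_mul, coeff_X_add_C_pow]
  rw [Finset.sum_eq_zero]
  · have h2 : s - (s - 1) = 1 := by omega
    have h3 : s.choose (s - 1) = s := by
      rw [← Nat.choose_symm (by omega), h2, Nat.choose_one_right]
    rw [h2, h3]; ring
  · intro j hj
    rw [Finset.mem_range] at hj
    rcases (show j = s - 1 ∨ j < s - 1 by omega) with h | h
    · rw [h, hc]; ring
    · rw [Nat.choose_eq_zero_of_lt h]; simp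

theorem IsA.tschirnhaus {q s : ℕ} (hs : s ≠ 0) {G : (Fin (q + 1) → ℝ) → ℝ} (hG : IsA G)
    (h0 : RM.cf (s - 1) G 0 = 0) (h1 : RM.cf s G 0 ≠ 0) :
    ∃ θ : (Fin q → ℝ) → ℝ, IsA θ ∧ θ 0 = 0 ∧
      RM.cf (s - 1) (fun x => G (Fin.cons (x 0 + θ (Fin.tail x)) (Fin.tail x))) =ᶠ[𝓝 0] 0 := by
  obtain ⟨s, rfl⟩ := Nat.exists_eq_succ_of_ne_zero hs
  simp only [Nat.succ_eq_add_one, Nat.add_sub_cancel] at *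
  have e0 := (cf_eq hG s).self_of_nhds
  have e1 := (cf_eq hG (s + 1)).self_of_nhds
  rw [h0, cons_zero_zero, eq_comm, div_eq_zero_iff] at e0
  rw [e1, cons_zero_zero] at h1
  obtain ⟨θ, q1, q2, q3⟩ := (hG.pdl (List.replicate s 0)).implicit
    (e0.resolve_right (by positivity)) (left_ne_zero_of_mul h1)
  refine ⟨θ, q1, q2, ?_⟩
  obtain ⟨ρ, hρ, h⟩ := hG
  have hc : Tendsto (fun w => (Fin.cons (θ w) w : Fin (q + 1) → ℝ)) (𝓝 0) (𝓝 0) := by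
    have : Tendsto (fun w => (θ w, w)) (𝓝 0) (𝓝 (0 : ℝ × (Fin q → ℝ))) := by
      have := q1.continuousAt.tendsto
      rw [q2] at this
      exact this.prodMk_nhds tendsto_id
    exact tendsto_cons.comp this
  filter_upwards [q3, hc.eventually (Metric.ball_mem_nhds _ hρ)] with w hw hb
  rw [RM.cf]
  simp only [Fin.cons_zero, Fin.tail_cons]
  have := congrFun (iteratedDeriv_comp_add_const s (fun t => G (Fin.cons t w)) (θ w)) 0
  rw [this, zero_add, iteratedDeriv_line Metric.isOpen_ball h.analytic hb, hw]
  simp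

theorem MU.eventually_ne {E : (Fin n → ℝ) → ℝ} (hE : MU E) {v : Fin n → α → ℝ} (hv : ∀ j, Inf l M (v j))
    (hp : ∀ j, ∀ᶠ a in l, 0 < v j a) : ∀ᶠ a in l, E (fun j => v j a) ≠ 0 := by
  obtain ⟨β, U, h1, h2, h3⟩ := hE
  filter_upwards [(tendsto_inf hv).eventually h3, (tendsto_inf hv).eventually
    (h1.continuousAt.eventually_ne h2), eventually_all.2 hp] with a e1 e2 e3
  rw [e1]
  exact mul_ne_zero (mono_pos β e3).ne' e2

theorem good_of_infinite [l.NeBot] (hM : IsHF l M) {q s : ℕ} {t : α → ℝ} {V : Fin q → α → ℝ}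
    (ht : Inf l M t) (hV : ∀ j, Inf l M (V j)) (hVp : ∀ j, ∀ᶠ a in l, 0 < V j a)
    {E : (Fin q → ℝ) → ℝ} (hE : MU E) {κ : Type} {G : κ → (Fin (q + 1) → ℝ) → ℝ} {γ : Fin q → ℕ}
    {b : ℕ → κ → (Fin q → ℝ) → ℝ} {U : κ → (Fin (q + 1) → ℝ) → ℝ}
    (hb : ∀ j k, IsA (b j k)) (hU : ∀ k, IsA (U k))
    (hG : ∀ k, ∀ᶠ x in 𝓝 0, G k x = ∑ j ∈ Finset.range s,
      mono ((s - j) • γ) (Fin.tail x) * b j k (Fin.tail x) * x 0 ^ j + x 0 ^ s * U k x)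
    {k0 : κ} (hk0 : U k0 0 ≠ 0) (hlim : Tendsto (fun a => mono γ (fun j => V j a) / t a) l (𝓝 0))
    (ht0 : ¬ t =ᶠ[l] 0) :
    Good l M (Fin.cons t V : Fin (q + 1) → α → ℝ) (fun x => E (Fin.tail x)) G := by
  obtain ⟨c, g, hg, hgp, hge, hc⟩ := hM.sign_chart ht
  have hc := hc.resolve_left ht0
  obtain ⟨σ, v, h1, h2, h3, N, h4, h5, h6⟩ := hM.toric γ g V hg hgp hV hVp (by
    have := hlim.const_mul c
    rw [mul_zero] at this
    refine this.congr' ?_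
    filter_upwards [hge, hgp] with a e1 e2
    rw [e1]; field_simp)
  let τ : Fin (q + 1) → (Fin (q + 1) → ℝ) → ℝ := Fin.cons (fun x => c * σ 0 x) fun j => σ j.succ
  have hτMU : ∀ i, MU (τ i) := fun i => Fin.cases ((MU.unit (IsA.const c) hc).mul (h3 0)) (fun k => h3 _) i
  have hτ : Chg l M (Fin.cons t V : Fin (q + 1) → α → ℝ) τ v :=
    { isA := fun i => (hτMU i).isA
      zero := fun i => Fin.cases (by simp [τ, h1.zero]) (fun k => h1.zero _) i
      inf := h1.inf
      eq := fun i => by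
        refine Fin.cases ?_ (fun k => ?_) i
        · filter_upwards [hge, h1.eq 0] with a e1 e2
          simp only [Fin.cons_zero] at e2
          simp only [Fin.cons_zero, τ, e1, e2]
        · exact h1.eq k.succ }
  have hτt : ∀ x, Fin.tail (fun i => τ i x) = fun j => σ j.succ x := fun x => rfl
  have hτ0 : ∀ x, τ 0 x = c * σ 0 x := fun x => rfl
  clear_value τ
  refine ⟨τ, v, hτ, h2, ?_, ?_⟩
  · simp only [hτt]
    exact hE.comp (fun j => h3 _) fun j => h1.zero _
  · have key : Princ fun k x => σ 0 x ^ s * (∑ j ∈ Finset.range s,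
        N x ^ (s - j) * b j k (fun i => σ i.succ x) * c ^ j + c ^ s * U k fun i => τ i x) := by
      refine Princ.mul (Or.inr ⟨0, _, fun k => ⟨?_, by simp; rfl⟩, k0, ?_⟩) ((h3 0).pow s)
      · refine IsA.add (IsA.sum _ fun j _ => ((h4.pow _).mul ((hb j k).comp (fun i => h1.isA _)
          fun i => h1.zero _)).mul (IsA.const _)) ((IsA.const _).mul ((hU k).comp hτ.isA hτ.zero))
      · rw [show (fun i => τ i 0) = 0 from funext hτ.zero, Finset.sum_eq_zero, zero_add]
        · exact mul_ne_zero (pow_ne_zero _ hc) hk0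
        · intro j hj
          rw [h5, zero_pow, zero_mul, zero_mul]
          have := Finset.mem_range.1 hj
          omega
    refine key.congr fun k => ?_
    filter_upwards [hτ.tendsto.eventually (hG k), h6] with x e1 e2
    rw [e1, hτt, hτ0, mul_add, Finset.mul_sum]
    congr 1
    · refine Finset.sum_congr rfl fun j hj => ?_
      have : s = (s - j) + j := by have := Finset.mem_range.1 hj; omega
      rw [mono_smul, e2]
      conv_lhs => rw [this, pow_add]
      rw [show s - j + j - j = s - j by omega]
      ring
    · rw [mul_pow]; ring

theorem good_of_finite [l.NeBot] (hM : IsHF l M) {q s : ℕ} (hs : s ≠ 0) (ih : ∀ s' < s, RegGood l M q s')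
    {t : α → ℝ} {V : Fin q → α → ℝ}
    (ht : Inf l M t) (hV : ∀ j, Inf l M (V j)) (hVp : ∀ j, ∀ᶠ a in l, 0 < V j a)
    {E : (Fin q → ℝ) → ℝ} (hE : MU E) {κ : Type} {G : κ → (Fin (q + 1) → ℝ) → ℝ} {γ : Fin q → ℕ}
    {b : ℕ → κ → (Fin q → ℝ) → ℝ} {U : κ → (Fin (q + 1) → ℝ) → ℝ}
    (hb : ∀ j k, IsA (b j k)) (hU : ∀ k, IsA (U k))
    (hG : ∀ k, ∀ᶠ x in 𝓝 0, G k x = ∑ j ∈ Finset.range s,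
      mono ((s - j) • γ) (Fin.tail x) * b j k (Fin.tail x) * x 0 ^ j + x 0 ^ s * U k x)
    {k0 : κ} (hk0 : U k0 0 ≠ 0) (hbk0 : b (s - 1) k0 0 = 0) (hb0 : ∃ j < s, ∃ k, b j k 0 ≠ 0)
    {r : ℝ} (hlim : Tendsto (fun a => t a / mono γ (fun j => V j a)) l (𝓝 r)) :
    Good l M (Fin.cons t V : Fin (q + 1) → α → ℝ) (fun x => E (Fin.tail x)) G := by
  have hVm : ∀ᶠ a in l, 0 < mono γ (fun j => V j a) := by
    filter_upwards [eventually_all.2 hVp] with a e using mono_pos γ e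
  have hγr : γ = 0 → r = 0 := by
    rintro rfl
    simp only [mono_zero, div_one] at hlim
    exact tendsto_nhds_unique hlim ht.2
  have hVM : (fun a => mono γ fun j => V j a) ∈ M := hM.anal (IsA.mono γ) (fun j => (hV j).1) fun j => (hV j).2
  let W : α → ℝ := fun a => t a / mono γ (fun j => V j a) - r
  have hW : Inf l M W := ⟨hM.sub (hM.div ht.1 hVM) (hM.const r), by simpa using hlim.sub_const r⟩
  let η : (Fin (q + 1) → ℝ) → ℝ := fun x => mono γ (Fin.tail x) * (r + x 0)
  have hη : IsA η := (IsA.tail (IsA.mono γ)).mul ((IsA.const r).add (IsA.proj 0))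
  have hη0' : ∀ w, η (Fin.cons w 0) = mono γ 0 * (r + w) := fun w => by simp [η]
  have hη0 : η 0 = 0 := by
    rw [← cons_zero_zero, hη0']
    by_cases h : γ = 0
    · simp [hγr h]
    · simp [mono_at_zero h]
  have hch := (Chg.refl hV).cons (t := t) hη hη0 hW (by
    filter_upwards [hVm] with a ha
    simp only [η, W, Fin.tail_cons, Fin.cons_zero]
    field_simp; ring)
  set τ : Fin (q + 1) → (Fin (q + 1) → ℝ) → ℝ := Fin.cons η fun j x => (fun i (x : Fin q → ℝ) => x i) j (Fin.tail x)
    with hτdef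
  have hτ : ∀ x, (fun i => τ i x) = Fin.cons (η x) (Fin.tail x) := fun x => by
    funext j; refine Fin.cases rfl (fun k => rfl) j
  have hUτ : ∀ k, IsA fun x => U k (Fin.cons (η x) (Fin.tail x)) := fun k => by
    simpa only [hτ] using (hU k).comp hch.isA hch.zero
  let H : κ → (Fin (q + 1) → ℝ) → ℝ := fun k x => ∑ j ∈ Finset.range s,
    b j k (Fin.tail x) * (r + x 0) ^ j + (r + x 0) ^ s * U k (Fin.cons (η x) (Fin.tail x))
  have hr0 : IsA fun x : Fin (q + 1) → ℝ => r + x 0 := (IsA.const r).add (IsA.proj 0)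
  have hH : ∀ k, IsA (H k) := fun k =>
    IsA.add (IsA.sum _ fun j _ => (IsA.tail (hb j k)).mul (hr0.pow j)) ((hr0.pow s).mul (hUτ k))
  refine Good.of_chg hch (Good.factor (F := fun x => mono (s • γ) (Fin.tail x)) (H := H) ?_ ?_ ?_ ?_)
  · simp only [hτ, Fin.tail_cons]
    exact IsA.tail hE.isA
  · exact IsA.tail (IsA.mono _)
  · simp only [hτ, Fin.tail_cons]
    have hF : MU fun x : Fin q → ℝ => E x * mono (s • γ) x :=
      hE.mul ⟨s • γ, fun _ => 1, IsA.const 1, one_ne_zero, by simp⟩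
    have hne := hF.eventually_ne hV hVp
    by_cases hr : r = 0
    · obtain ⟨j0, hj0, k1, h1⟩ := hb0
      refine ih j0 hj0 W V hW hV (fun x => E x * mono (s • γ) x) hF.isA hne H hH ⟨k1, ?_⟩
      have := cf_taylor (G := H k1) (s := s) (a := fun j => b j k1) (hUτ k1).analyticAt
        (Eventually.of_forall fun x => by simp only [H, hr, zero_add]) hj0
      rwa [this.self_of_nhds]
    · have hγ : γ ≠ 0 := fun h => hr (hγr h)
      refine ih (s - 1) (by omega) W V hW hV (fun x => E x * mono (s • γ) x) hF.isA hne H hH ⟨k0, ?_⟩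
      rw [cf]
      have e : (fun t => H k0 (Fin.cons t 0)) = fun t =>
          ∑ j ∈ Finset.range s, b j k0 0 * (r + t) ^ j + (r + t) ^ s * U k0 0 := by
        funext t
        simp only [H, Fin.tail_cons, Fin.cons_zero, hη0', mono_at_zero hγ, zero_mul, cons_zero_zero]
      rw [e, cf_shift_poly hs (fun j => b j k0 0) hbk0]
      have : (s : ℝ) ≠ 0 := by exact_mod_cast hs
      have := (s - 1).factorial_ne_zero
      positivity
  · intro k
    filter_upwards [hch.tendsto.eventually (hG k)] with x e1
    rw [e1]
    have e2 : Fin.tail (fun i => τ i x) = Fin.tail x := rfl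
    have e3 : τ 0 x = mono γ (Fin.tail x) * (r + x 0) := rfl
    rw [e2, e3, hτ]
    simp only [H]
    rw [mul_add (mono (s • γ) (Fin.tail x)), Finset.mul_sum]
    congr 1
    · refine Finset.sum_congr rfl fun j hj => ?_
      have : s = (s - j) + j := by have := Finset.mem_range.1 hj; omega
      rw [mono_smul, mono_smul]
      conv_rhs => rw [this, pow_add]
      rw [mul_pow]; ring
    · rw [mono_smul, mul_pow]; ring

theorem IsA.taylor_ne {q s : ℕ} {G U : (Fin (q + 1) → ℝ) → ℝ} (hU : IsA U)
    (h : ∀ᶠ x in 𝓝 0, G x = ∑ i ∈ Finset.range s, RM.cf i G (Fin.tail x) * x 0 ^ i + x 0 ^ s * U x) :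
    U 0 = RM.cf s G 0 := by
  obtain ⟨U', h1, h2⟩ := hU.taylor 1
  let a : ℕ → (Fin q → ℝ) → ℝ := fun i w => if i < s then RM.cf i G w else U (Fin.cons 0 w)
  have ha : ∀ i < s, a i = RM.cf i G := fun i hi => funext fun w => if_pos hi
  have has : a s = fun w => U (Fin.cons 0 w) := funext fun w => if_neg (lt_irrefl s)
  have h3 : ∀ᶠ x in 𝓝 0, G x = ∑ i ∈ Finset.range (s + 1), a i (Fin.tail x) * x 0 ^ i + x 0 ^ (s + 1) * U' x := by
    filter_upwards [h, h2] with x e1 e2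
    rw [e1, Finset.sum_range_succ, has,
      Finset.sum_congr rfl fun i hi => by rw [← ha i (Finset.mem_range.1 hi)], e2]
    simp only [Finset.range_one, Finset.sum_singleton, RM.cf_zero]
    ring
  rw [(cf_taylor (a := a) h1.analyticAt h3 (Nat.lt_succ_self s)).self_of_nhds, has]
  simp [cons_zero_zero]

theorem cons_fun_eq' {q : ℕ} (η : (Fin (q + 1) → ℝ) → ℝ) (x : Fin (q + 1) → ℝ) :
    (fun i => (Fin.cons η fun j x => Fin.tail x j : Fin (q + 1) → (Fin (q + 1) → ℝ) → ℝ) i x) =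
      Fin.cons (η x) (Fin.tail x) :=
  cons_fun_eq η (fun j x => x j) x

theorem regGood_succ [l.NeBot] (hM : IsHF l M) {q s : ℕ} (hs : s ≠ 0) (hLU : LU l M q)
    (ih : ∀ s' < s, RegGood l M q s') : RegGood l M q s := by
  intro t w ht hw E hE hEw κ G hG ⟨k0, hk0⟩
  by_cases hz : cf (s - 1) (G k0) 0 = 0
  swap
  · exact ih (s - 1) (by omega) t w ht hw E hE hEw G hG ⟨k0, hz⟩
  obtain ⟨θ, hθ, hθ0, hθc⟩ := (hG k0).tschirnhaus hs hz hk0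
  let η : (Fin (q + 1) → ℝ) → ℝ := fun x => x 0 + θ (Fin.tail x)
  have hη : IsA η := (IsA.proj 0).add (IsA.tail hθ)
  have hη0 : η 0 = 0 := by
    have : Fin.tail (0 : Fin (q + 1) → ℝ) = 0 := rfl
    simp [η, this, hθ0]
  have hθw := hM.inf_comp hθ hθ0 hw
  have ht' : Inf l M fun a => t a - θ fun j => w j a :=
    ⟨hM.sub ht.1 hθw.1, by simpa using ht.2.sub hθw.2⟩
  have hch := (Chg.refl hw).cons (t := t) hη hη0 ht' (Eventually.of_forall fun a => by
    simp [η, Fin.tail_cons])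
  refine Good.of_chg hch ?_
  simp only [cons_fun_eq', Fin.tail_cons]
  set t' : α → ℝ := fun a => t a - θ fun j => w j a
  let H : κ → (Fin (q + 1) → ℝ) → ℝ := fun k x => G k (Fin.cons (η x) (Fin.tail x))
  have hH : ∀ k, IsA (H k) := fun k => by
    simpa only [cons_fun_eq, cons_fun_eq'] using (hG k).comp hch.isA hch.zero
  have hHs : cf s (H k0) 0 ≠ 0 := by
    have : cf s (H k0) 0 = cf s (G k0) 0 := by
      simp [cf, H, η, hθ0]
    rwa [this]
  choose U hU hUe using fun k => (hH k).taylor s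
  obtain ⟨σ, v, c1, c2, c3, c4⟩ := hLU.charts hM hw hE hEw s (a := fun j k => cf j (H k))
    fun j k => (hH k).cf j
  have hch2 := c1.cons (t := t') (t' := t') (η := fun x => x 0) (IsA.proj 0) rfl ht' (by simp)
  refine Good.of_chg hch2 ?_
  simp only [cons_fun_eq, Fin.tail_cons]
  have hUσ : ∀ k, IsA fun x : Fin (q + 1) → ℝ => U k (Fin.cons (x 0) fun j => σ j (Fin.tail x)) := fun k => by
    simpa only [cons_fun_eq, cons_fun_eq'] using (hU k).comp hch2.isA hch2.zero
  have hUσ0 : U k0 (Fin.cons ((0 : Fin (q + 1) → ℝ) 0) fun j => σ j (Fin.tail (0 : Fin (q + 1) → ℝ))) ≠ 0 := by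
    have e1 : (fun j => σ j (Fin.tail (0 : Fin (q + 1) → ℝ))) = 0 := funext fun j => c1.zero j
    rw [e1, Pi.zero_apply, cons_zero_zero, IsA.taylor_ne (hU k0) (hUe k0)]
    exact hHs
  have hexp : ∀ k, ∀ᶠ x : Fin (q + 1) → ℝ in 𝓝 0, H k (Fin.cons (x 0) fun j => σ j (Fin.tail x)) =
      ∑ j ∈ Finset.range s, cf j (H k) (fun j => σ j (Fin.tail x)) * x 0 ^ j +
        x 0 ^ s * U k (Fin.cons (x 0) fun j => σ j (Fin.tail x)) := fun k => by
    have := hch2.tendsto.eventually (hUe k)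
    simpa only [cons_fun_eq, cons_fun_eq', Fin.tail_cons, Fin.cons_zero] using this
  have hHeq : ∀ k, (fun x : Fin (q + 1) → ℝ => H k (Fin.cons (x 0) fun j => σ j (Fin.tail x))) =ᶠ[𝓝 0]
      fun x => G k (Fin.cons (η (Fin.cons (x 0) fun j => σ j (Fin.tail x))) fun j => σ j (Fin.tail x)) :=
    fun k => Eventually.of_forall fun x => by simp only [H, Fin.tail_cons]
  refine Good.congr ?_ EventuallyEq.rfl hHeq
  rcases c4 with c4 | ⟨γ, b, hb, hab, hb0⟩
  · obtain ⟨c, g, hg, hgp, hge, -⟩ := hM.sign_chart ht'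
    have hch3 := (Chg.refl c1.inf).cons (η := fun x => c * x 0) (t := t') (t' := g)
      ((IsA.const c).mul (IsA.proj 0)) (by simp) hg (by simpa using hge)
    refine ⟨_, _, hch3, fun j => Fin.cases hgp c2 j, ?_, ?_⟩
    · simp only [cons_fun_eq', Fin.tail_cons]
      exact c3.tail
    have hred : ∀ k, ∀ᶠ x : Fin (q + 1) → ℝ in 𝓝 0, H k (Fin.cons (c * x 0) fun j => σ j (Fin.tail x)) =
        (c * x 0) ^ s * U k (Fin.cons (c * x 0) fun j => σ j (Fin.tail x)) := fun k => by
      have q1 := hch3.tendsto.eventually (hexp k)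
      simp only [cons_fun_eq', Fin.tail_cons, Fin.cons_zero] at q1
      have q2 : ∀ᶠ x : Fin (q + 1) → ℝ in 𝓝 0, ∀ j ∈ Finset.range s,
          cf j (H k) (fun i => σ i (Fin.tail x)) = 0 := by
        rw [Filter.eventually_all_finset]
        exact fun j hj => tendsto_tail.eventually (c4 j (Finset.mem_range.1 hj) k)
      filter_upwards [q1, q2] with x e1 e2
      rw [e1, Finset.sum_eq_zero fun j hj => by rw [e2 j hj, zero_mul], zero_add]
    simp only [cons_fun_eq', Fin.tail_cons]
    simp only [Fin.cons_zero]
    by_cases hc : c = 0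
    · refine Or.inl fun k => ?_
      filter_upwards [hred k] with x e
      rw [e, hc, zero_mul, zero_pow hs, zero_mul]; rfl
    · have : Princ fun k (x : Fin (q + 1) → ℝ) =>
          (c * x 0) ^ s * U k (Fin.cons (c * x 0) fun j => σ j (Fin.tail x)) := by
        refine Princ.mul (F := fun x : Fin (q + 1) → ℝ => (c * x 0) ^ s) (Or.inr ⟨0, _, fun k => ⟨?_, by simp; rfl⟩, k0, ?_⟩)
          (((MU.unit (IsA.const c) hc).mul (MU.proj 0)).pow s)
        · have := (hUσ k).comp hch3.isA hch3.zero
          simpa only [cons_fun_eq, cons_fun_eq', Fin.tail_cons, Fin.cons_zero] using this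
        · simpa using hUσ0
      exact this.congr fun k => by filter_upwards [hred k] with x e using e.symm
  · have hVM : (fun a => mono γ fun j => v j a) ∈ M :=
      hM.anal (IsA.mono γ) (fun j => (c1.inf j).1) fun j => (c1.inf j).2
    have hG' : ∀ k, ∀ᶠ x : Fin (q + 1) → ℝ in 𝓝 0, H k (Fin.cons (x 0) fun j => σ j (Fin.tail x)) =
        ∑ j ∈ Finset.range s, mono ((s - j) • γ) (Fin.tail x) * b j k (Fin.tail x) * x 0 ^ j +
          x 0 ^ s * U k (Fin.cons (x 0) fun j => σ j (Fin.tail x)) := fun k => by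
      have q2 : ∀ᶠ x : Fin (q + 1) → ℝ in 𝓝 0, ∀ j ∈ Finset.range s,
          cf j (H k) (fun i => σ i (Fin.tail x)) = mono ((s - j) • γ) (Fin.tail x) * b j k (Fin.tail x) := by
        rw [Filter.eventually_all_finset]
        exact fun j hj => tendsto_tail.eventually (hab j (Finset.mem_range.1 hj) k)
      filter_upwards [hexp k, q2] with x e1 e2
      rw [e1, Finset.sum_congr rfl fun j hj => by rw [e2 j hj] ]
    have hbk0 : b (s - 1) k0 0 = 0 := by
      have q1 := c1.tendsto.eventually hθc
      have q2 := hab (s - 1) (by omega) k0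
      have := germ_cancel (IsA.mono ((s - (s - 1)) • γ)).analyticAt (hb (s - 1) k0).analyticAt analyticAt_const
        (mono_germ_ne _) (h := fun _ => 0) (by
          filter_upwards [q1, q2] with x e1 e2
          rw [mul_zero, ← e2]; exact e1)
      exact this.self_of_nhds
    have hfin : ∀ r, Tendsto (fun a => t' a / mono γ (fun j => v j a)) l (𝓝 r) →
        Good l M (Fin.cons t' v : Fin (q + 1) → α → ℝ) (fun x => E fun i => σ i (Fin.tail x))
          (fun k (x : Fin (q + 1) → ℝ) => H k (Fin.cons (x 0) fun j => σ j (Fin.tail x))) := fun r hr =>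
      good_of_finite hM hs ih ht' c1.inf c2 c3 hb hUσ hG' hUσ0 hbk0 hb0 hr
    have hinf : Tendsto (fun a => mono γ (fun j => v j a) / t' a) l (𝓝 0) →
        Good l M (Fin.cons t' v : Fin (q + 1) → α → ℝ) (fun x => E fun i => σ i (Fin.tail x))
          (fun k (x : Fin (q + 1) → ℝ) => H k (Fin.cons (x 0) fun j => σ j (Fin.tail x))) := fun hlim => by
      by_cases h0 : t' =ᶠ[l] 0
      · refine hfin 0 (tendsto_const_nhds.congr' ?_)
        filter_upwards [h0] with a e
        simp [e]
      · exact good_of_infinite hM ht' c1.inf c2 c3 hb hUσ hG' hUσ0 hlim h0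
    rcases hM.limit (hM.div ht'.1 hVM) with ⟨r, hr⟩ | hr | hr
    · exact hfin r hr
    · refine hinf (hr.inv_tendsto_atTop.congr fun a => ?_)
      simp
    · refine hinf (hr.inv_tendsto_atBot.congr fun a => ?_)
      simp

theorem regGood [l.NeBot] (hM : IsHF l M) {q : ℕ} (hLU : LU l M q) (s : ℕ) : RegGood l M q s := by
  induction s using Nat.strong_induction_on with
  | _ s ih =>
    rcases eq_or_ne s 0 with rfl | hs
    · exact regGood_zero hM hLU
    · exact regGood_succ hM hs hLU ih

theorem exists_iteratedDeriv_ne {g : ℝ → ℝ} (hg : AnalyticAt ℝ g 0) (h : ¬ g =ᶠ[𝓝 0] 0) :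
    ∃ s, iteratedDeriv s g 0 ≠ 0 := by
  by_contra! hc
  refine h (analyticOrderAt_eq_top.1 (ENat.eq_top_iff_forall_ge.2 fun m => ?_))
  exact (natCast_le_analyticOrderAt_iff_iteratedDeriv_eq_zero hg).2 fun i _ => hc i

theorem exists_line_ne {G : (Fin n → ℝ) → ℝ} (hG : AnalyticAt ℝ G 0) (h : ¬ G =ᶠ[𝓝 0] 0) (hn : n ≠ 0) :
    ∃ v : Fin n → ℝ, v ≠ 0 ∧ ¬ (fun t : ℝ => G (t • v)) =ᶠ[𝓝 0] 0 := by
  obtain ⟨ε, hε, he⟩ := Metric.eventually_nhds_iff_ball.1 hG.eventually_analyticAt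
  by_cases h0 : G 0 = 0
  · have hf : ∃ᶠ x in 𝓝 0, G x ≠ 0 := fun h' => h (h'.mono fun x hx => not_not.1 hx)
    obtain ⟨x, hx, hxe⟩ := (hf.and_eventually (Metric.ball_mem_nhds _ hε)).exists
    refine ⟨x, fun h => hx (h ▸ h0), fun hz => hx ?_⟩
    have hA : AnalyticOnNhd ℝ (fun t : ℝ => G (t • x)) (Icc 0 1) := by
      intro t ht
      have : t • x ∈ Metric.ball 0 ε := by
        rw [dist_zero_right] at hxe
        rw [mem_ball_zero_iff]
        rw [norm_smul, Real.norm_of_nonneg ht.1]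
        exact (mul_le_of_le_one_left (norm_nonneg _) ht.2).trans_lt hxe
      exact (he _ this).comp_of_eq (by fun_prop) rfl
    have := hA.eqOn_zero_of_preconnected_of_eventuallyEq_zero isPreconnected_Icc
      (left_mem_Icc.2 zero_le_one) hz (right_mem_Icc.2 zero_le_one)
    simpa using this
  · refine ⟨fun _ => 1, fun h => ?_, fun hz => h0 ?_⟩
    · exact one_ne_zero (congrFun h ⟨0, Nat.pos_of_ne_zero hn⟩)
    · simpa using hz.self_of_nhds

theorem LU.of_zero (hM : IsHF l M) {p : ℕ} {w : Fin p → α → ℝ} (hw : ∀ j, Inf l M (w j)) {κ : Type}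
    {G : κ → (Fin p → ℝ) → ℝ} (hG : ∀ k, G k =ᶠ[𝓝 0] 0) :
    ∃ (σ : Fin p → (Fin p → ℝ) → ℝ) (v : Fin p → α → ℝ), Chg l M w σ v ∧
      (∀ j, ∀ᶠ a in l, 0 < v j a) ∧ Princ fun k x => G k fun i => σ i x := by
  obtain ⟨c, v, h1, h2⟩ := hM.sign_charts hw
  exact ⟨_, v, h1, h2, Or.inl fun k => h1.tendsto.eventually (hG k)⟩

theorem lu [l.NeBot] (hM : IsHF l M) (p : ℕ) : LU l M p := by
  induction p with
  | zero =>
    intro w hw κ G hG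
    by_cases h : ∀ k, G k 0 = 0
    · exact LU.of_zero hM hw fun k => Eventually.of_forall fun x => by
        rw [Subsingleton.elim x 0]; exact h k
    · push Not at h
      obtain ⟨c, v, h1, h2⟩ := hM.sign_charts hw
      refine ⟨_, v, h1, h2, Or.inr ⟨0, _, fun k => ⟨(hG k).comp h1.isA h1.zero,
        Eventually.of_forall fun x => by
          beta_reduce; rw [mono_zero, one_mul]⟩, h.choose, ?_⟩⟩
      rw [Subsingleton.elim (fun i => _) (0 : Fin 0 → ℝ)]
      exact h.choose_spec
  | succ p ih =>
    intro w hw κ G hG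
    by_cases h : ∀ k, G k =ᶠ[𝓝 0] 0
    · exact LU.of_zero hM hw h
    push Not at h
    obtain ⟨k, hk⟩ := h
    obtain ⟨d, hd, hdG⟩ := exists_line_ne (hG k).analyticAt hk (Nat.succ_ne_zero p)
    obtain ⟨i0, hi0⟩ := Function.ne_iff.1 hd
    rw [Pi.zero_apply] at hi0
    let τ : Fin (p + 1) → (Fin (p + 1) → ℝ) → ℝ := fun i x =>
      (i0.insertNth 0 (Fin.tail x) : Fin (p + 1) → ℝ) i + d i * x 0
    have ht : Inf l M fun a => w i0 a / d i0 :=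
      ⟨hM.div (hw i0).1 (hM.const _), by simpa using (hw i0).2.div_const (d i0)⟩
    have hu : ∀ j, Inf l M fun a => w (i0.succAbove j) a - d (i0.succAbove j) * (w i0 a / d i0) := fun j =>
      ⟨hM.sub (hw _).1 (hM.mul (hM.const _) ht.1), by simpa using (hw _).2.sub (ht.2.const_mul _)⟩
    have hτ : Chg l M w τ (Fin.cons (fun a => w i0 a / d i0)
        fun j a => w (i0.succAbove j) a - d (i0.succAbove j) * (w i0 a / d i0)) :=
      { isA := fun i => by
          refine IsA.add ?_ ((IsA.const _).mul (IsA.proj 0))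
          refine Fin.succAboveCases i0 ?_ (fun j => ?_) i
          · simpa using IsA.const 0
          · simpa [Fin.tail] using IsA.proj j.succ
        zero := fun i => by
          refine Fin.succAboveCases i0 ?_ (fun j => ?_) i <;> simp [τ, Fin.tail]
        inf := fun j => Fin.cases ht hu j
        eq := fun i => by
          refine Fin.succAboveCases i0 ?_ (fun j => ?_) i
          · refine Eventually.of_forall fun a => ?_
            simp only [τ, Fin.insertNth_apply_same, Fin.cons_zero]
            field_simp; simp
          · refine Eventually.of_forall fun a => ?_
            simp only [τ, Fin.insertNth_apply_succAbove, Fin.cons_zero, Fin.tail, Fin.cons_succ]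
            ring }
    have hGτ := fun k => (hG k).comp hτ.isA hτ.zero
    have hline : (fun t => (fun x => G k fun i => τ i x) (Fin.cons t 0)) = fun t => G k (t • d) := by
      funext t
      refine congrArg (G k) (funext fun i => ?_)
      refine Fin.succAboveCases i0 ?_ (fun j => ?_) i <;> simp [τ, mul_comm]
    obtain ⟨s, hs⟩ := exists_iteratedDeriv_ne ((hG k).analyticAt.comp_of_eq
      (f := fun t : ℝ => t • d) (x := 0) (by fun_prop) (by simp)) hdG
    obtain ⟨σ, v, h1, h2, -, h4⟩ := Good.of_chg (E := fun _ => 1) hτ (regGood hM ih s _ _ ht hu (fun _ => 1) (IsA.const 1)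
      (Eventually.of_forall fun _ => one_ne_zero) _ hGτ ⟨k, by
        rw [cf, hline]
        exact div_ne_zero hs (by exact_mod_cast s.factorial_ne_zero)⟩)
    exact ⟨σ, v, h1, h2, h4⟩

/-- Germs obtained by applying an `IsA` function to elements of `S`. -/
def Rep (l : Filter α) (S : Set (α → ℝ)) (f : α → ℝ) : Prop :=
  ∃ (n : ℕ) (Φ : (Fin n → ℝ) → ℝ) (e : Fin n → α → ℝ), IsA Φ ∧ (∀ i, e i ∈ S) ∧ f =ᶠ[l] fun a => Φ fun i => e i a

section Rep

variable {S : Set (α → ℝ)}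

theorem Rep.congr {f g : α → ℝ} (h : Rep l S f) (e : f =ᶠ[l] g) : Rep l S g := by
  obtain ⟨n, Φ, u, h1, h2, h3⟩ := h
  exact ⟨n, Φ, u, h1, h2, e.symm.trans h3⟩

theorem Rep.of_mem {f : α → ℝ} (h : f ∈ S) : Rep l S f :=
  ⟨1, fun x => x 0, fun _ => f, IsA.proj 0, fun _ => h, EventuallyEq.rfl⟩

theorem Rep.const (c : ℝ) : Rep l S fun _ => c :=
  ⟨0, fun _ => c, fun i => i.elim0, IsA.const c, fun i => i.elim0, EventuallyEq.rfl⟩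

variable (hS : ∀ e ∈ S, Tendsto e l (𝓝 0))
include hS

/-- Simultaneous representation by centred functions of a common tuple. -/
theorem Rep.common [l.NeBot] {m : ℕ} {f : Fin m → α → ℝ} (h : ∀ i, Rep l S (f i)) :
    ∃ (n : ℕ) (Φ : Fin m → (Fin n → ℝ) → ℝ) (e : Fin n → α → ℝ), (∀ i, IsA (Φ i)) ∧ (∀ i, e i ∈ S) ∧
      (∀ i, f i =ᶠ[l] fun a => Φ i fun j => e j a) ∧ ∀ i r, Tendsto (f i) l (𝓝 r) → Φ i 0 = r := by
  choose n Φ e h1 h2 h3 using h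
  let ψ : (i : Fin m) → Fin (n i) → Fin (∑ i, n i) := fun i k => finSigmaFinEquiv ⟨i, k⟩
  have h4 : ∀ i, f i =ᶠ[l] fun a => Φ i fun j => e (finSigmaFinEquiv.symm (ψ i j)).1
      (finSigmaFinEquiv.symm (ψ i j)).2 a := fun i => by
    have : ∀ j, e (finSigmaFinEquiv.symm (ψ i j)).1 (finSigmaFinEquiv.symm (ψ i j)).2 = e i j := fun j =>
      congrArg (fun s : Σ i, Fin (n i) => e s.1 s.2) (finSigmaFinEquiv.symm_apply_apply ⟨i, j⟩)
    simpa only [this] using h3 i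
  refine ⟨_, fun i x => Φ i fun j => x (ψ i j), fun k => e (finSigmaFinEquiv.symm k).1 (finSigmaFinEquiv.symm k).2,
    fun i => (h1 i).comp (h := fun j x => x (ψ i j)) (fun j => IsA.proj _) fun j => rfl, fun k => h2 _ _, h4, ?_⟩
  intro i r hr
  refine tendsto_nhds_unique (((h1 i).continuousAt.tendsto.comp (tendsto_pi_zero fun k => hS _ (h2 i k))).congr'
    (h3 i).symm) hr

theorem Rep.comp [l.NeBot] {m : ℕ} {Ψ : (Fin m → ℝ) → ℝ} (hΨ : IsA Ψ) {f : Fin m → α → ℝ} (h : ∀ i, Rep l S (f i))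
    (h0 : ∀ i, Tendsto (f i) l (𝓝 0)) : Rep l S fun a => Ψ fun i => f i a := by
  obtain ⟨n, Φ, e, h1, h2, h3, h4⟩ := Rep.common hS h
  refine ⟨n, _, e, hΨ.comp h1 fun i => h4 i 0 (h0 i), h2, ?_⟩
  filter_upwards [eventually_all.2 h3] with a ha
  exact congrArg Ψ (funext ha)

theorem Rep.add [l.NeBot] {f g : α → ℝ} (hf : Rep l S f) (hg : Rep l S g) : Rep l S fun a => f a + g a := by
  obtain ⟨n, Φ, e, h1, h2, h3, h4⟩ := Rep.common hS (f := ![f, g]) (by simp [Fin.forall_fin_two, hf, hg])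
  refine ⟨n, _, e, (h1 0).add (h1 1), h2, ?_⟩
  filter_upwards [h3 0, h3 1] with a e1 e2
  rw [← e1, ← e2]; rfl

theorem Rep.mul [l.NeBot] {f g : α → ℝ} (hf : Rep l S f) (hg : Rep l S g) : Rep l S fun a => f a * g a := by
  obtain ⟨n, Φ, e, h1, h2, h3, h4⟩ := Rep.common hS (f := ![f, g]) (by simp [Fin.forall_fin_two, hf, hg])
  refine ⟨n, _, e, (h1 0).mul (h1 1), h2, ?_⟩
  filter_upwards [h3 0, h3 1] with a e1 e2
  rw [← e1, ← e2]; rfl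

/-- Composition with a univariate `IsA` function at a real limit. -/
theorem Rep.comp_at [l.NeBot] {f : α → ℝ} (hf : Rep l S f) {r : ℝ} (hr : Tendsto f l (𝓝 r)) {φ : ℝ → ℝ}
    (hφ : ∀ {n : ℕ} {Φ : (Fin n → ℝ) → ℝ}, IsA Φ → Φ 0 = r → IsA fun x => φ (Φ x)) : Rep l S fun a => φ (f a) := by
  obtain ⟨n, Φ, e, h1, h2, h3⟩ := hf
  refine ⟨n, _, e, hφ h1 (tendsto_nhds_unique ((h1.continuousAt.tendsto.comp
    (tendsto_pi_zero fun k => hS _ (h2 k))).congr' h3.symm) hr), h2, ?_⟩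
  filter_upwards [h3] with a e1
  rw [e1]

end Rep

/-- Generalized monomials `N` and infinitesimals `S` which generate an extension of `M`. -/
structure IsMon (l : Filter α) (M N S : Set (α → ℝ)) : Prop where
  mul : ∀ {f g : α → ℝ}, f ∈ N → g ∈ N → (fun a => f a * g a) ∈ N
  inv : ∀ {f : α → ℝ}, f ∈ N → (fun a => (f a)⁻¹) ∈ N
  of_mem : ∀ {f : α → ℝ}, f ∈ M → (∀ᶠ a in l, f a ≠ 0) → f ∈ N
  sign : ∀ {f : α → ℝ}, f ∈ N → (∀ᶠ a in l, 0 < f a) ∨ ∀ᶠ a in l, f a < 0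
  root : ∀ {f : α → ℝ}, f ∈ N → (∀ᶠ a in l, 0 < f a) → ∀ {n : ℕ}, n ≠ 0 → (fun a => f a ^ ((n : ℝ)⁻¹)) ∈ N
  limit : ∀ {f : α → ℝ}, f ∈ N → (∃ r, Tendsto f l (𝓝 r)) ∨ Tendsto (fun a => (f a)⁻¹) l (𝓝 0)
  tendsto : ∀ e ∈ S, Tendsto e l (𝓝 0)
  fin : ∀ {f : α → ℝ}, f ∈ N → ∀ {r : ℝ}, Tendsto f l (𝓝 r) → Rep l S f
  norm : ∀ {f : α → ℝ}, Rep l S f → f =ᶠ[l] 0 ∨ ∃ c ∈ N, ∃ g r, Rep l S g ∧ Tendsto g l (𝓝 r) ∧ r ≠ 0 ∧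
    f =ᶠ[l] fun a => c a * g a

/-- The extension generated by `N` and `S`. -/
def Ext (l : Filter α) (N S : Set (α → ℝ)) : Set (α → ℝ) :=
  {f | f =ᶠ[l] 0 ∨ ∃ c ∈ N, ∃ g r, Rep l S g ∧ Tendsto g l (𝓝 r) ∧ r ≠ 0 ∧ f =ᶠ[l] fun a => c a * g a}

section Ext

variable {N S : Set (α → ℝ)}

theorem Ext.congr {f g : α → ℝ} (hf : f ∈ Ext l N S) (e : f =ᶠ[l] g) : g ∈ Ext l N S := by
  rcases hf with h | ⟨c, hc, u, r, h1, h2, h3, h4⟩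
  · exact Or.inl (e.symm.trans h)
  · exact Or.inr ⟨c, hc, u, r, h1, h2, h3, e.symm.trans h4⟩

theorem Ext.of_mon {f : α → ℝ} (hf : f ∈ N) : f ∈ Ext l N S :=
  Or.inr ⟨f, hf, fun _ => 1, 1, Rep.const 1, tendsto_const_nhds, one_ne_zero, by simp⟩

theorem sign_lim {g : α → ℝ} {r : ℝ} (h2 : Tendsto g l (𝓝 r)) (h3 : r ≠ 0) :
    (0 < r ∧ ∀ᶠ a in l, 0 < g a) ∨ (r < 0 ∧ ∀ᶠ a in l, g a < 0) := by
  rcases h3.lt_or_gt with h | h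
  · exact Or.inr ⟨h, h2.eventually_lt_const h⟩
  · exact Or.inl ⟨h, h2.eventually_const_lt h⟩

variable (hN : IsMon l M N S)
include hN

theorem IsMon.of_rep {f : α → ℝ} (hf : Rep l S f) : f ∈ Ext l N S := hN.norm hf

theorem IsMon.ext_of_mem (hM : IsHF l M) {f : α → ℝ} (hf : f ∈ M) : f ∈ Ext l N S := by
  rcases hM.tri hf with h | h | h
  · exact Or.inl h
  · exact Ext.of_mon (hN.of_mem hf (h.mono fun a ha => ha.ne'))
  · exact Ext.of_mon (hN.of_mem hf (h.mono fun a ha => ha.ne))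

theorem IsMon.ext_mul [l.NeBot] {f g : α → ℝ} (hf : f ∈ Ext l N S) (hg : g ∈ Ext l N S) :
    (fun a => f a * g a) ∈ Ext l N S := by
  rcases hf with h | ⟨c, hc, u, r, h1, h2, h3, h4⟩
  · exact Or.inl (by filter_upwards [h] with a e; simp [e])
  rcases hg with h | ⟨c', hc', u', r', h1', h2', h3', h4'⟩
  · exact Or.inl (by filter_upwards [h] with a e; simp [e])
  refine Or.inr ⟨_, hN.mul hc hc', _, _, h1.mul hN.tendsto h1', h2.mul h2', mul_ne_zero h3 h3', ?_⟩
  filter_upwards [h4, h4'] with a e e'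
  rw [e, e']; ring

theorem IsMon.ext_add_aux [l.NeBot] {c c' u u' : α → ℝ} (hc : c ∈ N) (hc' : c' ∈ N) (hu : Rep l S u) (hu' : Rep l S u')
    {r : ℝ} (hr : Tendsto (fun a => c a * (c' a)⁻¹) l (𝓝 r)) :
    (fun a => c a * u a + c' a * u' a) ∈ Ext l N S := by
  have := ((hN.fin (hN.mul hc (hN.inv hc')) hr).mul hN.tendsto hu).add hN.tendsto hu'
  refine Ext.congr (hN.ext_mul (Ext.of_mon hc') (hN.of_rep this)) ?_
  have h0 : ∀ᶠ a in l, c' a ≠ 0 := (hN.sign hc').elim (fun h => h.mono fun a ha => ha.ne')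
    fun h => h.mono fun a ha => ha.ne
  filter_upwards [h0] with a e
  field_simp

theorem IsMon.ext_add [l.NeBot] {f g : α → ℝ} (hf : f ∈ Ext l N S) (hg : g ∈ Ext l N S) :
    (fun a => f a + g a) ∈ Ext l N S := by
  rcases hf with h | ⟨c, hc, u, r, h1, h2, h3, h4⟩
  · exact Ext.congr hg (by filter_upwards [h] with a e; simp [e])
  rcases hg with h | ⟨c', hc', u', r', h1', h2', h3', h4'⟩
  · exact Ext.congr (Or.inr ⟨c, hc, u, r, h1, h2, h3, h4⟩) (by filter_upwards [h] with a e; simp [e])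
  rcases hN.limit (hN.mul hc (hN.inv hc')) with ⟨s, hs⟩ | hs
  · refine Ext.congr (hN.ext_add_aux hc hc' h1 h1' hs) ?_
    filter_upwards [h4, h4'] with a e e'
    rw [e, e']
  · refine Ext.congr (hN.ext_add_aux hc' hc h1' h1 (r := 0) (hs.congr fun a => by simp)) ?_
    filter_upwards [h4, h4'] with a e e'
    rw [e, e', add_comm]

theorem IsMon.rep_of_tendsto [l.NeBot] {f : α → ℝ} (hf : f ∈ Ext l N S) {s : ℝ} (hs : Tendsto f l (𝓝 s)) : Rep l S f := by
  rcases hf with h | ⟨c, hc, u, r, h1, h2, h3, h4⟩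
  · exact (Rep.const 0).congr h.symm
  · have hc0 : Tendsto c l (𝓝 (s / r)) := by
      refine (hs.div h2 h3).congr' ?_
      filter_upwards [h4, h2.eventually_ne h3] with a e e'
      simp only [Pi.div_apply, e]; field_simp
    exact ((hN.fin hc hc0).mul hN.tendsto h1).congr h4.symm

/-- A positive element is a positive monomial times a positive unit. -/
theorem IsMon.pos_form [l.NeBot] (hM : IsHF l M) {f : α → ℝ} (hf : f ∈ Ext l N S) (hp : ∀ᶠ a in l, 0 < f a) :
    ∃ c ∈ N, ∃ g r, (∀ᶠ a in l, 0 < c a) ∧ Rep l S g ∧ Tendsto g l (𝓝 r) ∧ 0 < r ∧ f =ᶠ[l] fun a => c a * g a := by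
  rcases hf with h | ⟨c, hc, u, r, h1, h2, h3, h4⟩
  · obtain ⟨a, e1, e2⟩ := (h.and hp).exists
    rw [e1] at e2
    exact absurd e2 (lt_irrefl _)
  rcases sign_lim h2 h3 with ⟨h, hu⟩ | ⟨h, hu⟩
  · refine ⟨c, hc, u, r, ?_, h1, h2, h, h4⟩
    filter_upwards [hp, h4, hu] with a e1 e2 e3
    rw [e2] at e1
    exact pos_of_mul_pos_left e1 e3.le
  · refine ⟨_, hN.mul (hN.of_mem (hM.const (-1)) (Eventually.of_forall fun _ => by norm_num)) hc, fun a => -1 * u a, -r, ?_,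
      (Rep.const (-1)).mul hN.tendsto h1, by simpa using h2.neg, by linarith, ?_⟩
    · filter_upwards [hp, h4, hu] with a e1 e2 e3
      rw [e2] at e1
      nlinarith
    · filter_upwards [h4] with a e
      rw [e]; ring

theorem IsMon.isHF [l.NeBot] (hM : IsHF l M) : IsHF l (Ext l N S) where
  congr := Ext.congr
  const c := hN.of_rep (Rep.const c)
  add := hN.ext_add
  mul := hN.ext_mul
  inv := by
    rintro f (h | ⟨c, hc, u, r, h1, h2, h3, h4⟩)
    · exact Or.inl (by filter_upwards [h] with a e; simp [e])
    · refine Or.inr ⟨_, hN.inv hc, fun a => (u a)⁻¹, r⁻¹, Rep.comp_at hN.tendsto h1 h2 (φ := fun x => x⁻¹) fun hΦ h0 => ?_,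
        h2.inv₀ h3, inv_ne_zero h3, ?_⟩
      · exact hΦ.inv (by rwa [h0])
      · filter_upwards [h4] with a e
        rw [e, mul_inv]
  tri := by
    rintro f (h | ⟨c, hc, u, r, h1, h2, h3, h4⟩)
    · exact Or.inl h
    · right
      rcases sign_lim h2 h3 with ⟨-, h⟩ | ⟨-, h⟩ <;> rcases hN.sign hc with h' | h'
      · left; filter_upwards [h, h', h4] with a e1 e2 e3
        rw [e3]; exact mul_pos e2 e1
      · right; filter_upwards [h, h', h4] with a e1 e2 e3
        rw [e3]; exact mul_neg_of_neg_of_pos e2 e1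
      · right; filter_upwards [h, h', h4] with a e1 e2 e3
        rw [e3]; exact mul_neg_of_pos_of_neg e2 e1
      · left; filter_upwards [h, h', h4] with a e1 e2 e3
        rw [e3]; exact mul_pos_of_neg_of_neg e2 e1
  anal := fun hφ t ht h0 => hN.of_rep (Rep.comp hN.tendsto hφ (fun i => hN.rep_of_tendsto (ht i) (h0 i)) h0)
  root := by
    intro f hf hp n hn
    obtain ⟨c, hc, u, r, h0, h1, h2, h3, h4⟩ := hN.pos_form hM hf hp
    refine Ext.congr (hN.ext_mul (Ext.of_mon (hN.root hc h0 hn)) (hN.of_rep (Rep.comp_at hN.tendsto h1 h2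
      (φ := fun x => x ^ ((n : ℝ)⁻¹)) fun hΦ e => hΦ.rpow (by rw [e]; exact h3) _))) ?_
    filter_upwards [h4, h0, h2.eventually_const_lt h3] with a e1 e2 e3
    rw [e1, Real.mul_rpow e2.le e3.le]
  small := by
    obtain ⟨δ, h1, h2⟩ := hM.small
    exact ⟨δ, hN.ext_of_mem hM h1, h2⟩

end Ext

theorem cons_mem_ball {q : ℕ} {ρ t : ℝ} {w : Fin q → ℝ} (hρ : 0 < ρ) :
    (Fin.cons t w : Fin (q + 1) → ℝ) ∈ Metric.ball 0 ρ ↔ |t| < ρ ∧ w ∈ Metric.ball 0 ρ := by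
  simp only [mem_ball_zero_iff, pi_norm_lt_iff hρ, Fin.forall_fin_succ, Fin.cons_zero, Fin.cons_succ,
    Real.norm_eq_abs]

theorem germ_zero_of_cf {q : ℕ} {G : (Fin (q + 1) → ℝ) → ℝ} (hG : IsA G) (h : ∀ j, RM.cf j G =ᶠ[𝓝 0] 0) :
    G =ᶠ[𝓝 0] 0 := by
  have hG' := hG
  obtain ⟨ρ, hρ, hA⟩ := hG
  have h1 : ∀ j, ∀ w ∈ Metric.ball (0 : Fin q → ℝ) ρ, RM.pdl (List.replicate j 0) G (Fin.cons 0 w) = 0 := by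
    intro j w hw
    have ha : AnalyticOnNhd ℝ (fun w : Fin q → ℝ => RM.pdl (List.replicate j 0) G (Fin.cons 0 w))
        (Metric.ball 0 ρ) := by
      intro w hw
      refine AnalyticAt.comp (g := RM.pdl (List.replicate j 0) G) (f := fun w : Fin q → ℝ => Fin.cons 0 w)
        (analytic_pdl hA.analytic _ _ ((cons_mem_ball hρ).2 ⟨by simpa using hρ, hw⟩)) ?_
      simp only [cons_eq_fun]
      refine AnalyticAt.pi fun j => ?_
      refine Fin.cases analyticAt_const (fun k => ?_) j
      exact (ContinuousLinearMap.proj (R := ℝ) (φ := fun _ : Fin q => ℝ) k).analyticAt w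
    refine ha.eqOn_zero_of_preconnected_of_eventuallyEq_zero (convex_ball _ _).isPreconnected
      (Metric.mem_ball_self hρ) ?_ hw
    filter_upwards [cf_eq hG' j, h j] with w e1 e2
    rw [e1, Pi.zero_apply, div_eq_zero_iff] at e2
    exact e2.resolve_right (by exact_mod_cast j.factorial_ne_zero)
  filter_upwards [Metric.ball_mem_nhds (0 : Fin (q + 1) → ℝ) hρ] with x hx
  rw [← Fin.cons_self_tail x, cons_mem_ball hρ] at hx
  have h2 : AnalyticOnNhd ℝ (fun t => G (Fin.cons t (Fin.tail x))) (Metric.ball 0 ρ) := fun t ht =>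
    analyticAt_line (hA.analytic _ ((cons_mem_ball hρ).2 ⟨by simpa using ht, hx.2⟩))
  have h3 := h2.eqOn_zero_of_preconnected_of_eventuallyEq_zero (convex_ball _ _).isPreconnected
    (Metric.mem_ball_self hρ) (by
      by_contra hc
      obtain ⟨s, hs⟩ := exists_iteratedDeriv_ne (h2 0 (Metric.mem_ball_self hρ)) hc
      rw [iteratedDeriv_line Metric.isOpen_ball hA.analytic ((cons_mem_ball hρ).2 ⟨by simpa using hρ, hx.2⟩),
        h1 s _ hx.2] at hs
      exact hs rfl) (show x 0 ∈ Metric.ball 0 ρ by simpa using hx.1)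
  simpa using h3

theorem cf_tail_mul {q : ℕ} (u : (Fin q → ℝ) → ℝ) (G : (Fin (q + 1) → ℝ) → ℝ) (j : ℕ) (w : Fin q → ℝ) :
    RM.cf j (fun x => u (Fin.tail x) * G x) w = u w * RM.cf j G w := by
  simp only [RM.cf, Fin.tail_cons]
  rw [iteratedDeriv_const_mul_field, mul_div_assoc]

theorem cf_comp_tail {q p : ℕ} (σ : (Fin p → ℝ) → Fin q → ℝ) (G : (Fin (q + 1) → ℝ) → ℝ) (j : ℕ) (w : Fin p → ℝ) :
    RM.cf j (fun x : Fin (p + 1) → ℝ => G (Fin.cons (x 0) (σ (Fin.tail x)))) w = RM.cf j G (σ w) := by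
  simp [RM.cf, Fin.tail_cons]

theorem div_mono {q : ℕ} (β : Fin q → ℕ) : ∀ {G : (Fin (q + 1) → ℝ) → ℝ}, IsA G →
    (∀ j, ∃ B, IsA B ∧ RM.cf j G =ᶠ[𝓝 0] fun w => RM.mono β w * B w) →
    ∃ H, IsA H ∧ G =ᶠ[𝓝 0] fun x => RM.mono β (Fin.tail x) * H x := by
  refine exp_induction (P := fun β => ∀ {G : (Fin (q + 1) → ℝ) → ℝ}, IsA G →
    (∀ j, ∃ B, IsA B ∧ RM.cf j G =ᶠ[𝓝 0] fun w => RM.mono β w * B w) →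
    ∃ H, IsA H ∧ G =ᶠ[𝓝 0] fun x => RM.mono β (Fin.tail x) * H x) ?_ ?_ β
  · intro G hG _
    exact ⟨G, hG, by simp [RM.mono]⟩
  · intro β i ih G hG h
    have hu : ∀ x : Fin (q + 1) → ℝ, Function.update x i.succ 0 = Fin.cons (x 0) (Function.update (Fin.tail x) i 0) := by
      intro x
      rw [Fin.cons_update, Fin.cons_self_tail]
    obtain ⟨K, hK, e⟩ := hG.div i.succ (by
      refine germ_zero_of_cf (hG.update i.succ) fun j => ?_
      obtain ⟨B, hB, e⟩ := h j
      simp only [hu]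
      filter_upwards [(tendsto_update_zero i).eventually e] with w hw
      rw [cf_comp_tail (fun w => Function.update w i 0), hw, mono_add, mono_single]
      simp)
    obtain ⟨H, hH, e2⟩ := ih hK fun j => by
      obtain ⟨B, hB, e1⟩ := h j
      refine ⟨B, hB, germ_cancel (IsA.proj i).analyticAt (hK.cf j).analyticAt ((IsA.mono β).mul hB).analyticAt
        (proj_ne_zero i) ?_⟩
      filter_upwards [e1, RM.cf_congr e j] with w q1 q2
      have := cf_tail_mul (fun w => w i) K j w
      simp only [Fin.tail] at this
      rw [← this, ← q2, q1, mono_add, mono_single]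
      ring
    refine ⟨H, hH, ?_⟩
    filter_upwards [e, e2] with x q1 q2
    rw [q1, q2, mono_add, mono_single]
    simp only [Fin.tail]
    ring

/-- Monomialization of the content with respect to the first variable. -/
theorem IsHF.content [l.NeBot] (hM : IsHF l M) {q : ℕ} {G : (Fin (q + 1) → ℝ) → ℝ} (hG : IsA G)
    {w : Fin q → α → ℝ} (hw : ∀ j, Inf l M (w j)) :
    ∃ (σ : Fin q → (Fin q → ℝ) → ℝ) (v : Fin q → α → ℝ), Chg l M w σ v ∧ (∀ j, ∀ᶠ a in l, 0 < v j a) ∧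
      ((fun x : Fin (q + 1) → ℝ => G (Fin.cons (x 0) fun j => σ j (Fin.tail x))) =ᶠ[𝓝 0] 0 ∨
        ∃ β H s, IsA H ∧ (fun x : Fin (q + 1) → ℝ => G (Fin.cons (x 0) fun j => σ j (Fin.tail x))) =ᶠ[𝓝 0]
          (fun x => RM.mono β (Fin.tail x) * H x) ∧ RM.cf s H 0 ≠ 0) := by
  obtain ⟨σ, v, h1, h2, h3⟩ := lu hM q w hw (fun j => RM.cf j G) fun j => hG.cf j
  refine ⟨σ, v, h1, h2, ?_⟩
  have hΨ : IsA fun x : Fin (q + 1) → ℝ => G (Fin.cons (x 0) fun j => σ j (Fin.tail x)) := by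
    have := hG.comp (h := fun i x => (Fin.cons (x 0) (fun j => σ j (Fin.tail x)) : Fin (q + 1) → ℝ) i)
      (n := q + 1) (fun i => ?_) fun i => ?_
    · exact this
    · exact Fin.cases (IsA.proj 0) (fun k => IsA.tail (h1.isA k)) i
    · exact Fin.cases rfl (fun k => h1.zero k) i
  have hcf : ∀ j w, RM.cf j (fun x : Fin (q + 1) → ℝ => G (Fin.cons (x 0) fun j => σ j (Fin.tail x))) w =
      RM.cf j G fun i => σ i w := fun j w => cf_comp_tail (fun w i => σ i w) G j w
  rcases h3 with h3 | ⟨β, B, h3, s, hs⟩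
  · left
    exact germ_zero_of_cf hΨ fun j => (h3 j).mono fun w hw => (hcf j w).trans hw
  · right
    obtain ⟨H, hH, e⟩ := div_mono β hΨ fun j => ⟨B j, (h3 j).1, (h3 j).2.mono fun w hw => (hcf j w).trans hw⟩
    refine ⟨β, H, s, hH, e, ?_⟩
    have : RM.cf s H =ᶠ[𝓝 0] B s := by
      refine germ_cancel (IsA.mono β).analyticAt (hH.cf s).analyticAt (h3 s).1.analyticAt (mono_germ_ne β) ?_
      filter_upwards [RM.cf_congr e s, (h3 s).2] with w q1 q2
      rw [← cf_tail_mul, ← q1, hcf, q2]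
    rwa [this.self_of_nhds]

theorem shift_ne {s : ℕ} (hs : s ≠ 0) (c : ℕ → ℝ) (hc : c (s - 1) = 0) (u : ℝ)
    (h : (∃ j < s, c j ≠ 0) ∨ u ≠ 0) :
    ∃ k < s, iteratedDeriv k (fun W => ∑ j ∈ Finset.range s, c j * (1 + W) ^ j + (1 + W) ^ s * u) 0 ≠ 0 := by
  by_cases hu : u = 0
  swap
  · refine ⟨s - 1, by omega, ?_⟩
    rw [cf_shift_poly hs c hc]
    have := (s - 1).factorial_pos
    positivity
  obtain ⟨j0, hj0, hj⟩ := h.resolve_right (by simpa using hu)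
  open Polynomial in
  let Q : ℝ[X] := ∑ j ∈ Finset.range s, monomial j (c j)
  have hQ : Q ≠ 0 := by
    intro h0
    have : Q.coeff j0 = c j0 := by
      simp only [Q, finsetSum_coeff, coeff_monomial, Finset.sum_ite_eq', Finset.mem_range, hj0, if_true]
    rw [h0, coeff_zero] at this
    exact hj this.symm
  have hdQ : Q.degree < s := by
    refine (degree_sum_le _ _).trans_lt ((Finset.sup_lt_iff (WithBot.bot_lt_coe s)).2 fun j hj => ?_)
    exact (degree_monomial_le _ _).trans_lt (WithBot.coe_lt_coe.2 (Finset.mem_range.1 hj))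
  let P := taylor 1 Q
  have hP : P ≠ 0 := fun h0 => hQ (taylor_injective 1 (by rw [map_zero]; exact h0))
  have hdP : P.natDegree < s := by
    rw [natDegree_taylor]
    exact (natDegree_lt_iff_degree_lt hQ).2 hdQ
  have hev : (fun W => ∑ j ∈ Finset.range s, c j * (1 + W) ^ j + (1 + W) ^ s * u) =
      fun W => ∑ i ∈ Finset.range s, P.coeff i * W ^ i + W ^ s * 0 := by
    funext W
    have h1 : P.eval W = ∑ j ∈ Finset.range s, c j * (1 + W) ^ j := by
      simp only [P, taylor_eval, Q, eval_finsetSum, eval_monomial, add_comm W 1]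
    rw [hu, ← h1, eval_eq_sum_range' hdP]; ring
  have hk : P.leadingCoeff ≠ 0 := leadingCoeff_ne_zero.2 hP
  refine ⟨P.natDegree, hdP, ?_⟩
  rw [hev, iteratedDeriv_taylor (u := fun _ => 0) _ analyticAt_const hdP]
  exact mul_ne_zero (by exact_mod_cast Nat.factorial_ne_zero _) hk

/-- Monomial times unit. -/
def Norm (l : Filter α) (N S : Set (α → ℝ)) (f : α → ℝ) : Prop :=
  ∃ c ∈ N, ∃ g r, Rep l S g ∧ Tendsto g l (𝓝 r) ∧ r ≠ 0 ∧ f =ᶠ[l] fun a => c a * g a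

/-- Nonzero elements. -/
def NZ (l : Filter α) (M : Set (α → ℝ)) : Set (α → ℝ) := {f | f ∈ M ∧ ∀ᶠ a in l, f a ≠ 0}

/-- Infinitesimals which are affine in `y`. -/
def AffInf (l : Filter α) (M : Set (α → ℝ)) (y : α → ℝ) : Set (α → ℝ) :=
  {e | Tendsto e l (𝓝 0) ∧ ∃ p ∈ M, ∃ q ∈ M, e = fun x => p x + q x * y x}

theorem Norm.mul_left {N S : Set (α → ℝ)} (hN : ∀ {f g : α → ℝ}, f ∈ N → g ∈ N → (fun a => f a * g a) ∈ N)
    {b f : α → ℝ} (hb : b ∈ N) (hf : Norm l N S f) : Norm l N S fun x => b x * f x := by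
  obtain ⟨c, hc, g, r, h1, h2, h3, h4⟩ := hf
  refine ⟨_, hN hb hc, g, r, h1, h2, h3, ?_⟩
  filter_upwards [h4] with a e
  rw [e]; ring

theorem Norm.congr {N S : Set (α → ℝ)} {f g : α → ℝ} (hf : Norm l N S f) (e : g =ᶠ[l] f) : Norm l N S g := by
  obtain ⟨c, hc, g, r, h1, h2, h3, h4⟩ := hf
  exact ⟨c, hc, g, r, h1, h2, h3, e.trans h4⟩

section ExtII

variable (hM : IsHF l M) {y : α → ℝ}
  (hy : ∀ a ∈ M, ∃ b ∈ M, (∀ᶠ x in l, b x ≠ 0) ∧ Tendsto (fun x => (y x - a x) / b x) l (𝓝 1))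
include hM

theorem NZ.mul {f g : α → ℝ} (hf : f ∈ NZ l M) (hg : g ∈ NZ l M) : (fun a => f a * g a) ∈ NZ l M :=
  ⟨hM.mul hf.1 hg.1, by filter_upwards [hf.2, hg.2] with a h1 h2 using mul_ne_zero h1 h2⟩

theorem NZ.mono {q : ℕ} (β : Fin q → ℕ) {v : Fin q → α → ℝ} (hv : ∀ j, Inf l M (v j))
    (hp : ∀ j, ∀ᶠ a in l, 0 < v j a) : (fun a => RM.mono β fun j => v j a) ∈ NZ l M :=
  ⟨hM.anal (IsA.mono β) (fun j => (hv j).1) fun j => (hv j).2, by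
    filter_upwards [eventually_all.2 hp] with a ha using (mono_pos β ha).ne'⟩

theorem AffInf.of_inf {f : α → ℝ} (hf : Inf l M f) : f ∈ AffInf l M y :=
  ⟨hf.2, f, hf.1, _, hM.const 0, by simp⟩

theorem AffInf.centre {a η : α → ℝ} (ha : a ∈ M) (hη : η ∈ M)
    (h : Tendsto (fun x => (y x - a x) / η x) l (𝓝 1)) :
    (fun x => (y x - a x) / η x - 1) ∈ AffInf l M y :=
  ⟨by simpa using h.sub_const 1, _, hM.sub (hM.neg (hM.div ha hη)) (hM.const 1), _, hM.inv hη, by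
    funext x; ring⟩

include hy

theorem AffInf.refine {k : ℕ} {p q : Fin k → α → ℝ} (hp : ∀ i, p i ∈ M) (hq : ∀ i, q i ∈ M)
    (h : ∀ i, Tendsto (fun x => p i x + q i x * y x) l (𝓝 0)) :
    ∃ a ∈ M, ∃ η ∈ M, (∀ᶠ x in l, η x ≠ 0) ∧ Tendsto (fun x => (y x - a x) / η x) l (𝓝 1) ∧
      ∀ i, Tendsto (fun x => q i x * η x) l (𝓝 0) := by
  induction k with
  | zero =>
    obtain ⟨b, h1, h2, h3⟩ := hy _ (hM.const 0)
    exact ⟨_, hM.const 0, b, h1, h2, h3, fun i => i.elim0⟩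
  | succ k ih =>
    obtain ⟨a, ha, η, hη, h1, h2, h3⟩ := ih (fun i => hp i.succ) (fun i => hq i.succ) fun i => h i.succ
    have : ∃ a' ∈ M, ∃ η' ∈ M, (∀ᶠ x in l, η' x ≠ 0) ∧ Tendsto (fun x => (y x - a' x) / η' x) l (𝓝 1) ∧
        Tendsto (fun x => q 0 x * η' x) l (𝓝 0) := by
      have hnz : (∀ᶠ x in l, q 0 x ≠ 0) → ∃ a' ∈ M, ∃ η' ∈ M, (∀ᶠ x in l, η' x ≠ 0) ∧
          Tendsto (fun x => (y x - a' x) / η' x) l (𝓝 1) ∧ Tendsto (fun x => q 0 x * η' x) l (𝓝 0) := fun hz => by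
        obtain ⟨b, g1, g2, g3⟩ := hy _ (hM.neg (hM.div (hp 0) (hq 0)))
        refine ⟨_, hM.neg (hM.div (hp 0) (hq 0)), b, g1, g2, g3, ?_⟩
        have := (h 0).div g3 one_ne_zero
        rw [zero_div] at this
        refine this.congr' ?_
        filter_upwards [hz, g2, g3.eventually_ne one_ne_zero] with x e1 e2 e3
        have e4 : y x - -(p 0 x / q 0 x) ≠ 0 := fun e => e3 (by rw [e, zero_div])
        have e5 : p 0 x + q 0 x * y x = q 0 x * (y x - -(p 0 x / q 0 x)) := by field_simp; ring
        simp only [Pi.div_apply]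
        rw [e5, div_div_eq_mul_div, mul_assoc, mul_comm (y x - _), ← mul_assoc, mul_div_cancel_right₀ _ e4]
      rcases hM.tri (hq 0) with h0 | h0 | h0
      · refine ⟨a, ha, η, hη, h1, h2, tendsto_const_nhds.congr' ?_⟩
        filter_upwards [h0] with x hx
        simp [hx]
      · exact hnz (h0.mono fun x hx => hx.ne')
      · exact hnz (h0.mono fun x hx => hx.ne)
    obtain ⟨a', ha', η', hη', g1, g2, g3⟩ := this
    have key : ∀ {q η η' : α → ℝ}, (∀ᶠ x in l, |η x| ≤ |η' x|) → Tendsto (fun x => q x * η' x) l (𝓝 0) →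
        Tendsto (fun x => q x * η x) l (𝓝 0) := fun {q η η'} e t => by
      refine squeeze_zero_norm' ?_ (a := fun x => |q x| * |η' x|) (by simpa [abs_mul] using t.abs)
      filter_upwards [e] with x hx
      rw [Real.norm_eq_abs, abs_mul]
      exact mul_le_mul_of_nonneg_left hx (abs_nonneg _)
    have hsq := hM.sub (hM.pow hη 2) (hM.pow hη' 2)
    have hcmp : (∀ᶠ x in l, |η x| ≤ |η' x|) ∨ ∀ᶠ x in l, |η' x| ≤ |η x| := by
      rcases hM.tri hsq with e | e | e
      · left; filter_upwards [e] with x hx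
        exact sq_le_sq.1 (by simp only [Pi.zero_apply] at hx; linarith)
      · right; filter_upwards [e] with x hx
        exact sq_le_sq.1 (by linarith)
      · left; filter_upwards [e] with x hx
        exact sq_le_sq.1 (by linarith)
    rcases hcmp with e | e
    · exact ⟨a, ha, η, hη, h1, h2, Fin.cases (key e g3) h3⟩
    · exact ⟨a', ha', η', hη', g1, g2, Fin.cases g3 fun i => key e (h3 i)⟩

omit hy in
theorem rep_centre {a η : α → ℝ} (ha : a ∈ M) (hη : η ∈ M)
    (h : Tendsto (fun x => (y x - a x) / η x) l (𝓝 1)) {q : ℕ} {v : Fin q → α → ℝ} (hv : ∀ j, Inf l M (v j))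
    {H : (Fin (q + 1) → ℝ) → ℝ} (hH : IsA H) :
    Rep l (AffInf l M y) (fun x => H (Fin.cons ((y x - a x) / η x - 1) fun j => v j x)) ∧
    Tendsto (fun x => H (Fin.cons ((y x - a x) / η x - 1) fun j => v j x)) l (𝓝 (H 0)) := by
  let e : Fin (q + 1) → α → ℝ := Fin.cons (fun x => (y x - a x) / η x - 1) v
  have he : ∀ i, e i ∈ AffInf l M y := Fin.cases (AffInf.centre hM ha hη h) fun k => AffInf.of_inf hM (hv k)
  have hx : ∀ x, (Fin.cons ((y x - a x) / η x - 1) fun j => v j x : Fin (q + 1) → ℝ) = fun i => e i x := by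
    intro x; funext i; exact Fin.cases rfl (fun k => rfl) i
  simp only [hx]
  exact ⟨⟨_, H, e, hH, he, EventuallyEq.rfl⟩, hH.continuousAt.tendsto.comp (tendsto_pi_zero fun i => (he i).1)⟩

theorem AffInf.norm_reg [l.NeBot] (s : ℕ) : ∀ {q : ℕ} {H : (Fin (q + 1) → ℝ) → ℝ}, IsA H → RM.cf s H 0 ≠ 0 →
    ∀ {v : Fin q → α → ℝ}, (∀ j, Inf l M (v j)) →
    ∀ {a η : α → ℝ}, a ∈ M → η ∈ M → (∀ᶠ x in l, η x ≠ 0) →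
    Tendsto (fun x => (y x - a x) / η x) l (𝓝 1) →
    Norm l (NZ l M) (AffInf l M y) fun x => H (Fin.cons ((y x - a x) / η x - 1) fun j => v j x) := by
  induction s using Nat.strong_induction_on with
  | _ s ih =>
  intro q H hH hs v hv a η ha hη hη0 hlim
  rcases Nat.eq_zero_or_pos s with rfl | hs0
  · obtain ⟨h1, h2⟩ := rep_centre hM ha hη hlim hv hH
    rw [cf_zero, cons_zero_zero] at hs
    exact ⟨_, ⟨hM.const 1, Eventually.of_forall fun _ => one_ne_zero⟩, _, H 0, h1, h2, hs, by simp⟩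
  by_cases hz : RM.cf (s - 1) H 0 = 0
  swap
  · exact ih (s - 1) (by omega) hH hz hv ha hη hη0 hlim
  obtain ⟨θ, hθ, hθ0, hθc⟩ := hH.tschirnhaus hs0.ne' hz hs
  let H1 : (Fin (q + 1) → ℝ) → ℝ := fun x => H (Fin.cons (x 0 + θ (Fin.tail x)) (Fin.tail x))
  have hH1 : IsA H1 := by
    refine hH.comp (h := fun i x => (Fin.cons (x 0 + θ (Fin.tail x)) (Fin.tail x) : Fin (q + 1) → ℝ) i)
      (fun i => ?_) fun i => ?_
    · exact Fin.cases ((IsA.proj 0).add (IsA.tail hθ)) (fun k => IsA.proj k.succ) i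
    · refine Fin.cases ?_ (fun k => rfl) i
      have : Fin.tail (0 : Fin (q + 1) → ℝ) = 0 := rfl
      simp [this, hθ0]
  have hH1s : RM.cf s H1 0 ≠ 0 := by
    have : RM.cf s H1 0 = RM.cf s H 0 := by simp [RM.cf, H1, hθ0]
    rwa [this]
  have hθv := hM.inf_comp hθ hθ0 hv
  obtain ⟨η', hη', hη'0, hlim'⟩ := hy _ (hM.add ha (hM.mul hη (hM.add (hM.const 1) hθv.1)))
  set a' : α → ℝ := fun x => a x + η x * (1 + θ fun j => v j x)
  change Tendsto (fun x => (y x - a' x) / η' x) l (𝓝 1) at hlim'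
  have ha' : a' ∈ M := hM.add ha (hM.mul hη (hM.add (hM.const 1) hθv.1))
  let u : α → ℝ := fun x => η' x / η x
  have hu0 : ∀ᶠ x in l, u x ≠ 0 := by
    filter_upwards [hη0, hη'0] with x h1 h2 using div_ne_zero h2 h1
  have hY : ∀ᶠ x in l, (y x - a x) / η x - 1 - θ (fun j => v j x) = u x * ((y x - a' x) / η' x) := by
    filter_upwards [hη0, hη'0] with x h1 h2
    simp only [u, a']
    field_simp
    ring
  have hu : Inf l M u := by
    refine ⟨hM.div hη' hη, ?_⟩
    have h1 : Tendsto (fun x => (y x - a x) / η x - 1 - θ (fun j => v j x)) l (𝓝 0) := by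
      simpa using (hlim.sub_const 1).sub hθv.2
    have h2 := (h1.congr' hY).div hlim' one_ne_zero
    rw [zero_div] at h2
    refine h2.congr' ?_
    filter_upwards [hlim'.eventually_ne one_ne_zero] with x hx
    exact mul_div_cancel_right₀ _ hx
  obtain ⟨U, hU, hUe⟩ := hH1.taylor s
  have hU0 : U 0 ≠ 0 := by rwa [IsA.taylor_ne hU hUe]
  let G : Fin (s + 1) → (Fin (q + 1) → ℝ) → ℝ := fun j x =>
    if (j : ℕ) < s then RM.cf j H1 (Fin.tail x) * x 0 ^ (j : ℕ) else x 0 ^ s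
  have hG : ∀ j, IsA (G j) := by
    intro j
    by_cases hj : (j : ℕ) < s
    · simp only [G, hj, if_true]
      exact (IsA.tail (hH1.cf j)).mul ((IsA.proj 0).pow _)
    · simp only [G, hj, if_false]
      exact (IsA.proj 0).pow _
  obtain ⟨σ, V, c1, c2, c3⟩ := lu hM (q + 1) (Fin.cons u v : Fin (q + 1) → α → ℝ)
    (Fin.cases hu hv) G hG
  have hcσ : ∀ᶠ x in l, u x = σ 0 (fun j => V j x) ∧ ∀ k : Fin q, v k x = σ k.succ fun j => V j x := by
    filter_upwards [c1.eq'] with x hx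
    exact ⟨congrFun hx 0, fun k => congrFun hx k.succ⟩
  rcases c3 with c3 | ⟨β, B, c3, j0, c4⟩
  · refine absurd (c3 (Fin.last s)) (germ_ne_of_inf c1.inf ?_)
    filter_upwards [hcσ, hu0] with x h1 h2
    simp only [G, Fin.val_last, lt_irrefl, if_false, ← h1.1]
    exact pow_ne_zero _ h2
  -- the coefficients as a sequence
  let b : ℕ → (Fin (q + 1) → ℝ) → ℝ := fun j => if h : j < s + 1 then B ⟨j, h⟩ else fun _ => 0
  have hbA : ∀ j, IsA (b j) := fun j => by
    by_cases h : j < s + 1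
    · simp only [b, h, dif_pos]; exact (c3 _).1
    · simp only [b, h, dif_neg, not_false_eq_true]; exact IsA.const 0
  have hbe : ∀ j < s, (fun x => RM.cf j H1 (fun i => σ i.succ x) * σ 0 x ^ j) =ᶠ[𝓝 0] fun x => RM.mono β x * b j x := by
    intro j hj
    have := (c3 ⟨j, by omega⟩).2
    simp only [G, hj, if_true] at this
    simp only [b, show j < s + 1 by omega, dif_pos]
    exact this
  have hbs : (fun x => σ 0 x ^ s) =ᶠ[𝓝 0] fun x => RM.mono β x * b s x := by
    have := (c3 ⟨s, by omega⟩).2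
    simp only [G, lt_irrefl, if_false] at this
    simp only [b, show s < s + 1 by omega, dif_pos]
    exact this
  have hb1 : b (s - 1) 0 = 0 := by
    have : b (s - 1) =ᶠ[𝓝 0] fun _ => 0 := by
      refine germ_cancel (IsA.mono β).analyticAt (hbA _).analyticAt analyticAt_const (mono_germ_ne β) ?_
      have ht : Tendsto (fun (x : Fin (q + 1) → ℝ) (i : Fin q) => σ i.succ x) (𝓝 0) (𝓝 0) :=
        IsA.tendsto_zero (fun i => c1.isA i.succ) fun i => c1.zero i.succ
      filter_upwards [hbe (s - 1) (by omega), ht.eventually hθc] with x h1 h2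
      rw [← h1, mul_zero, show RM.cf (s - 1) H1 (fun i => σ i.succ x) = 0 from h2, zero_mul]
    exact this.self_of_nhds
  let H3 : (Fin (q + 1 + 1) → ℝ) → ℝ := fun x => ∑ j ∈ Finset.range s, b j (Fin.tail x) * (1 + x 0) ^ j +
    (1 + x 0) ^ s * (b s (Fin.tail x) * U (Fin.cons (σ 0 (Fin.tail x) * (1 + x 0)) fun i => σ i.succ (Fin.tail x)))
  have h1x : IsA fun x : Fin (q + 1 + 1) → ℝ => 1 + x 0 := (IsA.const 1).add (IsA.proj 0)
  have hUσ : IsA fun x : Fin (q + 1 + 1) → ℝ => U (Fin.cons (σ 0 (Fin.tail x) * (1 + x 0)) fun i => σ i.succ (Fin.tail x)) := by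
    refine hU.comp (h := fun i x => (Fin.cons (σ 0 (Fin.tail x) * (1 + x 0)) fun i => σ i.succ (Fin.tail x) :
      Fin (q + 1) → ℝ) i) (fun i => ?_) fun i => ?_
    · exact Fin.cases ((IsA.tail (c1.isA 0)).mul h1x) (fun k => IsA.tail (c1.isA k.succ)) i
    · refine Fin.cases ?_ (fun k => c1.zero k.succ) i
      have : Fin.tail (0 : Fin (q + 1 + 1) → ℝ) = 0 := rfl
      simp [this, c1.zero]
  have hH3 : IsA H3 := (IsA.sum _ fun j _ => (IsA.tail (hbA j)).mul (h1x.pow j)).add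
    ((h1x.pow s).mul ((IsA.tail (hbA s)).mul hUσ))
  obtain ⟨k, hk, hkne⟩ := shift_ne hs0.ne' (fun j => b j 0) hb1 (b s 0 * U 0) (by
    by_cases hj : (j0 : ℕ) < s
    · refine Or.inl ⟨j0, hj, ?_⟩
      simpa only [b, j0.2, dif_pos] using c4
    · refine Or.inr (mul_ne_zero ?_ hU0)
      have : (j0 : ℕ) = s := by have := j0.2; omega
      have e : j0 = ⟨s, by omega⟩ := Fin.ext this
      simp only [b, show s < s + 1 by omega, dif_pos]
      rwa [← e])
  have hH3k : RM.cf k H3 0 ≠ 0 := by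
    have : ∀ t, H3 (Fin.cons t 0) = ∑ j ∈ Finset.range s, b j 0 * (1 + t) ^ j + (1 + t) ^ s * (b s 0 * U 0) := by
      intro t
      have e0 : (fun i : Fin q => σ i.succ 0) = 0 := funext fun i => c1.zero i.succ
      simp only [H3, Fin.tail_cons, Fin.cons_zero, c1.zero 0, zero_mul, e0, cons_zero_zero]
    simp only [RM.cf, this]
    exact div_ne_zero hkne (by exact_mod_cast Nat.factorial_ne_zero _)
  refine ((ih k hk hH3 hH3k c1.inf ha' hη' hη'0 hlim').mul_left (NZ.mul hM) (NZ.mono hM β c1.inf c2)).congr ?_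
  have htend : Tendsto (fun x => (Fin.cons (u x * ((y x - a' x) / η' x)) fun j => v j x : Fin (q + 1) → ℝ)) l (𝓝 0) := by
    refine tendsto_cons.comp (Tendsto.prodMk_nhds ?_ (tendsto_inf hv))
    simpa using hu.2.mul hlim'
  have hVt := tendsto_inf c1.inf
  filter_upwards [hY, hcσ, htend.eventually hUe, hVt.eventually hbs,
    (eventually_all_finset (Finset.range s)).2 fun j hj => hVt.eventually (hbe j (Finset.mem_range.1 hj))] with x e1 e2 e3 e4 e5
  have e6 : H (Fin.cons ((y x - a x) / η x - 1) fun j => v j x) =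
      H1 (Fin.cons (u x * ((y x - a' x) / η' x)) fun j => v j x) := by
    simp only [H1, Fin.cons_zero, Fin.tail_cons, ← e1, sub_add_cancel]
  rw [e6, e3]
  simp only [H3, Fin.cons_zero, Fin.tail_cons, add_sub_cancel]
  have e7 : (fun i : Fin q => σ i.succ fun j => V j x) = fun i => v i x := funext fun i => (e2.2 i).symm
  rw [e7, ← e2.1, mul_add, Finset.mul_sum]
  rw [← e2.1] at e4
  congr 1
  · refine Finset.sum_congr rfl fun j hj => ?_
    have := e5 j hj
    simp only [e7, ← e2.1] at this
    rw [mul_pow, ← mul_assoc, ← mul_assoc, this]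
  · rw [mul_pow, e4]
    ring

theorem AffInf.norm [l.NeBot] {f : α → ℝ} (hf : Rep l (AffInf l M y) f) :
    f =ᶠ[l] 0 ∨ Norm l (NZ l M) (AffInf l M y) f := by
  obtain ⟨k, Φ, e, hΦ, he, hfe⟩ := hf
  choose he0 p hp r hr hpr using he
  obtain ⟨a, ha, η, hη, hη0, hlim, hrη⟩ := AffInf.refine hM hy hp hr fun i => by
    have := he0 i; rwa [hpr i] at this
  let w : Fin (k + k) → α → ℝ := Fin.append (fun i x => p i x + r i x * a x) fun i x => r i x * η x
  have hee : ∀ i, ∀ᶠ x in l, e i x = (p i x + r i x * a x) + r i x * η x * (1 + ((y x - a x) / η x - 1)) := by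
    intro i
    filter_upwards [hη0] with x hx
    rw [hpr i]; field_simp; ring
  have hw : ∀ j, Inf l M (w j) := by
    intro j
    refine Fin.addCases (fun i => ?_) (fun i => ?_) j
    · simp only [w, Fin.append_left]
      refine ⟨hM.add (hp i) (hM.mul (hr i) ha), ?_⟩
      have h1 := (he0 i).sub ((hrη i).mul hlim)
      rw [zero_mul, sub_zero] at h1
      refine h1.congr' ?_
      filter_upwards [hee i] with x hx
      rw [hx]; ring
    · simp only [w, Fin.append_right]
      exact ⟨hM.mul (hr i) hη, hrη i⟩
  let G : (Fin (k + k + 1) → ℝ) → ℝ := fun x =>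
    Φ fun i => x (Fin.castAdd k i).succ + x (Fin.natAdd k i).succ * (1 + x 0)
  have hG : IsA G := hΦ.comp
    (h := fun i x => x (Fin.castAdd k i).succ + x (Fin.natAdd k i).succ * (1 + x 0))
    (fun i => (IsA.proj _).add ((IsA.proj _).mul ((IsA.const 1).add (IsA.proj 0)))) fun i => by simp
  have hfG : f =ᶠ[l] fun x => G (Fin.cons ((y x - a x) / η x - 1) fun j => w j x) := by
    filter_upwards [hfe, eventually_all.2 hee] with x h1 h2
    rw [h1]
    refine congrArg Φ (funext fun i => ?_)
    simp only [Fin.cons_succ, Fin.cons_zero, w, Fin.append_left, Fin.append_right, h2 i]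
  obtain ⟨σ, v, c1, c2, c3⟩ := hM.content hG hw
  have hct : Tendsto (fun x => (Fin.cons ((y x - a x) / η x - 1) fun j => v j x : Fin (k + k + 1) → ℝ)) l (𝓝 0) :=
    tendsto_cons.comp (Tendsto.prodMk_nhds (by simpa using hlim.sub_const 1) (tendsto_inf c1.inf))
  rcases c3 with c3 | ⟨β, H, s, hH, c3, hs⟩
  · left
    filter_upwards [hfG, c1.eq', hct.eventually c3] with x h1 h2 h3
    simp only [Fin.cons_zero, Fin.tail_cons] at h3
    rw [h1, h2]; exact h3
  · right
    refine ((AffInf.norm_reg hM hy s hH hs c1.inf ha hη hη0 hlim).mul_left (NZ.mul hM)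
      (NZ.mono hM β c1.inf c2)).congr ?_
    filter_upwards [hfG, c1.eq', hct.eventually c3] with x h1 h2 h3
    simp only [Fin.cons_zero, Fin.tail_cons] at h3
    rw [h1, h2]; exact h3

theorem AffInf.isMon [l.NeBot] : IsMon l M (NZ l M) (AffInf l M y) where
  mul := NZ.mul hM
  inv hf := ⟨hM.inv hf.1, hf.2.mono fun _ h => inv_ne_zero h⟩
  of_mem h1 h2 := ⟨h1, h2⟩
  sign {f} hf := by
    rcases hM.tri hf.1 with h | h
    · obtain ⟨x, h1, h2⟩ := (h.and hf.2).exists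
      exact absurd h1 h2
    · exact h
  root hf hp n hn := ⟨hM.root hf.1 hp hn, hp.mono fun x hx => (Real.rpow_pos_of_pos hx _).ne'⟩
  limit hf := (hM.limit hf.1).imp id fun h =>
    h.elim (fun h => h.inv_tendsto_atTop) fun h => h.inv_tendsto_atBot
  tendsto e he := he.1
  fin {f} hf r hr := by
    refine ((Rep.const r).add (fun e he => he.1) (Rep.of_mem (AffInf.of_inf (y := y) hM
      (f := fun x => f x - r) ⟨hM.sub hf.1 (hM.const r), by simpa using hr.sub_const r⟩))).congr ?_
    exact Eventually.of_forall fun x => by simp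
  norm hf := AffInf.norm hM hy hf

theorem AffInf.mem_ext [l.NeBot] : y ∈ Ext l (NZ l M) (AffInf l M y) := by
  obtain ⟨b, h1, h2, h3⟩ := hy _ (hM.const 0)
  refine Or.inr ⟨b, ⟨h1, h2⟩, fun x => 1 + ((y x - 0) / b x - 1), 1, (Rep.const 1).add (fun e he => he.1)
    (Rep.of_mem (AffInf.centre hM (hM.const 0) h1 h3)), by simpa using h3, one_ne_zero, ?_⟩
  filter_upwards [h2] with x hx
  field_simp
  ring

end ExtII

theorem IsHF.zpow (hM : IsHF l M) {f : α → ℝ} (hf : f ∈ M) (k : ℤ) : (fun a => f a ^ k) ∈ M := by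
  obtain ⟨k, rfl | rfl⟩ := k.eq_nat_or_neg
  · simpa using hM.pow hf k
  · simpa using hM.inv (hM.pow hf k)

theorem IsHF.rpow_rat (hM : IsHF l M) {f : α → ℝ} (hf : f ∈ M) (hp : ∀ᶠ a in l, 0 < f a) (q : ℚ) :
    (fun a => f a ^ (q : ℝ)) ∈ M := by
  refine hM.congr (hM.zpow (hM.root hf hp q.den_ne_zero) q.num) ?_
  filter_upwards [hp] with a ha
  rw [← Real.rpow_intCast, ← Real.rpow_mul ha.le]
  congr 1
  rw [mul_comm, ← div_eq_mul_inv]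
  exact_mod_cast Rat.num_div_den q

theorem exists_dominant [l.NeBot] {m : ℕ → α → ℝ} (T : Finset ℕ) (hT : T.Nonempty)
    (hne : ∀ i ∈ T, ∀ᶠ a in l, m i a ≠ 0)
    (h : ∀ i ∈ T, ∀ j ∈ T, i ≠ j → Tendsto (fun a => m i a / m j a) l (𝓝 0) ∨ Tendsto (fun a => m j a / m i a) l (𝓝 0)) :
    ∃ J ∈ T, ∀ i ∈ T, i ≠ J → Tendsto (fun a => m i a / m J a) l (𝓝 0) := by
  classical
  induction hT using Finset.Nonempty.cons_induction with
  | singleton i => exact ⟨i, Finset.mem_singleton_self i, fun j hj hji => absurd (Finset.mem_singleton.1 hj) hji⟩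
  | cons i T hi hT ih =>
    obtain ⟨J, hJ, hJm⟩ := ih (fun k hk => hne k (Finset.mem_cons_of_mem hk)) fun k hk k' hk' =>
      h k (Finset.mem_cons_of_mem hk) k' (Finset.mem_cons_of_mem hk')
    have hiJ : i ≠ J := fun e => hi (e ▸ hJ)
    rcases h i (Finset.mem_cons_self i T) J (Finset.mem_cons_of_mem hJ) hiJ with h1 | h1
    · refine ⟨J, Finset.mem_cons_of_mem hJ, fun k hk hkJ => ?_⟩
      rcases Finset.mem_cons.1 hk with rfl | hk
      exacts [h1, hJm k hk hkJ]
    · refine ⟨i, Finset.mem_cons_self i T, fun k hk hki => ?_⟩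
      have hk := (Finset.mem_cons.1 hk).resolve_left hki
      by_cases hkJ : k = J
      · rwa [hkJ]
      · have := (hJm k hk hkJ).mul h1
        rw [zero_mul] at this
        refine this.congr' ?_
        filter_upwards [hne J (Finset.mem_cons_of_mem hJ)] with a ha
        field_simp

/-- Monomials in `y` with coefficients in `M`. -/
def PN (l : Filter α) (M : Set (α → ℝ)) (y : α → ℝ) : Set (α → ℝ) :=
  {f | ∃ b ∈ NZ l M, ∃ q : ℚ, f =ᶠ[l] fun a => b a * y a ^ (q : ℝ)}

/-- Infinitesimal monomials in `y`. -/
def PS (l : Filter α) (M : Set (α → ℝ)) (y : α → ℝ) : Set (α → ℝ) :=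
  {e | e ∈ PN l M y ∧ Tendsto e l (𝓝 0)}

/-- Elements whose nontrivial integer powers are incomparable with `M`. -/
structure Typ (l : Filter α) (M : Set (α → ℝ)) (y Y : α → ℝ) : Prop where
  pos : ∀ᶠ a in l, 0 < Y a
  mem : ∀ {b : α → ℝ}, b ∈ NZ l M → ∀ k : ℤ, (fun a => b a * Y a ^ k) ∈ PN l M y
  dich : ∀ {b : α → ℝ}, b ∈ NZ l M → ∀ {k : ℤ}, k ≠ 0 →
    Tendsto (fun a => b a * Y a ^ k) l (𝓝 0) ∨ Tendsto (fun a => (b a * Y a ^ k)⁻¹) l (𝓝 0)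

section ExtI

variable (hM : IsHF l M) {y : α → ℝ} (hy0 : ∀ᶠ a in l, 0 < y a)

theorem PN.congr {f g : α → ℝ} (hf : f ∈ PN l M y) (e : f =ᶠ[l] g) : g ∈ PN l M y := by
  obtain ⟨b, hb, q, h⟩ := hf
  exact ⟨b, hb, q, e.symm.trans h⟩

theorem NZ.inv (hM : IsHF l M) {f : α → ℝ} (hf : f ∈ NZ l M) : (fun a => (f a)⁻¹) ∈ NZ l M :=
  ⟨hM.inv hf.1, hf.2.mono fun _ h => inv_ne_zero h⟩

theorem PN.of_nz {f : α → ℝ} (hf : f ∈ NZ l M) : f ∈ PN l M y :=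
  ⟨f, hf, 0, by simp⟩

include hy0 in
theorem PN.ne {f : α → ℝ} (hf : f ∈ PN l M y) : ∀ᶠ a in l, f a ≠ 0 := by
  obtain ⟨b, hb, q, h⟩ := hf
  filter_upwards [h, hb.2, hy0] with a h1 h2 h3
  rw [h1]
  exact mul_ne_zero h2 (Real.rpow_pos_of_pos h3 _).ne'

include hM

theorem PN.inv {f : α → ℝ} (hy0 : ∀ᶠ a in l, 0 < y a) (hf : f ∈ PN l M y) : (fun a => (f a)⁻¹) ∈ PN l M y := by
  obtain ⟨b, hb, q, h⟩ := hf
  refine ⟨_, NZ.inv hM hb, -q, ?_⟩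
  filter_upwards [h, hy0] with a h1 h2
  rw [h1, mul_inv, Rat.cast_neg, Real.rpow_neg h2.le]

include hy0

theorem PN.mul {f g : α → ℝ} (hf : f ∈ PN l M y) (hg : g ∈ PN l M y) : (fun a => f a * g a) ∈ PN l M y := by
  obtain ⟨b, hb, q, h⟩ := hf
  obtain ⟨b', hb', q', h'⟩ := hg
  refine ⟨_, NZ.mul hM hb hb', q + q', ?_⟩
  filter_upwards [h, h', hy0] with a h1 h2 h3
  rw [h1, h2, Rat.cast_add, Real.rpow_add h3]; ring

theorem PN.div {f g : α → ℝ} (hf : f ∈ PN l M y) (hg : g ∈ PN l M y) : (fun a => f a / g a) ∈ PN l M y := by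
  simpa only [div_eq_mul_inv] using PN.mul hM hy0 hf (PN.inv hM hy0 hg)

omit hy0 in
theorem PS.of_inf {f : α → ℝ} (hf : Inf l M f) : Rep l (PS l M y) f := by
  rcases hM.tri hf.1 with h | h | h
  · exact (Rep.const 0).congr h.symm
  · exact Rep.of_mem ⟨PN.of_nz ⟨hf.1, h.mono fun _ h => h.ne'⟩, hf.2⟩
  · exact Rep.of_mem ⟨PN.of_nz ⟨hf.1, h.mono fun _ h => h.ne⟩, hf.2⟩

omit hM hy0 in
theorem PS.tendsto : ∀ e ∈ PS l M y, Tendsto e l (𝓝 0) := fun _ h => h.2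

/-- One-sided expansions: leading term and domination. -/
theorem Typ.one_sided [l.NeBot] {Y : α → ℝ} (hY : Typ l M y Y) (hY0 : Tendsto Y l (𝓝 0)) {q : ℕ}
    {G : (Fin (q + 1) → ℝ) → ℝ} (hG : IsA G) {w : Fin q → α → ℝ} (hw : ∀ j, Inf l M (w j)) :
    (∀ Y0 : α → ℝ, Tendsto Y0 l (𝓝 0) → (fun a => G (Fin.cons (Y0 a) fun j => w j a)) =ᶠ[l] 0) ∨
    ∃ c ∈ PN l M y, ∃ g r, Rep l (PS l M y) g ∧ Tendsto g l (𝓝 r) ∧ r ≠ 0 ∧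
      ((fun a => G (Fin.cons (Y a) fun j => w j a)) =ᶠ[l] fun a => c a * g a) ∧
      ∀ Y0 : α → ℝ, (∀ᶠ a in l, 0 ≤ Y0 a ∧ Y0 a ≤ Y a) →
        ∃ C, ∀ᶠ a in l, |G (Fin.cons (Y0 a) fun j => w j a)| ≤ C * |c a| := by
  obtain ⟨σ, v, c1, c2, c3⟩ := hM.content hG hw
  have hct : ∀ Y0 : α → ℝ, Tendsto Y0 l (𝓝 0) →
      Tendsto (fun x => (Fin.cons (Y0 x) fun j => v j x : Fin (q + 1) → ℝ)) l (𝓝 0) := fun Y0 h =>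
    tendsto_cons.comp (Tendsto.prodMk_nhds h (tendsto_inf c1.inf))
  rcases c3 with c3 | ⟨β, H, s, hH, c3, hs⟩
  · left
    intro Y0 h
    filter_upwards [c1.eq', (hct Y0 h).eventually c3] with x h2 h3
    simp only [Fin.cons_zero, Fin.tail_cons] at h3
    rw [h2]; exact h3
  right
  obtain ⟨U, hU, hUe⟩ := hH.taylor s
  have hU0 : U 0 ≠ 0 := by rwa [IsA.taylor_ne hU hUe]
  let A : ℕ → α → ℝ := fun j x => if j < s then RM.cf j H (fun i => v i x) else 1
  have hA : ∀ j, A j ∈ M := fun j => by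
    by_cases hj : j < s
    · simp only [A, hj, if_true]
      exact hM.anal (hH.cf j) (fun i => (c1.inf i).1) fun i => (c1.inf i).2
    · simp only [A, hj, if_false]; exact hM.const 1
  let m : ℕ → α → ℝ := fun j x => A j x * Y x ^ j
  have htri : ∀ j, A j =ᶠ[l] 0 ∨ A j ∈ NZ l M := fun j => by
    rcases hM.tri (hA j) with h | h | h
    · exact Or.inl h
    · exact Or.inr ⟨hA j, h.mono fun _ h => h.ne'⟩
    · exact Or.inr ⟨hA j, h.mono fun _ h => h.ne⟩
  have hAs : A s = fun _ => 1 := by funext x; simp [A]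
  have hAsN : A s ∈ NZ l M := by
    rw [hAs]; exact ⟨hM.const 1, Eventually.of_forall fun _ => one_ne_zero⟩
  have hmN : ∀ j, A j ∈ NZ l M → m j ∈ PN l M y := fun j hj => by
    simpa [m] using hY.mem hj j
  classical
  let T : Finset ℕ := (Finset.range (s + 1)).filter fun j => A j ∈ NZ l M
  have hratio : ∀ i j, A i ∈ NZ l M → A j ∈ NZ l M → i ≠ j →
      Tendsto (fun a => m i a / m j a) l (𝓝 0) ∨ Tendsto (fun a => m j a / m i a) l (𝓝 0) := by
    intro i j hi hj hij
    have e : ∀ᶠ a in l, m i a / m j a = A i a * (A j a)⁻¹ * Y a ^ ((i : ℤ) - j) := by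
      filter_upwards [hY.pos] with a ha
      rw [zpow_sub₀ ha.ne']
      simp only [m, zpow_natCast]
      rw [div_eq_mul_inv, div_eq_mul_inv, mul_inv]; ring
    rcases hY.dich (NZ.mul hM hi (NZ.inv hM hj)) (k := (i : ℤ) - j) (by omega) with h | h
    · left
      exact h.congr' (e.mono fun _ h => h.symm)
    · right
      refine h.congr' ?_
      filter_upwards [e] with a ha
      rw [← ha, inv_div]
  obtain ⟨J, hJ, hJm⟩ := exists_dominant (m := m) T ⟨s, by simp [T, hAsN]⟩
    (fun i hi => PN.ne hy0 (hmN i (Finset.mem_filter.1 hi).2))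
    fun i hi j hj => hratio i j (Finset.mem_filter.1 hi).2 (Finset.mem_filter.1 hj).2
  have hJs : J ≤ s := by
    have := (Finset.mem_filter.1 hJ).1
    rw [Finset.mem_range] at this; omega
  have hJN := hmN J (Finset.mem_filter.1 hJ).2
  have hJne := PN.ne hy0 hJN
  have hrat : ∀ j ≤ s, j ≠ J → Rep l (PS l M y) (fun a => m j a / m J a) ∧ Tendsto (fun a => m j a / m J a) l (𝓝 0) := by
    intro j hj hjJ
    rcases htri j with h | h
    · have h0 : (fun _ => (0 : ℝ)) =ᶠ[l] fun a => m j a / m J a := by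
        filter_upwards [h] with a ha
        simp [m, ha]
      exact ⟨(Rep.const 0).congr h0, tendsto_const_nhds.congr' h0⟩
    · have := hJm j (by simp only [T, Finset.mem_filter, Finset.mem_range]; exact ⟨by omega, h⟩) hjJ
      exact ⟨Rep.of_mem ⟨PN.div hM hy0 (hmN j h) hJN, this⟩, this⟩
  have hJJ : (fun a => m J a / m J a) =ᶠ[l] fun _ => 1 := hJne.mono fun a h => div_self h
  have hratR : ∀ j ≤ s, Rep l (PS l M y) (fun a => m j a / m J a) ∧
      Tendsto (fun a => m j a / m J a) l (𝓝 (if j = J then 1 else 0)) := by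
    intro j hj
    by_cases hjJ : j = J
    · subst hjJ
      simp only [if_true]
      exact ⟨(Rep.const 1).congr hJJ.symm, tendsto_const_nhds.congr' hJJ.symm⟩
    · simpa only [hjJ, if_false] using hrat j hj hjJ
  let u : α → ℝ := fun a => U (Fin.cons (Y a) fun j => v j a)
  have hYS : Rep l (PS l M y) Y := by
    refine Rep.of_mem ⟨?_, hY0⟩
    simpa using hY.mem (b := fun _ => 1) ⟨hM.const 1, Eventually.of_forall fun _ => one_ne_zero⟩ 1
  have hcons : ∀ a, (Fin.cons (Y a) fun j => v j a : Fin (q + 1) → ℝ) =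
      fun i => (Fin.cons Y v : Fin (q + 1) → α → ℝ) i a := fun a => by
    funext i; exact Fin.cases rfl (fun k => rfl) i
  have hu : Rep l (PS l M y) u := by
    simp only [u, hcons]
    refine Rep.comp PS.tendsto hU (fun i => ?_) fun i => ?_
    · exact Fin.cases hYS (fun k => PS.of_inf hM (c1.inf k)) i
    · exact Fin.cases hY0 (fun k => (c1.inf k).2) i
  have huU : Tendsto u l (𝓝 (U 0)) := hU.continuousAt.tendsto.comp (hct Y hY0)
  have hmono := NZ.mono hM β c1.inf c2
  have hGH : ∀ Y0 : α → ℝ, Tendsto Y0 l (𝓝 0) → ∀ᶠ a in l, G (Fin.cons (Y0 a) fun j => w j a) =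
      RM.mono β (fun j => v j a) * (∑ j ∈ Finset.range s, A j a * Y0 a ^ j +
        Y0 a ^ s * U (Fin.cons (Y0 a) fun j => v j a)) := by
    intro Y0 h
    filter_upwards [c1.eq', (hct Y0 h).eventually c3, (hct Y0 h).eventually hUe] with a h2 h3 h4
    simp only [Fin.cons_zero, Fin.tail_cons] at h3 h4
    rw [h2, h3, h4]
    congr 2
    exact Finset.sum_congr rfl fun j hj => by simp only [A, Finset.mem_range.1 hj, if_true]
  have hsum : Rep l (PS l M y) fun a => ∑ j ∈ Finset.range s, m j a / m J a := by
    have : ∀ T ⊆ Finset.range s, Rep l (PS l M y) fun a => ∑ j ∈ T, m j a / m J a := by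
      intro T
      induction T using Finset.induction_on with
      | empty => intro _; simpa using Rep.const 0
      | insert i T hi ih =>
        intro hT
        simp only [Finset.sum_insert hi]
        have hi' := Finset.mem_range.1 (hT (Finset.mem_insert_self i T))
        exact ((hratR i hi'.le).1).add PS.tendsto (ih fun k hk => hT (Finset.mem_insert_of_mem hk))
    exact this _ (Finset.Subset.refl _)
  refine ⟨_, PN.mul hM hy0 (PN.of_nz hmono) hJN, fun a => ∑ j ∈ Finset.range s, m j a / m J a + m s a / m J a * u a,
    (∑ j ∈ Finset.range s, if j = J then 1 else 0) + (if s = J then 1 else 0) * U 0, ?_, ?_, ?_, ?_, ?_⟩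
  · exact hsum.add PS.tendsto ((hratR s le_rfl).1.mul PS.tendsto hu)
  · exact (tendsto_finsetSum _ fun j hj => (hratR j (Finset.mem_range.1 hj).le).2).add ((hratR s le_rfl).2.mul huU)
  · rw [Finset.sum_ite_eq']
    rcases hJs.lt_or_eq with h | h
    · simp [h, h.ne']
    · simp [h, hU0]
  · filter_upwards [hGH Y hY0, hJne] with a h1 h2
    rw [h1, mul_assoc]
    congr 1
    rw [mul_add, Finset.mul_sum]
    congr 1
    · exact Finset.sum_congr rfl fun j _ => by rw [mul_div_cancel₀ _ h2]
    · rw [← mul_assoc, mul_div_cancel₀ _ h2]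
      simp [m, hAs, u]
  · intro Y0 hYY
    have hY00 : Tendsto Y0 l (𝓝 0) := tendsto_of_tendsto_of_tendsto_of_le_of_le' tendsto_const_nhds hY0
      (hYY.mono fun _ h => h.1) (hYY.mono fun _ h => h.2)
    have hUb : ∀ᶠ a in l, |U (Fin.cons (Y0 a) fun j => v j a)| ≤ |U 0| + 1 :=
      ((hU.continuousAt.tendsto.comp (hct Y0 hY00)).abs.eventually_lt_const (lt_add_one |U 0|)).mono fun _ h => h.le
    have hrb : ∀ᶠ a in l, ∀ j ∈ Finset.range (s + 1), |m j a| ≤ 2 * |m J a| := by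
      refine (eventually_all_finset _).2 fun j hj => ?_
      have h1 := (hratR j (by rw [Finset.mem_range] at hj; omega)).2.abs
      have h2 : |(if j = J then 1 else 0 : ℝ)| < 2 := by split_ifs <;> norm_num
      filter_upwards [h1.eventually_lt_const h2, hJne] with a e1 e2
      rw [abs_div, div_lt_iff₀ (abs_pos.2 e2)] at e1
      exact e1.le
    refine ⟨s * 2 + 2 * (|U 0| + 1), ?_⟩
    filter_upwards [hGH Y0 hY00, hYY, hUb, hrb] with a h1 h2 h3 h4
    rw [h1, abs_mul, abs_mul, mul_left_comm]
    refine mul_le_mul_of_nonneg_left ?_ (abs_nonneg _)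
    have h5 : ∀ j ∈ Finset.range (s + 1), |A j a| * Y0 a ^ j ≤ 2 * |m J a| := fun j hj => by
      refine le_trans ?_ (h4 j hj)
      simp only [m, abs_mul, abs_pow]
      rw [abs_of_nonneg (h2.1.trans h2.2)]
      exact mul_le_mul_of_nonneg_left (pow_le_pow_left₀ h2.1 h2.2 _) (abs_nonneg _)
    have h6 := h5 s (by simp)
    rw [hAs, abs_one, one_mul] at h6
    refine (abs_add_le _ _).trans ?_
    rw [add_mul]
    refine add_le_add ((Finset.abs_sum_le_sum_abs _ _).trans ?_) ?_
    · refine (Finset.sum_le_card_nsmul _ _ (2 * |m J a|) fun j hj => ?_).trans ?_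
      · rw [abs_mul, abs_pow, abs_of_nonneg h2.1]
        exact h5 j (by rw [Finset.mem_range] at hj ⊢; omega)
      · simp [mul_assoc]
    · rw [abs_mul, abs_pow, abs_of_nonneg h2.1]
      calc Y0 a ^ s * |U _| ≤ (2 * |m J a|) * (|U 0| + 1) := mul_le_mul h6 h3 (abs_nonneg _) (by positivity)
        _ = _ := by ring

end ExtI

theorem IsA.comp_cons₂ {p q : ℕ} {H : (Fin (q + 2) → ℝ) → ℝ} (hH : IsA H) {f g : (Fin p → ℝ) → ℝ}
    {h : Fin q → (Fin p → ℝ) → ℝ} (hf : IsA f) (f0 : f 0 = 0) (hg : IsA g) (g0 : g 0 = 0) (hh : ∀ j, IsA (h j))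
    (h0 : ∀ j, h j 0 = 0) : IsA fun x => H (Fin.cons (f x) (Fin.cons (g x) fun j => h j x)) := by
  have := hH.comp (h := fun i x => (Fin.cons (f x) (Fin.cons (g x) fun j => h j x) : Fin (q + 2) → ℝ) i)
    (fun i => Fin.cases hf (fun i => Fin.cases hg hh i) i) fun i => Fin.cases f0 (fun i => Fin.cases g0 h0 i) i
  exact this

/-- Restriction of `H` to the hyperbola `Y Z = (mono δ)²`, near `Y = mono δ`. -/
def hyp {q : ℕ} (δ : Fin q → ℕ) (H : (Fin (q + 2) → ℝ) → ℝ) (x : Fin (q + 1) → ℝ) : ℝ :=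
  H (Fin.cons (mono δ (Fin.tail x) * (1 + x 0)) (Fin.cons (mono δ (Fin.tail x) * (1 + x 0)⁻¹) (Fin.tail x)))

theorem IsA.one_add_inv (i : Fin n) : IsA fun x : Fin n → ℝ => (1 + x i)⁻¹ :=
  IsA.inv (f := fun x => 1 + x i) ((IsA.const 1).add (IsA.proj i)) (by simp)

theorem IsA.hyp {q : ℕ} {δ : Fin q → ℕ} (hδ : δ ≠ 0) {H : (Fin (q + 2) → ℝ) → ℝ} (hH : IsA H) : IsA (hyp δ H) := by
  have h1 : IsA fun x : Fin (q + 1) → ℝ => RM.mono δ (Fin.tail x) := IsA.tail (IsA.mono δ)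
  have h2 : RM.mono δ (Fin.tail (0 : Fin (q + 1) → ℝ)) = 0 := mono_at_zero hδ
  refine hH.comp_cons₂ (h := fun j x => Fin.tail x j) (h1.mul ((IsA.const 1).add (IsA.proj 0))) ?_ (h1.mul (IsA.one_add_inv 0)) ?_
    (fun j => IsA.proj j.succ) fun j => rfl
  · rw [h2, zero_mul]
  · rw [h2, zero_mul]

section TwoSided

variable {q : ℕ} {v : Fin q → α → ℝ} (hv : ∀ j, Inf l M (v j)) (hvp : ∀ j, ∀ᶠ a in l, 0 < v j a)
  {δ : Fin q → ℕ} (hδ : δ ≠ 0) {Y : α → ℝ} (hYp : ∀ᶠ a in l, 0 < Y a) (hY0 : Tendsto Y l (𝓝 0))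
  (hZ0 : Tendsto (fun a => mono δ (fun j => v j a) ^ 2 / Y a) l (𝓝 0))

/-- The value of `H` at `Y` on the hyperbola. -/
def onHyp {q : ℕ} (v : Fin q → α → ℝ) (δ : Fin q → ℕ) (Y : α → ℝ) (H : (Fin (q + 2) → ℝ) → ℝ) (a : α) : ℝ :=
  H (Fin.cons (Y a) (Fin.cons (mono δ (fun j => v j a) ^ 2 / Y a) fun j => v j a))

include hv hY0 hZ0 in
theorem onHyp_tendsto : Tendsto (fun a => (Fin.cons (Y a) (Fin.cons (mono δ (fun j => v j a) ^ 2 / Y a) fun j => v j a) :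
    Fin (q + 2) → ℝ)) l (𝓝 0) :=
  tendsto_cons.comp (Tendsto.prodMk_nhds hY0 (tendsto_cons.comp (Tendsto.prodMk_nhds hZ0 (tendsto_inf hv))))

include hv hδ in
theorem mono_tendsto : Tendsto (fun a => mono δ (fun j => v j a)) l (𝓝 0) := by
  have := (IsA.mono δ).continuousAt.tendsto.comp (tendsto_inf hv)
  rwa [mono_at_zero hδ] at this

include hvp in
theorem mono_ev_pos : ∀ᶠ a in l, 0 < mono δ fun j => v j a := by
  filter_upwards [eventually_all.2 hvp] with a ha
  exact mono_pos δ ha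

include hv hvp hδ hYp hY0 hZ0 in
theorem onHyp_zero {H : (Fin (q + 2) → ℝ) → ℝ} (hH : IsA H) (h : hyp δ H =ᶠ[𝓝 0] 0) : onHyp v δ Y H =ᶠ[l] 0 := by
  obtain ⟨ρ, hρ, hA⟩ := hH
  obtain ⟨ε, hε, he⟩ := Metric.eventually_nhds_iff_ball.1 h
  filter_upwards [(tendsto_inf hv).eventually (Metric.ball_mem_nhds 0 hε),
    (tendsto_inf hv).eventually (Metric.ball_mem_nhds 0 hρ), (mono_tendsto hv hδ).eventually_lt_const hρ,
    mono_ev_pos (δ := δ) hvp, hYp, hY0.eventually_lt_const hρ, hZ0.eventually_lt_const hρ] with a h1 h2 h3 h4 h5 h6 h7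
  set S := mono δ fun j => v j a
  set w := fun j => v j a
  have hmem : ∀ t ∈ Ioo (S ^ 2 / ρ) ρ, (Fin.cons t (Fin.cons (S ^ 2 / t) w) : Fin (q + 2) → ℝ) ∈ Metric.ball 0 ρ := by
    intro t ht
    have ht0 : 0 < t := lt_trans (by positivity) ht.1
    rw [cons_mem_ball hρ, cons_mem_ball hρ, abs_of_pos ht0, abs_of_pos (by positivity)]
    refine ⟨ht.2, ?_, h2⟩
    have := ht.1
    rw [div_lt_iff₀ hρ] at this
    rw [div_lt_iff₀ ht0]; linarith
  have han : AnalyticOnNhd ℝ (fun t => H (Fin.cons t (Fin.cons (S ^ 2 / t) w))) (Ioo (S ^ 2 / ρ) ρ) := by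
    intro t ht
    have ht0 : 0 < t := lt_trans (by positivity) ht.1
    refine AnalyticAt.comp (g := H) (f := fun t : ℝ => (Fin.cons t (Fin.cons (S ^ 2 / t) w) : Fin (q + 2) → ℝ))
      (hA.analytic _ (hmem t ht)) ?_
    rw [analyticAt_pi_iff]
    intro i
    refine Fin.cases analyticAt_id (fun i => Fin.cases ?_ (fun k => analyticAt_const) i) i
    exact analyticAt_const.div analyticAt_id ht0.ne'
  have hS : S ∈ Ioo (S ^ 2 / ρ) ρ := ⟨by rw [div_lt_iff₀ hρ, sq]; exact mul_lt_mul_of_pos_left h3 h4, h3⟩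
  have hz := han.eqOn_zero_of_preconnected_of_eventuallyEq_zero (convex_Ioo _ _).isPreconnected hS (by
    have ht : Tendsto (fun t => t / S - 1) (𝓝 S) (𝓝 0) := by
      have : ContinuousAt (fun t => t / S - 1) S := by fun_prop
      simpa [ContinuousAt, h4.ne'] using this
    filter_upwards [ht.eventually (Metric.ball_mem_nhds 0 hε), isOpen_Ioo.mem_nhds hS] with t ht1 ht2
    have ht0 : 0 < t := lt_trans (by positivity) ht2.1
    have := he (Fin.cons (t / S - 1) w) ((cons_mem_ball hε).2 ⟨by simpa using ht1, h1⟩)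
    simp only [hyp, Fin.tail_cons, Fin.cons_zero] at this
    change H (Fin.cons (S * _) (Fin.cons (S * _) w)) = 0 at this
    rw [show S * (1 + (t / S - 1)) = t by field_simp; ring, show S * (1 + (t / S - 1))⁻¹ = S ^ 2 / t by
      rw [show 1 + (t / S - 1) = t / S by ring]; field_simp] at this
    exact this)
  refine hz ⟨?_, h6⟩
  rw [div_lt_iff₀ h5] at h7
  rw [div_lt_iff₀ hρ]; linarith

include hv hvp hδ hYp hY0 hZ0 in
/-- Removing from `H` the monomial content not visible on the hyperbola. -/
theorem onHyp_reduce (β : Fin q → ℕ) {K : (Fin (q + 1) → ℝ) → ℝ} (hK : IsA K) : ∀ {H : (Fin (q + 2) → ℝ) → ℝ}, IsA H →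
    ∀ {β₀ : Fin q → ℕ}, (∀ i, δ i = 0 → β₀ i = 0) →
    (hyp δ H =ᶠ[𝓝 0] fun x => mono β (Fin.tail x) * (mono β₀ (Fin.tail x) * K x)) →
    ∃ (γ : Fin q → ℕ) (H' : (Fin (q + 2) → ℝ) → ℝ) (β' : Fin q → ℕ), IsA H' ∧ (∀ i, δ i = 0 → β' i = 0) ∧
      (onHyp v δ Y H =ᶠ[l] fun a => mono γ (fun j => v j a) * onHyp v δ Y H' a) ∧
      hyp δ H' =ᶠ[𝓝 0] fun x => mono β' (Fin.tail x) * K x := by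
  refine exp_induction (P := fun β => ∀ {H : (Fin (q + 2) → ℝ) → ℝ}, IsA H →
    ∀ {β₀ : Fin q → ℕ}, (∀ i, δ i = 0 → β₀ i = 0) →
    (hyp δ H =ᶠ[𝓝 0] fun x => mono β (Fin.tail x) * (mono β₀ (Fin.tail x) * K x)) →
    ∃ (γ : Fin q → ℕ) (H' : (Fin (q + 2) → ℝ) → ℝ) (β' : Fin q → ℕ), IsA H' ∧ (∀ i, δ i = 0 → β' i = 0) ∧
      (onHyp v δ Y H =ᶠ[l] fun a => mono γ (fun j => v j a) * onHyp v δ Y H' a) ∧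
      hyp δ H' =ᶠ[𝓝 0] fun x => mono β' (Fin.tail x) * K x) ?_ ?_ β
  · intro H hH β₀ h0 e
    exact ⟨0, H, β₀, hH, h0, by simp, by simpa using e⟩
  · intro β i ih H hH β₀ h0 e
    by_cases hi : δ i = 0
    · -- divide by the coordinate `i`
      have hu : ∀ x : Fin (q + 1) → ℝ, hyp δ (fun z => H (Function.update z i.succ.succ 0)) x =
          hyp δ H (Function.update x i.succ 0) := by
        intro x
        have e1 : Fin.tail (Function.update x i.succ 0) = Function.update (Fin.tail x) i 0 := by
          simp
        have e2 : mono δ (Function.update (Fin.tail x) i 0) = mono δ (Fin.tail x) :=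
          mono_eq_of_eq δ hi fun j hj => Function.update_of_ne hj _ _
        simp only [hyp, e1, e2, Function.update_of_ne (Fin.succ_ne_zero i).symm]
        rw [Fin.cons_update, Fin.cons_update]
      have hz : hyp δ (fun z => H (Function.update z i.succ.succ 0)) =ᶠ[𝓝 0] 0 := by
        filter_upwards [(tendsto_update_zero i.succ).eventually e] with x hx
        rw [hu, hx, mono_add, mono_single]
        simp [Fin.tail]
      have hf0 := onHyp_zero hv hvp hδ hYp hY0 hZ0 (hH.update i.succ.succ) hz
      obtain ⟨h, hh, eh⟩ := IsA.div (f := fun x => H x - H (Function.update x i.succ.succ 0))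
        (hH.sub (hH.update i.succ.succ)) i.succ.succ (by
          refine Eventually.of_forall fun x => ?_
          simp)
      have htt : Tendsto (fun x : Fin (q + 1) → ℝ => (Fin.cons (mono δ (Fin.tail x) * (1 + x 0))
          (Fin.cons (mono δ (Fin.tail x) * (1 + x 0)⁻¹) (Fin.tail x)) : Fin (q + 2) → ℝ)) (𝓝 0) (𝓝 0) := by
        refine tendsto_pi_nhds.2 fun k => ?_
        have := ((IsA.proj k).hyp hδ).continuousAt.tendsto
        have e0 : hyp δ (fun x : Fin (q + 2) → ℝ => x k) 0 = 0 := by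
          have : mono δ (Fin.tail (0 : Fin (q + 1) → ℝ)) = 0 := mono_at_zero hδ
          simp only [hyp, this, zero_mul]
          exact Fin.cases rfl (fun k => Fin.cases rfl (fun k => rfl) k) k
        rw [e0] at this
        exact this
      obtain ⟨γ, H', β', q1, q2, q3, q4⟩ := ih hh h0 (by
        refine germ_cancel (IsA.proj i.succ).analyticAt (hh.hyp hδ).analyticAt
          ((IsA.tail (IsA.mono β)).mul ((IsA.tail (IsA.mono β₀)).mul hK)).analyticAt (proj_ne_zero _) ?_
        filter_upwards [e, hz, htt.eventually eh] with x e1 e2 e3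
        simp only [hyp, Pi.zero_apply] at e1 e2 e3 ⊢
        rw [e2, e1] at e3
        simp only [Fin.cons_succ] at e3
        rw [show x i.succ = Fin.tail x i from rfl, ← e3, mono_add, mono_single]
        ring)
      refine ⟨Pi.single i 1 + γ, H', β', q1, q2, ?_, q4⟩
      filter_upwards [q3, hf0, (onHyp_tendsto hv hY0 hZ0).eventually eh] with a e1 e2 e3
      simp only [onHyp, Pi.zero_apply, Fin.cons_succ] at e1 e2 e3 ⊢
      rw [e2, sub_zero] at e3
      rw [e3, e1, mono_add, mono_single]
      ring
    · refine ih hH (β₀ := Pi.single i 1 + β₀) (fun j hj => ?_) ?_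
      · have : j ≠ i := fun h => hi (h ▸ hj)
        simp [this, h0 j hj]
      · filter_upwards [e] with x hx
        rw [hx, mono_add, mono_add]; ring

end TwoSided

/-- Leading terms along the hyperbola, when the content is supported on the hyperbola. -/
theorem Typ.on_hyp [l.NeBot] (hM : IsHF l M) {y Y : α → ℝ} (hy0 : ∀ᶠ a in l, 0 < y a) (hY : Typ l M y Y)
    (hY0 : Tendsto Y l (𝓝 0)) {q : ℕ} {v : Fin q → α → ℝ} (hv : ∀ j, Inf l M (v j))
    (hvp : ∀ j, ∀ᶠ a in l, 0 < v j a) {δ : Fin q → ℕ} (hδ : δ ≠ 0)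
    (hSY : Tendsto (fun a => mono δ (fun j => v j a) / Y a) l (𝓝 0))
    {H : (Fin (q + 2) → ℝ) → ℝ} (hH : IsA H) {β : Fin q → ℕ} (hβ : ∀ i, δ i = 0 → β i = 0)
    {K : (Fin (q + 1) → ℝ) → ℝ} (hK : IsA K) {s : ℕ} (hs : RM.cf s K 0 ≠ 0)
    (e : hyp δ H =ᶠ[𝓝 0] fun x => mono β (Fin.tail x) * K x) :
    Norm l (PN l M y) (PS l M y) (onHyp v δ Y H) := by
  set S : α → ℝ := fun a => mono δ fun j => v j a with hS
  have hSp : ∀ᶠ a in l, 0 < S a := mono_ev_pos (δ := δ) hvp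
  have hS0 : Tendsto S l (𝓝 0) := mono_tendsto hv hδ
  have hSN : S ∈ NZ l M := NZ.mono hM δ hv hvp
  have hZ0 : Tendsto (fun a => S a ^ 2 / Y a) l (𝓝 0) := by
    have := hS0.mul hSY
    rw [mul_zero] at this
    exact this.congr fun a => by rw [sq, mul_div_assoc]
  -- a point of the hyperbola where the leading coefficient does not vanish
  have hKne : ∃ᶠ t in 𝓝 (0 : ℝ), K (Fin.cons t 0) ≠ 0 := by
    intro h
    apply hs
    have : (fun t => K (Fin.cons t 0)) =ᶠ[𝓝 0] fun _ => 0 := h.mono fun t ht => not_not.1 ht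
    rw [RM.cf, (this.iteratedDeriv_eq s)]
    simp
  have hline := (eventually_cons_line (q := q) (e.eventually_nhds.and hK.analyticAt.eventually_analyticAt)).self_of_nhds
  obtain ⟨t0, ⟨hK0, ht1, ht2⟩, ht3⟩ := ((hKne.and_eventually hline).and_eventually
    (Metric.ball_mem_nhds (0 : ℝ) (by norm_num : (0 : ℝ) < 1 / 2))).exists
  have ht3 : |t0| < 1 / 2 := by simpa using ht3
  obtain ⟨ht4, ht5⟩ := abs_lt.1 ht3
  have hct : Tendsto (fun a => (Fin.cons t0 fun j => v j a : Fin (q + 1) → ℝ)) l (𝓝 (Fin.cons t0 0)) := by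
    refine tendsto_pi_nhds.2 fun i => Fin.cases tendsto_const_nhds (fun k => (hv k).2) i
  set Y₀ : α → ℝ := fun a => S a * (1 + t0) with hY₀
  have hY₀Y : ∀ᶠ a in l, 0 ≤ Y₀ a ∧ Y₀ a ≤ Y a := by
    filter_upwards [hSp, hY.pos, hSY.eventually_lt_const (by norm_num : (0 : ℝ) < 1 / 2)] with a h1 h2 h3
    rw [div_lt_iff₀ h2] at h3
    change S a < _ at h3
    refine ⟨mul_nonneg h1.le (by linarith), ?_⟩
    simp only [hY₀]
    nlinarith
  have hY₀0 : Tendsto Y₀ l (𝓝 0) := by simpa using hS0.mul_const (1 + t0)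
  have hZ₀0 : Tendsto (fun a => S a ^ 2 / Y₀ a) l (𝓝 0) := by
    have := hS0.mul_const (1 + t0)⁻¹
    rw [zero_mul] at this
    refine this.congr' ?_
    filter_upwards [hSp] with a h1
    have : 1 + t0 ≠ 0 := by linarith
    simp only [hY₀]; field_simp
  set D := ∑ i, β i with hD
  set κ := |K (Fin.cons t0 0)| / 2 with hκ
  have hκ0 : 0 < κ := half_pos (abs_pos.2 hK0)
  have hlow : ∀ᶠ a in l, κ * S a ^ D ≤ |onHyp v δ Y₀ H a| := by
    filter_upwards [hct.eventually ht1, (ht2.continuousAt.tendsto.comp hct).abs.eventually_const_lt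
      (half_lt_self (abs_pos.2 hK0)), eventually_all.2 hvp,
      eventually_all.2 fun j => (hv j).2.eventually_lt_const one_pos, hSp] with a h1 h2 h3 h4 h5
    have e1 : onHyp v δ Y₀ H a = mono β (fun j => v j a) * K (Fin.cons t0 fun j => v j a) := by
      have h1 : _ = _ := h1
      simp only [Fin.tail_cons] at h1
      rw [← h1]
      simp only [hyp, onHyp, Fin.cons_zero, Fin.tail_cons]
      have : 1 + t0 ≠ 0 := by linarith
      congr 3
      simp only [hY₀]
      change S a ^ 2 / _ = S a * _
      have := h5.ne'
      field_simp
    rw [e1, abs_mul, abs_of_pos (mono_pos β h3), mul_comm]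
    refine mul_le_mul ?_ (show κ ≤ |K _| from h2.le) hκ0.le (mono_pos β h3).le
    simp only [hS, mono]
    rw [← Finset.prod_pow]
    refine Finset.prod_le_prod (fun i _ => by have := (h3 i).le; positivity) fun i _ => ?_
    rw [← pow_mul]
    refine pow_le_pow_of_le_one (h3 i).le (h4 i).le ?_
    by_cases hi : δ i = 0
    · simp [hβ i hi]
    · calc β i ≤ D := Finset.single_le_sum (f := β) (fun _ _ => Nat.zero_le _) (Finset.mem_univ i)
        _ ≤ δ i * D := Nat.le_mul_of_pos_left _ (Nat.pos_of_ne_zero hi)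
  -- expansion in the second coordinate
  have hHs : IsA fun x : Fin (q + 2) → ℝ => H (Fin.cons (x 1) (Fin.cons (x 0) (fun j => x j.succ.succ))) :=
    hH.comp_cons₂ (h := fun j x => x j.succ.succ) (IsA.proj 1) rfl (IsA.proj 0) rfl (fun j => IsA.proj _) fun _ => rfl
  set Hs : (Fin (q + 2) → ℝ) → ℝ := fun x => H (Fin.cons (x 1) (Fin.cons (x 0) (fun j => x j.succ.succ))) with hHsd
  obtain ⟨U, hU, hUe⟩ := hHs.taylor (D + 1)
  set G : (Fin (q + 1) → ℝ) → ℝ := fun x => ∑ i ∈ Finset.range (D + 1),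
    RM.cf i Hs x * (x 0 ^ (D + 1 - i) * mono δ (Fin.tail x) ^ (2 * i)) with hGd
  have hG : IsA G := IsA.sum _ fun i _ => (hHs.cf i).mul (((IsA.proj 0).pow _).mul ((IsA.tail (IsA.mono δ)).pow _))
  let u : (α → ℝ) → α → ℝ := fun Y a => U (Fin.cons (S a ^ 2 / Y a) (Fin.cons (Y a) fun j => v j a))
  have hexp : ∀ Y : α → ℝ, (∀ᶠ a in l, 0 < Y a) → Tendsto Y l (𝓝 0) → Tendsto (fun a => S a ^ 2 / Y a) l (𝓝 0) →
      (∀ᶠ a in l, Y a ^ (D + 1) * onHyp v δ Y H a = G (Fin.cons (Y a) fun j => v j a) + S a ^ (2 * (D + 1)) * u Y a) ∧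
      Tendsto (u Y) l (𝓝 (U 0)) := by
    intro Y hYp hY0 hZ0
    have htt : Tendsto (fun a => (Fin.cons (S a ^ 2 / Y a) (Fin.cons (Y a) fun j => v j a) : Fin (q + 2) → ℝ)) l (𝓝 0) :=
      tendsto_cons.comp (Tendsto.prodMk_nhds hZ0 (tendsto_cons.comp (Tendsto.prodMk_nhds hY0 (tendsto_inf hv))))
    refine ⟨?_, hU.continuousAt.tendsto.comp htt⟩
    filter_upwards [htt.eventually hUe, hYp] with a h1 h2
    simp only [Fin.cons_zero, Fin.tail_cons] at h1
    have e1 : onHyp v δ Y H a = Hs (Fin.cons (S a ^ 2 / Y a) (Fin.cons (Y a) fun j => v j a)) := by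
      simp only [Hs, onHyp, Fin.cons_zero, Fin.cons_succ]
      rfl
    have h2 := h2.ne'
    rw [e1, h1, mul_add, Finset.mul_sum]
    congr 1
    · refine Finset.sum_congr rfl fun i hi => ?_
      have hi : i ≤ D + 1 := (Finset.mem_range.1 hi).le
      simp only [Fin.cons_zero, Fin.tail_cons]
      change _ = _ * (_ * S a ^ (2 * i))
      rw [mul_left_comm]
      congr 1
      rw [div_pow, ← pow_mul, ← Nat.sub_add_cancel hi, pow_add, Nat.sub_add_cancel hi]
      field_simp
    · rw [← mul_assoc, div_pow, ← pow_mul]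
      field_simp
      rfl
  obtain ⟨hexpY, huY⟩ := hexp Y hY.pos hY0 hZ0
  have hY₀p : ∀ᶠ a in l, 0 < Y₀ a := hSp.mono fun a h => mul_pos h (by linarith)
  obtain ⟨hexp₀, hu₀⟩ := hexp Y₀ hY₀p hY₀0 hZ₀0
  set κ' := κ / 2 ^ (D + 1) / 2 with hκ'
  have hκ'0 : 0 < κ' := by positivity
  have hGlow : ∀ᶠ a in l, κ' * S a ^ (2 * D + 1) ≤ |G (Fin.cons (Y₀ a) fun j => v j a)| := by
    have hsm : Tendsto (fun a => S a * |u Y₀ a|) l (𝓝 0) := by simpa using hS0.mul hu₀.abs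
    filter_upwards [hexp₀, hlow, hSp, hsm.eventually_lt_const hκ'0] with a h1 h2 h3 h4
    have h5 : (S a / 2) ^ (D + 1) ≤ Y₀ a ^ (D + 1) :=
      pow_le_pow_left₀ (by positivity) (by simp only [hY₀]; nlinarith) _
    have h6 : 0 < Y₀ a := mul_pos h3 (by linarith)
    have h7 : (S a / 2) ^ (D + 1) * (κ * S a ^ D) ≤ |G (Fin.cons (Y₀ a) fun j => v j a) + S a ^ (2 * (D + 1)) * u Y₀ a| := by
      rw [← h1, abs_mul, abs_of_pos (pow_pos h6 _)]
      exact mul_le_mul h5 h2 (by positivity) (by positivity)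
    have h8 := abs_add_le (G (Fin.cons (Y₀ a) fun j => v j a)) (S a ^ (2 * (D + 1)) * u Y₀ a)
    have h9 : |S a ^ (2 * (D + 1)) * u Y₀ a| ≤ κ' * S a ^ (2 * D + 1) := by
      rw [abs_mul, abs_of_pos (pow_pos h3 _), show 2 * (D + 1) = (2 * D + 1) + 1 by ring, pow_succ, mul_assoc, mul_comm]
      exact mul_le_mul_of_nonneg_right h4.le (by positivity)
    have h10 : (S a / 2) ^ (D + 1) * (κ * S a ^ D) = 2 * (κ' * S a ^ (2 * D + 1)) := by
      rw [hκ', div_pow, show 2 * D + 1 = D + 1 + D by ring, pow_add (S a) (D + 1) D]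
      field_simp
    linarith
  rcases hY.one_sided hM hy0 hY0 hG hv with h | ⟨c, hc, g, r, hg1, hg2, hr, hge, hdom⟩
  · obtain ⟨a, h1, h2, h3⟩ := ((h Y₀ hY₀0).and (hGlow.and hSp)).exists
    simp only [Pi.zero_apply] at h1
    rw [h1, abs_zero] at h2
    exact absurd h2 (not_le.2 (by positivity))
  obtain ⟨C, hC⟩ := hdom Y₀ hY₀Y
  have hcne := PN.ne hy0 hc
  have hSpow : ∀ k : ℕ, (fun a => S a ^ k) ∈ NZ l M := fun k =>
    ⟨hM.pow hSN.1 k, hSp.mono fun a h => (pow_pos h k).ne'⟩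
  have hw : (fun a => S a ^ (2 * (D + 1)) / c a) ∈ PS l M y := by
    refine ⟨PN.div hM hy0 (PN.of_nz (hSpow _)) hc, ?_⟩
    have h0 : Tendsto (fun a => S a * (C / κ')) l (𝓝 0) := by simpa using hS0.mul_const (C / κ')
    refine squeeze_zero_norm' ?_ h0
    filter_upwards [hC, hGlow, hSp, hcne] with a h1 h2 h3 h4
    rw [Real.norm_eq_abs, abs_div, abs_of_pos (pow_pos h3 _), div_le_iff₀ (abs_pos.2 h4),
      show 2 * (D + 1) = (2 * D + 1) + 1 by ring, pow_succ, mul_comm, mul_assoc]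
    refine mul_le_mul_of_nonneg_left ?_ h3.le
    rw [div_mul_eq_mul_div, le_div_iff₀ hκ'0, mul_comm]
    exact h2.trans h1
  have hYPN : Y ∈ PN l M y := by
    simpa using hY.mem (b := fun _ => 1) ⟨hM.const 1, Eventually.of_forall fun _ => one_ne_zero⟩ 1
  have hZPN : (fun a => S a ^ 2 / Y a) ∈ PN l M y := PN.div hM hy0 (PN.of_nz (hSpow 2)) hYPN
  have hcons : ∀ a, (Fin.cons (S a ^ 2 / Y a) (Fin.cons (Y a) fun j => v j a) : Fin (q + 2) → ℝ) =
      fun i => (Fin.cons (fun a => S a ^ 2 / Y a) (Fin.cons Y v) : Fin (q + 2) → α → ℝ) i a := fun a => by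
    funext i; exact Fin.cases rfl (fun i => Fin.cases rfl (fun k => rfl) i) i
  have huR : Rep l (PS l M y) (u Y) := by
    simp only [u, hcons]
    refine Rep.comp PS.tendsto hU (fun i => ?_) fun i => ?_
    · exact Fin.cases (Rep.of_mem ⟨hZPN, hZ0⟩) (fun i => Fin.cases (Rep.of_mem ⟨hYPN, hY0⟩)
        (fun k => PS.of_inf hM (hv k)) i) i
    · exact Fin.cases hZ0 (fun i => Fin.cases hY0 (fun k => (hv k).2) i) i
  have hYinv : (fun a => (Y a ^ (D + 1))⁻¹) ∈ PN l M y := by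
    have := hY.mem (b := fun _ => 1) ⟨hM.const 1, Eventually.of_forall fun _ => one_ne_zero⟩ (-((D + 1 : ℕ) : ℤ))
    refine PN.congr this (Eventually.of_forall fun a => ?_)
    simp only [one_mul, zpow_neg, zpow_natCast]
  refine ⟨_, PN.mul hM hy0 hYinv hc, fun a => g a + S a ^ (2 * (D + 1)) / c a * u Y a, r + 0 * U 0,
    hg1.add PS.tendsto ((Rep.of_mem hw).mul PS.tendsto huR), hg2.add (hw.2.mul huY), by simpa using hr, ?_⟩
  filter_upwards [hexpY, hge, hcne, hY.pos] with a h1 h2 h3 h4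
  have h5 : onHyp v δ Y H a = (Y a ^ (D + 1))⁻¹ * (G (Fin.cons (Y a) fun j => v j a) + S a ^ (2 * (D + 1)) * u Y a) := by
    rw [← h1, inv_mul_cancel_left₀ (pow_pos h4 _).ne']
  rw [h5, h2]
  field_simp

theorem Typ.mul_left (hM : IsHF l M) {y Y b : α → ℝ} (hY : Typ l M y Y) (hb : b ∈ M) (hbp : ∀ᶠ a in l, 0 < b a) :
    Typ l M y fun a => b a * Y a := by
  have hbk : ∀ {c : α → ℝ}, c ∈ NZ l M → ∀ k : ℤ, (fun a => c a * b a ^ k) ∈ NZ l M := fun hc k =>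
    NZ.mul hM hc ⟨hM.zpow hb k, hbp.mono fun a h => (zpow_pos h k).ne'⟩
  have he : ∀ (c : α → ℝ) (k : ℤ) a, c a * (b a * Y a) ^ k = c a * b a ^ k * Y a ^ k := fun c k a => by
    rw [mul_zpow, mul_assoc]
  refine ⟨?_, fun {c} hc k => ?_, fun {c} hc k hk => ?_⟩
  · filter_upwards [hbp, hY.pos] with a h1 h2 using mul_pos h1 h2
  · simp only [he c k]
    exact hY.mem (hbk hc k) k
  · simp only [he c k]
    exact hY.dich (hbk hc k) hk

/-- Two-sided expansions: leading terms of functions of `Y` and `s² / Y`. -/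
theorem Typ.two_sided [l.NeBot] (hM : IsHF l M) {y Y s : α → ℝ} (hy0 : ∀ᶠ a in l, 0 < y a) (hY : Typ l M y Y)
    (hY0 : Tendsto Y l (𝓝 0)) (hs : Inf l M s) (hsp : ∀ᶠ a in l, 0 < s a)
    (hsY : Tendsto (fun a => s a / Y a) l (𝓝 0)) {q : ℕ} {w : Fin q → α → ℝ} (hw : ∀ j, Inf l M (w j))
    {H : (Fin (q + 2) → ℝ) → ℝ} (hH : IsA H) :
    (fun a => H (Fin.cons (Y a) (Fin.cons (s a ^ 2 / Y a) fun j => w j a))) =ᶠ[l] 0 ∨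
      Norm l (PN l M y) (PS l M y) fun a => H (Fin.cons (Y a) (Fin.cons (s a ^ 2 / Y a) fun j => w j a)) := by
  set Φ : (Fin (q + 2) → ℝ) → ℝ := fun x =>
    H (Fin.cons (x 1 * (1 + x 0)) (Fin.cons (x 1 * (1 + x 0)⁻¹) fun j => x j.succ.succ)) with hΦ
  have hΦA : IsA Φ := hH.comp_cons₂ (h := fun j x => x j.succ.succ) ((IsA.proj 1).mul ((IsA.const 1).add (IsA.proj 0)))
    (by simp) ((IsA.proj 1).mul (IsA.one_add_inv 0)) (by simp) (fun j => IsA.proj _) fun _ => rfl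
  have hws : ∀ j, Inf l M ((Fin.cons s w : Fin (q + 1) → α → ℝ) j) := fun j => Fin.cases hs hw j
  obtain ⟨σ, v, hC, hvp, ⟨δ, U, hU, hU0, hUe⟩, hP⟩ := (lu hM (q + 1)).marked hws (IsA.proj 0) (by
    filter_upwards [hsp] with a h using h.ne') (G := fun j => RM.cf j Φ) fun j => hΦA.cf j
  have hsσ : ∀ᶠ a in l, s a = mono δ (fun j => v j a) * U fun j => v j a := by
    filter_upwards [hC.eq 0, (tendsto_inf hC.inf).eventually hUe] with a h1 h2
    rw [← h2]; exact h1
  have hUl : Tendsto (fun a => U fun j => v j a) l (𝓝 (U 0)) := hU.continuousAt.tendsto.comp (tendsto_inf hC.inf)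
  have hUp : ∀ᶠ a in l, 0 < U fun j => v j a := by
    filter_upwards [hsσ, hsp, mono_ev_pos (δ := δ) hvp] with a h1 h2 h3
    rw [h1] at h2
    exact pos_of_mul_pos_right h2 h3.le
  have hUM : (fun a => U fun j => v j a) ∈ M := hM.anal hU (fun j => (hC.inf j).1) fun j => (hC.inf j).2
  set Y' : α → ℝ := fun a => (U fun j => v j a)⁻¹ * Y a with hY'
  have hYT : Typ l M y Y' := hY.mul_left hM (hM.inv hUM) (hUp.mono fun a h => inv_pos.2 h)
  have hY'0 : Tendsto Y' l (𝓝 0) := by simpa using (hUl.inv₀ hU0).mul hY0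
  have hSY : Tendsto (fun a => mono δ (fun j => v j a) / Y' a) l (𝓝 0) := by
    refine hsY.congr' ?_
    filter_upwards [hsσ, hUp] with a h1 h2
    rw [h1]
    simp only [hY']
    have := h2.ne'
    field_simp
  have hδ : δ ≠ 0 := by
    rintro rfl
    have h1 : Tendsto s l (𝓝 (U 0)) := hUl.congr' (hsσ.mono fun a h => by rw [h, mono_zero, one_mul])
    exact hU0 (tendsto_nhds_unique h1 hs.2)
  set H' : (Fin (q + 3) → ℝ) → ℝ := fun x => H (Fin.cons ((U fun j => x j.succ.succ) * x 0)
    (Fin.cons ((U fun j => x j.succ.succ) * x 1) fun j => σ j.succ fun j => x j.succ.succ)) with hH'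
  have hpr : ∀ j : Fin (q + 1), IsA fun x : Fin (q + 3) → ℝ => x j.succ.succ := fun j => IsA.proj _
  have hU2 : IsA fun x : Fin (q + 3) → ℝ => U fun j => x j.succ.succ := hU.comp hpr fun _ => rfl
  have hH'A : IsA H' := hH.comp_cons₂ (h := fun j x => σ j.succ fun j => x j.succ.succ)
    (hU2.mul (IsA.proj 0)) (by simp) (hU2.mul (IsA.proj 1)) (by simp)
    (fun j => (hC.isA j.succ).comp hpr fun _ => rfl) fun j => hC.zero j.succ
  have hval : (fun a => H (Fin.cons (Y a) (Fin.cons (s a ^ 2 / Y a) fun j => w j a))) =ᶠ[l] onHyp v δ Y' H' := by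
    filter_upwards [hsσ, hUp, hC.eq'] with a h1 h2 h3
    have h2 := h2.ne'
    simp only [onHyp, hH', Fin.cons_succ, Fin.cons_zero, Fin.cons_one, hY']
    congr 2
    · field_simp
    · congr 1
      · rw [h1]; field_simp
      · funext j
        exact congrFun h3 j.succ
  have hhyp : hyp δ H' =ᶠ[𝓝 0] fun x => Φ (Fin.cons (x 0) fun i => σ i (Fin.tail x)) := by
    have ht : Tendsto (fun x : Fin (q + 2) → ℝ => Fin.tail x) (𝓝 0) (𝓝 0) := tendsto_tail
    filter_upwards [ht.eventually hUe] with x hx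
    simp only [hyp, hH', hΦ, Fin.cons_succ, Fin.cons_zero, Fin.cons_one]
    have hx : σ 0 (Fin.tail x) = mono δ (Fin.tail x) * U (Fin.tail x) := hx
    change H (Fin.cons (U (Fin.tail x) * _) (Fin.cons (U (Fin.tail x) * _) fun j => σ j.succ (Fin.tail x))) =
      H (Fin.cons (σ 0 (Fin.tail x) * _) (Fin.cons (σ 0 (Fin.tail x) * _) fun j => σ j.succ (Fin.tail x)))
    rw [hx]
    congr 2
    · ring
    · congr 1; ring
  have hhA := hH'A.hyp hδ
  have hcf : ∀ j, RM.cf j (hyp δ H') =ᶠ[𝓝 0] fun x => RM.cf j Φ fun i => σ i x := fun j => by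
    filter_upwards [RM.cf_congr hhyp j] with x hx
    rw [hx]; exact cf_comp_tail (fun w i => σ i w) Φ j x
  have hYp := hYT.pos
  have hZ0 : Tendsto (fun a => mono δ (fun j => v j a) ^ 2 / Y' a) l (𝓝 0) := by
    have := (mono_tendsto hC.inf hδ).mul hSY
    rw [mul_zero] at this
    exact this.congr fun a => by rw [sq, mul_div_assoc]
  rcases hP with hP | ⟨β, B, hB, s0, hs0⟩
  · left
    exact hval.trans (onHyp_zero hC.inf hvp hδ hYp hY'0 hZ0 hH'A
      (germ_zero_of_cf hhA fun j => (hcf j).trans (hP j)))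
  right
  obtain ⟨K, hK, eK⟩ := div_mono β hhA fun j => ⟨B j, (hB j).1, (hcf j).trans (hB j).2⟩
  have hK0 : RM.cf s0 K 0 ≠ 0 := by
    have : RM.cf s0 K =ᶠ[𝓝 0] B s0 := by
      refine germ_cancel (IsA.mono β).analyticAt (hK.cf s0).analyticAt (hB s0).1.analyticAt (mono_germ_ne β) ?_
      filter_upwards [RM.cf_congr eK s0, (hB s0).2, hcf s0] with w q1 q2 q3
      rw [← cf_tail_mul, ← q1, q3, q2]
    rwa [this.self_of_nhds]
  obtain ⟨γ, H₂, β', h1, h2, h3, h4⟩ := onHyp_reduce hC.inf hvp hδ hYp hY'0 hZ0 β hK hH'A (β₀ := 0) (fun _ _ => rfl)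
    (eK.trans (Eventually.of_forall fun x => by simp))
  exact ((hYT.on_hyp hM hy0 hY'0 hC.inf hvp hδ hSY h1 h2 hK hK0 h4).mul_left (PN.mul hM hy0)
    (PN.of_nz (NZ.mono hM γ hC.inf hvp))).congr (hval.trans h3)

theorem IsHF.abs (hM : IsHF l M) {f : α → ℝ} (hf : f ∈ M) : (fun a => |f a|) ∈ M := by
  rcases hM.tri hf with h | h | h
  · exact hM.congr (hM.const 0) (h.mono fun a h => by simp [h])
  · exact hM.congr hf (h.mono fun a h => (abs_of_pos h).symm)
  · exact hM.congr (hM.neg hf) (h.mono fun a h => (abs_of_neg h).symm)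

theorem Typ.inv (hM : IsHF l M) {y Y : α → ℝ} (hY : Typ l M y Y) : Typ l M y fun a => (Y a)⁻¹ := by
  have e : ∀ (c : α → ℝ) (k : ℤ), (fun a => c a * (Y a)⁻¹ ^ k) = fun a => c a * Y a ^ (-k) := fun c k =>
    funext fun a => by rw [inv_zpow, zpow_neg]
  refine ⟨hY.pos.mono fun a h => inv_pos.2 h, fun hc k => ?_, fun {c} hc k hk => ?_⟩
  · rw [e]; exact hY.mem hc _
  · have := hY.dich hc (neg_ne_zero.2 hk)
    simp only [congrFun (e c k)]
    exact this

theorem exists_limit_of_abs_le [l.NeBot] (hM : IsHF l M) {f : α → ℝ} (hf : f ∈ M) {C : ℝ}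
    (h : ∀ᶠ a in l, |f a| ≤ C) : ∃ r, Tendsto f l (𝓝 r) := by
  rcases hM.limit hf with h1 | h1 | h1
  · exact h1
  · obtain ⟨a, h2, h3⟩ := (h.and (h1.eventually_gt_atTop C)).exists
    exact absurd h3 (not_lt.2 ((le_abs_self _).trans h2))
  · obtain ⟨a, h2, h3⟩ := (h.and (h1.eventually_lt_atBot (-C))).exists
    exact absurd h3 (not_lt.2 (neg_le_of_abs_le h2))

theorem exists_scale [l.NeBot] (hM : IsHF l M) {Z : α → ℝ} (hZ : ∀ᶠ a in l, 0 < Z a) {n : ℕ} {b : Fin n → α → ℝ}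
    {k : Fin n → ℤ} (hb : ∀ i, b i ∈ NZ l M) (h0 : ∀ i, Tendsto (fun a => b i a * Z a ^ k i) l (𝓝 0))
    (hk : ∃ i, 0 < k i) :
    ∃ Γ ∈ M, (∀ᶠ a in l, 0 < Γ a) ∧ Tendsto (fun a => Γ a * Z a) l (𝓝 0) ∧
      ∀ i, 0 < k i → ∃ (r : ℝ) (w : α → ℝ), Inf l M w ∧
        ∀ᶠ a in l, b i a * Z a ^ k i = (r + w a) * (Γ a * Z a) ^ (k i).toNat := by
  classical
  let T : Finset (Fin n) := Finset.univ.filter fun i => 0 < k i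
  have hkn : ∀ i ∈ T, (k i).toNat ≠ 0 ∧ ((k i).toNat : ℤ) = k i := fun i hi => by
    have := (Finset.mem_filter.1 hi).2
    constructor <;> omega
  let c : Fin n → α → ℝ := fun i a => |b i a| ^ (((k i).toNat : ℝ)⁻¹)
  have hbp : ∀ i, ∀ᶠ a in l, 0 < |b i a| := fun i => (hb i).2.mono fun a h => abs_pos.2 h
  have hc : ∀ i ∈ T, c i ∈ M := fun i hi => hM.root (hM.abs (hb i).1) (hbp i) (hkn i hi).1
  have hcp : ∀ i, ∀ᶠ a in l, 0 < c i a := fun i => (hbp i).mono fun a h => Real.rpow_pos_of_pos h _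
  let Γ : α → ℝ := fun a => ∑ i ∈ T, c i a
  have hΓM : Γ ∈ M := hM.sum T hc
  have hcle : ∀ᶠ a in l, ∀ i ∈ T, c i a ≤ Γ a := by
    filter_upwards [eventually_all.2 hcp] with a h i hi
    exact Finset.single_le_sum (f := fun i => c i a) (fun j _ => (h j).le) hi
  obtain ⟨i0, hi0⟩ := hk
  have hi0T : i0 ∈ T := Finset.mem_filter.2 ⟨Finset.mem_univ _, hi0⟩
  have hΓp : ∀ᶠ a in l, 0 < Γ a := by
    filter_upwards [hcle, hcp i0] with a h1 h2
    exact h2.trans_le (h1 i0 hi0T)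
  refine ⟨Γ, hΓM, hΓp, ?_, fun i hi => ?_⟩
  · have : Tendsto (fun a => ∑ i ∈ T, c i a * Z a) l (𝓝 (∑ i ∈ T, 0)) := by
      refine tendsto_finsetSum _ fun i hi => ?_
      have h1 := ((h0 i).abs).rpow_const (p := (((k i).toNat : ℝ)⁻¹)) (Or.inr (by positivity))
      have h2 : (((k i).toNat : ℝ)⁻¹) ≠ 0 := inv_ne_zero (Nat.cast_ne_zero.2 (hkn i hi).1)
      rw [abs_zero, Real.zero_rpow h2] at h1
      refine h1.congr' ?_
      filter_upwards [hZ] with a ha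
      rw [abs_mul, abs_of_pos (zpow_pos ha _), Real.mul_rpow (abs_nonneg _) (zpow_pos ha _).le]
      congr 1
      conv_lhs => rw [← (hkn i hi).2, zpow_natCast]
      exact Real.pow_rpow_inv_natCast ha.le (hkn i hi).1
    rw [Finset.sum_const_zero] at this
    exact this.congr fun a => by rw [← Finset.sum_mul]
  · have hiT : i ∈ T := Finset.mem_filter.2 ⟨Finset.mem_univ _, hi⟩
    obtain ⟨h1, h2⟩ := hkn i hiT
    have hg : (fun a => b i a / Γ a ^ (k i).toNat) ∈ M := hM.div (hb i).1 (hM.pow hΓM _)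
    obtain ⟨r, hr⟩ := exists_limit_of_abs_le hM hg (C := 1) (by
      filter_upwards [hcle, hΓp, hcp i] with a h3 h4 h5
      rw [abs_div, abs_of_pos (pow_pos h4 _), div_le_one (pow_pos h4 _)]
      calc |b i a| = c i a ^ (k i).toNat := (Real.rpow_inv_natCast_pow (abs_nonneg _) h1).symm
        _ ≤ _ := pow_le_pow_left₀ h5.le (h3 i hiT) _)
    refine ⟨r, fun a => b i a / Γ a ^ (k i).toNat - r, ⟨hM.sub hg (hM.const r), by simpa using hr.sub_const r⟩, ?_⟩
    filter_upwards [hΓp] with a ha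
    have : Z a ^ k i = Z a ^ (k i).toNat := by rw [← zpow_natCast, h2]
    rw [this]
    field_simp
    ring

section
variable [l.NeBot] (hM : IsHF l M) {y Z : α → ℝ} (hy0 : ∀ᶠ a in l, 0 < y a) (hZ : Typ l M y Z) {n : ℕ}
  {b : Fin n → α → ℝ} {k : Fin n → ℤ} (hb : ∀ i, b i ∈ NZ l M)
  (h0 : ∀ i, Tendsto (fun a => b i a * Z a ^ k i) l (𝓝 0)) {Φ : (Fin n → ℝ) → ℝ} (hΦ : IsA Φ)
include hM hy0 hZ hb h0 hΦ

omit [l.NeBot] hy0 hZ in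
theorem norm_of_all_zero (hk : ∀ i, k i = 0) : (fun a => Φ fun i => b i a * Z a ^ k i) =ᶠ[l] 0 ∨
    Norm l (PN l M y) (PS l M y) fun a => Φ fun i => b i a * Z a ^ k i := by
  have e : ∀ i, (fun a => b i a * Z a ^ k i) = b i := fun i => funext fun a => by simp [hk i]
  have hf : (fun a => Φ fun i => b i a * Z a ^ k i) ∈ M :=
    hM.anal hΦ (t := fun i a => b i a * Z a ^ k i) (fun i => by rw [e]; exact (hb i).1) h0
  have key : (∀ᶠ a in l, (Φ fun i => b i a * Z a ^ k i) ≠ 0) →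
      Norm l (PN l M y) (PS l M y) fun a => Φ fun i => b i a * Z a ^ k i := fun h =>
    ⟨_, PN.of_nz ⟨hf, h⟩, fun _ => 1, 1, Rep.const 1, tendsto_const_nhds, one_ne_zero,
      Eventually.of_forall fun a => (mul_one _).symm⟩
  rcases hM.tri hf with h | h | h
  · exact Or.inl h
  · exact Or.inr (key (h.mono fun _ h => h.ne'))
  · exact Or.inr (key (h.mono fun _ h => h.ne))

theorem norm_of_nonneg (hk : ∀ i, 0 ≤ k i) : (fun a => Φ fun i => b i a * Z a ^ k i) =ᶠ[l] 0 ∨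
    Norm l (PN l M y) (PS l M y) fun a => Φ fun i => b i a * Z a ^ k i := by
  by_cases hex : ∃ i, 0 < k i
  · obtain ⟨Γ, hΓ, hΓp, hΓ0, hΓe⟩ := exists_scale hM hZ.pos hb h0 hex
    have : ∀ i, ∃ (r : ℝ) (w : α → ℝ), Inf l M w ∧ (k i = 0 → r = 0) ∧
        ∀ᶠ a in l, b i a * Z a ^ k i = (r + w a) * (Γ a * Z a) ^ (k i).toNat := fun i => by
      rcases (hk i).lt_or_eq with h | h
      · obtain ⟨r, w, hw, e⟩ := hΓe i h
        exact ⟨r, w, hw, fun h' => absurd h' h.ne', e⟩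
      · have h1 := h0 i
        rw [← h] at h1 ⊢
        simp only [zpow_zero, mul_one] at h1
        exact ⟨0, b i, ⟨(hb i).1, h1⟩, fun _ => rfl, Eventually.of_forall fun a => by simp⟩
    choose r w hw hr he using this
    let G : (Fin (n + 1) → ℝ) → ℝ := fun x => Φ fun i => (r i + x i.succ) * x 0 ^ (k i).toNat
    have hG : IsA G := hΦ.comp (h := fun i x => (r i + x i.succ) * x 0 ^ (k i).toNat)
      (fun i => ((IsA.const _).add (IsA.proj _)).mul ((IsA.proj 0).pow _)) fun i => by
        rcases (hk i).lt_or_eq with h | h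
        · have : (k i).toNat ≠ 0 := by omega
          simp [this]
        · simp [hr i h.symm]
    have e : (fun a => Φ fun i => b i a * Z a ^ k i) =ᶠ[l] fun a => G (Fin.cons (Γ a * Z a) fun j => w j a) := by
      filter_upwards [eventually_all.2 he] with a h
      simp only [G, Fin.cons_zero, Fin.cons_succ, h]
    rcases (hZ.mul_left hM hΓ hΓp).one_sided hM hy0 hΓ0 hG hw with h | ⟨c, hc, g, r, h1, h2, h3, h4, -⟩
    · exact Or.inl (e.trans (h _ hΓ0))
    · exact Or.inr ⟨c, hc, g, r, h1, h2, h3, e.trans h4⟩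
  · refine norm_of_all_zero hM hb h0 hΦ fun i => ?_
    have := not_exists.1 hex i
    have := hk i
    omega

omit hb h0 in
theorem norm_of_mixed {Γ Δ s : α → ℝ} {r : Fin n → ℝ} {w : Fin n → α → ℝ} (hw : ∀ i, Inf l M (w i))
    (hΓ : Γ ∈ M) (hΓp : ∀ᶠ a in l, 0 < Γ a) (hΓ0 : Tendsto (fun a => Γ a * Z a) l (𝓝 0))
    (hs : Inf l M s) (hsp : ∀ᶠ a in l, 0 < s a)
    (hs2 : ∀ᶠ a in l, s a ^ 2 = Γ a * Δ a) (hsY : Tendsto (fun a => s a / (Γ a * Z a)) l (𝓝 0))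
    (hr : ∀ i, k i = 0 → r i = 0)
    (he1 : ∀ i, 0 ≤ k i → ∀ᶠ a in l, b i a * Z a ^ k i = (r i + w i a) * (Γ a * Z a) ^ (k i).toNat)
    (he2 : ∀ i, k i < 0 → ∀ᶠ a in l, b i a * Z a ^ k i = (r i + w i a) * (Δ a * (Z a)⁻¹) ^ (-k i).toNat) :
    (fun a => Φ fun i => b i a * Z a ^ k i) =ᶠ[l] 0 ∨
    Norm l (PN l M y) (PS l M y) fun a => Φ fun i => b i a * Z a ^ k i := by
  let h : Fin n → (Fin (n + 2) → ℝ) → ℝ := fun i x =>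
    (r i + x i.succ.succ) * if 0 ≤ k i then x 0 ^ (k i).toNat else x (Fin.succ 0) ^ (-k i).toNat
  have hG : IsA fun x => Φ fun i => h i x := by
    refine hΦ.comp (fun i => ((IsA.const _).add (IsA.proj _)).mul ?_) fun i => ?_
    · split_ifs
      exacts [(IsA.proj _).pow _, (IsA.proj _).pow _]
    · rcases lt_trichotomy (k i) 0 with h1 | h1 | h1
      · have : (-k i).toNat ≠ 0 := by omega
        simp [h, this, not_le.2 h1]
      · simp [h, hr i h1]
      · have : (k i).toNat ≠ 0 := by omega
        simp [h, this, h1.le]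
  have e : (fun a => Φ fun i => b i a * Z a ^ k i) =ᶠ[l] fun a => (fun x => Φ fun i => h i x)
      (Fin.cons (Γ a * Z a) (Fin.cons (s a ^ 2 / (Γ a * Z a)) fun j => w j a) : Fin (n + 2) → ℝ) := by
    have he : ∀ i, ∀ᶠ a in l, b i a * Z a ^ k i = h i
        (Fin.cons (Γ a * Z a) (Fin.cons (s a ^ 2 / (Γ a * Z a)) fun j => w j a) : Fin (n + 2) → ℝ) := fun i => by
      by_cases hk : 0 ≤ k i
      · filter_upwards [he1 i hk] with a h1
        simp only [h, if_pos hk, Fin.cons_zero, Fin.cons_succ, h1]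
      · filter_upwards [he2 i (not_le.1 hk), hs2, hΓp, hZ.pos] with a h1 h2 h3 h4
        have : s a ^ 2 / (Γ a * Z a) = Δ a * (Z a)⁻¹ := by rw [h2]; field_simp
        simp only [h, if_neg hk, Fin.cons_zero, Fin.cons_succ, h1, this]
    filter_upwards [eventually_all.2 he] with a h1
    simp only [h1]
  exact ((hZ.mul_left hM hΓ hΓp).two_sided hM hy0 hΓ0 hs hsp hsY hw hG).imp e.trans
    fun ⟨c, hc, g, r, h1, h2, h3, h4⟩ => ⟨c, hc, g, r, h1, h2, h3, e.trans h4⟩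

theorem norm_of_powers : (fun a => Φ fun i => b i a * Z a ^ k i) =ᶠ[l] 0 ∨
    Norm l (PN l M y) (PS l M y) fun a => Φ fun i => b i a * Z a ^ k i := by
  have einv : ∀ i, (fun a => b i a * (Z a)⁻¹ ^ (-k i)) = fun a => b i a * Z a ^ k i := fun i =>
    funext fun a => by rw [inv_zpow, zpow_neg, inv_inv]
  have einv' : ∀ i a, b i a * (Z a)⁻¹ ^ (-k i) = b i a * Z a ^ k i := fun i a => congrFun (einv i) a
  have hZ' := hZ.inv hM
  have h0' : ∀ i, Tendsto (fun a => b i a * (Z a)⁻¹ ^ (-k i)) l (𝓝 0) := fun i => by rw [einv]; exact h0 i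
  by_cases hp : ∀ i, 0 ≤ k i
  · exact norm_of_nonneg hM hy0 hZ hb h0 hΦ hp
  by_cases hn : ∀ i, k i ≤ 0
  · have := norm_of_nonneg hM hy0 hZ' hb h0' hΦ fun i => by have := hn i; omega
    simpa only [einv'] using this
  push Not at hp hn
  obtain ⟨Γ, hΓ, hΓp, hΓ0, hΓe⟩ := exists_scale hM hZ.pos hb h0 hn
  obtain ⟨Δ, hΔ, hΔp, hΔ0, hΔe⟩ := exists_scale hM hZ'.pos hb h0' (by simpa using hp)
  simp only [einv'] at hΔe
  have : ∀ i, ∃ (r : ℝ) (w : α → ℝ), Inf l M w ∧ (k i = 0 → r = 0) ∧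
      (0 ≤ k i → ∀ᶠ a in l, b i a * Z a ^ k i = (r + w a) * (Γ a * Z a) ^ (k i).toNat) ∧
      (k i ≤ 0 → ∀ᶠ a in l, b i a * Z a ^ k i = (r + w a) * (Δ a * (Z a)⁻¹) ^ (-k i).toNat) := fun i => by
    rcases lt_trichotomy (k i) 0 with h | h | h
    · obtain ⟨r, w, hw, e⟩ := hΔe i (by omega)
      exact ⟨r, w, hw, fun h' => absurd h' h.ne, fun h' => absurd h' (not_le.2 h), fun _ => e⟩
    · have h1 := h0 i
      rw [h] at h1 ⊢
      simp only [zpow_zero, mul_one] at h1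
      exact ⟨0, b i, ⟨(hb i).1, h1⟩, fun _ => rfl, fun _ => Eventually.of_forall fun a => by simp,
        fun _ => Eventually.of_forall fun a => by simp⟩
    · obtain ⟨r, w, hw, e⟩ := hΓe i h
      exact ⟨r, w, hw, fun h' => absurd h' h.ne', fun _ => e, fun h' => absurd h' (not_le.2 h)⟩
  choose r w hw hr he1 he2 using this
  have hΓΔ : (fun a => Γ a * Δ a) ∈ M := hM.mul hΓ hΔ
  have hΓΔp : ∀ᶠ a in l, 0 < Γ a * Δ a := by filter_upwards [hΓp, hΔp] with a h1 h2 using mul_pos h1 h2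
  have hΓΔ0 : Tendsto (fun a => Γ a * Δ a) l (𝓝 0) := by
    have := hΓ0.mul hΔ0
    rw [mul_zero] at this
    refine this.congr' ?_
    filter_upwards [hZ.pos] with a ha
    field_simp
  obtain ⟨hs, hsp, hs2⟩ := rpow_inv_pos_inf hM ⟨hΓΔ, hΓΔ0⟩ hΓΔp two_ne_zero
  set s : α → ℝ := fun a => (Γ a * Δ a) ^ (((2 : ℕ) : ℝ)⁻¹) with hsdef
  have hsΓ : (fun a => s a / Γ a) ∈ NZ l M := ⟨hM.div hs.1 hΓ, by
    filter_upwards [hsp, hΓp] with a h1 h2 using (div_pos h1 h2).ne'⟩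
  have hs2' : ∀ᶠ a in l, s a ^ 2 = Γ a * Δ a := hs2
  rcases hZ.dich hsΓ (k := -1) (by norm_num) with h | h
  · refine norm_of_mixed hM hy0 hZ hΦ hw hΓ hΓp hΓ0 hs hsp hs2' ?_ hr he1 fun i h => he2 i h.le
    refine h.congr fun a => ?_
    rw [zpow_neg_one, div_mul_eq_div_div, ← div_eq_mul_inv]
  · have := norm_of_mixed hM hy0 hZ' hΦ hw hΔ hΔp hΔ0 hs hsp (Γ := Δ) (Δ := Γ) (r := r) (k := fun i => -k i)
      (by simpa only [mul_comm] using hs2') (by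
        refine h.congr' ?_
        filter_upwards [hs2', hsp, hΓp, hΔp, hZ.pos] with a h1 h2 h3 h4 h5
        rw [zpow_neg_one]
        have : Γ a = s a ^ 2 / Δ a := by rw [h1]; field_simp
        rw [this]
        field_simp) (fun i h => hr i (by omega))
      (fun i h => by
        filter_upwards [he2 i (by omega)] with a h3
        exact (einv' i a).trans h3)
      (fun i h => by
        filter_upwards [he1 i (by omega)] with a h3
        simp only [neg_neg, inv_inv]
        exact (einv' i a).trans h3)
    simpa only [einv'] using this
end

theorem rpow_dich (hM : IsHF l M) {y : α → ℝ} (hy0 : ∀ᶠ a in l, 0 < y a)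
    (hyd : ∀ c ∈ M, (∀ᶠ a in l, 0 < c a) → Tendsto (fun a => y a / c a) l (𝓝 0) ∨ Tendsto (fun a => y a / c a) l atTop)
    {b : α → ℝ} (hb : b ∈ NZ l M) {q : ℚ} (hq : q ≠ 0) :
    Tendsto (fun a => b a * y a ^ (q : ℝ)) l (𝓝 0) ∨ Tendsto (fun a => (b a * y a ^ (q : ℝ))⁻¹) l (𝓝 0) := by
  have hbp : ∀ᶠ a in l, 0 < |b a| := hb.2.mono fun a h => abs_pos.2 h
  have hc := hM.rpow_rat (hM.abs hb.1) hbp (-q⁻¹)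
  have hcp : ∀ᶠ a in l, 0 < |b a| ^ ((-q⁻¹ : ℚ) : ℝ) := hbp.mono fun a h => Real.rpow_pos_of_pos h _
  have e : ∀ᶠ a in l, (y a / |b a| ^ ((-q⁻¹ : ℚ) : ℝ)) ^ (q : ℝ) = |b a * y a ^ (q : ℝ)| := by
    filter_upwards [hy0, hbp] with a h1 h2
    rw [Real.div_rpow h1.le (Real.rpow_pos_of_pos h2 _).le, ← Real.rpow_mul h2.le, ← Rat.cast_mul, neg_mul,
      inv_mul_cancel₀ hq, abs_mul, abs_of_pos (Real.rpow_pos_of_pos h1 _)]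
    simp only [Rat.cast_neg, Rat.cast_one, Real.rpow_neg_one]
    field_simp
  have key1 : Tendsto (fun a => (y a / |b a| ^ ((-q⁻¹ : ℚ) : ℝ)) ^ (q : ℝ)) l (𝓝 0) →
      Tendsto (fun a => b a * y a ^ (q : ℝ)) l (𝓝 0) := fun h =>
    (tendsto_zero_iff_abs_tendsto_zero _).2 (h.congr' e)
  have key2 : Tendsto (fun a => (y a / |b a| ^ ((-q⁻¹ : ℚ) : ℝ)) ^ (q : ℝ)) l atTop →
      Tendsto (fun a => (b a * y a ^ (q : ℝ))⁻¹) l (𝓝 0) := fun h =>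
    (tendsto_zero_iff_abs_tendsto_zero _).2 ((h.congr' e).inv_tendsto_atTop.congr fun a => by simp [abs_inv])
  have hqr : (q : ℝ) ≠ 0 := Rat.cast_ne_zero.2 hq
  rcases hyd _ hc hcp with h | h <;> rcases lt_or_gt_of_ne hqr with h' | h'
  · refine Or.inr (key2 ?_)
    have h1 := (tendsto_rpow_neg_nhdsGT_zero h').comp (tendsto_nhdsWithin_iff.2 ⟨h, by
      filter_upwards [hy0, hcp] with a h1 h2 using div_pos h1 h2⟩)
    exact h1
  · refine Or.inl (key1 ?_)
    have h1 := h.rpow_const (p := (q : ℝ)) (Or.inr h'.le)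
    rwa [Real.zero_rpow hqr] at h1
  · refine Or.inl (key1 ?_)
    have := (tendsto_rpow_neg_atTop (neg_pos.2 h')).comp h
    simpa [Function.comp_def] using this
  · exact Or.inr (key2 ((tendsto_rpow_atTop h').comp h))

theorem exists_common_den {n : ℕ} (q : Fin n → ℚ) : ∃ (L : ℕ) (k : Fin n → ℤ), L ≠ 0 ∧ ∀ i, q i = k i * (L : ℚ)⁻¹ := by
  have hL : ∏ i, (q i).den ≠ 0 := Finset.prod_ne_zero_iff.2 fun i _ => (q i).den_ne_zero
  have h : ∀ i, ∃ c : ℕ, ∏ i, (q i).den = (q i).den * c := fun i => Finset.dvd_prod_of_mem (fun i => (q i).den) (Finset.mem_univ i)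
  choose c hc using h
  refine ⟨∏ i, (q i).den, fun i => (q i).num * c i, hL, fun i => ?_⟩
  have hc0 : (c i : ℚ) ≠ 0 := by
    have := hc i ▸ hL
    exact_mod_cast (mul_ne_zero_iff.1 this).2
  have hd : ((q i).den : ℚ) ≠ 0 := Nat.cast_ne_zero.2 (q i).den_ne_zero
  rw [hc i]
  conv_lhs => rw [← Rat.num_div_den (q i)]
  push_cast
  field_simp

theorem rpow_inv_zpow {t : ℝ} (ht : 0 < t) (L : ℕ) (k : ℤ) :
    (t ^ ((L : ℝ)⁻¹)) ^ k = t ^ (((k * (L : ℚ)⁻¹ : ℚ)) : ℝ) := by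
  rw [← Real.rpow_intCast, ← Real.rpow_mul ht.le]
  push_cast
  rw [mul_comm]

section ExtI

variable (hM : IsHF l M) {y : α → ℝ} (hy0 : ∀ᶠ a in l, 0 < y a)
  (hyd : ∀ c ∈ M, (∀ᶠ a in l, 0 < c a) → Tendsto (fun a => y a / c a) l (𝓝 0) ∨ Tendsto (fun a => y a / c a) l atTop)
include hM hy0 hyd

theorem Typ.of_root {L : ℕ} (hL : L ≠ 0) : Typ l M y fun a => y a ^ ((L : ℝ)⁻¹) where
  pos := hy0.mono fun a h => Real.rpow_pos_of_pos h _
  mem {b} hb k := ⟨b, hb, k * (L : ℚ)⁻¹, hy0.mono fun a h => by simp only [rpow_inv_zpow h]⟩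
  dich {b} hb k hk := by
    have e : ∀ᶠ a in l, b a * y a ^ (((k * (L : ℚ)⁻¹ : ℚ)) : ℝ) = b a * (y a ^ ((L : ℝ)⁻¹)) ^ k :=
      hy0.mono fun a h => by simp only [rpow_inv_zpow h]
    have hq : (k * (L : ℚ)⁻¹ : ℚ) ≠ 0 := mul_ne_zero (Int.cast_ne_zero.2 hk) (inv_ne_zero (Nat.cast_ne_zero.2 hL))
    exact (rpow_dich hM hy0 hyd hb hq).imp (fun h => h.congr' e) fun h => h.congr' (e.mono fun a h => by rw [h])

theorem PS.norm [l.NeBot] {f : α → ℝ} (hf : Rep l (PS l M y) f) : f =ᶠ[l] 0 ∨ Norm l (PN l M y) (PS l M y) f := by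
  obtain ⟨n, Φ, e, hΦ, he, hfe⟩ := hf
  choose he1 he0 using he
  choose b hb q hq using he1
  obtain ⟨L, k, hL, hk⟩ := exists_common_den q
  have hee : ∀ i, e i =ᶠ[l] fun a => b i a * (y a ^ ((L : ℝ)⁻¹)) ^ k i := fun i => by
    filter_upwards [hq i, hy0] with a h1 h2
    rw [h1, rpow_inv_zpow h2, hk i]
  have hfe' : f =ᶠ[l] fun a => Φ fun i => b i a * (y a ^ ((L : ℝ)⁻¹)) ^ k i := by
    filter_upwards [hfe, eventually_all.2 hee] with a h1 h2
    rw [h1]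
    exact congrArg Φ (funext h2)
  exact (norm_of_powers hM hy0 (Typ.of_root hM hy0 hyd hL) hb (fun i => (he0 i).congr' (hee i)) hΦ).imp hfe'.trans
    fun ⟨c, hc, g, r, h1, h2, h3, h4⟩ => ⟨c, hc, g, r, h1, h2, h3, hfe'.trans h4⟩

theorem PN.trichotomy [l.NeBot] {f : α → ℝ} (hf : f ∈ PN l M y) :
    f ∈ NZ l M ∨ Tendsto f l (𝓝 0) ∨ Tendsto (fun a => (f a)⁻¹) l (𝓝 0) := by
  obtain ⟨b, hb, q, h⟩ := hf
  by_cases hq : q = 0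
  · subst hq
    simp only [Rat.cast_zero, Real.rpow_zero, mul_one] at h
    exact Or.inl ⟨hM.congr hb.1 h.symm, by filter_upwards [h, hb.2] with a h1 h2; rwa [h1]⟩
  · exact Or.inr ((rpow_dich hM hy0 hyd hb hq).imp (fun h1 => h1.congr' h.symm)
      fun h1 => h1.congr' (h.mono fun a h => by simp [h]))

theorem PS.isMon [l.NeBot] : IsMon l M (PN l M y) (PS l M y) where
  mul := PN.mul hM hy0
  inv := PN.inv hM hy0
  of_mem h1 h2 := PN.of_nz ⟨h1, h2⟩
  sign {f} hf := by
    obtain ⟨b, hb, q, h⟩ := hf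
    rcases hM.tri hb.1 with h1 | h1 | h1
    · obtain ⟨x, h1, h2⟩ := (h1.and hb.2).exists
      exact absurd h1 h2
    · left
      filter_upwards [h, h1, hy0] with a h h1 h2
      rw [h]; exact mul_pos h1 (Real.rpow_pos_of_pos h2 _)
    · right
      filter_upwards [h, h1, hy0] with a h h1 h2
      rw [h]; exact mul_neg_of_neg_of_pos h1 (Real.rpow_pos_of_pos h2 _)
  root {f} hf hp n hn := by
    obtain ⟨b, hb, q, h⟩ := hf
    have hbp : ∀ᶠ a in l, 0 < b a := by
      filter_upwards [h, hp, hy0] with a h1 h2 h3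
      rw [h1] at h2
      exact pos_of_mul_pos_left h2 (Real.rpow_pos_of_pos h3 _).le
    refine ⟨_, ⟨hM.root hb.1 hbp hn, hbp.mono fun x hx => (Real.rpow_pos_of_pos hx _).ne'⟩, q * (n : ℚ)⁻¹, ?_⟩
    filter_upwards [h, hbp, hy0] with a h1 h2 h3
    rw [h1, Real.mul_rpow h2.le (Real.rpow_pos_of_pos h3 _).le, ← Real.rpow_mul h3.le]
    push_cast
    rfl
  limit {f} hf := by
    rcases PN.trichotomy hM hy0 hyd hf with h | h | h
    · exact (hM.limit h.1).imp id fun h => h.elim (fun h => h.inv_tendsto_atTop) fun h => h.inv_tendsto_atBot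
    · exact Or.inl ⟨0, h⟩
    · exact Or.inr h
  tendsto := PS.tendsto
  fin {f} hf r hr := by
    rcases PN.trichotomy hM hy0 hyd hf with h | h | h
    · refine ((Rep.const r).add PS.tendsto (PS.of_inf hM (y := y)
        (f := fun x => f x - r) ⟨hM.sub h.1 (hM.const r), by simpa using hr.sub_const r⟩)).congr ?_
      exact Eventually.of_forall fun x => by simp
    · exact Rep.of_mem ⟨hf, h⟩
    · have h1 := (hr.mul h).congr' ((PN.ne hy0 hf).mono fun a h => mul_inv_cancel₀ h)
      rw [mul_zero] at h1
      exact absurd (tendsto_nhds_unique h1 tendsto_const_nhds) zero_ne_one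
  norm := PS.norm hM hy0 hyd

omit hy0 hyd in
theorem PN.self_mem : y ∈ PN l M y :=
  ⟨fun _ => 1, ⟨hM.const 1, Eventually.of_forall fun _ => one_ne_zero⟩, 1, by simp⟩

end ExtI

/-- Closure under logarithms. -/
def LogC (l : Filter α) (M : Set (α → ℝ)) : Prop :=
  ∀ {f : α → ℝ}, f ∈ M → (∀ᶠ a in l, 0 < f a) → (fun a => Real.log (f a)) ∈ M

/-- Closure under the exponential function. -/
def ExpC (M : Set (α → ℝ)) : Prop := ∀ {f : α → ℝ}, f ∈ M → (fun a => Real.exp (f a)) ∈ M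

theorem IsMon.log_form [l.NeBot] {N S : Set (α → ℝ)} (hN : IsMon l M N S) (hM : IsHF l M) {f : α → ℝ} (hf : f ∈ Ext l N S)
    (hp : ∀ᶠ a in l, 0 < f a) : ∃ c ∈ N, ∃ h ∈ Ext l N S, ∃ r, Tendsto h l (𝓝 r) ∧ (∀ᶠ a in l, 0 < c a) ∧
      ∀ᶠ a in l, Real.log (f a) = Real.log (c a) + h a := by
  obtain ⟨c, hc, u, r, h0, h1, h2, h3, h4⟩ := hN.pos_form hM hf hp
  refine ⟨c, hc, fun a => Real.log (u a), hN.of_rep (Rep.comp_at hN.tendsto h1 h2 (φ := Real.log) fun hΦ e => hΦ.log (by rwa [e])),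
    Real.log r, h2.log h3.ne', h0, ?_⟩
  filter_upwards [h4, h0, h2.eventually_const_lt h3] with a e1 e2 e3
  rw [e1, Real.log_mul e2.ne' e3.ne']

theorem PN.log_form {y c : α → ℝ} (hy0 : ∀ᶠ a in l, 0 < y a) (hc : c ∈ PN l M y)
    (hp : ∀ᶠ a in l, 0 < c a) : ∃ b ∈ M, (∀ᶠ a in l, 0 < b a) ∧ ∃ q : ℝ,
      ∀ᶠ a in l, Real.log (c a) = Real.log (b a) + q * Real.log (y a) := by
  obtain ⟨b, hb, q, h⟩ := hc
  have hbp : ∀ᶠ a in l, 0 < b a := by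
    filter_upwards [h, hp, hy0] with a h1 h2 h3
    rw [h1] at h2
    exact pos_of_mul_pos_left h2 (Real.rpow_pos_of_pos h3 _).le
  refine ⟨b, hb.1, hbp, q, ?_⟩
  filter_upwards [h, hbp, hy0] with a h1 h2 h3
  rw [h1, Real.log_mul h2.ne' (Real.rpow_pos_of_pos h3 _).ne', Real.log_rpow h3]

/-- Type one elements. -/
def TI (l : Filter α) (M : Set (α → ℝ)) (y : α → ℝ) : Prop :=
  (∀ᶠ a in l, 0 < y a) ∧ ∀ c ∈ M, (∀ᶠ a in l, 0 < c a) →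
    Tendsto (fun a => y a / c a) l (𝓝 0) ∨ Tendsto (fun a => y a / c a) l atTop

/-- The extension by a type one element. -/
def E1 (l : Filter α) (M : Set (α → ℝ)) (y : α → ℝ) : Set (α → ℝ) := Ext l (PN l M y) (PS l M y)

section
variable [l.NeBot] (hM : IsHF l M) {y : α → ℝ} (hy : TI l M y)
include hM hy

theorem TI.isHF : IsHF l (E1 l M y) := (PS.isMon hM hy.1 hy.2).isHF hM

theorem TI.subset : M ⊆ E1 l M y := fun _ h => (PS.isMon hM hy.1 hy.2).ext_of_mem hM h

omit [l.NeBot] hy in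
theorem TI.mem : y ∈ E1 l M y := Ext.of_mon (PN.self_mem hM)

theorem TI.log_form {f : α → ℝ} (hf : f ∈ E1 l M y) (hp : ∀ᶠ a in l, 0 < f a) :
    ∃ b ∈ M, (∀ᶠ a in l, 0 < b a) ∧ ∃ q : ℝ, ∃ h ∈ E1 l M y, ∃ r, Tendsto h l (𝓝 r) ∧
      ∀ᶠ a in l, Real.log (f a) = Real.log (b a) + q * Real.log (y a) + h a := by
  obtain ⟨c, hc, h, hh, r, hr, hcp, e⟩ := (PS.isMon hM hy.1 hy.2).log_form hM hf hp
  obtain ⟨b, hb, hbp, q, e'⟩ := PN.log_form hy.1 hc hcp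
  refine ⟨b, hb, hbp, q, h, hh, r, hr, ?_⟩
  filter_upwards [e, e'] with a h1 h2
  rw [h1, h2]

theorem TI.logC (hL : LogC l M) (hly : (fun a => Real.log (y a)) ∈ M) : LogC l (E1 l M y) := by
  intro f hf hp
  obtain ⟨b, hb, hbp, q, h, hh, r, -, e⟩ := hy.log_form hM hf hp
  have hE := hy.isHF hM
  exact hE.congr (hE.add (hy.subset hM (hM.add (hL hb hbp) (hM.mul (hM.const q) hly))) hh) (e.mono fun a h => h.symm)
end

theorem AffInf.logC [l.NeBot] (hM : IsHF l M) {y : α → ℝ}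
    (hy : ∀ a ∈ M, ∃ b ∈ M, (∀ᶠ x in l, b x ≠ 0) ∧ Tendsto (fun x => (y x - a x) / b x) l (𝓝 1)) (hL : LogC l M) :
    LogC l (Ext l (NZ l M) (AffInf l M y)) := by
  intro f hf hp
  have hN := AffInf.isMon hM hy
  obtain ⟨c, hc, h, hh, r, -, hcp, e⟩ := hN.log_form hM hf hp
  have hE := hN.isHF hM
  exact hE.congr (hE.add (hN.ext_of_mem hM (hL hc.1 hcp)) hh) (e.mono fun a h => h.symm)

theorem IsHF.sUnion {C : Set (Set (α → ℝ))} (hC : ∀ M ∈ C, IsHF l M) (hd : IsChain (· ⊆ ·) C) (hne : C.Nonempty) :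
    IsHF l (⋃₀ C) := by
  have h2 : ∀ {f g : α → ℝ}, f ∈ ⋃₀ C → g ∈ ⋃₀ C → ∃ M ∈ C, f ∈ M ∧ g ∈ M := by
    rintro f g ⟨M, hM, hf⟩ ⟨M', hM', hg⟩
    rcases hd.total hM hM' with h | h
    · exact ⟨M', hM', h hf, hg⟩
    · exact ⟨M, hM, hf, h hg⟩
  have h1 : ∀ {f}, ∀ M ∈ C, f ∈ M → f ∈ ⋃₀ C := fun M hM hf => ⟨M, hM, hf⟩
  have hfin : ∀ {n : ℕ} {t : Fin n → α → ℝ}, (∀ i, t i ∈ ⋃₀ C) → ∃ M ∈ C, ∀ i, t i ∈ M := by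
    intro n
    induction n with
    | zero => exact fun _ => ⟨hne.some, hne.some_mem, fun i => i.elim0⟩
    | succ n ih =>
      intro t ht
      obtain ⟨M, hM, h⟩ := ih (t := fun i => t i.succ) fun i => ht _
      obtain ⟨M', hM', h'⟩ := ht 0
      rcases hd.total hM hM' with hh | hh
      · exact ⟨M', hM', Fin.cases h' fun i => hh (h i)⟩
      · exact ⟨M, hM, Fin.cases (hh h') h⟩
  refine ⟨fun ⟨M, hM, h⟩ e => h1 M hM ((hC M hM).congr h e), fun c => h1 _ hne.some_mem ((hC _ hne.some_mem).const c),
    fun hf hg => ?_, fun hf hg => ?_, fun ⟨M, hM, h⟩ => h1 M hM ((hC M hM).inv h), fun ⟨M, hM, h⟩ => (hC M hM).tri h,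
    fun hφ t ht h0 => ?_, fun ⟨M, hM, h⟩ hp n hn => h1 M hM ((hC M hM).root h hp hn), ?_⟩
  · obtain ⟨M, hM, hf, hg⟩ := h2 hf hg
    exact h1 M hM ((hC M hM).add hf hg)
  · obtain ⟨M, hM, hf, hg⟩ := h2 hf hg
    exact h1 M hM ((hC M hM).mul hf hg)
  · obtain ⟨M, hM, h⟩ := hfin ht
    exact h1 M hM ((hC M hM).anal hφ h h0)
  · obtain ⟨δ, h, h'⟩ := (hC _ hne.some_mem).small
    exact ⟨δ, h1 _ hne.some_mem h, h'⟩

/-- Exponential-logarithmic Hardy fields. -/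
structure IsEL (l : Filter α) (M : Set (α → ℝ)) : Prop extends IsHF l M where
  logC : LogC l M
  expC : ExpC M

theorem IsHF.exp_of_tendsto (hM : IsHF l M) {t : α → ℝ} (ht : t ∈ M) {r : ℝ} (hr : Tendsto t l (𝓝 r)) :
    (fun a => Real.exp (t a)) ∈ M := by
  have h := hM.anal (φ := fun x : Fin 1 → ℝ => Real.exp (x 0)) (IsA.proj 0).exp (t := fun _ a => t a - r)
    (fun _ => hM.sub ht (hM.const r)) fun _ => by simpa using hr.sub_const r
  refine hM.congr (hM.mul (hM.const (Real.exp r)) h) (Eventually.of_forall fun a => ?_)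
  simp only [← Real.exp_add, add_sub_cancel]

theorem IsHF.exists_isEL [l.NeBot] (hM : IsHF l M) (hL : LogC l M) : ∃ M', M ⊆ M' ∧ IsEL l M' := by
  obtain ⟨M', hMM', hmax⟩ := zorn_subset_nonempty {M' : Set (α → ℝ) | IsHF l M' ∧ LogC l M'} (fun C hC hd hne => by
    refine ⟨⋃₀ C, ⟨IsHF.sUnion (fun M h => (hC h).1) hd hne, ?_⟩, fun s hs => subset_sUnion_of_mem hs⟩
    rintro f ⟨M, hM, hf⟩ hp
    exact ⟨M, hM, (hC hM).2 hf hp⟩) M ⟨hM, hL⟩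
  obtain ⟨hM', hL'⟩ := hmax.prop
  refine ⟨M', hMM', hM', hL', ?_⟩
  intro t ht
  have e : ∀ c : α → ℝ, (∀ᶠ a in l, 0 < c a) →
      ∀ᶠ a in l, Real.exp (t a - Real.log (c a)) = Real.exp (t a) / c a := fun c hc =>
    hc.mono fun a h => by rw [Real.exp_sub, Real.exp_log h]
  by_cases hy : TI l M' fun a => Real.exp (t a)
  · have hly : (fun a => Real.log (Real.exp (t a))) ∈ M' := by simpa only [Real.log_exp] using ht
    exact hmax.le_of_ge ⟨hy.isHF hM', hy.logC hM' hL' hly⟩ (hy.subset hM') (TI.mem hM')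
  · have : ∃ c ∈ M', (∀ᶠ a in l, 0 < c a) ∧ ∃ r, Tendsto (fun a => t a - Real.log (c a)) l (𝓝 r) := by
      by_contra hcon
      push Not at hcon
      refine hy ⟨Eventually.of_forall fun a => Real.exp_pos _, fun c hc hcp => ?_⟩
      rcases hM'.limit (hM'.sub ht (hL' hc hcp)) with ⟨r, hr⟩ | h | h
      · exact absurd hr (hcon c hc hcp r)
      · exact Or.inr ((Real.tendsto_exp_atTop.comp h).congr' (e c hcp))
      · exact Or.inl ((Real.tendsto_exp_atBot.comp h).congr' (e c hcp))
    obtain ⟨c, hc, hcp, r, hr⟩ := this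
    refine hM'.congr (hM'.mul hc (hM'.exp_of_tendsto (hM'.sub ht (hL' hc hcp)) hr)) ?_
    filter_upwards [e c hcp, hcp] with a h1 h2
    rw [h1]; field_simp

/-- Functions comparable with, and different from, all elements of `K`. -/
def Cut (l : Filter α) (K : Set (α → ℝ)) (y : α → ℝ) : Prop := ∀ c ∈ K, (∀ᶠ a in l, c a < y a) ∨ ∀ᶠ a in l, y a < c a

/-- Functions which belong to an exponential-logarithmic extension of `K`. -/
def Adj (l : Filter α) (K : Set (α → ℝ)) (y : α → ℝ) : Prop := ∃ M, K ⊆ M ∧ IsEL l M ∧ y ∈ M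

theorem cut_limit [l.NeBot] {f : α → ℝ} (hp : ∀ᶠ a in l, 0 < f a)
    (h : ∀ c : ℝ, 0 < c → (∀ᶠ a in l, c < f a) ∨ ∀ᶠ a in l, f a < c) :
    (∃ r, Tendsto f l (𝓝 r)) ∨ Tendsto f l atTop := by
  by_cases hall : ∀ c : ℝ, 0 < c → ∀ᶠ a in l, c < f a
  · exact Or.inr (tendsto_atTop.2 fun b => (hall (max b 1) (by positivity)).mono fun a h => (le_max_left _ _).trans h.le)
  simp only [not_forall] at hall
  obtain ⟨C, hC, hC'⟩ := hall
  have hC := (h C hC).resolve_left hC'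
  let S : Set ℝ := {c | ∀ᶠ a in l, c < f a}
  have hS : BddAbove S := ⟨C, fun c hc => by
    obtain ⟨a, h1, h2⟩ := (hc.and hC).exists
    exact (h1.trans h2).le⟩
  have h0 : 0 ∈ S := hp
  refine Or.inl ⟨sSup S, tendsto_order.2 ⟨fun c hc => ?_, fun c hc => ?_⟩⟩
  · obtain ⟨s, hs, hcs⟩ := exists_lt_of_lt_csSup ⟨0, h0⟩ hc
    exact hs.mono fun a h => hcs.trans h
  · refine (h c ((le_csSup hS h0).trans_lt hc)).resolve_left fun h => ?_
    exact absurd (le_csSup hS h) (not_le.2 hc)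

section
variable {K : Set (α → ℝ)} [l.NeBot] (hK : IsEL l K) {y : α → ℝ}
include hK

omit [l.NeBot] hK in
theorem Cut.sign (hy : Cut l K y) {a : α → ℝ} (ha : a ∈ K) :
    ∃ s : ℝ, (s = 1 ∨ s = -1) ∧ (∀ᶠ x in l, |y x - a x| = s * (y x - a x)) ∧ ∀ᶠ x in l, 0 < |y x - a x| := by
  rcases hy a ha with h | h
  · exact ⟨1, Or.inl rfl, h.mono fun x h => by rw [abs_of_pos (sub_pos.2 h), one_mul],
      h.mono fun x h => abs_pos.2 (sub_pos.2 h).ne'⟩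
  · exact ⟨-1, Or.inr rfl, h.mono fun x h => by rw [abs_of_neg (sub_neg.2 h), neg_one_mul],
      h.mono fun x h => abs_pos.2 (sub_neg.2 h).ne⟩

theorem Cut.ti (hy : Cut l K y) {a : α → ℝ} (ha : a ∈ K)
    (h : ∀ b ∈ K, (∀ᶠ x in l, b x ≠ 0) → ¬ Tendsto (fun x => (y x - a x) / b x) l (𝓝 1)) :
    TI l K fun x => |y x - a x| := by
  obtain ⟨s, hs, hse, hp⟩ := hy.sign ha
  have hs2 : s * s = 1 := by rcases hs with rfl | rfl <;> norm_num
  refine ⟨hp, fun c hc hcp => ?_⟩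
  have hfp : ∀ᶠ x in l, 0 < |y x - a x| / c x := by filter_upwards [hp, hcp] with x h1 h2 using div_pos h1 h2
  have key : ∀ ρ : ℝ, 0 < ρ → (∀ᶠ x in l, ρ < |y x - a x| / c x) ∨ ∀ᶠ x in l, |y x - a x| / c x < ρ := fun ρ hρ => by
    have hm : (fun x => a x + s * ρ * c x) ∈ K := hK.add ha (hK.mul (hK.const (s * ρ)) hc)
    rcases hs with rfl | rfl
    · refine (hy _ hm).imp (fun h => ?_) fun h => ?_ <;> filter_upwards [h, hse, hcp] with x h1 h2 h3
      · rw [h2, lt_div_iff₀ h3]; linarith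
      · rw [h2, div_lt_iff₀ h3]; linarith
    · refine (hy _ hm).symm.imp (fun h => ?_) fun h => ?_ <;> filter_upwards [h, hse, hcp] with x h1 h2 h3
      · rw [h2, lt_div_iff₀ h3]; linarith
      · rw [h2, div_lt_iff₀ h3]; linarith
  rcases cut_limit hfp key with ⟨r, hr⟩ | h'
  · by_cases hr0 : r = 0
    · exact Or.inl (hr0 ▸ hr)
    · exfalso
      have hsr : s * r ≠ 0 := mul_ne_zero (fun h => by simp [h] at hs2) hr0
      refine h _ (hK.mul (hK.const (s * r)) hc) (hcp.mono fun x h => mul_ne_zero hsr h.ne') ?_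
      have := hr.div_const r
      rw [div_self hr0] at this
      refine this.congr' ?_
      filter_upwards [hse, hcp] with x h1 h2
      rw [h1, div_div, mul_comm (c x) r, mul_div_assoc, mul_assoc s r (c x), ← div_div (y x - a x) s]
      have hs0 : s ≠ 0 := left_ne_zero_of_mul hsr
      have : (y x - a x) / s = s * (y x - a x) := by
        rw [div_eq_iff hs0, mul_right_comm, hs2, one_mul]
      rw [this, mul_div_assoc]
  · exact Or.inr h'

omit [l.NeBot] in
theorem TI.cut_log (hy : TI l K y) : Cut l K fun x => Real.log (y x) := by
  intro a ha
  rcases hy.2 _ (hK.expC ha) (Eventually.of_forall fun x => Real.exp_pos _) with h | h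
  · right
    filter_upwards [h.eventually_lt_const one_pos, hy.1] with x h1 h2
    rw [div_lt_one (Real.exp_pos _)] at h1
    exact (Real.log_lt_iff_lt_exp h2).2 h1
  · left
    filter_upwards [h.eventually_gt_atTop 1, hy.1] with x h1 h2
    rw [one_lt_div (Real.exp_pos _)] at h1
    exact (Real.lt_log_iff_exp_lt h2).2 h1

theorem Cut.adj_of_affInf (hy : ∀ a ∈ K, ∃ b ∈ K, (∀ᶠ x in l, b x ≠ 0) ∧ Tendsto (fun x => (y x - a x) / b x) l (𝓝 1)) :
    Adj l K y := by
  have hN := AffInf.isMon hK.toIsHF hy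
  obtain ⟨M, hM, hEL⟩ := (hN.isHF hK.toIsHF).exists_isEL (AffInf.logC hK.toIsHF hy hK.logC)
  exact ⟨M, fun _ h => hM (hN.ext_of_mem hK.toIsHF h), hEL, hM (AffInf.mem_ext hK.toIsHF hy)⟩

theorem TI.descend (hy : TI l K y) (hn : ¬ Adj l K y) :
    ∃ e ∈ K, TI l K (fun x => |Real.log (y x) - e x|) ∧ ¬ Adj l K fun x => |Real.log (y x) - e x| := by
  have hrec : Adj l K (fun x => Real.log (y x)) → Adj l K y := fun ⟨M, h1, h2, h3⟩ =>
    ⟨M, h1, h2, h2.congr (h2.expC h3) (hy.1.mono fun x h => Real.exp_log h)⟩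
  have hcut := hy.cut_log hK
  by_cases h : ∀ a ∈ K, ∃ b ∈ K, (∀ᶠ x in l, b x ≠ 0) ∧ Tendsto (fun x => (Real.log (y x) - a x) / b x) l (𝓝 1)
  · exact absurd (hrec (Cut.adj_of_affInf hK h)) hn
  push Not at h
  obtain ⟨e, he, h⟩ := h
  refine ⟨e, he, hcut.ti hK he h, fun ⟨M, h1, h2, h3⟩ => hn (hrec ⟨M, h1, h2, ?_⟩)⟩
  obtain ⟨s, hs, hse, -⟩ := hcut.sign he
  refine h2.congr (h2.add (h1 he) (h2.mul (h2.const s) h3)) ?_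
  filter_upwards [hse] with x hx
  rcases hs with rfl | rfl <;> linarith

omit [l.NeBot] in
theorem TI.add_sign (hy : TI l K y) {a : α → ℝ} (ha : a ∈ K) {s : ℝ} (hs : s = 1 ∨ s = -1) :
    (∀ᶠ x in l, y x / 2 ≤ a x + s * y x) ∨ ∀ᶠ x in l, a x + s * y x ≤ -(y x / 2) := by
  have key : ∀ {c : α → ℝ}, c ∈ K → (∀ᶠ x in l, 0 < c x) → (∀ᶠ x in l, y x < c x / 2) ∨ ∀ᶠ x in l, 2 * c x < y x := by
    intro c hc hcp
    rcases hy.2 c hc hcp with h | h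
    · left; filter_upwards [h.eventually_lt_const one_half_pos, hcp] with x h1 h2
      rw [div_lt_iff₀ h2] at h1; linarith
    · right; filter_upwards [h.eventually_gt_atTop 2, hcp] with x h1 h2
      rwa [lt_div_iff₀ h2] at h1
  rcases hK.tri ha with h | h | h
  · rcases hs with rfl | rfl
    · left; filter_upwards [h, hy.1] with x h1 h2
      rw [h1]; simp; linarith
    · right; filter_upwards [h, hy.1] with x h1 h2
      rw [h1]; simp; linarith
  · rcases hs with rfl | rfl
    · left; filter_upwards [h, hy.1] with x h1 h2
      linarith
    · refine (key ha h).imp (fun h' => ?_) fun h' => ?_ <;> filter_upwards [h', h] with x h1 h2 <;> linarith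
  · have := key (hK.neg ha) (h.mono fun x h => neg_pos.2 h)
    rcases hs with rfl | rfl
    · refine this.symm.imp (fun h' => ?_) fun h' => ?_ <;> filter_upwards [h', h] with x h1 h2 <;> linarith
    · right; filter_upwards [h, hy.1] with x h1 h2
      linarith
end

section
variable {K : Set (α → ℝ)} [l.NeBot] (hK : IsEL l K) {z e : ℕ → α → ℝ} (hz : ∀ n, TI l K (z n)) (he : ∀ n, e n ∈ K)
  (hze : ∀ n, z (n + 1) = fun x => |Real.log (z n x) - e n x|)
include hK hz he hze

omit [l.NeBot] in
theorem chain_log (n : ℕ) : ∃ s : ℝ, (s = 1 ∨ s = -1) ∧ ∀ᶠ x in l, Real.log (z n x) = e n x + s * z (n + 1) x := by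
  obtain ⟨s, hs, h, -⟩ := ((hz n).cut_log hK).sign (he n)
  refine ⟨s, hs, h.mono fun x h => ?_⟩
  rw [hze]
  dsimp only
  rw [h]
  rcases hs with rfl | rfl <;> ring

theorem chain_atTop (n : ℕ) : Tendsto (z (n + 1)) l atTop := by
  rcases (hz (n + 1)).2 _ (hK.const 1) (Eventually.of_forall fun _ => one_pos) with h | h
  · exfalso
    simp only [div_one, hze] at h
    have h1 := (tendsto_zero_iff_abs_tendsto_zero _).2 h
    have h2 := (Real.continuous_exp.tendsto _).comp h1
    have h3 : Tendsto (fun x => z n x / Real.exp (e n x)) l (𝓝 1) := by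
      rw [Real.exp_zero] at h2
      refine h2.congr' ((hz n).1.mono fun x hx => ?_)
      simp only [Function.comp_apply, Real.exp_sub, Real.exp_log hx]
    rcases (hz n).2 _ (hK.expC (he n)) (Eventually.of_forall fun _ => Real.exp_pos _) with h4 | h4
    · exact zero_ne_one (tendsto_nhds_unique h4 h3)
    · exact not_tendsto_nhds_of_tendsto_atTop h4 _ h3
  · simpa only [div_one] using h

omit [l.NeBot] in
theorem chain_le (n : ℕ) : ∀ᶠ x in l, z (n + 1) x ≤ 2 * |Real.log (z n x)| := by
  obtain ⟨s, hs, h⟩ := chain_log hK hz he hze n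
  rcases (hz (n + 1)).add_sign hK (he n) hs with h' | h' <;> filter_upwards [h, h'] with x h1 h2
  · rw [← h1] at h2
    linarith [le_abs_self (Real.log (z n x))]
  · rw [← h1] at h2
    linarith [neg_le_abs (Real.log (z n x))]

theorem chain_small (j d : ℕ) : Tendsto (fun x => Real.log (z (j + 1 + d) x) / z (j + 1) x) l (𝓝 0) := by
  have hlog : ∀ n, Tendsto (fun x => Real.log (z (n + 1) x) / z (n + 1) x) l (𝓝 0) := fun n =>
    Real.isLittleO_log_id_atTop.tendsto_div_nhds_zero.comp (chain_atTop hK hz he hze n)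
  induction d with
  | zero => exact hlog j
  | succ d ih =>
    have h1 : Tendsto (fun x => z (j + 1 + d + 1) x / z (j + 1) x) l (𝓝 0) := by
      have h2 := (ih.abs).const_mul 2
      rw [abs_zero, mul_zero] at h2
      refine squeeze_zero' ?_ ?_ h2
      · filter_upwards [(hz (j + 1 + d + 1)).1, (hz (j + 1)).1] with x h1 h2 using (div_pos h1 h2).le
      · filter_upwards [chain_le hK hz he hze (j + 1 + d), (hz (j + 1)).1] with x h1 h2
        rw [abs_div, abs_of_pos h2, ← mul_div_assoc]
        exact (div_le_div_iff_of_pos_right h2).2 h1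
    have h2 := (hlog (j + 1 + d)).mul h1
    rw [mul_zero] at h2
    refine h2.congr' ?_
    filter_upwards [(hz (j + 1 + d + 1)).1] with x hx
    rw [← add_assoc]
    field_simp

theorem chain_indep {k : α → ℝ} (hk : k ∈ K) (q : ℕ → ℝ) (n : ℕ) (hq : ∃ i, i < n ∧ q i ≠ 0) :
    Tendsto (fun x => k x + ∑ i ∈ Finset.range n, q i * Real.log (z i x)) l atTop ∨
    Tendsto (fun x => k x + ∑ i ∈ Finset.range n, q i * Real.log (z i x)) l atBot := by
  classical
  set i0 := Nat.find hq with hi0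
  have hin : i0 < n := (Nat.find_spec hq).1
  have hq0 : q i0 ≠ 0 := (Nat.find_spec hq).2
  have hmin : ∀ i < i0, q i = 0 := fun i hi => by
    by_contra h
    exact Nat.find_min hq hi ⟨hi.trans hin, h⟩
  have hR : Tendsto (fun x => ∑ i ∈ (Finset.range n).erase i0, q i * Real.log (z i x) / z (i0 + 1) x) l
      (𝓝 (∑ i ∈ (Finset.range n).erase i0, 0)) := by
    refine tendsto_finsetSum _ fun i hi => ?_
    rcases lt_or_ge i i0 with h | h
    · simp only [hmin i h, zero_mul, zero_div]
      exact tendsto_const_nhds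
    · have hne := (Finset.mem_erase.1 hi).1
      obtain ⟨d, rfl⟩ : ∃ d, i = i0 + 1 + d := ⟨i - (i0 + 1), by omega⟩
      have := (chain_small hK hz he hze i0 d).const_mul (q (i0 + 1 + d))
      simpa only [mul_zero, mul_div_assoc] using this
  rw [Finset.sum_const_zero] at hR
  obtain ⟨s, hs, hlog⟩ := chain_log hK hz he hze i0
  have ha : (fun x => k x / q i0 + e i0 x) ∈ K := hK.add (hK.div hk (hK.const _)) (he i0)
  have e1 : ∀ᶠ x in l, k x + ∑ i ∈ Finset.range n, q i * Real.log (z i x) =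
      z (i0 + 1) x * (q i0 * ((k x / q i0 + e i0 x + s * z (i0 + 1) x) / z (i0 + 1) x) +
        ∑ i ∈ (Finset.range n).erase i0, q i * Real.log (z i x) / z (i0 + 1) x) := by
    filter_upwards [hlog, (hz (i0 + 1)).1] with x h1 h2
    rw [← Finset.add_sum_erase _ _ (Finset.mem_range.2 hin), ← Finset.sum_div]
    rw [h1]
    field_simp
    ring
  have hzT := chain_atTop hK hz he hze i0
  have hqp : 0 < |q i0| := abs_pos.2 hq0
  have hR1 := hR.eventually_const_lt (show -(|q i0| / 4) < 0 by linarith)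
  have hR2 := hR.eventually_lt_const (show 0 < |q i0| / 4 by linarith)
  have key : (∀ᶠ x in l, |q i0| / 2 ≤ q i0 * ((k x / q i0 + e i0 x + s * z (i0 + 1) x) / z (i0 + 1) x)) ∨
      ∀ᶠ x in l, q i0 * ((k x / q i0 + e i0 x + s * z (i0 + 1) x) / z (i0 + 1) x) ≤ -(|q i0| / 2) := by
    have h1 : (∀ᶠ x in l, 1 / 2 ≤ (k x / q i0 + e i0 x + s * z (i0 + 1) x) / z (i0 + 1) x) ∨
        ∀ᶠ x in l, (k x / q i0 + e i0 x + s * z (i0 + 1) x) / z (i0 + 1) x ≤ -(1 / 2) := by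
      refine ((hz (i0 + 1)).add_sign hK ha hs).imp (fun h => ?_) fun h => ?_ <;>
        filter_upwards [h, (hz (i0 + 1)).1] with x h1 h2
      · rw [le_div_iff₀ h2]; linarith
      · rw [div_le_iff₀ h2]; linarith
    rcases lt_or_gt_of_ne hq0 with h | h
    · rw [abs_of_neg h]
      refine h1.symm.imp (fun h => ?_) fun h => ?_ <;> filter_upwards [h] with x hx <;> nlinarith
    · rw [abs_of_pos h]
      refine h1.imp (fun h => ?_) fun h => ?_ <;> filter_upwards [h] with x hx <;> nlinarith
  refine key.imp (fun h => ?_) fun h => ?_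
  · refine tendsto_atTop_mono' l ?_ (hzT.atTop_mul_const (show 0 < |q i0| / 4 by linarith))
    filter_upwards [h, hR1, e1, (hz (i0 + 1)).1] with x h1 h2 h3 h4
    rw [h3]
    exact mul_le_mul_of_nonneg_left (by linarith) h4.le
  · refine tendsto_atBot_mono' l ?_ (hzT.atTop_mul_const_of_neg (show -(|q i0| / 4) < 0 by linarith))
    filter_upwards [h, hR2, e1, (hz (i0 + 1)).1] with x h1 h2 h3 h4
    rw [h3]
    exact mul_le_mul_of_nonneg_left (by linarith) h4.le

omit hK hz he hze [l.NeBot]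

/-- Successive extensions along a chain. -/
def tower (l : Filter α) (K : Set (α → ℝ)) (z : ℕ → α → ℝ) : ℕ → Set (α → ℝ)
  | 0 => K
  | n + 1 => E1 l (tower l K z n) (z n)

/-- Logarithms of elements of `T` lie in the span of `K` and the `log (z i)`, `i < n`, up to a convergent error. -/
def LogSpan (l : Filter α) (K : Set (α → ℝ)) (z : ℕ → α → ℝ) (n : ℕ) (T : Set (α → ℝ)) : Prop :=
  ∀ f ∈ T, (∀ᶠ x in l, 0 < f x) → ∃ k ∈ K, ∃ q : ℕ → ℝ, ∃ r, Tendsto (fun x => Real.log (f x) -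
      (k x + ∑ i ∈ Finset.range n, q i * Real.log (z i x))) l (𝓝 r)

variable [l.NeBot]
include hK hz he hze

theorem LogSpan.ti {n : ℕ} {T : Set (α → ℝ)} (hlog : LogSpan l K z n T) : TI l T (z n) := by
  refine ⟨(hz n).1, fun c hc hcp => ?_⟩
  obtain ⟨k, hk, q, r, hr⟩ := hlog c hc hcp
  have := chain_indep hK hz he hze (hK.neg hk) (fun i => if i = n then 1 else -q i) (n + 1) ⟨n, n.lt_succ_self, by simp⟩
  have e1 : ∀ x, ∑ i ∈ Finset.range (n + 1), (if i = n then 1 else -q i) * Real.log (z i x) =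
      Real.log (z n x) - ∑ i ∈ Finset.range n, q i * Real.log (z i x) := fun x => by
    rw [Finset.sum_range_succ, if_pos rfl, one_mul, Finset.sum_congr rfl fun i hi => by
      rw [if_neg (Finset.mem_range.1 hi).ne, neg_mul], Finset.sum_neg_distrib]
    ring
  simp only [e1] at this
  have e2 : ∀ᶠ x in l, Real.exp ((-k x + (Real.log (z n x) - ∑ i ∈ Finset.range n, q i * Real.log (z i x))) +
      -(Real.log (c x) - (k x + ∑ i ∈ Finset.range n, q i * Real.log (z i x)))) = z n x / c x := by
    filter_upwards [(hz n).1, hcp] with x h1 h2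
    rw [← Real.exp_log (div_pos h1 h2), Real.log_div h1.ne' h2.ne']
    congr 1
    ring
  exact this.symm.imp (fun h => (Real.tendsto_exp_atBot.comp (h.atBot_add hr.neg)).congr' e2)
    fun h => (Real.tendsto_exp_atTop.comp (h.atTop_add hr.neg)).congr' e2

theorem tower_spec (n : ℕ) : IsHF l (tower l K z n) ∧ LogSpan l K z n (tower l K z n) := by
  induction n with
  | zero =>
    refine ⟨hK.toIsHF, fun f hf hp => ⟨_, hK.logC hf hp, 0, 0, ?_⟩⟩
    simp
  | succ n ih =>
    obtain ⟨hT, hlog⟩ := ih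
    have hTI := hlog.ti hK hz he hze
    refine ⟨hTI.isHF hT, fun f hf hp => ?_⟩
    obtain ⟨b, hb, hbp, q, h, -, r, hr, e⟩ := hTI.log_form hT hf hp
    obtain ⟨k, hk, q', r', hr'⟩ := hlog b hb hbp
    refine ⟨k, hk, fun i => if i = n then q else q' i, r' + r, (hr'.add hr).congr' ?_⟩
    have e1 : ∀ x, ∑ i ∈ Finset.range n, (if i = n then q else q' i) * Real.log (z i x) =
        ∑ i ∈ Finset.range n, q' i * Real.log (z i x) := fun x =>
      Finset.sum_congr rfl fun i hi => by rw [if_neg (Finset.mem_range.1 hi).ne]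
    filter_upwards [e] with x hx
    rw [hx, Finset.sum_range_succ, if_pos rfl, e1]
    ring

theorem tower_ti (n : ℕ) : TI l (tower l K z n) (z n) := (tower_spec hK hz he hze n).2.ti hK hz he hze

theorem tower_log (n : ℕ) {f : α → ℝ} (hf : f ∈ tower l K z n) (hp : ∀ᶠ x in l, 0 < f x) :
    (fun x => Real.log (f x)) ∈ tower l K z (n + 1) := by
  have hsub : ∀ n, tower l K z n ⊆ tower l K z (n + 1) := fun n =>
    (tower_ti hK hz he hze n).subset (tower_spec hK hz he hze n).1
  induction n generalizing f with
  | zero => exact hsub 0 (hK.logC hf hp)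
  | succ n ih =>
    have hH := (tower_spec hK hz he hze (n + 2)).1
    obtain ⟨b, hb, hbp, q, h, hh, r, hr, e⟩ :=
      (tower_ti hK hz he hze n).log_form (tower_spec hK hz he hze n).1 hf hp
    obtain ⟨s, hs, hzl⟩ := chain_log hK hz he hze n
    have hKs : ∀ n, K ⊆ tower l K z n := fun n => by
      induction n with
      | zero => exact subset_rfl
      | succ n ih => exact ih.trans (hsub n)
    have hzn : (fun x => Real.log (z n x)) ∈ tower l K z (n + 2) :=
      hH.congr (hH.add (hKs _ (he n)) (hH.mul (hH.const s) (TI.mem (tower_spec hK hz he hze (n + 1)).1)))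
        (hzl.mono fun x h => h.symm)
    exact hH.congr (hH.add (hH.add (hsub _ (ih hb hbp)) (hH.mul (hH.const q) hzn)) (hsub _ hh))
      (e.mono fun x h => h.symm)

theorem chain_adj : Adj l K (z 0) := by
  have hsub : Monotone (tower l K z) := monotone_nat_of_le_succ fun n =>
    (tower_ti hK hz he hze n).subset (tower_spec hK hz he hze n).1
  have hU := IsHF.sUnion (l := l) (C := range (tower l K z))
    (by rintro _ ⟨n, rfl⟩; exact (tower_spec hK hz he hze n).1) hsub.isChain_range ⟨_, 0, rfl⟩
  obtain ⟨M, hM, hEL⟩ := hU.exists_isEL (by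
    rintro f ⟨_, ⟨n, rfl⟩, hf⟩ hp
    exact ⟨_, ⟨n + 1, rfl⟩, tower_log hK hz he hze n hf hp⟩)
  exact ⟨M, fun f hf => hM ⟨_, ⟨0, rfl⟩, hf⟩, hEL, hM ⟨_, ⟨1, rfl⟩, TI.mem hK.toIsHF⟩⟩

end

theorem TI.adj [l.NeBot] {K : Set (α → ℝ)} (hK : IsEL l K) {y : α → ℝ} (hy : TI l K y) : Adj l K y := by
  by_contra hn
  let X := {z : α → ℝ // TI l K z ∧ ¬ Adj l K z}
  choose e he h using fun z : X => z.2.1.descend hK z.2.2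
  let z : ℕ → X := fun n => Nat.rec ⟨y, hy, hn⟩ (fun _ z => ⟨_, h z⟩) n
  exact hn (chain_adj hK (z := fun n => (z n).1) (e := fun n => e (z n)) (fun n => (z n).2.1) (fun n => he _) fun n => rfl)

/-- A function whose comparison with every element of an exponential-logarithmic field is decided
can be adjoined to it. -/
theorem IsEL.adj [l.NeBot] {K : Set (α → ℝ)} (hK : IsEL l K) {y : α → ℝ}
    (hy : ∀ c ∈ K, (∀ᶠ a in l, y a = c a) ∨ (∀ᶠ a in l, c a < y a) ∨ ∀ᶠ a in l, y a < c a) : Adj l K y := by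
  by_cases h : ∃ c ∈ K, ∀ᶠ a in l, y a = c a
  · obtain ⟨c, hc, h⟩ := h
    exact ⟨K, subset_rfl, hK, hK.congr hc (h.mono fun a h => h.symm)⟩
  have hcut : Cut l K y := fun c hc => (hy c hc).resolve_left fun h' => h ⟨c, hc, h'⟩
  by_cases h : ∀ a ∈ K, ∃ b ∈ K, (∀ᶠ x in l, b x ≠ 0) ∧ Tendsto (fun x => (y x - a x) / b x) l (𝓝 1)
  · exact Cut.adj_of_affInf hK h
  push Not at h
  obtain ⟨a, ha, h⟩ := h
  obtain ⟨M, h1, h2, h3⟩ := (hcut.ti hK ha h).adj hK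
  obtain ⟨s, hs, hse, -⟩ := hcut.sign ha
  refine ⟨M, h1, h2, h2.congr (h2.add (h1 ha) (h2.mul (h2.const s) h3)) ?_⟩
  filter_upwards [hse] with x hx
  rcases hs with rfl | rfl <;> linarith

theorem QF.lt_const {ι : Type} (i : ι) (c : ℝ) : QF {x : ι → ℝ | x i < c} ∧ QF {x : ι → ℝ | c < x i} := by
  let R : LM.Relations 2 := PUnit.unit
  let C : LM.Functions 0 := c
  constructor
  · refine ⟨R.formula ![Language.Term.var i, Language.Term.func C ![] ],
      (Language.BoundedFormula.IsAtomic.rel _ _).isQF, fun x => ?_⟩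
    rw [Language.Formula.realize_rel]
    rfl
  · refine ⟨R.formula ![Language.Term.func C ![], Language.Term.var i],
      (Language.BoundedFormula.IsAtomic.rel _ _).isQF, fun x => ?_⟩
    rw [Language.Formula.realize_rel]
    rfl

/-- The functions generated by field operations, order, exponential, logarithm and restricted
analytic functions. -/
inductive F {ι : Type} : ((ι → ℝ) → ℝ) → Prop
  | proj (i : ι) : F fun x => x i
  | const (c : ℝ) : F fun _ => c
  | add {f g : (ι → ℝ) → ℝ} : F f → F g → F fun x => f x + g x
  | mul {f g : (ι → ℝ) → ℝ} : F f → F g → F fun x => f x * g x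
  | exp {f : (ι → ℝ) → ℝ} : F f → F fun x => Real.exp (f x)
  | pos {f : (ι → ℝ) → ℝ} : F f → F fun x => if 0 < f x then 1 else 0
  | pinv {f : (ι → ℝ) → ℝ} : F f → F fun x => if 0 < f x then (f x)⁻¹ else 0
  | plog {f : (ι → ℝ) → ℝ} : F f → F fun x => if 0 < f x then Real.log (f x) else 0
  | anal {k : ℕ} {φ : (Fin k → ℝ) → ℝ} {ρ r : ℝ} {f : Fin k → (ι → ℝ) → ℝ} : 0 < ρ → AOn ρ φ → r < ρ →
      (∀ i, F (f i)) → F fun x => if ∀ i, |f i x| ≤ r then φ fun i => f i x else 0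

theorem SEon.posPart {ι : Type} {f g : (ι → ℝ) → ℝ} (hf : SEon univ f) (hg : SEon {x | 0 < f x} g) :
    SEon univ fun x => if 0 < f x then g x else 0 := by
  have h0 : SEon {x : ι → ℝ | ¬ 0 < f x} fun _ => 0 :=
    SEon.const ((SEon.le QF.univ.se hf (SEon.const QF.univ.se 0)).congr fun x => by simp) 0
  have := hg.piecewise h0 disjoint_compl_right
  rw [show {x : ι → ℝ | 0 < f x} ∪ {x | ¬ 0 < f x} = univ from union_compl_self _] at this
  exact this

theorem F.se {ι : Type} {f : (ι → ℝ) → ℝ} (hf : F f) : SEon univ f := by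
  have hu : SE (univ : Set (ι → ℝ)) := QF.univ.se
  have hp : ∀ {f : (ι → ℝ) → ℝ}, SEon univ f → SE {x | 0 < f x} := fun h =>
    ((SEon.const hu 0).lt hu h).congr fun x => by simp
  induction hf with
  | proj i => exact SEon.proj hu i
  | const c => exact SEon.const hu c
  | add _ _ h1 h2 => exact h1.add hu h2
  | mul _ _ h1 h2 => exact h1.mul hu h2
  | exp _ h => exact h.exp hu
  | pos _ h => exact h.posPart (SEon.const (hp h) 1)
  | pinv _ h => exact h.posPart (SEon.inv (hp h) (h.restrict (hp h) (subset_univ _)) fun x hx => ne_of_gt hx)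
  | plog _ h => exact h.posPart (SEon.log (hp h) (h.restrict (hp h) (subset_univ _)) fun x hx => hx)
  | @anal k φ ρ r f hρ hφ hr _ h =>
    have hS : QF {y : Fin k → ℝ | ∀ i, |y i| ≤ r} := by
      have := QF.iInter fun i : Fin k => (QF.lt_const i (-r)).1.compl.inter (QF.lt_const i r).2.compl
      convert this using 1
      ext y
      simp [abs_le]
    have h1 := (SEon.restrict (hφ.se []) hS.se (fun y hy => by
      rw [mem_ball_zero_iff, pi_norm_lt_iff hρ]
      exact fun i => (hy i).trans_lt hr)).piecewise (SEon.const hS.compl.se 0) disjoint_compl_right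
    rw [union_compl_self] at h1
    exact SEon.comp (g := f) hu h1 h fun _ _ => mem_univ _

namespace F
variable {ι : Type} {f g : (ι → ℝ) → ℝ}

theorem sub (hf : F f) (hg : F g) : F fun x => f x - g x := by
  have := hf.add ((F.const (-1)).mul hg)
  simpa [sub_eq_add_neg] using this

theorem inv (hf : F f) : F fun x => (f x)⁻¹ := by
  have := hf.mul (hf.mul hf).pinv
  convert this using 2 with x
  by_cases h : f x = 0
  · simp [h]
  · rw [if_pos (mul_self_pos.2 h)]; field_simp

theorem comp {κ : Type} {f : (κ → ℝ) → ℝ} (hf : F f) {g : κ → (ι → ℝ) → ℝ} (hg : ∀ k, F (g k)) :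
    F fun x => f fun k => g k x := by
  induction hf with
  | proj i => exact hg i
  | const c => exact F.const c
  | add _ _ h1 h2 => exact h1.add h2
  | mul _ _ h1 h2 => exact h1.mul h2
  | exp _ h => exact h.exp
  | pos _ h => exact h.pos
  | pinv _ h => exact h.pinv
  | plog _ h => exact h.plog
  | anal hρ hφ hr _ h => exact F.anal hρ hφ hr h

end F

theorem IsEL.comp_F [l.NeBot] (hM : IsEL l M) {κ : Type} {f : (κ → ℝ) → ℝ} (hf : F f) {t : κ → α → ℝ}
    (ht : ∀ k, t k ∈ M) : (fun a => f fun k => t k a) ∈ M := by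
  have hH := hM.toIsHF
  have hz : (fun _ => 0) ∈ M := hH.const 0
  have hite : ∀ {u v : α → ℝ}, u ∈ M → ((∀ᶠ a in l, 0 < u a) → v ∈ M) →
      (fun a => if 0 < u a then v a else 0) ∈ M := by
    intro u v hu hv
    rcases hH.tri hu with h | h | h
    · exact hH.congr hz (h.mono fun a h => by simp [h])
    · exact hH.congr (hv h) (h.mono fun a h => by simp [h])
    · exact hH.congr hz (h.mono fun a h => by simp [h.le])
  induction hf with
  | proj i => exact ht i
  | const c => exact hH.const c
  | add _ _ h1 h2 => exact hH.add h1 h2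
  | mul _ _ h1 h2 => exact hH.mul h1 h2
  | exp _ h => exact hM.expC h
  | pos _ h => exact hite h fun _ => hH.const 1
  | pinv _ h => exact hite h fun _ => hH.inv h
  | plog _ h => exact hite h fun h' => hM.logC h h'
  | @anal k φ ρ r f hρ hφ hr _ h =>
    let u : Fin k → α → ℝ := fun i a => f i fun k => t k a
    have hu : ∀ i, u i ∈ M := h
    have hd : ∀ i, (∀ᶠ a in l, |u i a| ≤ r) ∨ ∀ᶠ a in l, r < |u i a| := by
      intro i
      rcases hH.cmp (hH.abs (hu i)) r with h | h | h
      · exact Or.inl (h.mono fun a h => h.le)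
      · exact Or.inr h
      · exact Or.inl (h.mono fun a h => h.le)
    by_cases hb : ∀ i, ∀ᶠ a in l, |u i a| ≤ r
    · have hlim : ∀ i, ∃ c, Tendsto (u i) l (𝓝 c) := by
        intro i
        rcases hH.limit (hu i) with h | h | h
        · exact h
        · obtain ⟨a, h1, h2⟩ := ((h.eventually_gt_atTop r).and (hb i)).exists
          exact absurd ((le_abs_self _).trans h2) (not_le.2 h1)
        · obtain ⟨a, h1, h2⟩ := ((h.eventually_lt_atBot (-r)).and (hb i)).exists
          exact absurd (neg_le_of_abs_le h2) (not_le.2 h1)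
      choose c hc using hlim
      have hcr : ‖c‖ < ρ := by
        rw [pi_norm_lt_iff hρ]
        exact fun i => (le_of_tendsto (hc i).abs (hb i)).trans_lt hr
      have := hH.anal (hφ.translate hcr) (t := fun i a => u i a - c i) (fun i => hH.sub (hu i) (hH.const _))
        fun i => by simpa using (hc i).sub_const (c i)
      refine hH.congr this ?_
      filter_upwards [eventually_all.2 hb] with a ha
      rw [if_pos ha]
      congr 1
      funext i
      simp [u]
    · push Not at hb
      obtain ⟨i, hi⟩ := hb
      have := (hd i).resolve_left (by simpa using hi)
      refine hH.congr hz (this.mono fun a ha => ?_)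
      exact (if_neg fun h => absurd (h i) (not_le.2 ha)).symm

/-- The field generated by a tuple of functions with decided signs, one of which is infinite. -/
theorem F.isEL {κ : Type} {p : κ → α → ℝ} (hp : ∀ {c : (κ → ℝ) → ℝ}, F c → (∀ᶠ a in l, c (fun k => p k a) = 0) ∨
      (∀ᶠ a in l, 0 < c fun k => p k a) ∨ ∀ᶠ a in l, c (fun k => p k a) < 0) {k₀ : κ} (hk : Tendsto (p k₀) l atTop) :
    IsEL l {f | ∃ c : (κ → ℝ) → ℝ, F c ∧ f =ᶠ[l] fun a => c fun k => p k a} where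
  congr := fun ⟨c, hc, e⟩ e' => ⟨c, hc, e'.symm.trans e⟩
  const c := ⟨_, F.const c, EventuallyEq.rfl⟩
  add := fun ⟨c, hc, e⟩ ⟨c', hc', e'⟩ => ⟨_, hc.add hc', e.add e'⟩
  mul := fun ⟨c, hc, e⟩ ⟨c', hc', e'⟩ => ⟨_, hc.mul hc', e.mul e'⟩
  inv := fun ⟨c, hc, e⟩ => ⟨_, hc.inv, e.inv⟩
  tri := by
    rintro f ⟨c, hc, e⟩
    rcases hp hc with h | h | h
    · exact Or.inl (e.trans h)
    · exact Or.inr (Or.inl (by filter_upwards [e, h] with a h1 h2; rwa [h1]))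
    · exact Or.inr (Or.inr (by filter_upwards [e, h] with a h1 h2; rwa [h1]))
  anal := by
    rintro n φ ⟨ρ, hρ, hφ⟩ t ht h0
    choose c hc e using ht
    refine ⟨_, F.anal hρ hφ (half_lt_self hρ) hc, ?_⟩
    have h1 : ∀ i, ∀ᶠ a in l, |t i a| ≤ ρ / 2 := fun i =>
      (((h0 i).abs).eventually_lt_const (by simpa using half_pos hρ)).mono fun a h => h.le
    filter_upwards [eventually_all.2 h1, eventually_all.2 e] with a h2 h3
    have h4 : (fun i => t i a) = fun i => c i fun k => p k a := funext h3
    rw [if_pos fun i => by rw [← h3 i]; exact h2 i, h4]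
  root := by
    rintro f ⟨c, hc, e⟩ hf n hn
    refine ⟨_, (hc.plog.mul (F.const (n : ℝ)⁻¹)).exp, ?_⟩
    filter_upwards [e, hf] with a h1 h2
    rw [← h1, if_pos h2, Real.rpow_def_of_pos h2]
  small := ⟨_, ⟨_, (F.proj k₀).inv, EventuallyEq.rfl⟩, (hk.eventually_gt_atTop 0).mono fun a h => inv_pos.2 h,
    tendsto_inv_atTop_zero.comp hk⟩
  logC := by
    rintro f ⟨c, hc, e⟩ hf
    refine ⟨_, hc.plog, ?_⟩
    filter_upwards [e, hf] with a h1 h2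
    rw [← h1, if_pos h2]
  expC := fun ⟨c, hc, e⟩ => ⟨_, hc.exp, e.fun_comp Real.exp⟩

/-- `y` and `y'` have the same position with respect to `c`. -/
def Same (c y y' : ℝ) : Prop := (c < y ↔ c < y') ∧ (y < c ↔ y' < c)

/-- One-variable cell decomposition. -/
theorem F.cell {ι : Type} {χ : (Option ι → ℝ) → ℝ} (hχ : F χ) :
    ∃ Ξ : Finset ((ι → ℝ) → ℝ), (∀ ξ ∈ Ξ, F ξ) ∧ ∀ (x : ι → ℝ) (y y' : ℝ), (∀ ξ ∈ Ξ, Same (ξ x) y y') →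
      0 < χ (fun o => o.elim y x) → 0 < χ fun o => o.elim y' x := by
  classical
  by_contra! H
  let X := (Option ι → ℝ) × ℝ × ℝ
  let B : Finset {ξ : (Option ι → ℝ) → ℝ // F ξ} × ℕ → Set X := fun p =>
    {z | (∀ ξ ∈ p.1, Same (ξ.1 z.1) z.2.1 z.2.2) ∧ (p.2 : ℝ) ≤ z.1 none ∧
      0 < χ (fun o => o.elim z.2.1 fun i => z.1 (some i)) ∧ χ (fun o => o.elim z.2.2 fun i => z.1 (some i)) ≤ 0}
  have hB : ∀ p, (B p).Nonempty := by
    rintro ⟨Ξ, N⟩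
    obtain ⟨x, y, y', h1, h2, h3⟩ := H (Ξ.image fun ξ x => ξ.1 fun o => o.elim (N : ℝ) x) (by
      intro ξ hξ
      obtain ⟨ξ, -, rfl⟩ := Finset.mem_image.1 hξ
      exact ξ.2.comp (g := fun o x => o.elim (N : ℝ) x) (Option.rec (F.const _) F.proj))
    exact ⟨(fun o => o.elim N x, y, y'), fun ξ hξ => h1 _ (Finset.mem_image_of_mem _ hξ), le_rfl, h2, h3⟩
  have hm : ∀ p q, p ≤ q → B q ⊆ B p := fun p q h z hz =>
    ⟨fun ξ hξ => hz.1 ξ (h.1 hξ), le_trans (by exact_mod_cast h.2) hz.2.1, hz.2.2⟩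
  let G : Filter X := ⨅ p, 𝓟 (B p)
  have : G.NeBot := by
    refine iInf_neBot_of_directed' (fun p q => ⟨p ⊔ q, ?_, ?_⟩) fun p => principal_neBot_iff.2 (hB p)
    · exact principal_mono.2 (hm _ _ le_sup_left)
    · exact principal_mono.2 (hm _ _ le_sup_right)
  let V := Ultrafilter.of G
  have hV : ∀ p, ∀ᶠ z in V, z ∈ B p := fun p => Ultrafilter.of_le G (mem_iInf_of_mem p (mem_principal_self _))
  let α := (Option ι → ℝ) × ℝ
  let l : Filter α := map (fun z : X => (z.1, z.2.1)) V ⊔ map (fun z : X => (z.1, z.2.2)) V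
  have hl : ∀ {P : α → Prop}, (∀ᶠ a in l, P a) ↔
      (∀ᶠ z : X in V, P (z.1, z.2.1)) ∧ ∀ᶠ z : X in V, P (z.1, z.2.2) := eventually_sup
  have tri : ∀ {f : X → ℝ}, (∀ᶠ z in V, f z = 0) ∨ (∀ᶠ z in V, 0 < f z) ∨ ∀ᶠ z in V, f z < 0 := by
    intro f
    rcases V.em fun z => f z = 0 with h | h
    · exact Or.inl h
    · rcases V.em fun z => 0 < f z with h' | h'
      · exact Or.inr (Or.inl h')
      · exact Or.inr (Or.inr ((h.and h').mono fun z hz => lt_of_le_of_ne (not_lt.1 hz.2) hz.1))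
  have hK := F.isEL (l := l) (p := fun k a => a.1 k) (k₀ := none) (fun {c} hc => by
    simp only [hl, and_self]; exact tri) (by
    rw [tendsto_sup]
    have : Tendsto (fun z : X => z.1 none) V atTop := by
      refine tendsto_atTop.2 fun b => ?_
      obtain ⟨N, hN⟩ := exists_nat_ge b
      exact (hV (∅, N)).mono fun z hz => hN.trans hz.2.1
    exact ⟨this, this⟩)
  obtain ⟨M, hKM, hM, hy⟩ := hK.adj (y := fun a => a.2) (by
    rintro f ⟨c, hc, e⟩
    have hs : ∀ᶠ z : X in V, Same (c z.1) z.2.1 z.2.2 := (hV ({⟨c, hc⟩}, 0)).mono fun z hz =>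
      hz.1 ⟨c, hc⟩ (Finset.mem_singleton_self _)
    have he := hl.1 e
    rcases tri (f := fun z : X => z.2.1 - c z.1) with h | h | h
    · refine Or.inl (hl.2 ⟨?_, ?_⟩) <;> filter_upwards [h, hs, he.1, he.2] with z h1 h2 h3 h4
      · simp_all [sub_eq_zero]
      · have : z.2.1 = c z.1 := sub_eq_zero.1 h1
        simp only [Same, this, lt_irrefl, false_iff, not_lt] at h2
        rw [h4]; exact le_antisymm h2.1 h2.2
    · refine Or.inr (Or.inl (hl.2 ⟨?_, ?_⟩)) <;> filter_upwards [h, hs, he.1, he.2] with z h1 h2 h3 h4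
      · rw [h3]; exact sub_pos.1 h1
      · rw [h4]; exact h2.1.1 (sub_pos.1 h1)
    · refine Or.inr (Or.inr (hl.2 ⟨?_, ?_⟩)) <;> filter_upwards [h, hs, he.1, he.2] with z h1 h2 h3 h4
      · rw [h3]; exact sub_neg.1 h1
      · rw [h4]; exact h2.2.1 (sub_neg.1 h1))
  have hf := hM.comp_F hχ (t := fun o a => o.elim a.2 fun i => a.1 (some i)) (Option.rec hy fun i =>
    hKM ⟨_, F.proj (some i), EventuallyEq.rfl⟩)
  have h0 := hV (∅, 0)
  rcases hM.tri hf with h | h | h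
  · obtain ⟨z, h1, h2⟩ := ((hl.1 h).1.and h0).exists
    exact absurd h1 (ne_of_gt h2.2.2.1)
  · obtain ⟨z, h1, h2⟩ := ((hl.1 h).2.and h0).exists
    exact absurd h1 (not_lt.2 h2.2.2.2)
  · obtain ⟨z, h1, h2⟩ := ((hl.1 h).1.and h0).exists
    exact absurd h1 (not_lt.2 h2.2.2.1.le)

/-- Sets whose indicator functions lie in `F`. -/
def D {ι : Type} (S : Set (ι → ℝ)) : Prop := ∃ f : (ι → ℝ) → ℝ, F f ∧ ∀ x, x ∈ S ↔ 0 < f x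

namespace D
variable {ι : Type} {S T : Set (ι → ℝ)}

theorem compl (h : D S) : D Sᶜ := by
  obtain ⟨f, hf, e⟩ := h
  refine ⟨_, (F.const 1).sub hf.pos, fun x => ?_⟩
  rw [mem_compl_iff, e]
  split_ifs with h <;> simp [h]

theorem inter (hS : D S) (hT : D T) : D (S ∩ T) := by
  obtain ⟨f, hf, e⟩ := hS
  obtain ⟨g, hg, e'⟩ := hT
  refine ⟨_, hf.pos.mul hg.pos, fun x => ?_⟩
  rw [mem_inter_iff, e, e']
  split_ifs with h h' <;> simp [*]

theorem union (hS : D S) (hT : D T) : D (S ∪ T) := by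
  have := (hS.compl.inter hT.compl).compl
  rwa [compl_inter, compl_compl, compl_compl] at this

theorem biUnion {κ : Type} (A : Finset κ) {S : κ → Set (ι → ℝ)} (h : ∀ k ∈ A, D (S k)) : D {x | ∃ k ∈ A, x ∈ S k} := by
  classical
  induction A using Finset.induction_on with
  | empty => exact ⟨_, F.const 0, by simp⟩
  | insert a A _ ih =>
    convert (h a (Finset.mem_insert_self _ _)).union (ih fun k hk => h k (Finset.mem_insert_of_mem hk)) using 1
    ext x
    simp

theorem lt {f g : (ι → ℝ) → ℝ} (hf : F f) (hg : F g) : D {x | f x < g x} :=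
  ⟨_, hg.sub hf, fun x => (sub_pos (a := g x)).symm⟩

theorem eq {f g : (ι → ℝ) → ℝ} (hf : F f) (hg : F g) : D {x | f x = g x} := by
  convert (lt hf hg).compl.inter (lt hg hf).compl using 1
  ext x
  simp [le_antisymm_iff, and_comm]

theorem comp {κ : Type} (hS : D S) {g : ι → (κ → ℝ) → ℝ} (hg : ∀ i, F (g i)) :
    D {x : κ → ℝ | (fun i => g i x) ∈ S} := by
  obtain ⟨f, hf, e⟩ := hS
  exact ⟨_, hf.comp hg, fun x => e _⟩

theorem ite (hS : D S) {f g : (ι → ℝ) → ℝ} (hf : F f) (hg : F g) [DecidablePred (· ∈ S)] :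
    F fun x => if x ∈ S then f x else g x := by
  obtain ⟨u, hu, e⟩ := hS
  convert (hu.pos.mul hf).add (((F.const 1).sub hu.pos).mul hg) using 2 with x
  simp only [e]
  split_ifs <;> ring

theorem se (hS : D S) : SE S := by
  obtain ⟨f, hf, e⟩ := hS
  exact ((SEon.const QF.univ.se 0).lt QF.univ.se hf.se).congr fun x => by simp [e]

end D

theorem exists_same (A : Finset ℝ) (y : ℝ) : ∃ t : ℝ, (t = 0 ∨ ∃ a ∈ A, t = a + 1 ∨ t = a - 1 ∨ ∃ b ∈ A, t = (a + b) / 2) ∧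
    ∀ a ∈ A, Same a y t := by
  by_cases hy : y ∈ A
  · exact ⟨y, Or.inr ⟨y, hy, Or.inr (Or.inr ⟨y, hy, by ring⟩)⟩, fun a _ => ⟨Iff.rfl, Iff.rfl⟩⟩
  have hne : ∀ a ∈ A, a ≠ y := fun a ha e => hy (e ▸ ha)
  have key : ∀ t, (∀ a ∈ A, a < y → a < t) → (∀ a ∈ A, y < a → t < a) → ∀ a ∈ A, Same a y t := by
    intro t h1 h2 a ha
    rcases lt_or_gt_of_ne (hne a ha) with h | h
    · have := h1 a ha h
      exact ⟨iff_of_true h this, iff_of_false h.not_gt this.not_gt⟩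
    · have := h2 a ha h
      exact ⟨iff_of_false h.not_gt this.not_gt, iff_of_true h this⟩
  rcases (A.filter (· < y)).eq_empty_or_nonempty with h1 | h1 <;>
    rcases (A.filter (y < ·)).eq_empty_or_nonempty with h2 | h2
  · exact ⟨0, Or.inl rfl, key _ (fun a ha h => absurd h (Finset.filter_eq_empty_iff.1 h1 ha))
      fun a ha h => absurd h (Finset.filter_eq_empty_iff.1 h2 ha)⟩
  · have hb := Finset.mem_filter.1 (Finset.min'_mem _ h2)
    refine ⟨_, Or.inr ⟨_, hb.1, Or.inr (Or.inl rfl)⟩, key _ (fun a ha h => absurd h (Finset.filter_eq_empty_iff.1 h1 ha))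
      fun a ha h => ?_⟩
    have := Finset.min'_le _ a (Finset.mem_filter.2 ⟨ha, h⟩)
    linarith
  · have hb := Finset.mem_filter.1 (Finset.max'_mem _ h1)
    refine ⟨_, Or.inr ⟨_, hb.1, Or.inl rfl⟩, key _ (fun a ha h => ?_)
      fun a ha h => absurd h (Finset.filter_eq_empty_iff.1 h2 ha)⟩
    have := Finset.le_max' (A.filter (· < y)) a (Finset.mem_filter.2 ⟨ha, h⟩)
    linarith
  · have hb := Finset.mem_filter.1 (Finset.max'_mem _ h1)
    have hc := Finset.mem_filter.1 (Finset.min'_mem _ h2)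
    refine ⟨_, Or.inr ⟨_, hb.1, Or.inr (Or.inr ⟨_, hc.1, rfl⟩)⟩, key _ (fun a ha h => ?_) fun a ha h => ?_⟩
    · have := Finset.le_max' (A.filter (· < y)) a (Finset.mem_filter.2 ⟨ha, h⟩)
      linarith [hc.2, hb.2]
    · have := Finset.min'_le _ a (Finset.mem_filter.2 ⟨ha, h⟩)
      linarith [hc.2, hb.2]

theorem D.exists {ι : Type} {S : Set (Option ι → ℝ)} (hS : D S) : D {x : ι → ℝ | ∃ y, (fun o => o.elim y x) ∈ S} := by
  classical
  obtain ⟨χ, hχ, e⟩ := hS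
  obtain ⟨Ξ, hΞ, h⟩ := hχ.cell
  let T : Finset ((ι → ℝ) → ℝ) := {fun _ => 0} ∪ (Ξ.image fun ξ x => ξ x + 1) ∪ (Ξ.image fun ξ x => ξ x - 1) ∪
    Finset.image₂ (fun ξ η x => (ξ x + η x) / 2) Ξ Ξ
  have hT : ∀ t, t ∈ T ↔ t = (fun _ => 0) ∨ (∃ ξ ∈ Ξ, (fun x => ξ x + 1) = t) ∨ (∃ ξ ∈ Ξ, (fun x => ξ x - 1) = t) ∨
      ∃ ξ ∈ Ξ, ∃ η ∈ Ξ, (fun x => (ξ x + η x) / 2) = t := by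
    intro t
    simp only [T, Finset.mem_union, Finset.mem_singleton, Finset.mem_image, Finset.mem_image₂, or_assoc]
  have hF : ∀ t ∈ T, F t := by
    intro t ht
    rcases (hT t).1 ht with rfl | ⟨ξ, h1, rfl⟩ | ⟨ξ, h1, rfl⟩ | ⟨ξ, h1, η, h2, rfl⟩
    · exact F.const 0
    · exact (hΞ ξ h1).add (F.const 1)
    · exact (hΞ ξ h1).sub (F.const 1)
    · simpa [div_eq_mul_inv] using ((hΞ ξ h1).add (hΞ η h2)).mul (F.const 2⁻¹)
  have hD := D.biUnion T (S := fun t => {x : ι → ℝ | (fun o : Option ι => o.elim (t x) x) ∈ S}) fun t ht =>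
    D.comp (S := S) ⟨χ, hχ, e⟩ (g := fun o x => o.elim (t x) x) (Option.rec (hF t ht) F.proj)
  convert hD using 1
  ext x
  simp only [mem_ofPred_eq, e]
  refine ⟨fun ⟨y, hy⟩ => ?_, fun ⟨t, _, h⟩ => ⟨_, h⟩⟩
  obtain ⟨t, ht, hs⟩ := exists_same (Ξ.image fun ξ => ξ x) y
  obtain ⟨τ, hτ, rfl⟩ : ∃ τ ∈ T, τ x = t := by
    simp only [Finset.exists_mem_image] at ht
    rcases ht with rfl | ⟨ξ, h1, rfl | rfl | ⟨η, h2, rfl⟩⟩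
    · exact ⟨_, (hT _).2 (Or.inl rfl), rfl⟩
    · exact ⟨_, (hT _).2 (Or.inr (Or.inl ⟨ξ, h1, rfl⟩)), rfl⟩
    · exact ⟨_, (hT _).2 (Or.inr (Or.inr (Or.inl ⟨ξ, h1, rfl⟩))), rfl⟩
    · exact ⟨_, (hT _).2 (Or.inr (Or.inr (Or.inr ⟨ξ, h1, η, h2, rfl⟩))), rfl⟩
  exact ⟨τ, hτ, h x y _ (fun ξ hξ => hs _ (Finset.mem_image_of_mem _ hξ)) hy⟩

section
variable (hs : ∀ {ι : Type} {f : (ι → ℝ) → ℝ}, F f → F fun x => sinR (f x))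
  (hc : ∀ {ι : Type} {f : (ι → ℝ) → ℝ}, F f → F fun x => cosR (f x))
  (he : ∀ (s : Fin 3 × Bool) {ι : Type} {f g : (ι → ℝ) → ℝ}, F f → F g → F fun x => eisR s (f x) (g x))
include hs hc he

theorem F.term {β : Type} (t : LM.Term β) : F fun z : β → ℝ => t.realize z := by
  induction t with
  | var i => exact F.proj i
  | @func k f ts ih =>
    match k, f with
    | 0, r => exact F.const r
    | 1, Sum.inl _ =>
      have := (F.const 0).sub (ih 0)
      simp only [zero_sub] at this
      exact this
    | 1, Sum.inr c =>
      fin_cases c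
      · exact hs (ih 0)
      · exact hc (ih 0)
      · exact (ih 0).exp
    | 2, Sum.inl c =>
      fin_cases c
      · exact (ih 0).add (ih 1)
      · exact (ih 0).mul (ih 1)
    | 2, Sum.inr s => exact he s (ih 0) (ih 1)

theorem D.formula {β : Type} {n : ℕ} (φ : LM.BoundedFormula β n) :
    D {z : β ⊕ Fin n → ℝ | φ.Realize (z ∘ Sum.inl) (z ∘ Sum.inr)} := by
  have ht : ∀ {n} (t : LM.Term (β ⊕ Fin n)),
      F fun z : β ⊕ Fin n → ℝ => t.realize (Sum.elim (z ∘ Sum.inl) (z ∘ Sum.inr)) := fun t => by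
    simpa only [Sum.elim_comp_inl_inr] using F.term hs hc he t
  induction φ with
  | falsum => exact ⟨_, F.const 0, fun x => by simp [Language.BoundedFormula.Realize]⟩
  | equal t₁ t₂ => exact D.eq (ht t₁) (ht t₂)
  | @rel n k R ts =>
    match k, R with
    | 2, _ => exact D.lt (ht (ts 0)) (ht (ts 1))
    | 0, e => exact e.elim
    | 1, e => exact e.elim
    | _ + 3, e => exact e.elim
  | imp _ _ h₁ h₂ =>
    convert h₁.compl.union h₂ using 1
    ext z
    simp [Language.BoundedFormula.realize_imp, imp_iff_not_or]
  | @all n φ h =>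
    have h1 := (D.comp (κ := Option (β ⊕ Fin n)) h (g := fun i z => z (Sum.elim (fun b => some (Sum.inl b))
      (Fin.lastCases none fun i => some (Sum.inr i)) i)) fun i => F.proj _).compl.exists.compl
    convert h1 using 1
    ext z
    simp only [mem_ofPred_eq, mem_compl_iff, not_exists, not_not, Language.BoundedFormula.realize_all]
    refine forall_congr' fun y => ?_
    have : (Fin.snoc (z ∘ Sum.inr) y : Fin (n + 1) → ℝ) = (fun i => (fun o : Option (β ⊕ Fin n) => o.elim y z)
      (Sum.elim (fun b => some (Sum.inl b)) (Fin.lastCases none fun i => some (Sum.inr i)) i)) ∘ Sum.inr := by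
      funext i
      refine Fin.lastCases ?_ (fun i => ?_) i <;> simp
    rw [this]
    rfl

theorem stronglyModelComplete : StronglyModelComplete LM ℝ LMStructure := by
  intro k φ
  obtain ⟨m, T, ⟨ψ, h1, h2⟩, h3, h4⟩ := ((D.formula hs hc he φ).comp (κ := Fin k) (g := fun i x => Sum.elim x (fun i : Fin 0 => i.elim0) i)
    (Sum.rec F.proj fun i => i.elim0)).se
  refine ⟨m, ψ, h1, fun x => ?_, fun x w w' hw hw' => h4 x w w' ((h2 _).2 hw) ((h2 _).2 hw')⟩
  refine Iff.trans ?_ ((h3 x).trans (exists_congr fun w => h2 _))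
  exact iff_of_eq (congrArg (Language.BoundedFormula.Realize φ x) (Subsingleton.elim _ _))
end

section Ramanujan

open UpperHalfPlane hiding I
open ModularForm Derivative
open scoped MatrixGroups Manifold ModularForm

/-- Holomorphic functions on `ℍ` that extend analytically to the cusp. -/
structure Cuspidal (f : ℍ → ℂ) : Prop where
  holo : MDiff f
  per : Function.Periodic (f ∘ ofComplex) ((1 : ℝ) : ℂ)
  bdd : IsBoundedAtImInfty f

theorem Cuspidal.differentiableOn {f : ℍ → ℂ} (h : Cuspidal f) :
    DifferentiableOn ℂ (cuspFunction 1 f) (Metric.ball 0 1) :=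
  differentiableOn_cuspFunction_ball one_pos h.per h.holo h.bdd

theorem Cuspidal.eq {f : ℍ → ℂ} (h : Cuspidal f) (τ : ℍ) :
    cuspFunction 1 f (Function.Periodic.qParam 1 τ) = f τ :=
  eq_cuspFunction τ one_ne_zero h.per

theorem qParam_mem_ball (τ : ℍ) : Function.Periodic.qParam 1 τ ∈ Metric.ball (0 : ℂ) 1 := by
  rw [mem_ball_zero_iff]
  exact Function.Periodic.norm_qParam_lt_one one_pos τ.im_pos

theorem Cuspidal.tendsto {f : ℍ → ℂ} (h : Cuspidal f) :
    Tendsto f atImInfty (𝓝 (cuspFunction 1 f 0)) := by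
  have h1 := (h.differentiableOn.continuousOn.continuousAt
    (Metric.ball_mem_nhds (0 : ℂ) one_pos)).tendsto.comp (qParam_tendsto_atImInfty one_pos)
  exact h1.congr fun τ => h.eq τ

theorem Cuspidal.deriv_eq {f : ℍ → ℂ} (h : Cuspidal f) (τ : ℍ) :
    normalizedDerivOfComplex f τ = Function.Periodic.qParam 1 τ *
      deriv (cuspFunction 1 f) (Function.Periodic.qParam 1 τ) := by
  have h1 : HasDerivAt (Function.Periodic.qParam 1)
      (Function.Periodic.qParam 1 τ * (2 * Real.pi * I)) (τ : ℂ) := by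
    have : HasDerivAt (fun z : ℂ => 2 * Real.pi * I * z / ((1 : ℝ) : ℂ)) (2 * Real.pi * I) (τ : ℂ) := by
      simpa using ((hasDerivAt_id (τ : ℂ)).const_mul (2 * Real.pi * I))
    exact this.cexp
  have h2 := (h.differentiableOn.differentiableAt
    (Metric.isOpen_ball.mem_nhds (qParam_mem_ball τ))).hasDerivAt
  have h3 : (f ∘ ofComplex) =ᶠ[𝓝 (τ : ℂ)] cuspFunction 1 f ∘ Function.Periodic.qParam 1 := by
    filter_upwards [isOpen_upperHalfPlaneSet.mem_nhds τ.im_pos] with w hw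
    have := h.eq ⟨w, hw⟩
    simp only [Function.comp_apply, ofComplex_apply_of_im_pos hw]
    exact this.symm
  rw [normalizedDerivOfComplex, h3.deriv_eq, (h2.comp (τ : ℂ) h1).deriv]
  field [Real.pi_ne_zero]

theorem Cuspidal.tendsto_deriv {f : ℍ → ℂ} (h : Cuspidal f) :
    Tendsto (normalizedDerivOfComplex f) atImInfty (𝓝 0) := by
  have h1 := ((h.differentiableOn.deriv Metric.isOpen_ball).continuousOn.continuousAt
    (Metric.ball_mem_nhds (0 : ℂ) one_pos)).tendsto.comp (qParam_tendsto_atImInfty one_pos)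
  have h2 := (qParam_tendsto_atImInfty one_pos).mul h1
  rw [zero_mul] at h2
  exact h2.congr fun τ => (h.deriv_eq τ).symm

/-- The Eisenstein series of weights `2`, `4`, `6` on the upper half plane. -/
def EH : Fin 3 → ℍ → ℂ := ![EisensteinSeries.E2, ⇑E₄, ⇑E₆]

theorem mdiff_EH (i : Fin 3) : MDiff (EH i) := by
  fin_cases i
  · exact E2_mdifferentiable
  · exact ModularFormClass.holo E₄
  · exact ModularFormClass.holo E₆

theorem periodic_of_hasSum {f : ℍ → ℂ} {c : ℕ → ℂ}
    (hf : ∀ τ : ℍ, HasSum (fun m ↦ c m • Function.Periodic.qParam 1 τ ^ m) (f τ)) :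
    Function.Periodic (f ∘ ofComplex) ((1 : ℝ) : ℂ) := by
  intro w
  simp only [Function.comp_apply]
  by_cases hw : 0 < w.im
  · have hw' : 0 < (w + ((1 : ℝ) : ℂ)).im := by simpa using hw
    rw [ofComplex_apply_of_im_pos hw, ofComplex_apply_of_im_pos hw']
    have h1 := hf ⟨w, hw⟩
    have h2 := hf ⟨_, hw'⟩
    have : Function.Periodic.qParam 1 (w + ((1 : ℝ) : ℂ)) = Function.Periodic.qParam 1 w := by
      simpa [Function.Periodic.qParam, mul_add] using Complex.exp_periodic (2 * Real.pi * I * w)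
    simp only at h1 h2
    rw [this] at h2
    exact h2.unique h1
  · have hw' : ¬ 0 < (w + ((1 : ℝ) : ℂ)).im := by simpa using hw
    rw [ofComplex_apply_of_im_nonpos (not_lt.1 hw), ofComplex_apply_of_im_nonpos (not_lt.1 hw')]

theorem hasSum_EH (i : Fin 3) : ∃ c : ℕ → ℂ, c 0 = 1 ∧
    ∀ τ : ℍ, HasSum (fun m ↦ c m • Function.Periodic.qParam 1 τ ^ m) (EH i τ) := by
  have key : ∀ {k : ℕ} (hk : 3 ≤ k) (hk2 : Even k), ∃ c : ℕ → ℂ, c 0 = 1 ∧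
      ∀ τ : ℍ, HasSum (fun m ↦ c m • Function.Periodic.qParam 1 τ ^ m) (E hk τ) := fun hk hk2 =>
    ⟨fun m => (qExpansion 1 (E hk)).coeff m, EisensteinSeries.E_qExpansion_coeff_zero hk hk2,
      fun τ => ModularForm.hasSum_qExpansion (E hk) one_pos
        one_mem_strictPeriods_SL τ⟩
  fin_cases i
  · refine ⟨fun m => if m = 0 then 1 else -24 * ArithmeticFunction.sigma 1 m, if_pos rfl,
      fun τ => ?_⟩
    simpa only [Function.Periodic.qParam, ofReal_one, div_one] using!
      EisensteinSeries.hasSum_qExpansion_E2 (z := τ)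
  · exact key (by norm_num : 3 ≤ 4) (by decide)
  · exact key (by norm_num : 3 ≤ 6) (by decide)

theorem cuspidal_EH (i : Fin 3) : Cuspidal (EH i) := by
  obtain ⟨c, -, hc⟩ := hasSum_EH i
  exact ⟨mdiff_EH i, periodic_of_hasSum hc, isBoundedAtImInfty_of_hasSum_qExpansion one_pos hc⟩

theorem cuspFunction_EH_zero (i : Fin 3) : cuspFunction 1 (EH i) 0 = 1 := by
  obtain ⟨c, h0, hc⟩ := hasSum_EH i
  have h := cuspidal_EH i
  have h1 := (hasFPowerSeriesOnBall_cuspFunction one_pos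
    (analyticAt_cuspFunction_zero one_pos h.per h.holo h.bdd) hc).hasFPowerSeriesAt.coeff_zero 0
  rw [← h1, ← h0]
  simp [FormalMultilinearSeries.ofScalars]

theorem tendsto_EH (i : Fin 3) : Tendsto (EH i) atImInfty (𝓝 1) := by
  simpa [cuspFunction_EH_zero] using (cuspidal_EH i).tendsto

theorem eq_zero_of_slash {k : ℤ} (hk : k < 12) {f : ℍ → ℂ} (hf : MDiff f)
    (hs : ∀ γ : SL(2, ℤ), f ∣[k] γ = f) (h0 : Tendsto f atImInfty (𝓝 0)) (τ : ℍ) : f τ = 0 := by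
  let F : CuspForm 𝒮ℒ k :=
    { toFun := f
      slash_action_eq' := fun _ ⟨γ, hγ⟩ => hγ ▸ hs γ
      holo' := hf
      zero_at_cusps' := fun {c} hc => by
        rw [Subgroup.IsArithmetic.isCusp_iff_isCusp_SL2Z] at hc
        rw [OnePoint.isZeroAt_iff_forall_SL2Z hc]
        intro γ _
        rw [hs γ]
        exact h0 }
  have := rank_zero_iff_forall_zero.mp (CuspForm.rank_eq_zero_of_weight_lt_twelve hk) F
  exact DFunLike.congr_fun this τ

theorem slash_E {k : ℕ} (hk : 3 ≤ k) (γ : SL(2, ℤ)) : (⇑(E hk) : ℍ → ℂ) ∣[(k : ℤ)] γ = ⇑(E hk) :=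
  (E hk).slash_action_eq' _ ⟨γ, rfl⟩

theorem E2_slash (γ : SL(2, ℤ)) (z : ℍ) : (EH 0 ∣[(2 : ℤ)] γ) z =
    EH 0 z - 1 / (2 * riemannZeta 2) * EisensteinSeries.D2 γ z := by
  simp [EH, EisensteinSeries.E2_slash_action]

theorem deriv_E2_slash (γ : SL(2, ℤ)) (z : ℍ) : normalizedDerivOfComplex (EH 0 ∣[(2 : ℤ)] γ) z =
    normalizedDerivOfComplex (EH 0) z +
      1 / (2 * riemannZeta 2) * ((γ 1 0 : ℂ) / denom γ z) ^ 2 := by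
  have h1 := (mdifferentiableAt_iff.mp (mdiff_EH 0 z)).hasDerivAt
  have h2 := (hasDerivAt_denom_zpow (γ : GL (Fin 2) ℝ) (-1) z).const_mul
    (1 / (2 * riemannZeta 2) * (2 * Real.pi * I * γ 1 0))
  have h3 : ((EH 0 ∣[(2 : ℤ)] γ) ∘ ofComplex) =ᶠ[𝓝 (z : ℂ)] fun w => (EH 0 ∘ ofComplex) w -
      1 / (2 * riemannZeta 2) * (2 * Real.pi * I * γ 1 0) * denom (γ : GL (Fin 2) ℝ) w ^ (-1 : ℤ) := by
    filter_upwards [isOpen_upperHalfPlaneSet.mem_nhds z.im_pos] with w hw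
    simp only [Function.comp_apply, ofComplex_apply_of_im_pos hw, E2_slash, EisensteinSeries.D2,
      zpow_neg_one]
    ring
  rw [normalizedDerivOfComplex, normalizedDerivOfComplex, h3.deriv_eq, (h1.fun_sub h2).deriv]
  have hd := denom_ne_zero (γ : GL (Fin 2) ℝ) z
  have : (γ : GL (Fin 2) ℝ) 1 0 = ((γ 1 0 : ℤ) : ℝ) := rfl
  rw [this]
  push_cast
  field_simp
  ring

theorem ramanujan₁ (τ : ℍ) : normalizedDerivOfComplex (EH 0) τ =
    (EH 0 τ ^ 2 - EH 1 τ) / 12 := by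
  have hm : MDiff (normalizedDerivOfComplex (EH 0) +
      ((-12⁻¹ : ℂ) • (EH 0 * EH 0) + (12⁻¹ : ℂ) • EH 1)) :=
    (normalizedDerivOfComplex_mdifferentiable (mdiff_EH 0)).add ((((mdiff_EH 0).mul
      (mdiff_EH 0)).const_smul _).add ((mdiff_EH 1).const_smul _))
  have ht := (cuspidal_EH 0).tendsto_deriv.add ((((tendsto_EH 0).mul (tendsto_EH 0)).const_mul
      (-12⁻¹ : ℂ)).add ((tendsto_EH 1).const_mul (12⁻¹ : ℂ)))
  norm_num at ht
  have := eq_zero_of_slash (k := 4) (by norm_num) hm (fun γ => ?_) (ht.congr fun τ => by simp) τ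
  · simp only [Pi.add_apply, Pi.smul_apply, Pi.mul_apply, smul_eq_mul] at this
    linear_combination this
  · ext z
    have h1 := congrFun (normalizedDerivOfComplex_SL_slash (k := 2) (mdiff_EH 0) (γ := γ)) z
    have h2 := congrFun (ModularForm.mul_slash_SL2 2 2 γ (EH 0) (EH 0)) z
    have h3 : EH 1 ∣[(4 : ℤ)] γ = EH 1 := slash_E (by norm_num : 3 ≤ 4) γ
    simp only [deriv_E2_slash, Pi.sub_apply, Pi.mul_apply, E2_slash] at h1 h2
    norm_num at h1 h2
    simp only [SlashAction.add_slash, ModularForm.SL_smul_slash, h3, Pi.add_apply, Pi.smul_apply,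
      smul_eq_mul, Pi.mul_apply, h2]
    have h4 : (riemannZeta 2)⁻¹ * (1 / 2) = 3 * (Real.pi : ℂ)⁻¹ ^ 2 := by
      rw [riemannZeta_two]
      field_simp
      norm_num
    have h5 : (Real.pi : ℂ) ≠ 0 := mod_cast Real.pi_ne_zero
    have h6 : 3 * (Real.pi : ℂ)⁻¹ ^ 2 * EisensteinSeries.D2 γ z =
        6 * (Real.pi : ℂ)⁻¹ * I * (γ 1 0 / denom γ z) := by
      rw [EisensteinSeries.D2]
      field_simp
      ring
    rw [h4, h6] at h1 ⊢
    linear_combination -h1 + 3 * (Real.pi : ℂ)⁻¹ ^ 2 * (γ 1 0 / denom γ z) ^ 2 * I_sq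

theorem eq_zero_of_serre (i : Fin 3) (k : ℕ) (hk : k < 10) {g : ℍ → ℂ} (hg : MDiff g)
    (hi : ∀ γ : SL(2, ℤ), EH i ∣[(k : ℤ)] γ = EH i)
    (hs : ∀ γ : SL(2, ℤ), g ∣[(k + 2 : ℤ)] γ = g) (ht : Tendsto g atImInfty (𝓝 1)) (τ : ℍ) :
    normalizedDerivOfComplex (EH i) τ = k / 12 * (EH 0 τ * EH i τ - g τ) := by
  have hm : MDiff (serreDerivative (k : ℤ) (EH i) + (k / 12 : ℂ) • g) :=
    (serreDerivative_mdifferentiable _ (mdiff_EH i)).add (hg.const_smul _)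
  have ht' := ((cuspidal_EH i).tendsto_deriv.sub (((tendsto_EH 0).mul (tendsto_EH i)).const_mul
      (k / 12 : ℂ))).add (ht.const_mul (k / 12 : ℂ))
  norm_num at ht'
  have := eq_zero_of_slash (k := k + 2) (by lia) hm (fun γ => ?_) (ht'.congr fun τ => ?_) τ
  · simp only [Pi.add_apply, Pi.smul_apply, smul_eq_mul, serreDerivative_apply] at this
    have h0 : EisensteinSeries.E2 = EH 0 := rfl
    rw [h0] at this
    push_cast at this
    linear_combination this
  · rw [SlashAction.add_slash, ModularForm.SL_smul_slash, hs,
      serreDerivative_slash_invariant (mdiff_EH i) (hi γ)]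
  · simp only [Pi.add_apply, Pi.smul_apply, smul_eq_mul, serreDerivative_apply]
    have h0 : EisensteinSeries.E2 = EH 0 := rfl
    rw [h0]
    push_cast
    ring

theorem ramanujan₂ (τ : ℍ) : normalizedDerivOfComplex (EH 1) τ =
    (EH 0 τ * EH 1 τ - EH 2 τ) / 3 := by
  rw [eq_zero_of_serre 1 4 (by norm_num) (mdiff_EH 2) (slash_E (by norm_num : 3 ≤ 4))
    (slash_E (by norm_num : 3 ≤ 6)) (tendsto_EH 2)]
  push_cast
  ring

theorem ramanujan₃ (τ : ℍ) : normalizedDerivOfComplex (EH 2) τ =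
    (EH 0 τ * EH 2 τ - EH 1 τ ^ 2) / 2 := by
  rw [eq_zero_of_serre (g := EH 1 * EH 1) 2 6 (by norm_num) ((mdiff_EH 1).mul (mdiff_EH 1))
    (slash_E (by norm_num : 3 ≤ 6)) (fun γ => ?_)
    (by simpa using! (tendsto_EH 1).mul (tendsto_EH 1))]
  · simp only [Pi.mul_apply]
    push_cast
    ring
  · have h3 : EH 1 ∣[(4 : ℤ)] γ = EH 1 := slash_E (by norm_num : 3 ≤ 4) γ
    have h2 := ModularForm.mul_slash_SL2 4 4 γ (EH 1) (EH 1)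
    rw [h3] at h2
    exact h2

end Ramanujan

section Matching

open UpperHalfPlane hiding I
open EisensteinSeries ModularForm

theorem summable_e2Summand (z : ℍ) : Summable fun m : ℤ => e2Summand m z := by
  have h1 : Summable fun n : ℕ => e2Summand n z := by
    rw [← summable_nat_add_iff 1,
      ← summable_pnat_iff_summable_succ (f := fun n : ℕ => e2Summand n z)]
    refine ((summable_prod_mul_pow 1 (norm_exp_two_pi_I_lt_one z)).prod.mul_left
      ((-2 * Real.pi * I) ^ 2)).congr fun b => ?_
    have := qExpansion_identity_pnat (k := 1) le_rfl ⟨b * z, by simpa using z.2⟩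
    simp only [e2Summand, eisSummand, Matrix.cons_val_zero, Matrix.cons_val_one,
      Matrix.cons_val_fin_one, zpow_neg, Int.cast_natCast]
    simp only [one_div, Nat.reduceAdd, Nat.factorial_one, Nat.cast_one, div_one] at this
    refine Eq.trans ?_ this.symm
    congr 1
    refine tsum_congr fun c => ?_
    rw [← Complex.exp_nat_mul, ← Complex.exp_nat_mul]
    push_cast
    ring_nf
  exact Summable.of_nat_of_neg h1 (h1.congr fun n => (e2Summand_even z n).symm)

theorem zetaC_eq {k : ℕ} (hk : 1 < k) : zetaC k = riemannZeta k := by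
  have h := zeta_eq_tsum_one_div_nat_add_one_cpow (s := k) (by simpa using hk)
  rw [h, zetaC]
  exact tsum_congr fun n => by rw [Complex.cpow_natCast]

theorem eis_eq {k : ℕ} (hk : 3 ≤ k) (τ : ℍ) : Eis k τ = E hk τ := by
  have h2 : riemannZeta k ≠ 0 := riemannZeta_ne_zero_of_one_lt_re (by norm_cast; lia)
  have h1 := tsum_eisSummand_eq_riemannZeta_mul_eisensteinSeries hk τ
  rw [show E hk τ = 1 / 2 * eisensteinSeries (N := 1) 0 k τ from rfl, Eis, zetaC_eq (by lia)]
  have h3 : (∑' p : ℤ × ℤ, if p = (0, 0) then 0 else 1 / ((p.1 : ℂ) * τ + (p.2 : ℂ)) ^ k) =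
      ∑' v : Fin 2 → ℤ, eisSummand k v τ := by
    rw [← (finTwoArrowEquiv ℤ).symm.tsum_eq]
    refine tsum_congr fun p => ?_
    split_ifs with hp
    · simp [hp, eisSummand, show k ≠ 0 by lia]
    · simp [eisSummand]
  rw [h3, h1]
  field_simp

theorem g2_eq (τ : ℍ) : _root_.G2 τ = 1 / 2 * EisensteinSeries.G2 τ := by
  have h1 : EisensteinSeries.G2 τ = ∑' m : ℤ, e2Summand m τ :=
    tsum_eq_of_summable_unconditional (summable_e2Summand τ)
  have h2 : (∑' m : ℤ, if m = 0 then 0 else ∑' n : ℤ, 1 / ((m : ℂ) * τ + (n : ℂ)) ^ 2) =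
      ∑' m : ℤ, if m = 0 then 0 else e2Summand m τ := by
    refine tsum_congr fun m => ?_
    simp [e2Summand, eisSummand]
  have h3 : (∑' n : ℤ, if n = 0 then 0 else 1 / (n : ℂ) ^ 2) = e2Summand 0 τ := by
    refine tsum_congr fun m => ?_
    split_ifs with hm
    · simp [hm, eisSummand]
    · simp [eisSummand]
  rw [_root_.G2, h2, h3, h1, (summable_e2Summand τ).tsum_eq_add_tsum_ite 0]
  ring

theorem eisFull_eq (i : Fin 3) (τ : ℍ) : EisFull (wt i) τ = EH i τ := by
  fin_cases i
  · change _root_.G2 τ / zetaC 2 = 1 / (2 * riemannZeta 2) * EisensteinSeries.G2 τ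
    rw [g2_eq, zetaC_eq one_lt_two]
    push_cast
    field_simp
  · exact eis_eq (by norm_num : 3 ≤ 4) τ
  · exact eis_eq (by norm_num : 3 ≤ 6) τ

end Matching

section Trig

theorem SEon.sin_cos {ι : Type} {B : Set (ι → ℝ)} (hB : SE B) {f : (ι → ℝ) → ℝ} (hf : SEon B f)
    (h : ∀ x ∈ B, |f x| < 12) :
    SEon B (fun x => Real.sin (f x)) ∧ SEon B fun x => Real.cos (f x) := by
  have hq : SEon B fun x => f x * 4⁻¹ := hf.mul hB (SEon.const hB _)
  have hs : SEon (ι := Unit) {x | x () ∈ (univ : Set ℝ)} fun x => sinR (x ()) :=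
    (QF.sinR (some ()) none).se.congr (fun x => by simp)
  have hc : SEon (ι := Unit) {x | x () ∈ (univ : Set ℝ)} fun x => cosR (x ()) :=
    (QF.cosR (some ()) none).se.congr (fun x => by simp)
  have hm : ∀ x ∈ B, -Real.pi ≤ f x * 4⁻¹ ∧ f x * 4⁻¹ ≤ Real.pi := fun x hx => by
    have := abs_lt.1 (h x hx)
    have := Real.pi_gt_three
    constructor <;> linarith
  have hs' : SEon B fun x => Real.sin (f x * 4⁻¹) :=
    (SEon.comp₁ (u := sinR) (D := univ) hB hs hq fun _ _ => trivial).congr fun x hx => if_pos (hm x hx)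
  have hc' : SEon B fun x => Real.cos (f x * 4⁻¹) :=
    (SEon.comp₁ (u := cosR) (D := univ) hB hc hq fun _ _ => trivial).congr fun x hx => if_pos (hm x hx)
  have h2 := (SEon.const hB 2).mul hB (hs'.mul hB hc')
  have h3 := ((SEon.const hB 2).mul hB (hc'.mul hB hc')).sub hB (SEon.const hB 1)
  have e : ∀ x, f x = 2 * (2 * (f x * 4⁻¹)) := fun x => by ring
  refine ⟨((SEon.const hB 2).mul hB (h2.mul hB h3)).congr fun x _ => ?_,
    (((SEon.const hB 2).mul hB (h3.mul hB h3)).sub hB (SEon.const hB 1)).congr fun x _ => ?_⟩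
  · dsimp only
    rw [e x, Real.sin_two_mul, Real.sin_two_mul, Real.cos_two_mul, ← e x]
    ring
  · dsimp only
    rw [e x, Real.cos_two_mul, Real.cos_two_mul, ← e x]
    ring

theorem AOn.sin_cos : AOn 12 (fun x : Fin 1 → ℝ => Real.sin (x 0)) ∧
    AOn 12 fun x : Fin 1 → ℝ => Real.cos (x 0) := by
  have hB : SE (Metric.ball (0 : Fin 1 → ℝ) 12) := SE.ball (by norm_num)
  have hse := SEon.sin_cos hB (SEon.proj hB 0) fun x hx => mem_ball_one.1 hx
  set G : Set ((Fin 1 → ℝ) → ℝ) := {fun x => Real.sin (x 0), fun x => Real.cos (x 0)}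
  have hs : (fun x : Fin 1 → ℝ => Real.sin (x 0)) ∈ Algebra.adjoin ℝ G :=
    Algebra.subset_adjoin (Or.inl rfl)
  have hc : (fun x : Fin 1 → ℝ => Real.cos (x 0)) ∈ Algebra.adjoin ℝ G :=
    Algebra.subset_adjoin (Or.inr rfl)
  have key : ∀ {f}, f ∈ Algebra.adjoin ℝ G → AOn 12 f := fun hf =>
    AOn.of_closed (by norm_num) G
      (by
        rintro g (rfl | rfl) x -
        · exact analytic_one_var (u := Real.sin) Real.analyticAt_sin
        · exact analytic_one_var (u := Real.cos) Real.analyticAt_cos)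
      (by
        rintro g (rfl | rfl)
        exacts [hse.1, hse.2])
      (by
        rintro g (rfl | rfl) i
        · exact ⟨_, hc, fun x _ => pd_one_var (Real.hasDerivAt_sin _) i⟩
        · exact ⟨_, neg_mem hs, fun x _ => pd_one_var (Real.hasDerivAt_cos _) i⟩) hf
  exact ⟨key hs, key hc⟩

theorem F.restrict_abs {ι : Type} {φ : (Fin 1 → ℝ) → ℝ} (hφ : AOn 12 φ) {f : (ι → ℝ) → ℝ}
    (hf : F f) : F fun x => if |f x| ≤ 4 then φ (fun _ => f x) else 0 := by
  simpa using F.anal (f := fun _ => f) (by norm_num) hφ (by norm_num : (4 : ℝ) < 12) fun _ => hf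

theorem F.trig {ι : Type} {u : ℝ → ℝ} (hu : AOn 12 fun x : Fin 1 → ℝ => u (x 0))
    {f : (ι → ℝ) → ℝ} (hf : F f) :
    F fun x => if -Real.pi ≤ f x ∧ f x ≤ Real.pi then u (f x) else 0 := by
  classical
  have h1 : D {x | ¬ f x < -Real.pi} := (D.lt hf (F.const _)).compl
  have h2 : D {x | ¬ Real.pi < f x} := (D.lt (F.const _) hf).compl
  convert D.ite (h1.inter h2) (F.restrict_abs hu hf) (F.const 0) using 2 with x
  simp only [mem_inter_iff, mem_ofPred_eq, not_lt]
  split_ifs with h h'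
  · rfl
  · exact absurd (abs_le.2 ⟨by linarith [Real.pi_le_four, h.1], by linarith [Real.pi_le_four, h.2]⟩) h'
  · rfl

theorem F.sinR {ι : Type} {f : (ι → ℝ) → ℝ} (hf : F f) : F fun x => RM.sinR (f x) :=
  F.trig AOn.sin_cos.1 hf

theorem F.cosR {ι : Type} {f : (ι → ℝ) → ℝ} (hf : F f) : F fun x => RM.cosR (f x) :=
  F.trig AOn.sin_cos.2 hf

end Trig

section QSeries

open UpperHalfPlane hiding I
open Derivative

/-- The Eisenstein series as functions of `q = exp (2 * π * i * τ)`. -/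
def qE (i : Fin 3) : ℂ → ℂ := cuspFunction 1 (EH i)

theorem differentiableOn_qE (i : Fin 3) : DifferentiableOn ℂ (qE i) (Metric.ball 0 1) :=
  (cuspidal_EH i).differentiableOn

/-- The algebra generated by `1/q` and the Eisenstein series. -/
def qAlg : Subalgebra ℂ (ℂ → ℂ) := Algebra.adjoin ℂ (insert (fun q => q⁻¹) (range qE))

theorem qE_mem (i : Fin 3) : qE i ∈ qAlg := Algebra.subset_adjoin (Or.inr ⟨i, rfl⟩)

theorem inv_mem_qAlg : (fun q => q⁻¹) ∈ qAlg := Algebra.subset_adjoin (Or.inl rfl)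

theorem deriv_qE (i : Fin 3) : ∃ g ∈ qAlg, EqOn (deriv (qE i)) g (Metric.ball 0 1 \ {0}) := by
  have key : ∀ P ∈ qAlg, (∀ τ : ℍ, normalizedDerivOfComplex (EH i) τ =
      P (Function.Periodic.qParam 1 τ)) →
      ∃ g ∈ qAlg, EqOn (deriv (qE i)) g (Metric.ball 0 1 \ {0}) := by
    refine fun P hP h => ⟨_, mul_mem inv_mem_qAlg hP, fun q hq => ?_⟩
    have h0 : q ≠ 0 := hq.2
    have h1 := Function.Periodic.im_invQParam_pos_of_norm_lt_one one_pos
      (mem_ball_zero_iff.1 hq.1) h0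
    have h2 : Function.Periodic.qParam 1 (⟨_, h1⟩ : ℍ) = q :=
      Function.Periodic.qParam_right_inv one_ne_zero h0
    have h3 := h ⟨_, h1⟩
    rw [(cuspidal_EH i).deriv_eq, h2] at h3
    rw [Pi.mul_apply, ← h3]
    exact (inv_mul_cancel_left₀ h0 _).symm
  have e : ∀ (j : Fin 3) (τ : ℍ), EH j τ = qE j (Function.Periodic.qParam 1 τ) :=
    fun j τ => ((cuspidal_EH j).eq τ).symm
  have hs : ∀ (c : ℂ) {P}, P ∈ qAlg → c • P ∈ qAlg := fun c {P} hP => qAlg.smul_mem hP c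
  fin_cases i
  · refine key _ (hs (1 / 12) (sub_mem (pow_mem (qE_mem 0) 2) (qE_mem 1))) fun τ => ?_
    refine (ramanujan₁ τ).trans ?_
    simp only [e, Pi.smul_apply, Pi.sub_apply, Pi.pow_apply, smul_eq_mul]
    ring
  · refine key _ (hs (1 / 3) (sub_mem (mul_mem (qE_mem 0) (qE_mem 1)) (qE_mem 2))) fun τ => ?_
    refine (ramanujan₂ τ).trans ?_
    simp only [e, Pi.smul_apply, Pi.sub_apply, Pi.mul_apply, smul_eq_mul]
    ring
  · refine key _ (hs (1 / 2) (sub_mem (mul_mem (qE_mem 0) (qE_mem 2)) (pow_mem (qE_mem 1) 2)))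
      fun τ => ?_
    refine (ramanujan₃ τ).trans ?_
    simp only [e, Pi.smul_apply, Pi.sub_apply, Pi.mul_apply, Pi.pow_apply, smul_eq_mul]
    ring

theorem isOpen_punctured : IsOpen (Metric.ball (0 : ℂ) 1 \ {0}) :=
  Metric.isOpen_ball.sdiff isClosed_singleton

theorem deriv_qAlg {f : ℂ → ℂ} (hf : f ∈ qAlg) :
    DifferentiableOn ℂ f (Metric.ball 0 1 \ {0}) ∧
      ∃ g ∈ qAlg, EqOn (deriv f) g (Metric.ball 0 1 \ {0}) := by
  have hd : ∀ {f : ℂ → ℂ}, DifferentiableOn ℂ f (Metric.ball 0 1 \ {0}) →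
      ∀ q ∈ Metric.ball 0 1 \ {0}, DifferentiableAt ℂ f q := fun h q hq =>
    h.differentiableAt (isOpen_punctured.mem_nhds hq)
  induction hf using Algebra.adjoin_induction with
  | mem f hf =>
    rcases hf with rfl | ⟨i, rfl⟩
    · refine ⟨differentiableOn_inv.mono fun q hq => hq.2,
        _, neg_mem (pow_mem inv_mem_qAlg 2), fun q hq => ?_⟩
      simp
    · exact ⟨(differentiableOn_qE i).mono sdiff_subset, deriv_qE i⟩
  | algebraMap r =>
    refine ⟨differentiableOn_const (c := r), 0, zero_mem _, fun q hq => ?_⟩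
    exact deriv_const q r
  | add f g _ _ hf hg =>
    obtain ⟨hf1, f', hf', hf2⟩ := hf
    obtain ⟨hg1, g', hg', hg2⟩ := hg
    refine ⟨hf1.add hg1, _, add_mem hf' hg', fun q hq => ?_⟩
    rw [deriv_add (hd hf1 q hq) (hd hg1 q hq), hf2 hq, hg2 hq]
    rfl
  | mul f g hfm hgm hf hg =>
    obtain ⟨hf1, f', hf', hf2⟩ := hf
    obtain ⟨hg1, g', hg', hg2⟩ := hg
    refine ⟨hf1.mul hg1, _, add_mem (mul_mem hf' hgm) (mul_mem hfm hg'), fun q hq => ?_⟩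
    rw [deriv_mul (hd hf1 q hq) (hd hg1 q hq), hf2 hq, hg2 hq]
    rfl

theorem iteratedDeriv_qE (i : Fin 3) (j : ℕ) :
    ∃ g ∈ qAlg, EqOn (iteratedDeriv j (qE i)) g (Metric.ball 0 1 \ {0}) := by
  induction j with
  | zero => exact ⟨_, qE_mem i, fun q _ => by rw [iteratedDeriv_zero]⟩
  | succ j ih =>
    obtain ⟨g, hg, h⟩ := ih
    obtain ⟨-, g', hg', h'⟩ := deriv_qAlg hg
    refine ⟨g', hg', fun q hq => ?_⟩
    rw [iteratedDeriv_succ, (h.eventuallyEq_of_mem (isOpen_punctured.mem_nhds hq)).deriv_eq, h' hq]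

/-- Complex valued functions with strongly existential real and imaginary parts. -/
structure CSEon {ι : Type} (B : Set (ι → ℝ)) (f : (ι → ℝ) → ℂ) : Prop where
  re : SEon B fun x => (f x).re
  im : SEon B fun x => (f x).im

namespace CSEon

variable {ι : Type} {B : Set (ι → ℝ)} {f g : (ι → ℝ) → ℂ}

theorem congr (hf : CSEon B f) (h : EqOn f g B) : CSEon B g :=
  ⟨hf.re.congr fun _ hx => congrArg Complex.re (h hx),
    hf.im.congr fun _ hx => congrArg Complex.im (h hx)⟩

theorem const (hB : SE B) (c : ℂ) : CSEon B fun _ => c :=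
  ⟨SEon.const hB _, SEon.const hB _⟩

theorem ofReal (hB : SE B) {u : (ι → ℝ) → ℝ} (hu : SEon B u) : CSEon B fun x => (u x : ℂ) :=
  ⟨hu, SEon.const hB 0⟩

theorem add (hB : SE B) (hf : CSEon B f) (hg : CSEon B g) : CSEon B fun x => f x + g x :=
  ⟨hf.re.add hB hg.re, hf.im.add hB hg.im⟩

theorem mul (hB : SE B) (hf : CSEon B f) (hg : CSEon B g) : CSEon B fun x => f x * g x :=
  ⟨((hf.re.mul hB hg.re).sub hB (hf.im.mul hB hg.im)),
    ((hf.re.mul hB hg.im).add hB (hf.im.mul hB hg.re))⟩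

theorem normSq (hB : SE B) (hf : CSEon B f) : SEon B fun x => Complex.normSq (f x) :=
  (hf.re.mul hB hf.re).add hB (hf.im.mul hB hf.im)

theorem inv (hB : SE B) (hf : CSEon B f) (h0 : ∀ x ∈ B, f x ≠ 0) : CSEon B fun x => (f x)⁻¹ := by
  have hn := (hf.normSq hB).inv hB fun x hx => by simpa using h0 x hx
  exact ⟨(hf.re.mul hB hn).congr fun x _ => by simp [div_eq_mul_inv],
    (((SEon.const hB (-1)).mul hB hf.im).mul hB hn).congr fun x _ => by simp [div_eq_mul_inv]⟩

theorem union {C : Set (ι → ℝ)} (hf : CSEon B f) (hg : CSEon C f) (h : Disjoint B C) :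
    CSEon (B ∪ C) f := by
  classical
  exact ⟨(SEon.piecewise hf.re hg.re h).congr fun x _ => ite_self _,
    (SEon.piecewise hf.im hg.im h).congr fun x _ => ite_self _⟩

theorem log_norm (hB : SE B) (hf : CSEon B f) (h0 : ∀ x ∈ B, f x ≠ 0) :
    SEon B fun x => Real.log ‖f x‖ :=
  ((SEon.const hB 2⁻¹).mul hB (SEon.log hB (hf.normSq hB) fun x hx =>
    Complex.normSq_pos.2 (h0 x hx))).congr fun x _ => by
      simp only [Complex.normSq_eq_norm_sq, Real.log_pow]
      push_cast
      ring

theorem arg (hB : SE B) (hf : CSEon B f) (h0 : ∀ x ∈ B, f x ≠ 0) :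
    SEon B fun x => (f x).arg := by
  have hn : SEon B fun x => ‖f x‖ := (SEon.exp hB (hf.log_norm hB h0)).congr fun x hx =>
    Real.exp_log (norm_pos_iff.2 (h0 x hx))
  have hB' : SE {z : Option ι → ℝ | (fun i => z (some i)) ∈ B} := hB.preimage some
  have ht := SEon.proj hB' none
  have h1 := SEon.lt hB' (SEon.const hB' (-Real.pi)) ht
  have h2 := SEon.le h1 (ht.restrict h1 fun x hx => hx.1) (SEon.const h1 Real.pi)
  have hs : ∀ x ∈ {x | x ∈ {x : Option ι → ℝ | x ∈ {z | (fun i => z (some i)) ∈ B} ∧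
      -Real.pi < x none} ∧ x none ≤ Real.pi}, x ∈ {z : Option ι → ℝ | (fun i => z (some i)) ∈ B} :=
    fun x hx => hx.1.1
  obtain ⟨h3, h4⟩ := SEon.sin_cos h2 (ht.restrict h2 hs) fun x hx => abs_lt.2
    ⟨by linarith [hx.1.2, Real.pi_le_four], by linarith [hx.2, Real.pi_le_four]⟩
  have hn' := (hn.reindex some).restrict h2 hs
  have h5 := SEon.eq h2 ((hf.re.reindex some).restrict h2 hs) (hn'.mul h2 h4)
  have h6 := SEon.eq h2 ((hf.im.reindex some).restrict h2 hs) (hn'.mul h2 h3)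
  refine SEon.of_unique hB (h5.inter h6) fun x hx t => ?_
  simp only [mem_inter_iff, mem_ofPred_eq, Option.elim]
  constructor
  · rintro ⟨⟨⟨⟨-, h1⟩, h2⟩, h3⟩, -, h4⟩
    have : f x = ‖f x‖ * (Complex.cos t + Complex.sin t * I) := by
      rw [← Complex.ofReal_cos, ← Complex.ofReal_sin]
      apply Complex.ext
      · rw [Complex.re_ofReal_mul]
        simpa only [Complex.add_re, Complex.ofReal_re, Complex.re_ofReal_mul, Complex.I_re, mul_zero,
          add_zero] using h3
      · rw [Complex.im_ofReal_mul]
        simpa only [Complex.add_im, Complex.ofReal_im, Complex.im_ofReal_mul, Complex.I_im, mul_one,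
          zero_add] using h4
    rw [this, Complex.arg_mul_cos_add_sin_mul_I (norm_pos_iff.2 (h0 x hx)) ⟨h1, h2⟩]
  · rintro rfl
    have h1 := Complex.neg_pi_lt_arg (f x)
    have h2 := Complex.arg_le_pi (f x)
    rw [Complex.norm_mul_cos_arg, Complex.norm_mul_sin_arg]
    exact ⟨⟨⟨⟨hx, h1⟩, h2⟩, rfl⟩, ⟨⟨hx, h1⟩, h2⟩, rfl⟩

theorem qE (hB : SE B) (hf : CSEon B f) (h0 : ∀ x ∈ B, f x ≠ 0)
    (hc : ∀ x ∈ B, ‖f x‖ ≤ Real.exp (-(Real.pi * √3))) (i : Fin 3) :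
    CSEon B fun x => RM.qE i (f x) := by
  have hp := Real.pi_pos
  have ha := (SEon.const hB (2 * Real.pi)⁻¹).mul hB (hf.arg hB h0)
  have hl := (SEon.const hB (-(2 * Real.pi)⁻¹)).mul hB (hf.log_norm hB h0)
  have h2 : ∀ s : Fin 3 × Bool, SEon (ι := Bool) univ fun x => eisR s (x false) (x true) :=
    fun s => (QF.eisR s (some false) (some true) none).se.congr fun x => by simp
  have key : ∀ b : Bool, ∀ x ∈ B, eisR (i, b) ((2 * Real.pi)⁻¹ * (f x).arg)
      (-(2 * Real.pi)⁻¹ * Real.log ‖f x‖) =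
        if b then (RM.qE i (f x)).re else (RM.qE i (f x)).im := by
    intro b x hx
    have hlog : Real.log ‖f x‖ ≤ -(Real.pi * √3) :=
      (Real.log_le_iff_le_exp (norm_pos_iff.2 (h0 x hx))).2 (hc x hx)
    have hy : √3 / 2 ≤ -(2 * Real.pi)⁻¹ * Real.log ‖f x‖ := by
      have := mul_le_mul_of_nonneg_left hlog (by positivity : 0 ≤ (2 * Real.pi)⁻¹)
      have e : (2 * Real.pi)⁻¹ * -(Real.pi * √3) = -(√3 / 2) := by field_simp
      linarith
    have hx2 : |(2 * Real.pi)⁻¹ * (f x).arg| ≤ 1 / 2 := by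
      rw [abs_mul, abs_of_pos (by positivity)]
      have := mul_le_mul_of_nonneg_left (Complex.abs_arg_le_pi (f x))
        (by positivity : 0 ≤ (2 * Real.pi)⁻¹)
      have e : (2 * Real.pi)⁻¹ * Real.pi = 1 / 2 := by field_simp
      linarith
    have him : 0 < (((2 * Real.pi)⁻¹ * (f x).arg : ℝ) +
        ((-(2 * Real.pi)⁻¹ * Real.log ‖f x‖ : ℝ) : ℂ) * I).im := by
      have : 0 < √3 / 2 := by positivity
      simpa using this.trans_le hy
    have hq : Function.Periodic.qParam 1 (⟨_, him⟩ : ℍ) = f x := by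
      refine Eq.trans ?_ (Complex.exp_log (h0 x hx))
      rw [Function.Periodic.qParam, Complex.log]
      congr 1
      have : (Real.pi : ℂ) ≠ 0 := mod_cast hp.ne'
      push_cast
      field_simp
      linear_combination (-Real.log ‖f x‖ : ℂ) * I_sq
    have := eisFull_eq i ⟨_, him⟩
    rw [← (cuspidal_EH i).eq, hq] at this
    rw [eisR, if_pos ⟨hx2, hy⟩]
    exact if_congr Iff.rfl (congrArg Complex.re this) (congrArg Complex.im this)
  exact ⟨(SEon.comp₂ (u := eisR (i, true)) hB (h2 _) ha hl).congr fun x hx => key true x hx,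
    (SEon.comp₂ (u := eisR (i, false)) hB (h2 _) ha hl).congr fun x hx =>
      (key false x hx).trans (if_neg Bool.false_ne_true)⟩

theorem qAlg (hB : SE B) (hf : CSEon B f) (h0 : ∀ x ∈ B, f x ≠ 0)
    (hc : ∀ x ∈ B, ‖f x‖ ≤ Real.exp (-(Real.pi * √3))) {h : ℂ → ℂ} (hh : h ∈ RM.qAlg) :
    CSEon B fun x => h (f x) := by
  induction hh using Algebra.adjoin_induction with
  | mem h hh =>
    rcases hh with rfl | ⟨i, rfl⟩
    exacts [hf.inv hB h0, hf.qE hB h0 hc i]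
  | algebraMap r => exact CSEon.const hB r
  | add _ _ _ _ h1 h2 => exact h1.add hB h2
  | mul _ _ _ _ h1 h2 => exact h1.mul hB h2

end CSEon

end QSeries

section Eisenstein

theorem AOn.of_complex {ρ : ℝ} (hρ : 0 < ρ) {G : Set ((Fin n → ℝ) → ℂ)}
    (ha : ∀ g ∈ G, AnalyticOnNhd ℝ g (Metric.ball 0 ρ)) (hs : ∀ g ∈ G, CSEon (Metric.ball 0 ρ) g)
    (hd : ∀ g ∈ G, ∀ i, ∃ h ∈ Algebra.adjoin ℂ G,
      ∀ x ∈ Metric.ball 0 ρ, fderiv ℝ g x (Pi.single i 1) = h x)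
    {f : (Fin n → ℝ) → ℂ} (hf : f ∈ G) : AOn ρ (fun x => (f x).re) ∧ AOn ρ fun x => (f x).im := by
  let R : Set ((Fin n → ℝ) → ℝ) := {h | ∃ g ∈ G, h = (fun x => (g x).re) ∨ h = fun x => (g x).im}
  have hR : ∀ h ∈ Algebra.adjoin ℂ G,
      (fun x => (h x).re) ∈ Algebra.adjoin ℝ R ∧ (fun x => (h x).im) ∈ Algebra.adjoin ℝ R := by
    intro h hh
    induction hh using Algebra.adjoin_induction with
    | mem g hg => exact ⟨Algebra.subset_adjoin ⟨g, hg, Or.inl rfl⟩,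
        Algebra.subset_adjoin ⟨g, hg, Or.inr rfl⟩⟩
    | algebraMap r => exact ⟨Subalgebra.algebraMap_mem _ r.re, Subalgebra.algebraMap_mem _ r.im⟩
    | add _ _ _ _ h1 h2 => exact ⟨add_mem h1.1 h2.1, add_mem h1.2 h2.2⟩
    | mul _ _ _ _ h1 h2 => exact ⟨sub_mem (mul_mem h1.1 h2.1) (mul_mem h1.2 h2.2),
        add_mem (mul_mem h1.1 h2.2) (mul_mem h1.2 h2.1)⟩
  have key : ∀ h ∈ R, AOn ρ h := fun h hh => by
    refine AOn.of_closed hρ R ?_ ?_ ?_ (Algebra.subset_adjoin hh)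
    · rintro _ ⟨g, hg, rfl | rfl⟩ x hx
      exacts [(Complex.reCLM.analyticAt _).comp (ha g hg x hx),
        (Complex.imCLM.analyticAt _).comp (ha g hg x hx)]
    · rintro _ ⟨g, hg, rfl | rfl⟩
      exacts [(hs g hg).re, (hs g hg).im]
    · rintro _ ⟨g, hg, rfl | rfl⟩ i
      all_goals obtain ⟨h, hh, e⟩ := hd g hg i
      · refine ⟨_, (hR h hh).1, fun x hx => ?_⟩
        have := Complex.reCLM.hasFDerivAt.comp x (ha g hg x hx).differentiableAt.hasFDerivAt
        exact (DFunLike.congr_fun this.fderiv _).trans (congrArg Complex.re (e x hx))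
      · refine ⟨_, (hR h hh).2, fun x hx => ?_⟩
        have := Complex.imCLM.hasFDerivAt.comp x (ha g hg x hx).differentiableAt.hasFDerivAt
        exact (DFunLike.congr_fun this.fderiv _).trans (congrArg Complex.im (e x hx))
  exact ⟨key _ ⟨f, hf, Or.inl rfl⟩, key _ ⟨f, hf, Or.inr rfl⟩⟩

/-- The phase factor of the coordinates `qco` on the `q`-disc. -/
def phase (x : Fin 2 → ℝ) : ℂ := cexp (Real.pi * I * x 0)

/-- Coordinates on the image in the `q`-disc of the fundamental domain. -/
def qco (x : Fin 2 → ℝ) : ℂ := Real.exp (-(Real.pi * √3)) * (1 - x 1 ^ 2) * phase x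

theorem mem_ball_two {x : Fin 2 → ℝ} : x ∈ Metric.ball 0 (6 / 5) ↔ ∀ i, |x i| < 6 / 5 := by
  simp [pi_norm_lt_iff (by norm_num : (0 : ℝ) < 6 / 5)]

theorem norm_qco_le {x : Fin 2 → ℝ} (hx : x ∈ Metric.ball 0 (6 / 5)) :
    ‖qco x‖ ≤ Real.exp (-(Real.pi * √3)) := by
  have h1 := abs_lt.1 (mem_ball_two.1 hx 1)
  have h2 : ‖phase x‖ = 1 := by
    rw [phase, show (Real.pi * I * x 0 : ℂ) = (Real.pi * x 0 : ℝ) * I by push_cast; ring,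
      Complex.norm_exp_ofReal_mul_I]
  have h3 : |1 - x 1 ^ 2| ≤ 1 := abs_le.2 ⟨by nlinarith, by nlinarith⟩
  rw [qco, norm_mul, h2, mul_one, norm_mul, Complex.norm_real, Real.norm_of_nonneg (Real.exp_pos _).le,
    show (1 - (x 1 : ℂ) ^ 2) = ((1 - x 1 ^ 2 : ℝ) : ℂ) by push_cast; rfl, Complex.norm_real]
  exact mul_le_of_le_one_right (Real.exp_pos _).le h3

theorem qco_mem {x : Fin 2 → ℝ} (hx : x ∈ Metric.ball 0 (6 / 5)) : qco x ∈ Metric.ball (0 : ℂ) 1 :=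
  mem_ball_zero_iff.2 ((norm_qco_le hx).trans_lt (Real.exp_lt_one_iff.2 (neg_neg_of_pos (by positivity))))

theorem analyticAt_iteratedDeriv_qE (i : Fin 3) (j : ℕ) {q : ℂ} (hq : q ∈ Metric.ball (0 : ℂ) 1) :
    AnalyticAt ℂ (iteratedDeriv j (qE i)) q := by
  rw [iteratedDeriv_eq_iterate]
  exact ((differentiableOn_qE i).analyticOnNhd Metric.isOpen_ball q hq).iterated_deriv j

/-- The real coordinate functions as complex valued functions, and their derivatives. -/
theorem hasFDerivAt_coord (i : Fin 2) (x : Fin 2 → ℝ) :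
    HasFDerivAt (fun x : Fin 2 → ℝ => (x i : ℂ))
      (Complex.ofRealCLM.comp (ContinuousLinearMap.proj (R := ℝ) (φ := fun _ : Fin 2 => ℝ) i)) x :=
  (Complex.ofRealCLM.comp (ContinuousLinearMap.proj (R := ℝ) (φ := fun _ : Fin 2 => ℝ) i)).hasFDerivAt

theorem fderiv_phase (x : Fin 2 → ℝ) (i : Fin 2) : DifferentiableAt ℝ phase x ∧
    fderiv ℝ phase x (Pi.single i 1) = phase x * (Real.pi * I * (Pi.single i 1 : Fin 2 → ℝ) 0) := by
  have h := ((hasFDerivAt_coord 0 x).const_mul (Real.pi * I)).cexp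
  exact ⟨h.differentiableAt, DFunLike.congr_fun h.fderiv _⟩

theorem analyticAt_coord (i : Fin 2) (x : Fin 2 → ℝ) :
    AnalyticAt ℝ (fun x : Fin 2 → ℝ => (x i : ℂ)) x :=
  (Complex.ofRealCLM.comp
    (ContinuousLinearMap.proj (R := ℝ) (φ := fun _ : Fin 2 => ℝ) i)).analyticAt x

theorem analyticAt_phase (x : Fin 2 → ℝ) : AnalyticAt ℝ phase x :=
  AnalyticAt.comp (g := cexp) (f := fun x : Fin 2 → ℝ => Real.pi * I * x 0)
    analyticAt_cexp.restrictScalars (analyticAt_const.mul (analyticAt_coord 0 x))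

theorem analyticAt_qco (x : Fin 2 → ℝ) : AnalyticAt ℝ qco x :=
  (analyticAt_const.mul (analyticAt_const.sub ((analyticAt_coord 1 x).pow 2))).mul (analyticAt_phase x)

theorem CSEon.phase {B : Set (Fin 2 → ℝ)} (hB : SE B) (hb : B ⊆ Metric.ball 0 (6 / 5)) :
    CSEon B RM.phase := by
  obtain ⟨h1, h2⟩ := SEon.sin_cos hB ((SEon.const hB Real.pi).mul hB (SEon.proj hB 0)) fun x hx => by
    have := mem_ball_two.1 (hb hx) 0
    rw [abs_mul, abs_of_pos Real.pi_pos]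
    nlinarith [Real.pi_le_four, Real.pi_pos]
  have e : ∀ x, RM.phase x = (Real.cos (Real.pi * x 0) : ℂ) + Real.sin (Real.pi * x 0) * I := fun x => by
    rw [RM.phase, Complex.ofReal_cos, Complex.ofReal_sin, ← Complex.exp_mul_I]
    push_cast
    ring_nf
  exact ⟨h2.congr fun x _ => by simp [e, -Complex.ofReal_cos, -Complex.ofReal_sin],
    h1.congr fun x _ => by simp [e, -Complex.ofReal_cos, -Complex.ofReal_sin]⟩

theorem CSEon.qco {B : Set (Fin 2 → ℝ)} (hB : SE B) (hb : B ⊆ Metric.ball 0 (6 / 5)) :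
    CSEon B RM.qco := by
  have hx : SEon B fun x => x 1 := SEon.proj hB 1
  refine ((CSEon.ofReal hB ((SEon.const hB (Real.exp (-(Real.pi * √3)))).mul hB
    ((SEon.const hB 1).sub hB (hx.mul hB hx)))).mul hB (CSEon.phase hB hb)).congr fun x _ => ?_
  simp only [RM.qco]
  push_cast
  ring

theorem CSEon.iteratedDeriv_qE_qco (i : Fin 3) (j : ℕ) :
    CSEon (Metric.ball 0 (6 / 5)) fun x => iteratedDeriv j (RM.qE i) (RM.qco x) := by
  have hB : SE (Metric.ball (0 : Fin 2 → ℝ) (6 / 5)) := SE.ball (by norm_num)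
  have hx := (SEon.proj hB 1).mul hB (SEon.proj hB 1)
  have h1 := SEon.eq hB hx (SEon.const hB 1)
  have h2 := SEon.ne hB hx (SEon.const hB 1)
  obtain ⟨g, hg, e⟩ := RM.iteratedDeriv_qE i j
  have h0 : ∀ x ∈ {x : Fin 2 → ℝ | x ∈ Metric.ball 0 (6 / 5) ∧ x 1 * x 1 ≠ 1}, RM.qco x ≠ 0 := by
    intro x hx
    refine mul_ne_zero (mul_ne_zero (mod_cast (Real.exp_pos _).ne') ?_) (Complex.exp_ne_zero _)
    refine sub_ne_zero.2 fun h => hx.2 ?_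
    rw [← sq]
    exact_mod_cast h.symm
  have k1 : CSEon _ fun x => iteratedDeriv j (RM.qE i) (RM.qco x) :=
    (CSEon.const h1 (iteratedDeriv j (RM.qE i) 0)).congr fun x hx => by
      have : (x 1 : ℂ) ^ 2 = 1 := by rw [sq]; exact_mod_cast hx.2
      simp [RM.qco, this]
  have k2 : CSEon _ fun x => iteratedDeriv j (RM.qE i) (RM.qco x) :=
    ((CSEon.qco h2 fun x hx => hx.1).qAlg h2 h0 (fun x hx => norm_qco_le hx.1) hg).congr fun x hx =>
      (e ⟨qco_mem hx.1, h0 x hx⟩).symm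
  convert k1.union k2 (Set.disjoint_left.2 fun x hx hx' => hx'.2 hx.2) using 1
  ext x
  simp only [mem_union, mem_ofPred_eq, ← and_or_left, em, and_true]

theorem AOn.qE_qco (i : Fin 3) :
    AOn (6 / 5) (fun x => (RM.qE i (qco x)).re) ∧ AOn (6 / 5) fun x => (RM.qE i (qco x)).im := by
  have hp : (0 : ℝ) < 6 / 5 := by norm_num
  have hB : SE (Metric.ball (0 : Fin 2 → ℝ) (6 / 5)) := SE.ball hp
  let X : (Fin 2 → ℝ) → ℂ := fun x => x 1
  let H : ℕ → (Fin 2 → ℝ) → ℂ := fun j x => iteratedDeriv j (RM.qE i) (qco x)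
  let G : Set ((Fin 2 → ℝ) → ℂ) := insert X (insert phase (range H))
  have hX : X ∈ Algebra.adjoin ℂ G := Algebra.subset_adjoin (Or.inl rfl)
  have hE : phase ∈ Algebra.adjoin ℂ G := Algebra.subset_adjoin (Or.inr (Or.inl rfl))
  have hH : ∀ j, H j ∈ Algebra.adjoin ℂ G := fun j => Algebra.subset_adjoin (Or.inr (Or.inr ⟨j, rfl⟩))
  have hc : ∀ c : ℂ, (fun _ => c) ∈ Algebra.adjoin ℂ G := fun c => Subalgebra.algebraMap_mem _ c
  have hHa : ∀ j, ∀ x ∈ Metric.ball (0 : Fin 2 → ℝ) (6 / 5), AnalyticAt ℂ (iteratedDeriv j (RM.qE i))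
    (qco x) := fun j x hx => analyticAt_iteratedDeriv_qE i j (qco_mem hx)
  have := AOn.of_complex (G := G) (f := H 0) hp ?_ ?_ ?_ (Or.inr (Or.inr ⟨0, rfl⟩))
  · simpa only [H, iteratedDeriv_zero] using this
  · rintro _ (rfl | rfl | ⟨j, rfl⟩) x hx
    · exact analyticAt_coord 1 x
    · exact analyticAt_phase x
    · exact AnalyticAt.comp (g := iteratedDeriv j (RM.qE i)) (f := qco) (hHa j x hx).restrictScalars
        (analyticAt_qco x)
  · rintro _ (rfl | rfl | ⟨j, rfl⟩)
    · exact CSEon.ofReal hB (SEon.proj hB 1)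
    · exact CSEon.phase hB subset_rfl
    · exact CSEon.iteratedDeriv_qE_qco i j
  · rintro _ (rfl | rfl | ⟨j, rfl⟩) k
    · exact ⟨_, hc ((Pi.single k 1 : Fin 2 → ℝ) 1), fun x _ =>
        DFunLike.congr_fun (hasFDerivAt_coord 1 x).fderiv _⟩
    · exact ⟨_, mul_mem hE (hc (Real.pi * I * (Pi.single k 1 : Fin 2 → ℝ) 0)), fun x _ =>
        (fderiv_phase x k).2⟩
    · let c : ℂ := Real.exp (-(Real.pi * √3))
      refine ⟨_, mul_mem (hH (j + 1)) (add_mem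
        (mul_mem (mul_mem (hc c) (sub_mem (hc 1) (pow_mem hX 2)))
          (mul_mem hE (hc (Real.pi * I * (Pi.single k 1 : Fin 2 → ℝ) 0))))
        (mul_mem hE (mul_mem (hc (-2 * c * (Pi.single k 1 : Fin 2 → ℝ) 1)) hX))), fun x hx => ?_⟩
      have h1 := ((((hasFDerivAt_coord 1 x).pow 2).const_sub 1).const_mul c).mul
        (fderiv_phase x k).1.hasFDerivAt
      have h2 := (hHa j x hx).differentiableAt.hasDerivAt.comp_hasFDerivAt (f := qco) x h1
      refine (DFunLike.congr_fun h2.fderiv _).trans ?_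
      simp only [smul_apply, add_apply, (fderiv_phase x k).2,
        Pi.mul_apply, Pi.add_apply, Pi.sub_apply, Pi.pow_apply, H, X, iteratedDeriv_succ, smul_eq_mul,
        neg_apply, ContinuousLinearMap.comp_apply, ContinuousLinearMap.proj_apply,
        Complex.ofRealCLM_apply, nsmul_eq_mul]
      push_cast
      ring

theorem eisR_eq (s : Fin 3 × Bool) {a b : ℝ} (ha : |a| ≤ 1 / 2) (hb : √3 / 2 ≤ b) :
    RM.eisR s a b = if s.2 = true
      then (qE s.1 (qco ![2 * a, √(1 - Real.exp (-2 * Real.pi * (b - √3 / 2)))])).re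
      else (qE s.1 (qco ![2 * a, √(1 - Real.exp (-2 * Real.pi * (b - √3 / 2)))])).im := by
  have h0 : 0 < √3 / 2 := by positivity
  have him : 0 < ((a : ℂ) + b * I).im := by simpa using h0.trans_le hb
  have hw : 0 ≤ 1 - Real.exp (-2 * Real.pi * (b - √3 / 2)) := sub_nonneg.2 <| Real.exp_le_one_iff.2 <| by
    nlinarith [Real.pi_pos]
  have hq : Function.Periodic.qParam 1 (⟨_, him⟩ : UpperHalfPlane) =
      qco ![2 * a, √(1 - Real.exp (-2 * Real.pi * (b - √3 / 2)))] := by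
    have : ((√(1 - Real.exp (-2 * Real.pi * (b - √3 / 2))) : ℝ) : ℂ) ^ 2 =
        1 - cexp (-2 * Real.pi * (b - √3 / 2)) := by
      rw [← Complex.ofReal_pow, Real.sq_sqrt hw]
      push_cast
      rfl
    simp only [qco, phase, Matrix.cons_val_zero, Matrix.cons_val_one, this, sub_sub_cancel]
    push_cast
    rw [← Complex.exp_add, ← Complex.exp_add, Function.Periodic.qParam]
    congr 1
    push_cast
    linear_combination (2 * Real.pi * b : ℂ) * I_sq
  have := eisFull_eq s.1 ⟨_, him⟩
  rw [← (cuspidal_EH s.1).eq, hq] at this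
  rw [eisR, if_pos ⟨ha, hb⟩]
  exact if_congr Iff.rfl (congrArg Complex.re this) (congrArg Complex.im this)

theorem F.sqrt {ι : Type} {f : (ι → ℝ) → ℝ} (hf : F f) : F fun x => √(f x) := by
  convert hf.pos.mul ((F.const 2⁻¹).mul hf.plog).exp using 2 with x
  split_ifs with h
  · rw [one_mul, Real.sqrt_eq_rpow, Real.rpow_def_of_pos h, mul_comm, one_div]
  · rw [zero_mul, Real.sqrt_eq_zero_of_nonpos (not_lt.1 h)]

theorem F.eisR (s : Fin 3 × Bool) {ι : Type} {f g : (ι → ℝ) → ℝ} (hf : F f) (hg : F g) :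
    F fun x => RM.eisR s (f x) (g x) := by
  classical
  have hφ : AOn (6 / 5) fun x : Fin 2 → ℝ =>
      if s.2 = true then (RM.qE s.1 (qco x)).re else (RM.qE s.1 (qco x)).im := by
    cases s.2
    exacts [(AOn.qE_qco s.1).2, (AOn.qE_qco s.1).1]
  have hu := ((F.const 1).sub ((F.const (-2 * Real.pi)).mul (hg.sub (F.const (√3 / 2)))).exp).sqrt
  have h2 := F.anal (f := fun i x => ![2 * f x, √(1 - Real.exp (-2 * Real.pi * (g x - √3 / 2)))] i) (by norm_num) hφ (by norm_num : (1 : ℝ) < 6 / 5)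
    (Fin.forall_fin_two.2 ⟨(F.const 2).mul hf, hu⟩)
  have h1 := (((D.lt hf (F.const (-(1 / 2)))).compl.inter (D.lt (F.const (1 / 2)) hf).compl).inter
    (D.lt hg (F.const (√3 / 2))).compl)
  convert D.ite h1 h2 (F.const 0) using 2 with x
  simp only [mem_inter_iff, mem_compl_iff, mem_ofPred_eq, not_lt, ← abs_le, Fin.forall_fin_two]
  by_cases h : |f x| ≤ 1 / 2 ∧ √3 / 2 ≤ g x
  · have hm : |2 * f x| ≤ 1 := by
      rw [abs_mul, abs_two]
      linarith [h.1]
    have hn : |√(1 - Real.exp (-2 * Real.pi * (g x - √3 / 2)))| ≤ 1 := by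
      rw [abs_of_nonneg (Real.sqrt_nonneg _), Real.sqrt_le_one]
      linarith [Real.exp_pos (-2 * Real.pi * (g x - √3 / 2))]
    exact (eisR_eq s h.1 h.2).trans ((if_pos h).trans (if_pos (And.intro hm hn))).symm
  · exact (if_neg h).trans (if_neg h).symm

end Eisenstein

end RM

/-- Theorem: the structure `ℛ_M` (the real field expanded by the real and imaginary parts
of `E₂`, `E₄`, `E₆` on the part of the fundamental domain strip, the unrestricted
exponential, and the restricted sine and cosine) is strongly model complete. -/
theorem strong_model_completeness_RM :
    StronglyModelComplete LM ℝ LMStructure := by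
  exact RM.stronglyModelComplete RM.F.sinR RM.F.cosR RM.F.eisR

end
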